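/- (Theorem 1.1(iii), L^p gradient estimate in two dimensions.) Let n = 2 and assume λ ≤ det D²u ≤ Λ in Ω. Then there exists p* > 1 depending only on λ, Λ such that for every p with 1 < p < p*, every open set V ⊂⊂ Ω, every x₀ ∈ V, and every 0 < r < 1/4 with S_u(x₀, r^{1/2}) ⊂⊂ V, there is a constant C depending only on V, Ω, p, λ, Λ, r such that every Green's function g_V(·, x₀) of L_u in V with pole x₀ satisfies ( ∫_{S_u(x₀, r)} |∇_x g_V(x, x₀)|^p dx )^{1/p} ≤ C. -/

import Mathlib

open MeasureTheory

noncomputable section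

/-- Euclidean space `ℝⁿ`. -/
abbrev E (n : ℕ) := EuclideanSpace ℝ (Fin n)

/-- First partial derivative `∂_i f (x)`. -/
noncomputable def pd {n : ℕ} (f : E n → ℝ) (x : E n) (i : Fin n) : ℝ :=
  fderiv ℝ f x (EuclideanSpace.single i 1)

/-- Second partial derivative `∂_{ij} f (x)`. -/
noncomputable def pd2 {n : ℕ} (f : E n → ℝ) (x : E n) (i j : Fin n) : ℝ :=
  fderiv ℝ (fun y => fderiv ℝ f y (EuclideanSpace.single j 1)) x (EuclideanSpace.single i 1)

/-- Hessian matrix `D²f(x)`. -/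
noncomputable def Hess {n : ℕ} (f : E n → ℝ) (x : E n) : Matrix (Fin n) (Fin n) ℝ :=
  Matrix.of fun i j => pd2 f x i j

/-- The cofactor matrix `U = (det D²u)(D²u)⁻¹` of the Hessian of `u`,
realized as the adjugate. -/
noncomputable def cofU {n : ℕ} (u : E n → ℝ) (x : E n) : Matrix (Fin n) (Fin n) ℝ :=
  (Hess u x).adjugate

/-- Section of the convex function `u`:
`S_u(x₀,t) = {x ∈ cl Ω : u x < u x₀ + ∇u(x₀)·(x - x₀) + t}`. -/
def MASection {n : ℕ} (Ω : Set (E n)) (u : E n → ℝ) (x₀ : E n) (t : ℝ) : Set (E n) :=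
  {x ∈ closure Ω | u x < u x₀ + fderiv ℝ u x₀ (x - x₀) + t}

/-- `A ⊂⊂ B`: the closure of `A` is a compact subset of `B`. -/
def CptIn {n : ℕ} (A B : Set (E n)) : Prop :=
  IsCompact (closure A) ∧ closure A ⊆ B

/-- Uniform convexity of a domain: balls of radius proportional to `‖x - y‖²`
centered at midpoints of points of the closure stay in the closure. -/
def UnifConvex {n : ℕ} (Ω : Set (E n)) : Prop :=
  ∃ δ > 0, ∀ x ∈ closure Ω, ∀ y ∈ closure Ω,
    Metric.closedBall (midpoint ℝ x y) (δ * ‖x - y‖ ^ 2) ⊆ closure Ω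

/-- Standing assumptions: `Ω` is a bounded, open, nonempty, uniformly convex domain and
`u` is a smooth convex function on `cl Ω` vanishing on `∂Ω`. -/
def MASetup {n : ℕ} (Ω : Set (E n)) (u : E n → ℝ) : Prop :=
  IsOpen Ω ∧ Bornology.IsBounded Ω ∧ Ω.Nonempty ∧ UnifConvex Ω ∧
  ContDiffOn ℝ (⊤ : ℕ∞) u (closure Ω) ∧ ConvexOn ℝ (closure Ω) u ∧
  ∀ x ∈ frontier Ω, u x = 0

/-- `λ ≤ det D²u ≤ Λ` in `Ω`. -/
def DetBounds {n : ℕ} (Ω : Set (E n)) (u : E n → ℝ) (lam Lam : ℝ) : Prop :=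
  ∀ x ∈ Ω, lam ≤ (Hess u x).det ∧ (Hess u x).det ≤ Lam

/-- The Monge-Ampère measure of `u`: `μ(A) = ∫_A det D²u`. -/
noncomputable def maMeasure {n : ℕ} (u : E n → ℝ) (A : Set (E n)) : ℝ :=
  ∫ x in A, (Hess u x).det

/-- Center of mass of a set. -/
noncomputable def centerOfMass {n : ℕ} (S : Set (E n)) : E n :=
  (volume S).toReal⁻¹ • ∫ x in S, x

/-- The `α`-dilation of `S` with respect to its center of mass. -/
def dilateCM {n : ℕ} (α : ℝ) (S : Set (E n)) : Set (E n) :=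
  (fun x => centerOfMass S + α • (x - centerOfMass S)) '' S

/-- The Monge-Ampère measure of `u` is doubling with respect to the center of mass
on the sections of `u`, with constants `0 < α < 1 < β`. -/
def DoublingCM {n : ℕ} (Ω : Set (E n)) (u : E n → ℝ) (α β : ℝ) : Prop :=
  0 < α ∧ α < 1 ∧ 1 < β ∧
  ∀ x₀ ∈ Ω, ∀ t : ℝ, 0 < t → CptIn (MASection Ω u x₀ t) Ω →
    maMeasure u (MASection Ω u x₀ t) ≤ β * maMeasure u (dilateCM α (MASection Ω u x₀ (t / 2)))

/-- `g` is a Green's function of the linearized Monge-Ampère operator `L_u` in `V`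
with pole `y`: positive and smooth on `V \ {y}`, `L_u`-harmonic there, vanishing
continuously on `∂V`, and `∫_V g · (L_u φ) = φ(y)` (i.e. `∫_V g · U^{ij}∂_{ij}φ = -φ(y)`)
for all test functions `φ`. -/
def IsGreen {n : ℕ} (u : E n → ℝ) (V : Set (E n)) (y : E n) (g : E n → ℝ) : Prop :=
  (∀ x ∈ V \ {y}, 0 < g x) ∧
  ContDiffOn ℝ (⊤ : ℕ∞) g (V \ {y}) ∧
  (∀ x ∈ V \ {y}, ∑ i, ∑ j, cofU u x i j * pd2 g x i j = 0) ∧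
  ContinuousOn g (closure V \ {y}) ∧
  (∀ x ∈ frontier V, g x = 0) ∧
  ∀ φ : E n → ℝ, ContDiff ℝ (⊤ : ℕ∞) φ → HasCompactSupport φ → tsupport φ ⊆ V →
    (∫ x in V, g x * ∑ i, ∑ j, cofU u x i j * pd2 φ x i j) = -φ y

/-- Capacity of a compact set `K` relative to `V` for the operator `L_u`:
the infimum of `∫_V U^{ij} ∂_iΦ ∂_jΦ` over Lipschitz `Φ` compactly supported in `V`
with `Φ ≥ 1` on `K`. -/
noncomputable def capacity {n : ℕ} (u : E n → ℝ) (K V : Set (E n)) : ℝ :=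
  sInf { e : ℝ | ∃ Φ : E n → ℝ, (∃ L : NNReal, LipschitzWith L Φ) ∧
    HasCompactSupport Φ ∧ tsupport Φ ⊆ V ∧ (∀ x ∈ K, 1 ≤ Φ x) ∧
    e = ∫ x in V, ∑ i, ∑ j, cofU u x i j * pd Φ x i * pd Φ x j }

namespace GreenLp
open Set

/-- A saddle function `Z(x, q)`, strictly convex in `q` and concave in `x`, together with its
first derivatives `w = Z_q`, `p = -Z_x` and second derivatives `k = Z_qq`, `l = -Z_xx`,
`m = Z_xq`; the two pure second derivatives are comparable with constant `μ`. -/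
structure Saddle (μ : ℝ) (D : Set (ℝ × ℝ)) (Z w p k l m : ℝ × ℝ → ℝ) : Prop where
  hZ : ∀ z ∈ D, HasFDerivAt Z
    (-(p z) • ContinuousLinearMap.fst ℝ ℝ ℝ + w z • ContinuousLinearMap.snd ℝ ℝ ℝ) z
  hw : ∀ z ∈ D, HasFDerivAt w
    (m z • ContinuousLinearMap.fst ℝ ℝ ℝ + k z • ContinuousLinearMap.snd ℝ ℝ ℝ) z
  hp : ∀ z ∈ D, HasFDerivAt p
    (l z • ContinuousLinearMap.fst ℝ ℝ ℝ - m z • ContinuousLinearMap.snd ℝ ℝ ℝ) z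
  k_pos : ∀ z ∈ D, 0 < k z
  l_pos : ∀ z ∈ D, 0 < l z
  l_ge : ∀ z ∈ D, μ * k z ≤ l z
  k_ge : ∀ z ∈ D, μ * l z ≤ k z
  k_cont : ContinuousOn k D
  l_cont : ContinuousOn l D

namespace Saddle

variable {μ : ℝ} {D : Set (ℝ × ℝ)} {Z w p k l m : ℝ × ℝ → ℝ}

theorem hasFDerivAt_affine (α β xc qc : ℝ) (z : ℝ × ℝ) :
    HasFDerivAt (fun z : ℝ × ℝ => (xc + α * z.1, qc + β * z.2))
      ((α • ContinuousLinearMap.fst ℝ ℝ ℝ).prod (β • ContinuousLinearMap.snd ℝ ℝ ℝ)) z := by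
  have h1 : HasFDerivAt (fun z : ℝ × ℝ => xc + α * z.1)
      (α • ContinuousLinearMap.fst ℝ ℝ ℝ) z :=
    ((hasFDerivAt_fst (𝕜 := ℝ) (p := z)).const_mul α).const_add xc
  have h2 : HasFDerivAt (fun z : ℝ × ℝ => qc + β * z.2)
      (β • ContinuousLinearMap.snd ℝ ℝ ℝ) z :=
    ((hasFDerivAt_snd (𝕜 := ℝ) (p := z)).const_mul β).const_add qc
  exact h1.prodMk h2

theorem comp_affine (h : Saddle μ D Z w p k l m) {μ' : ℝ} (α β xc qc : ℝ) (hα : α ≠ 0)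
    (hβ : β ≠ 0) (h1 : μ' * β ^ 2 ≤ μ * α ^ 2) (h2 : μ' * α ^ 2 ≤ μ * β ^ 2) {D' : Set (ℝ × ℝ)}
    (hD : ∀ z ∈ D', (xc + α * z.1, qc + β * z.2) ∈ D) :
    Saddle μ' D' (fun z => Z (xc + α * z.1, qc + β * z.2))
      (fun z => β * w (xc + α * z.1, qc + β * z.2))
      (fun z => α * p (xc + α * z.1, qc + β * z.2))
      (fun z => β ^ 2 * k (xc + α * z.1, qc + β * z.2))
      (fun z => α ^ 2 * l (xc + α * z.1, qc + β * z.2))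
      (fun z => α * β * m (xc + α * z.1, qc + β * z.2)) where
  hZ z hz := by
    refine ((h.hZ _ (hD z hz)).comp z (hasFDerivAt_affine α β xc qc z)).congr_fderiv ?_
    ext <;> simp <;> ring
  hw z hz := by
    refine (((h.hw _ (hD z hz)).comp z (hasFDerivAt_affine α β xc qc z)).const_mul
      β).congr_fderiv ?_
    ext <;> simp <;> ring
  hp z hz := by
    refine (((h.hp _ (hD z hz)).comp z (hasFDerivAt_affine α β xc qc z)).const_mul
      α).congr_fderiv ?_
    ext <;> simp <;> ring
  k_pos z hz := mul_pos (by positivity) (h.k_pos _ (hD z hz))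
  l_pos z hz := mul_pos (by positivity) (h.l_pos _ (hD z hz))
  l_ge z hz := by
    have := h.l_ge _ (hD z hz)
    have hk := h.k_pos _ (hD z hz)
    calc _ = (μ' * β ^ 2) * k (xc + α * z.1, qc + β * z.2) := by ring
      _ ≤ (μ * α ^ 2) * k (xc + α * z.1, qc + β * z.2) := by gcongr
      _ = α ^ 2 * (μ * k (xc + α * z.1, qc + β * z.2)) := by ring
      _ ≤ _ := by gcongr
  k_ge z hz := by
    have := h.k_ge _ (hD z hz)
    have hk := h.l_pos _ (hD z hz)
    calc _ = (μ' * α ^ 2) * l (xc + α * z.1, qc + β * z.2) := by ring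
      _ ≤ (μ * β ^ 2) * l (xc + α * z.1, qc + β * z.2) := by gcongr
      _ = β ^ 2 * (μ * l (xc + α * z.1, qc + β * z.2)) := by ring
      _ ≤ _ := by gcongr
  k_cont := by
    refine continuousOn_const.mul (h.k_cont.comp ?_ hD)
    fun_prop
  l_cont := by
    refine continuousOn_const.mul (h.l_cont.comp ?_ hD)
    fun_prop

theorem mono (h : Saddle μ D Z w p k l m) {D' : Set (ℝ × ℝ)} (hD : D' ⊆ D) :
    Saddle μ D' Z w p k l m where
  hZ z hz := h.hZ z (hD hz)
  hw z hz := h.hw z (hD hz)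
  hp z hz := h.hp z (hD hz)
  k_pos z hz := h.k_pos z (hD hz)
  l_pos z hz := h.l_pos z (hD hz)
  l_ge z hz := h.l_ge z (hD hz)
  k_ge z hz := h.k_ge z (hD hz)
  k_cont := h.k_cont.mono hD
  l_cont := h.l_cont.mono hD

theorem hasFDerivAt_swap (z : ℝ × ℝ) :
    HasFDerivAt (Prod.swap : ℝ × ℝ → ℝ × ℝ)
      ((ContinuousLinearMap.snd ℝ ℝ ℝ).prod (ContinuousLinearMap.fst ℝ ℝ ℝ)) z :=
  (hasFDerivAt_snd (𝕜 := ℝ) (p := z)).prodMk (hasFDerivAt_fst (𝕜 := ℝ) (p := z))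

theorem swap (h : Saddle μ D Z w p k l m) :
    Saddle μ (Prod.swap ⁻¹' D) (fun z => - Z z.swap) (fun z => p z.swap) (fun z => w z.swap)
      (fun z => l z.swap) (fun z => k z.swap) (fun z => - m z.swap) where
  hZ z hz := by
    refine ((h.hZ _ hz).comp z (hasFDerivAt_swap z)).neg.congr_fderiv ?_
    ext <;> simp
  hw z hz := by
    refine ((h.hp _ hz).comp z (hasFDerivAt_swap z)).congr_fderiv ?_
    ext <;> simp
  hp z hz := by
    refine ((h.hw _ hz).comp z (hasFDerivAt_swap z)).congr_fderiv ?_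
    ext <;> simp
  k_pos z hz := h.l_pos _ hz
  l_pos z hz := h.k_pos _ hz
  l_ge z hz := h.k_ge _ hz
  k_ge z hz := h.l_ge _ hz
  k_cont := h.l_cont.comp continuous_swap.continuousOn fun _ hz => hz
  l_cont := h.k_cont.comp continuous_swap.continuousOn fun _ hz => hz

theorem sub_bilinear (h : Saddle μ D Z w p k l m) (a b c d : ℝ) :
    Saddle μ D (fun z => Z z - (a + b * z.1 + c * z.2 + d * (z.1 * z.2)))
      (fun z => w z - (c + d * z.1)) (fun z => p z + (b + d * z.2)) k l (fun z => m z - d) where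
  hZ z hz := by
    have h1 := hasFDerivAt_fst (𝕜 := ℝ) (p := z)
    have h2 := hasFDerivAt_snd (𝕜 := ℝ) (p := z)
    refine ((h.hZ z hz).sub ((((h1.const_mul b).const_add a).add (h2.const_mul c)).add
      ((h1.mul h2).const_mul d))).congr_fderiv ?_
    ext <;> simp; ring
  hw z hz := by
    have h1 := hasFDerivAt_fst (𝕜 := ℝ) (p := z)
    refine ((h.hw z hz).sub ((h1.const_mul d).const_add c)).congr_fderiv ?_
    ext <;> simp
  hp z hz := by
    have h2 := hasFDerivAt_snd (𝕜 := ℝ) (p := z)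
    refine ((h.hp z hz).add ((h2.const_mul d).const_add b)).congr_fderiv ?_
    ext <;> simp; ring
  k_pos := h.k_pos
  l_pos := h.l_pos
  l_ge := h.l_ge
  k_ge := h.k_ge
  k_cont := h.k_cont
  l_cont := h.l_cont

theorem Z_q (h : Saddle μ D Z w p k l m) {x q : ℝ} (hz : (x, q) ∈ D) :
    HasDerivAt (fun t => Z (x, t)) (w (x, q)) q := by
  have := (h.hZ _ hz).comp_hasDerivAt q ((hasDerivAt_const q x).prodMk (hasDerivAt_id q))
  simpa [Function.comp_def] using this

theorem Z_x (h : Saddle μ D Z w p k l m) {x q : ℝ} (hz : (x, q) ∈ D) :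
    HasDerivAt (fun t => Z (t, q)) (-(p (x, q))) x := by
  have := (h.hZ _ hz).comp_hasDerivAt x ((hasDerivAt_id x).prodMk (hasDerivAt_const x q))
  simpa [Function.comp_def] using this

theorem w_q (h : Saddle μ D Z w p k l m) {x q : ℝ} (hz : (x, q) ∈ D) :
    HasDerivAt (fun t => w (x, t)) (k (x, q)) q := by
  have := (h.hw _ hz).comp_hasDerivAt q ((hasDerivAt_const q x).prodMk (hasDerivAt_id q))
  simpa [Function.comp_def] using this

theorem p_x (h : Saddle μ D Z w p k l m) {x q : ℝ} (hz : (x, q) ∈ D) :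
    HasDerivAt (fun t => p (t, q)) (l (x, q)) x := by
  have := (h.hp _ hz).comp_hasDerivAt x ((hasDerivAt_id x).prodMk (hasDerivAt_const x q))
  simpa [Function.comp_def] using this

/-- `Z` lies above its tangent lines in `q`. -/
theorem tangent_le_q (h : Saddle μ D Z w p k l m) {x q q' : ℝ}
    (hD : ∀ t ∈ uIcc q q', (x, t) ∈ D) :
    Z (x, q) + w (x, q) * (q' - q) ≤ Z (x, q') := by
  have mono : ∀ s ∈ uIcc q q', ∀ t ∈ uIcc q q', s ≤ t → w (x, s) ≤ w (x, t) := by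
    have : MonotoneOn (fun t => w (x, t)) (uIcc q q') := by
      refine monotoneOn_of_deriv_nonneg (convex_uIcc q q')
        (fun t ht => (h.w_q (hD t ht)).continuousAt.continuousWithinAt)
        (fun t ht => (h.w_q (hD t (interior_subset ht))).differentiableAt.differentiableWithinAt)
        fun t ht => ?_
      rw [(h.w_q (hD t (interior_subset ht))).deriv]
      exact (h.k_pos _ (hD t (interior_subset ht))).le
    exact fun s hs t ht hst => this hs ht hst
  rcases lt_trichotomy q q' with hlt | rfl | hlt
  · obtain ⟨c, hc, hc'⟩ := exists_hasDerivAt_eq_slope (fun t => Z (x, t)) (fun t => w (x, t)) hlt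
      (fun t ht => (h.Z_q (hD t (by rwa [uIcc_of_le hlt.le]))).continuousAt.continuousWithinAt)
      (fun t ht => h.Z_q (hD t (by rw [uIcc_of_le hlt.le]; exact Ioo_subset_Icc_self ht)))
    have := mono q left_mem_uIcc c (by rw [uIcc_of_le hlt.le]; exact Ioo_subset_Icc_self hc) hc.1.le
    rw [hc', le_div_iff₀ (by linarith)] at this
    linarith
  · simp
  · obtain ⟨c, hc, hc'⟩ := exists_hasDerivAt_eq_slope (fun t => Z (x, t)) (fun t => w (x, t)) hlt
      (fun t ht => (h.Z_q (hD t (by rwa [uIcc_of_ge hlt.le]))).continuousAt.continuousWithinAt)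
      (fun t ht => h.Z_q (hD t (by rw [uIcc_of_ge hlt.le]; exact Ioo_subset_Icc_self ht)))
    have := mono c (by rw [uIcc_of_ge hlt.le]; exact Ioo_subset_Icc_self hc) q left_mem_uIcc hc.2.le
    rw [hc', div_le_iff₀ (by linarith)] at this
    linarith

/-- `Z` lies below its tangent lines in `x`. -/
theorem le_tangent_x (h : Saddle μ D Z w p k l m) {x x' q : ℝ}
    (hD : ∀ t ∈ uIcc x x', (t, q) ∈ D) :
    Z (x', q) ≤ Z (x, q) - p (x, q) * (x' - x) := by
  have := h.swap.tangent_le_q (x := q) (q := x) (q' := x') (fun t ht => hD t ht)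
  simp only [Prod.swap_prod_mk] at this
  linarith

end Saddle

end GreenLp

namespace GreenLp
open Set

theorem second_deriv_nonneg_of_isLocalMin {f f' : ℝ → ℝ} {f'' a : ℝ}
    (h1 : ∀ᶠ x in nhds a, HasDerivAt f (f' x) x) (h2 : HasDerivAt f' f'' a)
    (hmin : IsLocalMin f a) : 0 ≤ f'' := by
  by_contra! hneg
  have hd : deriv f =ᶠ[nhds a] f' := h1.mono fun x hx => hx.deriv
  have h0 : deriv f a = 0 := hmin.deriv_eq_zero
  have h3 : deriv (deriv f) a = f'' := by rw [hd.deriv_eq, h2.deriv]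
  have hmax : IsLocalMax f a := isLocalMax_of_deriv_deriv_neg (by rw [h3]; exact hneg) h0
    h1.self_of_nhds.continuousAt
  have heq : f =ᶠ[nhds a] fun _ => f a := by
    filter_upwards [hmin, hmax] with x hx hx' using le_antisymm hx' hx
  have hz : deriv f =ᶠ[nhds a] fun _ => 0 := by
    filter_upwards [heq.eventuallyEq_nhds] with x hx
    rw [hx.deriv_eq, deriv_const]
  have : deriv (deriv f) a = 0 := by rw [hz.deriv_eq, deriv_const]
  linarith

/-- The closed square of half-side `1` centered at the origin. -/
def unitSq : Set (ℝ × ℝ) := Icc (-1) 1 ×ˢ Icc (-1) 1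

theorem mem_unitSq {x q : ℝ} : (x, q) ∈ unitSq ↔ (-1 ≤ x ∧ x ≤ 1) ∧ (-1 ≤ q ∧ q ≤ 1) := Iff.rfl

namespace Saddle

variable {μ : ℝ} {D : Set (ℝ × ℝ)} {Z w p k l m : ℝ × ℝ → ℝ}

theorem continuousOn_Z (h : Saddle μ D Z w p k l m) : ContinuousOn Z D :=
  fun z hz => (h.hZ z hz).continuousAt.continuousWithinAt

/-- Interior second derivative test for `Z - b` at a minimum. -/
theorem min_test (h : Saddle μ D Z w p k l m) {X Q X' Q' : ℝ → ℝ} {x q X'' Q'' : ℝ}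
    (hD : D ∈ nhds (x, q))
    (hX : ∀ x, HasDerivAt X (X' x) x) (hX' : HasDerivAt X' X'' x)
    (hQ : ∀ x, HasDerivAt Q (Q' x) x) (hQ' : HasDerivAt Q' Q'' q)
    (hmin : IsLocalMin (fun z : ℝ × ℝ => Z z - X z.1 * Q z.2) (x, q)) :
    μ * (X x * Q'') ≤ - (X'' * Q q) ∨ μ < 0 := by
  by_cases hμ : μ < 0
  · exact Or.inr hμ
  refine Or.inl ?_
  have hcx : Filter.Tendsto (fun t : ℝ => (t, q)) (nhds x) (nhds (x, q)) :=
    (Continuous.prodMk_left q).tendsto x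
  have hcq : Filter.Tendsto (fun t : ℝ => (x, t)) (nhds q) (nhds (x, q)) :=
    (Continuous.prodMk_right x).tendsto q
  have hzD : (x, q) ∈ D := mem_of_mem_nhds hD
  have h1 : 0 ≤ -(l (x, q)) - X'' * Q q := by
    refine second_deriv_nonneg_of_isLocalMin (f := fun t => Z (t, q) - X t * Q q)
      (f' := fun t => -(p (t, q)) - X' t * Q q) (a := x) ?_ ?_ (hcx.eventually hmin)
    · filter_upwards [hcx hD] with t ht using (h.Z_x ht).sub ((hX t).mul_const _)
    · exact (h.p_x hzD).neg.sub (hX'.mul_const _)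
  have h2 : 0 ≤ k (x, q) - X x * Q'' := by
    refine second_deriv_nonneg_of_isLocalMin (f := fun t => Z (x, t) - X x * Q t)
      (f' := fun t => w (x, t) - X x * Q' t) (a := q) ?_ ?_ (hcq.eventually hmin)
    · filter_upwards [hcq hD] with t ht using (h.Z_q ht).sub ((hQ t).const_mul _)
    · exact (h.w_q hzD).sub (hQ'.const_mul _)
  have h3 := h.l_ge _ hzD
  have : μ * (X x * Q'') ≤ μ * k (x, q) := by
    apply mul_le_mul_of_nonneg_left _ (not_lt.mp hμ)
    linarith
  linarith

/-- Comparison with the barrier `κ cos(ω (x - x₀)) sinh(K (q - q₀))`. -/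
theorem barrier_le (h : Saddle μ D Z w p k l m) (hμ : 0 < μ) {x₀ q₀ q₁ s κ ω K B : ℝ}
    (hs : 0 < s) (hq : q₀ < q₁) (hω : ω * s = Real.pi / 2) (hK : ω ^ 2 < μ * K ^ 2) (hK0 : 0 < K)
    (hκ : 0 < κ) (hD : Icc (x₀ - s) (x₀ + s) ×ˢ Icc q₀ q₁ ⊆ D)
    (hbot : ∀ x ∈ Icc (x₀ - s) (x₀ + s), 0 ≤ Z (x, q₀) + B)
    (hside : ∀ q ∈ Icc q₀ q₁, 0 ≤ Z (x₀ - s, q) + B ∧ 0 ≤ Z (x₀ + s, q) + B)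
    (htop : ∀ x ∈ Icc (x₀ - s) (x₀ + s),
      κ * Real.cos (ω * (x - x₀)) * Real.sinh (K * (q₁ - q₀)) ≤ Z (x, q₁) + B) :
    ∀ x ∈ Icc (x₀ - s) (x₀ + s), ∀ q ∈ Icc q₀ q₁,
      κ * Real.cos (ω * (x - x₀)) * Real.sinh (K * (q - q₀)) ≤ Z (x, q) + B := by
  set R := Icc (x₀ - s) (x₀ + s) ×ˢ Icc q₀ q₁ with hR
  set X : ℝ → ℝ := fun x => κ * Real.cos (ω * (x - x₀)) with hXdef
  set Q : ℝ → ℝ := fun q => Real.sinh (K * (q - q₀)) with hQdef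
  have hXc : Continuous X := by fun_prop
  have hQc : Continuous Q := by fun_prop
  have hRc : IsCompact R := isCompact_Icc.prod isCompact_Icc
  have hne : R.Nonempty := ⟨(x₀, q₀), ⟨by constructor <;> linarith, by constructor <;> linarith⟩⟩
  obtain ⟨⟨x, q⟩, hzR, hzmin⟩ := hRc.exists_isMinOn hne
    (f := fun z : ℝ × ℝ => Z z - X z.1 * Q z.2) (by
      refine (h.continuousOn_Z.mono hD).sub (Continuous.continuousOn ?_)
      fun_prop)
  suffices hmain : -B ≤ Z (x, q) - X x * Q q by
    intro x' hx' q' hq'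
    have := hzmin (a := (x', q')) ⟨hx', hq'⟩
    simp only [mem_ofPred_eq] at this
    change X x' * Q q' ≤ _
    linarith
  by_contra! hlt
  obtain ⟨hxm, hqm⟩ := hzR
  simp only at hxm hqm
  have hω0 : 0 < ω := by
    by_contra! hc
    nlinarith [Real.pi_pos]
  have hx1 : x ≠ x₀ - s := by
    rintro rfl
    have := (hside q hqm).1
    have h0 : X (x₀ - s) = 0 := by
      simp only [hXdef]
      rw [show ω * (x₀ - s - x₀) = -(Real.pi / 2) by rw [← hω]; ring, Real.cos_neg,
        Real.cos_pi_div_two, mul_zero]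
    rw [h0] at hlt; linarith
  have hx2 : x ≠ x₀ + s := by
    rintro rfl
    have := (hside q hqm).2
    have h0 : X (x₀ + s) = 0 := by
      simp only [hXdef]
      rw [show ω * (x₀ + s - x₀) = (Real.pi / 2) by rw [← hω]; ring,
        Real.cos_pi_div_two, mul_zero]
    rw [h0] at hlt; linarith
  have hq1 : q ≠ q₀ := by
    rintro rfl
    have := hbot x hxm
    have h0 : Q q = 0 := by simp [hQdef]
    rw [h0] at hlt; linarith
  have hq2 : q ≠ q₁ := by
    rintro rfl
    have := htop x hxm
    change X x * Q q ≤ _ at this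
    linarith
  have hxi : x ∈ Ioo (x₀ - s) (x₀ + s) := ⟨lt_of_le_of_ne hxm.1 hx1.symm, lt_of_le_of_ne hxm.2 hx2⟩
  have hqi : q ∈ Ioo q₀ q₁ := ⟨lt_of_le_of_ne hqm.1 hq1.symm, lt_of_le_of_ne hqm.2 hq2⟩
  have hRn : R ∈ nhds (x, q) := prod_mem_nhds (Icc_mem_nhds hxi.1 hxi.2) (Icc_mem_nhds hqi.1 hqi.2)
  have hloc : IsLocalMin (fun z : ℝ × ℝ => Z z - X z.1 * Q z.2) (x, q) := hzmin.isLocalMin hRn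
  have hX1 : ∀ x, HasDerivAt X (-(κ * ω) * Real.sin (ω * (x - x₀))) x := fun x => by
    have := (((((hasDerivAt_id x).sub_const x₀).const_mul ω).cos).const_mul κ)
    refine this.congr_deriv ?_
    simp; ring
  have hX2 : HasDerivAt (fun x => -(κ * ω) * Real.sin (ω * (x - x₀))) (-(ω ^ 2) * X x) x := by
    have := (((((hasDerivAt_id x).sub_const x₀).const_mul ω).sin).const_mul (-(κ * ω)))
    refine this.congr_deriv ?_
    simp [hXdef]; ring
  have hQ1 : ∀ q, HasDerivAt Q (K * Real.cosh (K * (q - q₀))) q := fun q => by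
    have := (((hasDerivAt_id q).sub_const q₀).const_mul K).sinh
    refine this.congr_deriv ?_
    simp; ring
  have hQ2 : HasDerivAt (fun q => K * Real.cosh (K * (q - q₀))) (K ^ 2 * Q q) q := by
    have := ((((hasDerivAt_id q).sub_const q₀).const_mul K).cosh).const_mul K
    refine this.congr_deriv ?_
    simp [hQdef]; ring
  rcases h.min_test (Filter.mem_of_superset hRn hD) hX1 hX2 hQ1 hQ2 hloc with h1 | h1
  · have hXpos : 0 < X x := by
      refine mul_pos hκ (Real.cos_pos_of_mem_Ioo ⟨?_, ?_⟩)
      · rw [← hω]; nlinarith [hxi.1]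
      · rw [← hω]; nlinarith [hxi.2]
    have hQpos : 0 < Q q := Real.sinh_pos_iff.mpr (mul_pos hK0 (by linarith [hqi.1]))
    have : 0 < X x * Q q := mul_pos hXpos hQpos
    nlinarith
  · linarith

end Saddle

end GreenLp

namespace GreenLp
open Set

theorem uIcc_subset_of_abs {a b x : ℝ} (ha : |a| ≤ 1) (hb : |b| ≤ 1) (hx : x ∈ uIcc a b) :
    -1 ≤ x ∧ x ≤ 1 := by
  have := uIcc_subset_Icc (a₂ := (-1 : ℝ)) (b₂ := 1) (abs_le.mp ha) (abs_le.mp hb) hx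
  exact this

theorem tent_aux {M F N a d b : ℝ} (ha : 0 ≤ a) (hF : 0 ≤ F) (hN : 0 ≤ N) (h1 : N * a ≤ F)
    (h2 : M ≤ F + N * d) (h3 : a + d ≤ b) (h4 : a ≤ b) : M * a ≤ F * b := by
  have h5 : M * a ≤ F * a + (N * a) * d := by nlinarith
  rcases le_total 0 d with hd | hd
  · nlinarith [mul_le_mul_of_nonneg_right h1 hd]
  · nlinarith [mul_nonneg (mul_nonneg hN ha) (neg_nonneg.mpr hd)]

namespace Saddle

variable {μ : ℝ} {Z w p k l m : ℝ × ℝ → ℝ}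

theorem reflect (h : Saddle μ unitSq Z w p k l m) :
    Saddle μ unitSq (fun z => Z (z.1, -z.2)) (fun z => - w (z.1, -z.2)) (fun z => p (z.1, -z.2))
      (fun z => k (z.1, -z.2)) (fun z => l (z.1, -z.2)) (fun z => - m (z.1, -z.2)) := by
  have := h.comp_affine (μ' := μ) (D' := unitSq) 1 (-1) 0 0 one_ne_zero (by norm_num) (by simp)
    (by simp) (by
      rintro ⟨x, q⟩ hz
      rw [mem_unitSq] at *
      constructor <;> constructor <;> linarith)
  simpa using this

theorem swap_unitSq (h : Saddle μ unitSq Z w p k l m) :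
    Saddle μ unitSq (fun z => - Z z.swap) (fun z => p z.swap) (fun z => w z.swap)
      (fun z => l z.swap) (fun z => k z.swap) (fun z => - m z.swap) :=
  h.swap.mono fun _ hz => ⟨hz.2, hz.1⟩

theorem column_lower_aux (h : Saddle μ unitSq Z w p k l m) {s x q₀ q A : ℝ} (hs : 0 < s)
    (hx : |x| ≤ 1) (hq₀ : |q₀| ≤ 1 - s) (hA : ∀ t, |t - q₀| ≤ s → |Z (x, t)| ≤ A)
    (hq1 : q ≤ 1) (hq : q₀ + s ≤ q) : -((1 + 4 / s) * A) ≤ Z (x, q) := by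
  rw [abs_le] at hx hq₀
  have hA0 : 0 ≤ A := (abs_nonneg _).trans (hA q₀ (by simp; linarith))
  have h1 := h.tangent_le_q (x := x) (q := q₀ + s) (q' := q) (fun t ht => by
    rw [uIcc_of_le hq] at ht
    exact ⟨hx, by constructor <;> linarith [ht.1, ht.2]⟩)
  have h2 := h.tangent_le_q (x := x) (q := q₀ + s) (q' := q₀) (fun t ht => by
    rw [uIcc_of_ge (by linarith)] at ht
    exact ⟨hx, by constructor <;> linarith [ht.1, ht.2]⟩)
  have h3 := abs_le.mp (hA (q₀ + s) (by simp [abs_of_pos hs]))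
  have h4 := abs_le.mp (hA q₀ (by simp; linarith))
  set W := w (x, q₀ + s)
  have h5 : -(2 * A / s) ≤ W := by
    rw [neg_le, div_eq_mul_inv, ← div_eq_mul_inv, le_div_iff₀ hs]
    nlinarith
  have h6 : -(2 * A / s) * 2 ≤ W * (q - (q₀ + s)) := by
    have hr : 0 ≤ 2 * A / s := by positivity
    have : 0 ≤ q - (q₀ + s) := by linarith
    have h7 : q - (q₀ + s) ≤ 2 := by linarith
    nlinarith
  have h8 : (1 + 4 / s) * A = A + 2 * A / s * 2 := by ring
  linarith

theorem column_lower (h : Saddle μ unitSq Z w p k l m) {s x q₀ q A : ℝ} (hs : 0 < s)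
    (hx : |x| ≤ 1) (hq₀ : |q₀| ≤ 1 - s) (hA : ∀ t, |t - q₀| ≤ s → |Z (x, t)| ≤ A)
    (hq : |q| ≤ 1) : -((1 + 4 / s) * A) ≤ Z (x, q) := by
  have hA0 : 0 ≤ A := (abs_nonneg _).trans (hA q₀ (by simp; linarith))
  by_cases h1 : q₀ + s ≤ q
  · exact h.column_lower_aux hs hx hq₀ hA (le_of_abs_le hq) h1
  by_cases h2 : q ≤ q₀ - s
  · have := h.reflect.column_lower_aux (q₀ := -q₀) (q := -q) hs hx (by rwa [abs_neg])
      (fun t ht => hA (-t) (by rwa [← abs_neg, show -(-t - q₀) = t - -q₀ by ring]))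
      (by linarith [neg_le_of_abs_le hq]) (by linarith)
    simpa using this
  · have := neg_le_of_abs_le (hA q (abs_le.mpr ⟨by linarith, by linarith⟩))
    have h4 : (1 + 4 / s) * A = A + 4 / s * A := by ring
    have : 0 ≤ 4 / s * A := by positivity
    linarith

theorem column_upper_aux (h : Saddle μ unitSq Z w p k l m) (hμ : 0 < μ) {s K : ℝ} (hs : 0 < s)
    (hK0 : 0 < K) (hK : (Real.pi / (2 * s)) ^ 2 < μ * K ^ 2)
    {x₀ q₀ x₁ q₁ A B : ℝ} (hx₀ : |x₀| ≤ 1 - s) (hq₀ : |q₀| ≤ 1 - s)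
    (hA : Z (x₀, q₀ + s) ≤ A)
    (hB : ∀ x q, |x - x₀| ≤ s → |q| ≤ 1 → -B ≤ Z (x, q)) (hx₁ : |x₁ - x₀| ≤ s / 2)
    (hq1 : q₁ ≤ 1) (hq : q₀ + s ≤ q₁) :
    Z (x₁, q₁) + B ≤ (A + B) * (4 * Real.sinh (2 * K) / Real.sinh (K * s)) := by
  rw [abs_le] at hx₀ hq₀
  set M := Z (x₁, q₁) + B with hM
  have hsinh : 0 < Real.sinh (K * s) := Real.sinh_pos_iff.mpr (by positivity)
  have hsinh1 : 0 < Real.sinh (K * (q₁ - q₀)) :=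
    Real.sinh_pos_iff.mpr (mul_pos hK0 (by linarith))
  have hAB : 0 ≤ A + B := by
    have := hB x₀ (q₀ + s) (by simp; linarith) (abs_le.mpr ⟨by linarith, by linarith⟩)
    linarith
  have hmono : Real.sinh (K * (q₁ - q₀)) ≤ Real.sinh (2 * K) :=
    Real.sinh_le_sinh.mpr (by nlinarith)
  rcases le_or_gt M 0 with hM0 | hM0
  · have : 0 ≤ Real.sinh (2 * K) := hsinh1.le.trans hmono
    exact hM0.trans (by positivity)
  set ω := Real.pi / (2 * s) with hω
  have hωs : ω * s = Real.pi / 2 := by rw [hω]; field_simp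
  set κ := M / (4 * Real.sinh (K * (q₁ - q₀))) with hκ
  have hx₁' := abs_le.mp hx₁
  have key := h.barrier_le hμ (x₀ := x₀) (q₀ := q₀) (q₁ := q₁) (s := s) (κ := κ) (ω := ω)
    (K := K) (B := B) hs (by linarith) hωs hK hK0 (by positivity) (by
      rintro ⟨x, q⟩ ⟨h1, h2⟩
      simp only [mem_Icc] at h1 h2
      exact ⟨⟨by simp only; linarith, by simp only; linarith⟩,
        ⟨by simp only; linarith, by simp only; linarith⟩⟩)
    (fun x hx => by
      have := hB x q₀ (abs_le.mpr ⟨by linarith [hx.1], by linarith [hx.2]⟩)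
        (abs_le.mpr ⟨by linarith, by linarith⟩)
      linarith)
    (fun q hq => by
      have hqa : |q| ≤ 1 := abs_le.mpr ⟨by linarith [hq.1], by linarith [hq.2]⟩
      have h1 := hB (x₀ - s) q (by simp [abs_of_pos hs]) hqa
      have h2 := hB (x₀ + s) q (by simp [abs_of_pos hs]) hqa
      constructor <;> linarith)
    (fun x hx => by
      have hqa : |q₁| ≤ 1 := abs_le.mpr ⟨by linarith, by linarith⟩
      have hcos : κ * Real.cos (ω * (x - x₀)) * Real.sinh (K * (q₁ - q₀)) =
          M / 4 * Real.cos (ω * (x - x₀)) := by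
        rw [hκ]; field_simp
      rw [hcos]
      -- the cosine is dominated by the tent function
      have hcos2 : Real.cos (ω * (x - x₀)) ≤ 2 * (s - |x - x₀|) / s := by
        rw [← Real.cos_abs, abs_mul, abs_of_pos (show 0 < ω by positivity),
          show ω * |x - x₀| = Real.pi / 2 - ω * (s - |x - x₀|) by rw [mul_sub, hωs]; ring,
          Real.cos_pi_div_two_sub]
        have h0 : 0 ≤ s - |x - x₀| := by
          have := abs_le.mpr (⟨by linarith [hx.1], by linarith [hx.2]⟩ :
            -s ≤ x - x₀ ∧ x - x₀ ≤ s)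
          linarith
        refine (Real.sin_le (by positivity)).trans ?_
        rw [hω, div_mul_eq_mul_div, div_le_div_iff₀ (by positivity) hs]
        have := Real.pi_le_four
        nlinarith [mul_nonneg h0 hs.le]
      -- concavity in `x`
      have htent : M * ((s - |x - x₀|) / (2 * s)) ≤ Z (x, q₁) + B := by
        have tang : ∀ y, |y - x₀| ≤ s → Z (y, q₁) ≤ Z (x, q₁) - p (x, q₁) * (y - x) := by
          intro y hy
          rw [abs_le] at hy
          refine h.le_tangent_x fun t ht => ⟨?_, abs_le.mp hqa⟩
          exact uIcc_subset_of_abs (abs_le.mpr ⟨by linarith [hx.1], by linarith [hx.2]⟩)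
            (abs_le.mpr ⟨by linarith, by linarith⟩) ht
        have t1 := tang x₁ (by linarith)
        have t2 := tang (x₀ + s) (by simp [abs_of_pos hs])
        have t3 := tang (x₀ - s) (by simp [abs_of_pos hs])
        have b2 := hB (x₀ + s) q₁ (by simp [abs_of_pos hs]) hqa
        have b3 := hB (x₀ - s) q₁ (by simp [abs_of_pos hs]) hqa
        have h0 : |x - x₀| ≤ s := abs_le.mpr ⟨by linarith [hx.1], by linarith [hx.2]⟩
        set P := p (x, q₁)
        set F := Z (x, q₁) + B with hF
        rw [mul_div_assoc', div_le_iff₀ (by positivity)]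
        have e1 : M ≤ F - P * (x₁ - x) := by linarith
        have e2 : 0 ≤ F - P * (x₀ + s - x) := by linarith
        have e3 : 0 ≤ F - P * (x₀ - s - x) := by linarith
        have hF0 : 0 ≤ F := by
          have := hB x q₁ h0 hqa
          linarith
        have n1 := neg_abs_le (x - x₀)
        have n2 := le_abs_self (x - x₀)
        rcases le_total P 0 with hP | hP
        · have a1 : M * (x - (x₀ - s)) ≤ F * (2 * s) :=
            tent_aux (N := -P) (d := x₁ - x) (by linarith [hx.1]) hF0 (by linarith) (by linarith)
              (by linarith) (by linarith) (by linarith [hx.2])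
          have a2 : M * (s - |x - x₀|) ≤ M * (x - (x₀ - s)) :=
            mul_le_mul_of_nonneg_left (by linarith) hM0.le
          linarith
        · have a1 : M * (x₀ + s - x) ≤ F * (2 * s) :=
            tent_aux (N := P) (d := x - x₁) (by linarith [hx.2]) hF0 (by linarith) (by linarith)
              (by linarith) (by linarith) (by linarith [hx.1])
          have a2 : M * (s - |x - x₀|) ≤ M * (x₀ + s - x) :=
            mul_le_mul_of_nonneg_left (by linarith) hM0.le
          linarith
      refine le_trans ?_ htent
      calc M / 4 * Real.cos (ω * (x - x₀)) ≤ M / 4 * (2 * (s - |x - x₀|) / s) := by gcongr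
        _ = _ := by field_simp; norm_num)
  have := key x₀ ⟨by linarith, by linarith⟩ (q₀ + s) ⟨by linarith, by linarith⟩
  simp only [sub_self, mul_zero, Real.cos_zero, mul_one, add_sub_cancel_left] at this
  have h1 : M * Real.sinh (K * s) ≤ (A + B) * (4 * Real.sinh (K * (q₁ - q₀))) := by
    have h2 : κ * Real.sinh (K * s) ≤ A + B := by linarith
    rw [hκ, div_mul_eq_mul_div, div_le_iff₀ (by positivity)] at h2
    exact h2
  rw [mul_div_assoc', le_div_iff₀ hsinh]
  refine h1.trans ?_
  gcongr

theorem column_bound {μ s : ℝ} (hμ : 0 < μ) (hs : 0 < s) :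
    ∃ C ≥ 1, ∀ Z w p k l m : ℝ × ℝ → ℝ, Saddle μ unitSq Z w p k l m →
      ∀ x₀ q₀ A : ℝ, |x₀| ≤ 1 - s → |q₀| ≤ 1 - s →
      (∀ x q, |x - x₀| ≤ s → |q - q₀| ≤ s → |Z (x, q)| ≤ A) →
      ∀ x q, |x - x₀| ≤ s / 2 → |q| ≤ 1 → |Z (x, q)| ≤ C * A := by
  obtain ⟨K, hK0, hK⟩ : ∃ K > 0, (Real.pi / (2 * s)) ^ 2 < μ * K ^ 2 := by
    refine ⟨(Real.pi / (2 * s)) ^ 2 / μ + 1, by positivity, ?_⟩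
    have h1 : (Real.pi / (2 * s)) ^ 2 = μ * ((Real.pi / (2 * s)) ^ 2 / μ) := by field_simp
    set a := (Real.pi / (2 * s)) ^ 2 / μ
    have ha : 0 ≤ a := by positivity
    rw [h1]
    apply mul_lt_mul_of_pos_left _ hμ
    nlinarith
  set L := 4 * Real.sinh (2 * K) / Real.sinh (K * s)
  have hL : 0 ≤ L := by
    have h1 := Real.sinh_pos_iff.mpr (mul_pos hK0 hs)
    have h2 := Real.sinh_pos_iff.mpr (mul_pos two_pos hK0)
    positivity
  set b := 1 + 4 / s with hb
  have hb1 : 1 ≤ b := by rw [hb]; have : 0 ≤ 4 / s := by positivity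
                         linarith
  refine ⟨(1 + b) * L + b, ?_, ?_⟩
  · have : 0 ≤ (1 + b) * L := by positivity
    linarith
  intro Z w p k l m h x₀ q₀ A hx₀ hq₀ hA x q hx hq
  have hA0 : 0 ≤ A := (abs_nonneg _).trans (hA x₀ q₀ (by simp; linarith) (by simp; linarith))
  have hlow : ∀ x q, |x - x₀| ≤ s → |q| ≤ 1 → -(b * A) ≤ Z (x, q) := by
    intro x q hx hq
    refine h.column_lower hs ?_ hq₀ (fun t ht => hA x t hx ht) hq
    rw [abs_le] at *
    constructor <;> linarith
  have hLA : 0 ≤ (1 + b) * L * A := by positivity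
  have hbA : A ≤ b * A := by nlinarith
  rw [abs_le, add_mul]
  constructor
  · have := hlow x q (by linarith) hq
    linarith
  by_cases h1 : q₀ + s ≤ q
  · have := h.column_upper_aux hμ hs hK0 hK hx₀ hq₀
      (le_of_abs_le (hA x₀ (q₀ + s) (by simp; linarith) (by simp [abs_of_pos hs]))) hlow hx
      (le_of_abs_le hq) h1
    change _ ≤ _ * L at this
    have h2 : (A + b * A) * L = (1 + b) * L * A := by ring
    have : 0 ≤ b * A := by positivity
    linarith
  by_cases h2 : q ≤ q₀ - s
  · have := h.reflect.column_upper_aux (q₀ := -q₀) (q₁ := -q) hμ hs hK0 hK hx₀ (by rwa [abs_neg])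
      (A := A) (B := b * A) (by
        simp only [neg_add_rev, neg_neg]
        exact le_of_abs_le (hA x₀ (-s + q₀) (by simp; linarith) (by simp [abs_of_pos hs])))
      (fun x q hx hq => hlow x (-q) hx (by rwa [abs_neg])) hx
      (by linarith [neg_le_of_abs_le hq]) (by linarith)
    simp only [neg_neg] at this
    change _ ≤ _ * L at this
    have h2 : (A + b * A) * L = (1 + b) * L * A := by ring
    have : 0 ≤ b * A := by positivity
    linarith
  · have := le_of_abs_le (hA x q (by linarith) (abs_le.mpr ⟨by linarith, by linarith⟩))
    linarith

end Saddle

end GreenLp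

namespace GreenLp
open Set

/-- The closed box with center `c` and half-side `h`. -/
def box (c : ℝ × ℝ) (h : ℝ) : Set (ℝ × ℝ) := Icc (c.1 - h) (c.1 + h) ×ˢ Icc (c.2 - h) (c.2 + h)

theorem exists_slice_le {f : ℝ × ℝ → ℝ} {a b c d : ℝ} (hab : a < b)
    (hf : ContinuousOn f (Icc a b ×ˢ Icc c d)) :
    ∃ x ∈ Icc a b, (b - a) * (∫ q in Icc c d, f (x, q)) ≤ ∫ z in Icc a b ×ˢ Icc c d, f z := by
  have hInt : IntegrableOn f (Icc a b ×ˢ Icc c d) :=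
    hf.integrableOn_compact (isCompact_Icc.prod isCompact_Icc)
  have hInt' : Integrable f ((volume.restrict (Icc a b)).prod (volume.restrict (Icc c d))) := by
    rw [Measure.prod_restrict]; exact hInt
  have h1 : ∫ z in Icc a b ×ˢ Icc c d, f z = ∫ x in Icc a b, ∫ q in Icc c d, f (x, q) :=
    setIntegral_prod f hInt
  have h2 : IntegrableOn (fun x => ∫ q in Icc c d, f (x, q)) (Icc a b) := hInt'.integral_prod_left
  obtain ⟨x, hx, hle⟩ := exists_le_setAverage (by simp [hab]) (by simp) h2
  refine ⟨x, hx, ?_⟩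
  rw [h1]
  rw [setAverage_eq, smul_eq_mul, Real.volume_real_Icc_of_le hab.le] at hle
  have : 0 < b - a := by linarith
  calc _ ≤ (b - a) * ((b - a)⁻¹ * ∫ x in Icc a b, ∫ q in Icc c d, f (x, q)) := by gcongr
    _ = _ := by field_simp

theorem setIntegral_prod_swap' {f : ℝ × ℝ → ℝ} {s t : Set ℝ} :
    ∫ z in s ×ˢ t, f z.swap = ∫ z in t ×ˢ s, f z := by
  exact setIntegral_prod_swap t s f

theorem bilinear_interp {x₁ x₂ q₁ q₂ : ℝ} (hx : x₁ < x₂) (hq : q₁ < q₂) (z₁₁ z₁₂ z₂₁ z₂₂ : ℝ) :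
    ∃ a b c d : ℝ, z₁₁ - (a + b * x₁ + c * q₁ + d * (x₁ * q₁)) = 0 ∧
      z₁₂ - (a + b * x₁ + c * q₂ + d * (x₁ * q₂)) = 0 ∧
      z₂₁ - (a + b * x₂ + c * q₁ + d * (x₂ * q₁)) = 0 ∧
      z₂₂ - (a + b * x₂ + c * q₂ + d * (x₂ * q₂)) = 0 := by
  have h1 : x₂ - x₁ ≠ 0 := by linarith
  have h2 : q₂ - q₁ ≠ 0 := by linarith
  obtain ⟨d, hd⟩ : ∃ d, d * ((x₂ - x₁) * (q₂ - q₁)) = z₂₂ - z₂₁ - z₁₂ + z₁₁ :=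
    ⟨(z₂₂ - z₂₁ - z₁₂ + z₁₁) / ((x₂ - x₁) * (q₂ - q₁)), by field_simp⟩
  obtain ⟨b, hb⟩ : ∃ b, (b + d * q₁) * (x₂ - x₁) = z₂₁ - z₁₁ :=
    ⟨(z₂₁ - z₁₁) / (x₂ - x₁) - d * q₁, by field_simp; ring⟩
  obtain ⟨c, hc⟩ : ∃ c, (c + d * x₁) * (q₂ - q₁) = z₁₂ - z₁₁ :=
    ⟨(z₁₂ - z₁₁) / (q₂ - q₁) - d * x₁, by field_simp; ring⟩
  refine ⟨z₁₁ - (b * x₁ + c * q₁ + d * (x₁ * q₁)), b, c, d, by ring, ?_, ?_, ?_⟩ <;> linarith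

namespace Saddle

variable {μ : ℝ} {D : Set (ℝ × ℝ)} {Z w p k l m : ℝ × ℝ → ℝ}

theorem w_mono (h : Saddle μ D Z w p k l m) {x a b : ℝ} (hab : a ≤ b)
    (hD : ∀ t ∈ Icc a b, (x, t) ∈ D) : w (x, a) ≤ w (x, b) := by
  have : MonotoneOn (fun t => w (x, t)) (Icc a b) := by
    refine monotoneOn_of_deriv_nonneg (convex_Icc a b)
      (fun t ht => (h.w_q (hD t ht)).continuousAt.continuousWithinAt)
      (fun t ht => (h.w_q (hD t (interior_subset ht))).differentiableAt.differentiableWithinAt)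
      fun t ht => ?_
    rw [(h.w_q (hD t (interior_subset ht))).deriv]
    exact (h.k_pos _ (hD t (interior_subset ht))).le
  exact this ⟨le_rfl, hab⟩ ⟨hab, le_rfl⟩ hab

theorem integral_k (h : Saddle μ D Z w p k l m) {x a b : ℝ} (hab : a ≤ b)
    (hD : ∀ t ∈ Icc a b, (x, t) ∈ D) : ∫ q in Icc a b, k (x, q) = w (x, b) - w (x, a) := by
  rw [integral_Icc_eq_integral_Ioc, ← intervalIntegral.integral_of_le hab]
  rw [← uIcc_of_le hab] at hD
  refine intervalIntegral.integral_eq_sub_of_hasDerivAt (fun t ht => h.w_q (hD t ht)) ?_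
  refine ContinuousOn.intervalIntegrable ?_
  exact h.k_cont.comp (Continuous.prodMk_right x).continuousOn hD

theorem exists_w_diff (h : Saddle μ D Z w p k l m) {a b c d : ℝ} (hab : a < b) (hcd : c ≤ d)
    (hD : Icc a b ×ˢ Icc c d ⊆ D) :
    ∃ x ∈ Icc a b, (b - a) * (w (x, d) - w (x, c)) ≤ ∫ z in Icc a b ×ˢ Icc c d, k z := by
  obtain ⟨x, hx, hle⟩ := exists_slice_le hab (h.k_cont.mono hD)
  rw [h.integral_k hcd fun t ht => hD ⟨hx, ht⟩] at hle
  exact ⟨x, hx, hle⟩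

theorem exists_p_diff (h : Saddle μ D Z w p k l m) {a b c d : ℝ} (hab : a ≤ b) (hcd : c < d)
    (hD : Icc a b ×ˢ Icc c d ⊆ D) :
    ∃ q ∈ Icc c d, (d - c) * (p (b, q) - p (a, q)) ≤ ∫ z in Icc a b ×ˢ Icc c d, l z := by
  obtain ⟨x, hx, hle⟩ := h.swap.exists_w_diff hcd hab (fun z hz => hD ⟨hz.2, hz.1⟩)
  refine ⟨x, hx, hle.trans_eq ?_⟩
  exact setIntegral_prod_swap'

theorem edge_q (h : Saddle μ D Z w p k l m) {x a b M : ℝ} (hab : a < b)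
    (hD : ∀ t ∈ Icc a b, (x, t) ∈ D) (ha : Z (x, a) = 0) (hb : Z (x, b) = 0)
    (hM : w (x, b) - w (x, a) ≤ M) {q : ℝ} (hq : q ∈ Icc a b) :
    -(M * (b - a)) ≤ Z (x, q) ∧ Z (x, q) ≤ 0 := by
  have tang : ∀ s ∈ Icc a b, ∀ t ∈ Icc a b, Z (x, s) + w (x, s) * (t - s) ≤ Z (x, t) :=
    fun s hs t ht => h.tangent_le_q fun r hr => hD r (uIcc_subset_Icc hs ht hr)
  have ham : a ∈ Icc a b := ⟨le_rfl, hab.le⟩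
  have hbm : b ∈ Icc a b := ⟨hab.le, le_rfl⟩
  have t1 := tang a ham q hq
  have t2 := tang b hbm a ham
  have t3 := tang q hq a ham
  have t4 := tang q hq b hbm
  have t5 := tang a ham b hbm
  rw [ha] at t1 t2 t3 t5
  rw [hb] at t2 t4 t5
  obtain ⟨hq1, hq2⟩ := hq
  have hwb : 0 ≤ w (x, b) := by nlinarith
  have hwa : w (x, a) ≤ 0 := by nlinarith
  constructor
  · have h1 : -M ≤ w (x, a) := by linarith
    have hM0 : 0 ≤ M := by linarith
    nlinarith [mul_le_mul_of_nonneg_right h1 (sub_nonneg.mpr hq1)]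
  · rcases le_total 0 (w (x, q)) with hw | hw
    · nlinarith [mul_nonneg hw (sub_nonneg.mpr hq2)]
    · nlinarith [mul_nonneg (neg_nonneg.mpr hw) (sub_nonneg.mpr hq1)]

theorem le_of_ends_q (h : Saddle μ D Z w p k l m) {x a b M : ℝ}
    (hD : ∀ t ∈ Icc a b, (x, t) ∈ D) (ha : Z (x, a) ≤ M) (hb : Z (x, b) ≤ M)
    {q : ℝ} (hq : q ∈ Icc a b) : Z (x, q) ≤ M := by
  have hab : a ≤ b := hq.1.trans hq.2
  have tang : ∀ s ∈ Icc a b, ∀ t ∈ Icc a b, Z (x, s) + w (x, s) * (t - s) ≤ Z (x, t) :=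
    fun s hs t ht => h.tangent_le_q fun r hr => hD r (uIcc_subset_Icc hs ht hr)
  have t3 := tang q hq a ⟨le_rfl, hab⟩
  have t4 := tang q hq b ⟨hab, le_rfl⟩
  obtain ⟨hq1, hq2⟩ := hq
  rcases le_total 0 (w (x, q)) with hw | hw
  · nlinarith [mul_nonneg hw (sub_nonneg.mpr hq2)]
  · nlinarith [mul_nonneg (neg_nonneg.mpr hw) (sub_nonneg.mpr hq1)]

theorem edge_x (h : Saddle μ D Z w p k l m) {q a b M : ℝ} (hab : a < b)
    (hD : ∀ t ∈ Icc a b, (t, q) ∈ D) (ha : Z (a, q) = 0) (hb : Z (b, q) = 0)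
    (hM : p (b, q) - p (a, q) ≤ M) {x : ℝ} (hx : x ∈ Icc a b) :
    0 ≤ Z (x, q) ∧ Z (x, q) ≤ M * (b - a) := by
  have := h.swap.edge_q (x := q) hab (fun t ht => hD t ht) (by simpa using ha) (by simpa using hb)
    hM hx
  simp only [Prod.swap_prod_mk] at this
  constructor <;> linarith [this.1, this.2]

theorem le_of_ends_x (h : Saddle μ D Z w p k l m) {q a b M : ℝ}
    (hD : ∀ t ∈ Icc a b, (t, q) ∈ D) (ha : M ≤ Z (a, q)) (hb : M ≤ Z (b, q))
    {x : ℝ} (hx : x ∈ Icc a b) : M ≤ Z (x, q) := by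
  have := h.swap.le_of_ends_q (x := q) (M := -M) (fun t ht => hD t ht) (by simpa using ha)
    (by simpa using hb) hx
  simpa using this

/-- After subtracting a bilinear function, a saddle function is controlled by the mass of `k`. -/
theorem exists_bilinear (h : Saddle μ D Z w p k l m) (hμ : 0 < μ) (hμ1 : μ ≤ 1) {c : ℝ × ℝ}
    {s A : ℝ} (hs : 0 < s) (hD : box c s ⊆ D) (hA : ∫ z in box c s, k z ≤ A) :
    ∃ a₀ b₀ c₀ d₀ : ℝ, ∀ x q, |x - c.1| ≤ s / 2 → |q - c.2| ≤ s / 2 →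
      |Z (x, q) - (a₀ + b₀ * x + c₀ * q + d₀ * (x * q))| ≤ 4 / μ * A := by
  have hA0 : 0 ≤ A := le_trans (setIntegral_nonneg (measurableSet_Icc.prod measurableSet_Icc)
    fun z hz => (h.k_pos z (hD hz)).le) hA
  have hkint : IntegrableOn k (box c s) :=
    (h.k_cont.mono hD).integrableOn_compact (isCompact_Icc.prod isCompact_Icc)
  have hlint : IntegrableOn l (box c s) :=
    (h.l_cont.mono hD).integrableOn_compact (isCompact_Icc.prod isCompact_Icc)
  have hl : ∫ z in box c s, l z ≤ A / μ := by
    rw [le_div_iff₀ hμ]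
    refine le_trans ?_ hA
    rw [← integral_mul_const]
    exact setIntegral_mono_on (hlint.mul_const μ) hkint (measurableSet_Icc.prod measurableSet_Icc)
      fun z hz => by rw [mul_comm]; exact h.k_ge z (hD hz)
  have sub1 : ∀ a b : ℝ, c.1 - s ≤ a → b ≤ c.1 + s →
      Icc a b ×ˢ Icc (c.2 - s) (c.2 + s) ⊆ box c s := fun a b ha hb =>
    prod_mono (Icc_subset_Icc ha hb) subset_rfl
  have sub2 : ∀ a b : ℝ, c.2 - s ≤ a → b ≤ c.2 + s →
      Icc (c.1 - s) (c.1 + s) ×ˢ Icc a b ⊆ box c s := fun a b ha hb =>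
    prod_mono subset_rfl (Icc_subset_Icc ha hb)
  have selx : ∀ a b : ℝ, a + s / 2 = b → c.1 - s ≤ a → b ≤ c.1 + s → ∃ x ∈ Icc a b,
      w (x, c.2 + s) - w (x, c.2 - s) ≤ 2 * A / s := by
    intro a b hab ha hb
    obtain ⟨x, hx, hle⟩ := h.exists_w_diff (a := a) (b := b) (c := c.2 - s) (d := c.2 + s)
      (by linarith) (by linarith) ((sub1 a b ha hb).trans hD)
    refine ⟨x, hx, ?_⟩
    have h1 : ∫ z in Icc a b ×ˢ Icc (c.2 - s) (c.2 + s), k z ≤ ∫ z in box c s, k z :=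
      setIntegral_mono_set hkint (by
        filter_upwards [ae_restrict_mem (measurableSet_Icc.prod measurableSet_Icc)] with z hz
        exact (h.k_pos z (hD hz)).le) (Filter.Eventually.of_forall (sub1 a b ha hb))
    rw [le_div_iff₀ hs]
    rw [show b - a = s / 2 by linarith] at hle
    linarith
  have selq : ∀ a b : ℝ, a + s / 2 = b → c.2 - s ≤ a → b ≤ c.2 + s → ∃ q ∈ Icc a b,
      p (c.1 + s, q) - p (c.1 - s, q) ≤ 2 * (A / μ) / s := by
    intro a b hab ha hb
    obtain ⟨x, hx, hle⟩ := h.exists_p_diff (c := a) (d := b) (a := c.1 - s) (b := c.1 + s)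
      (by linarith) (by linarith) ((sub2 a b ha hb).trans hD)
    refine ⟨x, hx, ?_⟩
    have h1 : ∫ z in Icc (c.1 - s) (c.1 + s) ×ˢ Icc a b, l z ≤ ∫ z in box c s, l z :=
      setIntegral_mono_set hlint (by
        filter_upwards [ae_restrict_mem (measurableSet_Icc.prod measurableSet_Icc)] with z hz
        exact (h.l_pos z (hD hz)).le) (Filter.Eventually.of_forall (sub2 a b ha hb))
    rw [le_div_iff₀ hs]
    rw [show b - a = s / 2 by linarith] at hle
    linarith
  obtain ⟨x₁, ⟨hx₁, hx₁'⟩, hw₁⟩ :=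
    selx (c.1 - s) (c.1 - s / 2) (by ring) (by linarith) (by linarith)
  obtain ⟨x₂, ⟨hx₂, hx₂'⟩, hw₂⟩ :=
    selx (c.1 + s / 2) (c.1 + s) (by ring) (by linarith) (by linarith)
  obtain ⟨q₁, ⟨hq₁, hq₁'⟩, hp₁⟩ :=
    selq (c.2 - s) (c.2 - s / 2) (by ring) (by linarith) (by linarith)
  obtain ⟨q₂, ⟨hq₂, hq₂'⟩, hp₂⟩ :=
    selq (c.2 + s / 2) (c.2 + s) (by ring) (by linarith) (by linarith)
  obtain ⟨a₀, b₀, c₀, d₀, e₁₁, e₁₂, e₂₁, e₂₂⟩ := bilinear_interp (x₁ := x₁) (x₂ := x₂) (q₁ := q₁)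
    (q₂ := q₂) (by linarith) (by linarith) (Z (x₁, q₁)) (Z (x₁, q₂)) (Z (x₂, q₁)) (Z (x₂, q₂))
  refine ⟨a₀, b₀, c₀, d₀, fun x q hx hq => ?_⟩
  rw [abs_le] at hx hq
  have g := (h.mono hD).sub_bilinear a₀ b₀ c₀ d₀
  have hwm : ∀ x ∈ Icc (c.1 - s) (c.1 + s), w (x, q₂) - w (x, q₁) ≤
      w (x, c.2 + s) - w (x, c.2 - s) := by
    intro x hx
    have m1 := h.w_mono (x := x) (a := c.2 - s) (b := q₁) hq₁ fun t ht =>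
      hD ⟨hx, ⟨ht.1, by simp only; linarith [ht.2]⟩⟩
    have m2 := h.w_mono (x := x) (a := q₂) (b := c.2 + s) hq₂' fun t ht =>
      hD ⟨hx, ⟨by simp only; linarith [ht.1], ht.2⟩⟩
    linarith
  have hpm : ∀ q ∈ Icc (c.2 - s) (c.2 + s), p (x₂, q) - p (x₁, q) ≤
      p (c.1 + s, q) - p (c.1 - s, q) := by
    intro q hq
    have m1 := h.swap.w_mono (x := q) (a := c.1 - s) (b := x₁) hx₁ fun t ht =>
      hD ⟨⟨ht.1, by simp only [Prod.swap_prod_mk]; linarith [ht.2]⟩, hq⟩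
    have m2 := h.swap.w_mono (x := q) (a := x₂) (b := c.1 + s) hx₂' fun t ht =>
      hD ⟨⟨by simp only [Prod.swap_prod_mk]; linarith [ht.1], ht.2⟩, hq⟩
    simp only [Prod.swap_prod_mk] at m1 m2
    linarith
  have inbox : ∀ x q, x ∈ Icc x₁ x₂ → q ∈ Icc q₁ q₂ → (x, q) ∈ box c s := fun x q hx hq =>
    ⟨⟨hx₁.trans hx.1, hx.2.trans hx₂'⟩, ⟨hq₁.trans hq.1, hq.2.trans hq₂'⟩⟩
  have hxI : x ∈ Icc x₁ x₂ := ⟨by linarith, by linarith⟩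
  have hqI : q ∈ Icc q₁ q₂ := ⟨by linarith, by linarith⟩
  have x₁I : x₁ ∈ Icc x₁ x₂ := ⟨le_rfl, by linarith⟩
  have x₂I : x₂ ∈ Icc x₁ x₂ := ⟨by linarith, le_rfl⟩
  have q₁I : q₁ ∈ Icc q₁ q₂ := ⟨le_rfl, by linarith⟩
  have q₂I : q₂ ∈ Icc q₁ q₂ := ⟨by linarith, le_rfl⟩
  have eq1 := g.edge_q (x := x₁) (a := q₁) (b := q₂) (M := 2 * A / s) (by linarith)
    (fun t ht => inbox _ _ x₁I ht) e₁₁ e₁₂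
    (by have := hwm x₁ ⟨by linarith, by linarith⟩; linarith) hqI
  have eq2 := g.edge_q (x := x₂) (a := q₁) (b := q₂) (M := 2 * A / s) (by linarith)
    (fun t ht => inbox _ _ x₂I ht) e₂₁ e₂₂
    (by have := hwm x₂ ⟨by linarith, by linarith⟩; linarith) hqI
  have ex1 := g.edge_x (q := q₁) (a := x₁) (b := x₂) (M := 2 * (A / μ) / s) (by linarith)
    (fun t ht => inbox _ _ ht q₁I) e₁₁ e₂₁
    (by have := hpm q₁ ⟨by linarith, by linarith⟩; linarith) hxI
  have ex2 := g.edge_x (q := q₂) (a := x₁) (b := x₂) (M := 2 * (A / μ) / s) (by linarith)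
    (fun t ht => inbox _ _ ht q₂I) e₁₂ e₂₂
    (by have := hpm q₂ ⟨by linarith, by linarith⟩; linarith) hxI
  have hAμ : A ≤ A / μ := by rw [le_div_iff₀ hμ]; nlinarith
  have up : 2 * (A / μ) / s * (x₂ - x₁) ≤ 4 / μ * A := by
    have : x₂ - x₁ ≤ 2 * s := by linarith
    calc _ ≤ 2 * (A / μ) / s * (2 * s) := by gcongr
      _ = _ := by field_simp; ring
  have lo : 2 * A / s * (q₂ - q₁) ≤ 4 / μ * A := by
    have : q₂ - q₁ ≤ 2 * s := by linarith
    calc _ ≤ 2 * A / s * (2 * s) := by gcongr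
      _ = 4 * A := by field_simp; ring
      _ ≤ 4 * (A / μ) := by gcongr
      _ = _ := by ring
  rw [abs_le]
  constructor
  · have := g.le_of_ends_x (q := q) (a := x₁) (b := x₂) (M := -(2 * A / s * (q₂ - q₁)))
      (fun t ht => inbox _ _ ht hqI) eq1.1 eq2.1 hxI
    simp only at this
    linarith
  · have := g.le_of_ends_q (x := x) (a := q₁) (b := q₂) (M := (2 * (A / μ) / s * (x₂ - x₁)))
      (fun t ht => inbox _ _ hxI ht) ex1.2 ex2.2 hqI
    simp only at this
    linarith

end Saddle

end GreenLp

namespace GreenLp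
open Set

theorem det_prod_fst_snd (a b c d : ℝ) :
    ((a • ContinuousLinearMap.fst ℝ ℝ ℝ + b • ContinuousLinearMap.snd ℝ ℝ ℝ).prod
      (c • ContinuousLinearMap.fst ℝ ℝ ℝ + d • ContinuousLinearMap.snd ℝ ℝ ℝ)).det
      = a * d - b * c := by
  have : ((a • ContinuousLinearMap.fst ℝ ℝ ℝ + b • ContinuousLinearMap.snd ℝ ℝ ℝ).prod
      (c • ContinuousLinearMap.fst ℝ ℝ ℝ + d • ContinuousLinearMap.snd ℝ ℝ ℝ)) =
      (Matrix.toLin (Module.Basis.finTwoProd ℝ) (Module.Basis.finTwoProd ℝ)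
        !![a, b; c, d]).toContinuousLinearMap := by
    rw [Matrix.toLin_finTwoProd_toContinuousLinearMap]
  rw [this, LinearMap.det_toContinuousLinearMap, LinearMap.det_toLin, Matrix.det_fin_two_of]

namespace Saddle

variable {μ : ℝ} {Z w p k l m : ℝ × ℝ → ℝ}

theorem row_bound {μ s : ℝ} (hμ : 0 < μ) (hs : 0 < s) :
    ∃ C ≥ 1, ∀ Z w p k l m : ℝ × ℝ → ℝ, Saddle μ unitSq Z w p k l m →
      ∀ x₀ q₀ A : ℝ, |x₀| ≤ 1 - s → |q₀| ≤ 1 - s →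
      (∀ x q, |x - x₀| ≤ s → |q - q₀| ≤ s → |Z (x, q)| ≤ A) →
      ∀ x q, |q - q₀| ≤ s / 2 → |x| ≤ 1 → |Z (x, q)| ≤ C * A := by
  obtain ⟨C, hC, H⟩ := column_bound hμ hs
  refine ⟨C, hC, fun Z w p k l m h x₀ q₀ A hx₀ hq₀ hA x q hq hx => ?_⟩
  have := H _ _ _ _ _ _ h.swap_unitSq q₀ x₀ A hq₀ hx₀
    (fun x q hx hq => by simpa using hA q x hq hx) q x hq hx
  simpa using this

theorem strip_bound {μ s : ℝ} (hμ : 0 < μ) (hs : 0 < s) :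
    ∃ C ≥ 1, ∀ Z w p k l m : ℝ × ℝ → ℝ, Saddle μ unitSq Z w p k l m →
      ∀ x₀ q₀ A : ℝ, |x₀| ≤ 1 - s → |q₀| ≤ 1 - s →
      (∀ x q, |x - x₀| ≤ s → |q - q₀| ≤ s → |Z (x, q)| ≤ A) →
      ∀ x q, |x| ≤ 1 → |q| ≤ 1 - s → |Z (x, q)| ≤ C * A := by
  obtain ⟨C₁, hC₁, H₁⟩ := column_bound hμ hs
  obtain ⟨C₂, hC₂, H₂⟩ := row_bound hμ (half_pos hs)
  refine ⟨C₂ * C₁, by nlinarith, fun Z w p k l m h x₀ q₀ A hx₀ hq₀ hA x q hx hq => ?_⟩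
  have h1 := H₁ _ _ _ _ _ _ h x₀ q₀ A hx₀ hq₀ hA
  rw [mul_assoc]
  refine H₂ _ _ _ _ _ _ h x₀ q (C₁ * A) (by linarith) (by linarith) (fun x' q' hx' hq' => ?_) x q
    (by simp; linarith) hx
  refine h1 x' q' hx' ?_
  rw [abs_le] at *
  constructor <;> linarith

theorem abs_w_le (h : Saddle μ unitSq Z w p k l m) {s A x q : ℝ} (hs : 0 < s) (hx : |x| ≤ 1)
    (hq : |q| ≤ 1 - s) (hA : ∀ q', |q' - q| ≤ s → |Z (x, q')| ≤ A) :
    |w (x, q)| ≤ 2 * A / s := by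
  rw [abs_le] at hx hq
  have tang : ∀ q', |q' - q| ≤ s → Z (x, q) + w (x, q) * (q' - q) ≤ Z (x, q') := by
    intro q' hq'
    rw [abs_le] at hq'
    exact h.tangent_le_q fun r hr => ⟨hx, uIcc_subset_of_abs (abs_le.mpr ⟨by linarith, by linarith⟩)
      (abs_le.mpr ⟨by linarith, by linarith⟩) hr⟩
  have t1 := tang (q + s) (by simp [abs_of_pos hs])
  have t2 := tang (q - s) (by simp [abs_of_pos hs])
  have a0 := abs_le.mp (hA q (by simp; exact hs.le))
  have a1 := abs_le.mp (hA (q + s) (by simp [abs_of_pos hs]))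
  have a2 := abs_le.mp (hA (q - s) (by simp [abs_of_pos hs]))
  rw [abs_le, neg_le, le_div_iff₀ hs, le_div_iff₀ hs]
  constructor <;> linarith

theorem abs_p_le (h : Saddle μ unitSq Z w p k l m) {s A x q : ℝ} (hs : 0 < s) (hq : |q| ≤ 1)
    (hx : |x| ≤ 1 - s) (hA : ∀ x', |x' - x| ≤ s → |Z (x', q)| ≤ A) :
    |p (x, q)| ≤ 2 * A / s := by
  have := h.swap_unitSq.abs_w_le (x := q) (q := x) hs hq hx (A := A)
    (fun t ht => by simpa using hA t ht)
  simpa using this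

/-- The map `(w, p)` attached to a saddle function is injective on convex sets. -/
theorem injOn_wp {D : Set (ℝ × ℝ)} (h : Saddle μ D Z w p k l m) (hconv : Convex ℝ D) :
    InjOn (fun z => (w z, p z)) D := by
  intro z hz z' hz' heq
  by_contra hne
  have hwz : w z = w z' := congrArg Prod.fst heq
  have hpz : p z = p z' := congrArg Prod.snd heq
  set d := z' - z with hd
  have hseg : ∀ t ∈ Icc (0 : ℝ) 1, z + t • d ∈ D := fun t ht => by
    have := hconv hz hz' (sub_nonneg.mpr ht.2) ht.1 (by ring)
    convert this using 1
    rw [hd]; module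
  have hline : ∀ t : ℝ, HasDerivAt (fun t : ℝ => z + t • d) d t := fun t => by
    simpa using ((hasDerivAt_id t).smul_const d).const_add z
  have hder : ∀ t ∈ Icc (0 : ℝ) 1, HasDerivAt (fun t : ℝ => w (z + t • d) * d.2 + p (z + t • d) * d.1)
      (k (z + t • d) * d.2 ^ 2 + l (z + t • d) * d.1 ^ 2) t := fun t ht => by
    have h1 := ((h.hw _ (hseg t ht)).comp_hasDerivAt t (hline t)).mul_const d.2
    have h2 := ((h.hp _ (hseg t ht)).comp_hasDerivAt t (hline t)).mul_const d.1
    refine (h1.add h2).congr_deriv ?_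
    simp only [add_apply, sub_apply, smul_apply, ContinuousLinearMap.coe_fst',
      ContinuousLinearMap.coe_snd', smul_eq_mul]
    ring
  obtain ⟨t, ht, ht'⟩ := exists_hasDerivAt_eq_slope _ _ zero_lt_one
    (fun t ht => (hder t ht).continuousAt.continuousWithinAt)
    (fun t ht => hder t (Ioo_subset_Icc_self ht))
  have hzero : k (z + t • d) * d.2 ^ 2 + l (z + t • d) * d.1 ^ 2 = 0 := by
    rw [ht']
    have : z + d = z' := by rw [hd]; abel
    simp [this, hwz, hpz]
  have hm := hseg t (Ioo_subset_Icc_self ht)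
  have hk := h.k_pos _ hm
  have hl := h.l_pos _ hm
  have e1 : d.2 ^ 2 = 0 := by
    by_contra hc
    have : 0 < d.2 ^ 2 := lt_of_le_of_ne (sq_nonneg _) (Ne.symm hc)
    nlinarith [mul_pos hk this, mul_nonneg hl.le (sq_nonneg d.1)]
  have e2 : d.1 ^ 2 = 0 := by
    by_contra hc
    have : 0 < d.1 ^ 2 := lt_of_le_of_ne (sq_nonneg _) (Ne.symm hc)
    nlinarith [mul_pos hl this, mul_nonneg hk.le (sq_nonneg d.2)]
  apply hne
  have : d = 0 := Prod.ext (pow_eq_zero_iff (by norm_num) |>.mp e2)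
    (pow_eq_zero_iff (by norm_num) |>.mp e1)
  rw [hd, sub_eq_zero] at this
  exact this.symm

theorem integral_sq_le {D : Set (ℝ × ℝ)} (h : Saddle μ D Z w p k l m) (hμ : 0 < μ)
    (hconv : Convex ℝ D) (hD : MeasurableSet D) {M : ℝ} (hM : 0 ≤ M)
    (hw : ∀ z ∈ D, |w z| ≤ M) (hp : ∀ z ∈ D, |p z| ≤ M) :
    ∫⁻ z in D, ENNReal.ofReal (μ * k z ^ 2) ≤ ENNReal.ofReal ((2 * M) ^ 2) := by
  have hder : ∀ z ∈ D, HasFDerivWithinAt (fun z => (w z, p z))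
      ((m z • ContinuousLinearMap.fst ℝ ℝ ℝ + k z • ContinuousLinearMap.snd ℝ ℝ ℝ).prod
      (l z • ContinuousLinearMap.fst ℝ ℝ ℝ + (-m z) • ContinuousLinearMap.snd ℝ ℝ ℝ)) D z := by
    intro z hz
    refine ((h.hw z hz).prodMk (h.hp z hz)).hasFDerivWithinAt.congr_fderiv ?_
    ext <;> simp
  have key := lintegral_abs_det_fderiv_eq_addHaar_image volume hD hder (h.injOn_wp hconv)
  have himg : (fun z => (w z, p z)) '' D ⊆ Icc (-M) M ×ˢ Icc (-M) M := by
    rintro _ ⟨z, hz, rfl⟩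
    exact ⟨abs_le.mp (hw z hz), abs_le.mp (hp z hz)⟩
  have hvol : (volume : Measure (ℝ × ℝ)) ((fun z => (w z, p z)) '' D) ≤
      ENNReal.ofReal ((2 * M) ^ 2) := by
    refine (measure_mono himg).trans ?_
    rw [Measure.volume_eq_prod, Measure.prod_prod, Real.volume_Icc, ← ENNReal.ofReal_mul (by linarith)]
    apply le_of_eq
    congr 1; ring
  rw [← key] at hvol
  refine le_trans (setLIntegral_mono_ae' hD (Filter.Eventually.of_forall fun z hz => ?_)) hvol
  rw [det_prod_fst_snd]
  apply ENNReal.ofReal_le_ofReal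
  have hk := h.k_pos z hz
  have hl := h.l_ge z hz
  rw [show m z * -m z - k z * l z = -(m z ^ 2 + k z * l z) by ring, abs_neg]
  refine le_trans ?_ (le_abs_self _)
  nlinarith [sq_nonneg (m z), mul_le_mul_of_nonneg_left hl hk.le]

/-- Core estimates for saddle functions on the unit square in terms of the mass of `k` on a
small sub-box. -/
theorem core {μ s : ℝ} (hμ : 0 < μ) (hμ1 : μ ≤ 1) (hs : 0 < s) :
    ∃ C ≥ 1, ∀ Z w p k l m : ℝ × ℝ → ℝ, Saddle μ unitSq Z w p k l m →
      ∀ (c : ℝ × ℝ) (A : ℝ), |c.1| ≤ 1 - s → |c.2| ≤ 1 - s → ∫ z in box c s, k z ≤ A →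
      (∀ x q q', |x| ≤ 1 → |q| ≤ 1 - 2 * s → |q'| ≤ 1 - 2 * s → w (x, q') - w (x, q) ≤ C * A) ∧
      ∫⁻ z in box 0 (1 - 2 * s), ENNReal.ofReal (k z ^ 2) ≤ ENNReal.ofReal (C * A ^ 2) := by
  obtain ⟨C, hC, H⟩ := strip_bound hμ (half_pos hs)
  set C₁ := 2 * (C * (4 / μ)) / s with hC₁
  have hC₁0 : 0 < C₁ := by positivity
  refine ⟨max 1 (max (2 * C₁) ((2 * C₁) ^ 2 / μ)), le_max_left _ _,
    fun Z w p k l m h c A hc1 hc2 hA => ?_⟩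
  have hbox : box c s ⊆ unitSq := by
    rw [abs_le] at hc1 hc2
    exact prod_mono (Icc_subset_Icc (by linarith) (by linarith))
      (Icc_subset_Icc (by linarith) (by linarith))
  have hA0 : 0 ≤ A := le_trans (setIntegral_nonneg (measurableSet_Icc.prod measurableSet_Icc)
    fun z hz => (h.k_pos z (hbox hz)).le) hA
  obtain ⟨a₀, b₀, c₀, d₀, hZ⟩ := h.exists_bilinear hμ hμ1 hs hbox hA
  have g := h.sub_bilinear a₀ b₀ c₀ d₀
  have strip := H _ _ _ _ _ _ g c.1 c.2 (4 / μ * A) (by linarith) (by linarith) hZ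
  have hwb : ∀ x q, |x| ≤ 1 → |q| ≤ 1 - 2 * s → |w (x, q) - (c₀ + d₀ * x)| ≤ C₁ * A := by
    intro x q hx hq
    have := g.abs_w_le (x := x) (q := q) hs hx (by linarith) (A := C * (4 / μ * A))
      (fun q' hq' => strip x q' hx (by rw [abs_le] at *; constructor <;> linarith))
    refine this.trans_eq ?_
    rw [hC₁]; ring
  have hpb : ∀ x q, |x| ≤ 1 - 2 * s → |q| ≤ 1 - 2 * s → |p (x, q) + (b₀ + d₀ * q)| ≤ C₁ * A := by
    intro x q hx hq
    have := g.abs_p_le (x := x) (q := q) hs (by linarith) (by linarith) (A := C * (4 / μ * A))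
      (fun x' hx' => strip x' q (by rw [abs_le] at *; constructor <;> linarith) (by linarith))
    refine this.trans_eq ?_
    rw [hC₁]; ring
  constructor
  · intro x q q' hx hq hq'
    have h1 := abs_le.mp (hwb x q hx hq)
    have h2 := abs_le.mp (hwb x q' hx hq')
    have h3 : w (x, q') - w (x, q) ≤ 2 * C₁ * A := by linarith
    refine h3.trans (mul_le_mul_of_nonneg_right ?_ hA0)
    exact (le_max_left _ _).trans (le_max_right _ _)
  · have hsub : box 0 (1 - 2 * s) ⊆ unitSq := by
      exact prod_mono (Icc_subset_Icc (by simp; linarith) (by simp; linarith))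
        (Icc_subset_Icc (by simp; linarith) (by simp; linarith))
    have hmem : ∀ z ∈ box 0 (1 - 2 * s), |z.1| ≤ 1 - 2 * s ∧ |z.2| ≤ 1 - 2 * s := by
      rintro z ⟨h1, h2⟩
      simp only [Prod.fst_zero, Prod.snd_zero, mem_Icc] at h1 h2
      exact ⟨abs_le.mpr ⟨by linarith, by linarith⟩, abs_le.mpr ⟨by linarith, by linarith⟩⟩
    have := (g.mono hsub).integral_sq_le hμ ((convex_Icc _ _).prod (convex_Icc _ _))
      (measurableSet_Icc.prod measurableSet_Icc) (M := C₁ * A) (by positivity)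
      (fun z hz => hwb z.1 z.2 (by linarith [(hmem z hz).1]) (hmem z hz).2)
      (fun z hz => hpb z.1 z.2 (hmem z hz).1 (hmem z hz).2)
    have hk : ∀ z, ENNReal.ofReal (k z ^ 2) = ENNReal.ofReal μ⁻¹ * ENNReal.ofReal (μ * k z ^ 2) := by
      intro z
      rw [← ENNReal.ofReal_mul (by positivity)]
      congr 1; field_simp
    simp_rw [hk]
    rw [lintegral_const_mul' _ _ ENNReal.ofReal_ne_top]
    refine (mul_le_mul_right this _).trans ?_
    rw [← ENNReal.ofReal_mul (by positivity)]
    apply ENNReal.ofReal_le_ofReal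
    calc μ⁻¹ * (2 * (C₁ * A)) ^ 2 = (2 * C₁) ^ 2 / μ * A ^ 2 := by ring
      _ ≤ _ := by
        gcongr
        exact (le_max_right _ _).trans (le_max_right _ _)

end Saddle

end GreenLp

namespace GreenLp
open Set

section Affine

variable {α β : ℝ}

theorem affine_injective (hα : 0 < α) (hβ : 0 < β) (xc qc : ℝ) :
    Function.Injective (fun z : ℝ × ℝ => (xc + α * z.1, qc + β * z.2)) := by
  rintro ⟨x, q⟩ ⟨x', q'⟩ h
  simp only [Prod.mk.injEq, add_right_inj, mul_eq_mul_left_iff, hα.ne', hβ.ne', or_false] at h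
  exact Prod.ext h.1 h.2

theorem affine_surjective (hα : 0 < α) (hβ : 0 < β) (xc qc : ℝ) :
    Function.Surjective (fun z : ℝ × ℝ => (xc + α * z.1, qc + β * z.2)) := by
  rintro ⟨x, q⟩
  refine ⟨((x - xc) / α, (q - qc) / β), ?_⟩
  ext <;> simp <;> field_simp <;> ring

theorem det_affine (α β : ℝ) :
    ((α • ContinuousLinearMap.fst ℝ ℝ ℝ).prod (β • ContinuousLinearMap.snd ℝ ℝ ℝ)).det = α * β := by
  have := det_prod_fst_snd α 0 0 β
  simpa using this

theorem setLIntegral_affine (hα : 0 < α) (hβ : 0 < β) (xc qc : ℝ)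
    {S : Set (ℝ × ℝ)} (hS : MeasurableSet S) (f : ℝ × ℝ → ENNReal) :
    ∫⁻ z in S, f z = ENNReal.ofReal (α * β) *
      ∫⁻ z in (fun z : ℝ × ℝ => (xc + α * z.1, qc + β * z.2)) ⁻¹' S,
        f (xc + α * z.1, qc + β * z.2) := by
  have hmeas : MeasurableSet ((fun z : ℝ × ℝ => (xc + α * z.1, qc + β * z.2)) ⁻¹' S) :=
    (by fun_prop : Measurable fun z : ℝ × ℝ => (xc + α * z.1, qc + β * z.2)) hS
  have := lintegral_image_eq_lintegral_abs_det_fderiv_mul volume hmeas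
    (fun z _ => (Saddle.hasFDerivAt_affine α β xc qc z).hasFDerivWithinAt)
    (affine_injective hα hβ xc qc).injOn f
  rw [image_preimage_eq _ (affine_surjective hα hβ xc qc)] at this
  rw [this]
  simp_rw [det_affine, abs_of_pos (mul_pos hα hβ)]
  rw [lintegral_const_mul' _ _ ENNReal.ofReal_ne_top]

theorem setIntegral_affine (hα : 0 < α) (hβ : 0 < β) (xc qc : ℝ)
    {S : Set (ℝ × ℝ)} (hS : MeasurableSet S) (f : ℝ × ℝ → ℝ) :
    ∫ z in S, f z = (α * β) *
      ∫ z in (fun z : ℝ × ℝ => (xc + α * z.1, qc + β * z.2)) ⁻¹' S,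
        f (xc + α * z.1, qc + β * z.2) := by
  have hmeas : MeasurableSet ((fun z : ℝ × ℝ => (xc + α * z.1, qc + β * z.2)) ⁻¹' S) :=
    (by fun_prop : Measurable fun z : ℝ × ℝ => (xc + α * z.1, qc + β * z.2)) hS
  have := integral_image_eq_integral_abs_det_fderiv_smul volume hmeas
    (fun z _ => (Saddle.hasFDerivAt_affine α β xc qc z).hasFDerivWithinAt)
    (affine_injective hα hβ xc qc).injOn f
  rw [image_preimage_eq _ (affine_surjective hα hβ xc qc)] at this
  rw [this]
  simp_rw [det_affine, abs_of_pos (mul_pos hα hβ), smul_eq_mul]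
  rw [integral_const_mul]

theorem affine_preimage_box (hα : 0 < α) (c a : ℝ × ℝ) (r : ℝ) :
    (fun z : ℝ × ℝ => (c.1 + α * z.1, c.2 + α * z.2)) ⁻¹' box (c + α • a) (α * r) = box a r := by
  ext ⟨x, q⟩
  simp only [box, mem_preimage, mem_prod, mem_Icc, Prod.fst_add, Prod.snd_add, Prod.smul_fst,
    Prod.smul_snd, smul_eq_mul]
  have key : ∀ u v w : ℝ, (u + α * v - α * r ≤ u + α * w ∧ u + α * w ≤ u + α * v + α * r) ↔
      (v - r ≤ w ∧ w ≤ v + r) := by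
    intro u v w
    constructor
    · rintro ⟨h1, h2⟩
      constructor <;> nlinarith
    · rintro ⟨h1, h2⟩
      constructor <;> nlinarith
  rw [key, key]

end Affine

theorem measurableSet_box (c : ℝ × ℝ) (h : ℝ) : MeasurableSet (box c h) :=
  measurableSet_Icc.prod measurableSet_Icc

theorem box_zero_one : box 0 1 = unitSq := by simp [box, unitSq]

namespace Saddle

/-- Reverse Hölder inequality with mass on a corner sub-box. -/
theorem reverse_holder {μ : ℝ} (hμ : 0 < μ) (hμ1 : μ ≤ 1) :
    ∃ C ≥ 1, ∀ (D : Set (ℝ × ℝ)) (Z w p k l m : ℝ × ℝ → ℝ), Saddle μ D Z w p k l m →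
      ∀ (c c' : ℝ × ℝ) (h : ℝ), 0 < h → box c (5 / 3 * h) ⊆ D →
      |c'.1 - c.1| ≤ h / 2 → |c'.2 - c.2| ≤ h / 2 →
      ∫⁻ z in box c h, ENNReal.ofReal (k z ^ 2) ≤
        ENNReal.ofReal (C / h ^ 2 * (∫ z in box c' (h / 2), k z) ^ 2) := by
  obtain ⟨C, hC, H⟩ := core hμ hμ1 (s := 1 / 5) (by norm_num)
  refine ⟨C, hC, fun D Z w p k l m hS c c' h hh hD h1 h2 => ?_⟩
  set α := 5 / 3 * h with hα
  have hα0 : 0 < α := by positivity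
  set a : ℝ × ℝ := α⁻¹ • (c' - c) with ha
  have hc' : c' = c + α • a := by
    rw [ha, smul_inv_smul₀ hα0.ne']; abel
  have ha' : ∀ t : ℝ, |t| ≤ h / 2 → |α⁻¹ * t| ≤ 3 / 10 := by
    intro t ht
    rw [abs_mul, abs_of_pos (inv_pos.mpr hα0), inv_mul_le_iff₀ hα0, hα]
    linarith
  have pre1 := affine_preimage_box hα0 c 0 1
  rw [smul_zero, add_zero, mul_one, box_zero_one] at pre1
  have pre2 := affine_preimage_box hα0 c 0 (1 - 2 * (1 / 5))
  rw [smul_zero, add_zero, show α * (1 - 2 * (1 / 5)) = h by rw [hα]; ring] at pre2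
  have pre3 := affine_preimage_box hα0 c a (1 / 5)
  rw [← hc', show α * (1 / 5) = h / 3 by rw [hα]; ring] at pre3
  have S := hS.comp_affine (μ' := μ) (D' := unitSq) α α c.1 c.2 hα0.ne' hα0.ne' le_rfl le_rfl
    (fun z hz => hD (by rw [← pre1] at hz; exact hz))
  have hsub : box c' (h / 3) ⊆ box c' (h / 2) :=
    prod_mono (Icc_subset_Icc (by linarith) (by linarith))
      (Icc_subset_Icc (by linarith) (by linarith))
  have hsub2 : box c' (h / 2) ⊆ D := by
    refine Subset.trans (prod_mono (Icc_subset_Icc ?_ ?_) (Icc_subset_Icc ?_ ?_)) hD <;>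
      rw [abs_le] at h1 h2 <;> linarith
  have hA : ∫ z in box a (1 / 5), α ^ 2 * k (c.1 + α * z.1, c.2 + α * z.2) ≤
      ∫ z in box c' (h / 2), k z := by
    rw [integral_const_mul, ← pre3, sq, ← setIntegral_affine hα0 hα0 c.1 c.2 (measurableSet_box _ _)]
    refine setIntegral_mono_set ((hS.k_cont.mono hsub2).integrableOn_compact
      (isCompact_Icc.prod isCompact_Icc)) ?_ (Filter.Eventually.of_forall hsub)
    filter_upwards [ae_restrict_mem (measurableSet_box _ _)] with z hz
    exact (hS.k_pos z (hsub2 hz)).le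
  have key := (H _ _ _ _ _ _ S a _ ((ha' _ h1).trans (by norm_num)) ((ha' _ h2).trans (by norm_num))
    hA).2
  have hrw : ∀ z : ℝ × ℝ, ENNReal.ofReal ((α ^ 2 * k (c.1 + α * z.1, c.2 + α * z.2)) ^ 2) =
      ENNReal.ofReal (α ^ 4) * ENNReal.ofReal (k (c.1 + α * z.1, c.2 + α * z.2) ^ 2) := fun z => by
    rw [← ENNReal.ofReal_mul (by positivity)]
    congr 1; ring
  simp_rw [hrw] at key
  rw [lintegral_const_mul' _ _ ENNReal.ofReal_ne_top] at key
  rw [setLIntegral_affine hα0 hα0 c.1 c.2 (measurableSet_box _ _), pre2]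
  set I := ∫⁻ z in box 0 (1 - 2 * (1 / 5)), ENNReal.ofReal (k (c.1 + α * z.1, c.2 + α * z.2) ^ 2)
  set A := ∫ z in box c' (h / 2), k z
  have h4 : ENNReal.ofReal (α * α) = ENNReal.ofReal ((α ^ 2)⁻¹) * ENNReal.ofReal (α ^ 4) := by
    rw [← ENNReal.ofReal_mul (by positivity)]
    congr 1; field_simp
  rw [h4, mul_assoc]
  refine (mul_le_mul_right key _).trans ?_
  rw [← ENNReal.ofReal_mul (by positivity)]
  apply ENNReal.ofReal_le_ofReal
  have h5 : (α ^ 2)⁻¹ ≤ (h ^ 2)⁻¹ := by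
    apply inv_anti₀ (by positivity)
    rw [hα]; nlinarith
  calc (α ^ 2)⁻¹ * (C * A ^ 2) ≤ (h ^ 2)⁻¹ * (C * A ^ 2) := by gcongr
    _ = _ := by ring

end Saddle

end GreenLp

namespace GreenLp
open Set

section Tree

variable {T : Type*}

/-- Iterated average of `f` over the `n`-th generation descendants in a 4-ary tree. -/
def treeAvg (ch : Fin 4 → T → T) (f : T → ℝ) : ℕ → T → ℝ
  | 0, R => f R
  | n + 1, R => (∑ i, treeAvg ch f n (ch i R)) / 4

open Classical in
/-- Proportion of the descendants (up to generation `n`) lying below a node with `b ≤ t`. -/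
def stopAvg (ch : Fin 4 → T → T) (b : T → ℝ) (t : ℝ) : ℕ → T → ℝ
  | 0, R => if b R ≤ t then 1 else 0
  | n + 1, R => if b R ≤ t then 1 else (∑ i, stopAvg ch b t n (ch i R)) / 4

theorem stopAvg_of_le (ch : Fin 4 → T → T) {b : T → ℝ} {t : ℝ} (n : ℕ) {R : T} (h : b R ≤ t) :
    stopAvg ch b t n R = 1 := by
  cases n <;> simp [stopAvg, h]

theorem stopAvg_zero_of_lt (ch : Fin 4 → T → T) {b : T → ℝ} {t : ℝ} {R : T} (h : t < b R) :
    stopAvg ch b t 0 R = 0 := by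
  simp [stopAvg, h]

theorem stopAvg_succ_of_lt (ch : Fin 4 → T → T) {b : T → ℝ} {t : ℝ} (n : ℕ) {R : T}
    (h : t < b R) : stopAvg ch b t (n + 1) R = (∑ i, stopAvg ch b t n (ch i R)) / 4 := by
  simp [stopAvg, h]

/-- Averages on a 4-ary tree satisfying a reverse Hölder inequality with respect to every child. -/
structure TreeRH (C : ℝ) (ch : Fin 4 → T → T) (P : T → Prop) (b σ : T → ℝ) : Prop where
  step : ∀ R, P R → ∀ i, P (ch i R)
  pos : ∀ R, P R → 0 < b R
  avg_b : ∀ R, P R → b R = (∑ i, b (ch i R)) / 4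
  avg_σ : ∀ R, P R → σ R = (∑ i, σ (ch i R)) / 4
  sq_le : ∀ R, P R → b R ^ 2 ≤ σ R
  rh : ∀ R, P R → ∀ i, σ R ≤ C * b (ch i R) ^ 2

theorem TreeRH.le_stopped {C : ℝ} {ch : Fin 4 → T → T} {P : T → Prop} {b σ : T → ℝ}
    (h : TreeRH C ch P b σ) {t θ : ℝ} (hθ : 0 < θ) (n : ℕ) :
    ∀ R, P R → b R ≤ t * stopAvg ch b t n R +
      (θ * σ R + (1 - stopAvg ch b t n R) / θ) / 2 := by
  have base : ∀ R, P R → b R ≤ (θ * σ R + 1 / θ) / 2 := by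
    intro R hR
    have h1 := h.sq_le R hR
    have h2 : 2 * b R ≤ θ * b R ^ 2 + 1 / θ := by
      have : 0 ≤ (θ * b R - 1) ^ 2 / θ := by positivity
      have e : (θ * b R - 1) ^ 2 / θ = θ * b R ^ 2 + 1 / θ - 2 * b R := by field_simp; ring
      linarith
    have := mul_le_mul_of_nonneg_left h1 hθ.le
    linarith
  have stopped : ∀ n R, P R → b R ≤ t → b R ≤ t * stopAvg ch b t n R +
      (θ * σ R + (1 - stopAvg ch b t n R) / θ) / 2 := by
    intro n R hR hle
    rw [stopAvg_of_le ch n hle]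
    have h1 : 0 ≤ σ R := (sq_nonneg _).trans (h.sq_le R hR)
    have : 0 ≤ θ * σ R := by positivity
    simp; linarith
  induction n with
  | zero =>
    intro R hR
    rcases le_or_gt (b R) t with hle | hlt
    · exact stopped 0 R hR hle
    · rw [stopAvg_zero_of_lt ch hlt]
      simpa using base R hR
  | succ n ih =>
    intro R hR
    rcases le_or_gt (b R) t with hle | hlt
    · exact stopped _ R hR hle
    · rw [stopAvg_succ_of_lt ch n hlt, h.avg_b R hR, h.avg_σ R hR]
      have h0 := ih _ (h.step R hR 0)
      have h1 := ih _ (h.step R hR 1)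
      have h2 := ih _ (h.step R hR 2)
      have h3 := ih _ (h.step R hR 3)
      simp only [Fin.sum_univ_four, div_eq_mul_inv] at *
      linarith

/-- Negative powers of a reverse Hölder weight are integrable for a small exponent. -/
theorem exists_neg_power {C : ℝ} (hC : 1 ≤ C) :
    ∃ ε : ℝ, 0 < ε ∧ ∃ B : ℝ, 0 < B ∧ ∀ (T : Type) (ch : Fin 4 → T → T) (P : T → Prop) (b σ : T → ℝ),
      TreeRH C ch P b σ → ∀ n R, P R → treeAvg ch (fun R => b R ^ (-ε)) n R ≤ B * b R ^ (-ε) := by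
  set η : ℝ := 1 / (32 * C) with hη
  have hη0 : 0 < η := by positivity
  have hη1 : η < 1 := by rw [hη, div_lt_one (by positivity)]; linarith
  set c : ℝ := 1 / C with hc
  have hc0 : 0 < c := by positivity
  obtain ⟨ε, hε0, hε⟩ : ∃ ε : ℝ, 0 < ε ∧ (c * (1 / 4)) ^ (-ε) * (1 - η) ≤ 1 - η / 2 := by
    have hcont : Filter.Tendsto (fun ε : ℝ => (c * (1 / 4)) ^ (-ε) * (1 - η)) (nhds 0)
        (nhds ((c * (1 / 4)) ^ (-(0 : ℝ)) * (1 - η))) := by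
      refine Filter.Tendsto.mul_const _ ?_
      exact (Real.continuousAt_const_rpow (by positivity)).tendsto.comp
        (continuous_neg.tendsto (0 : ℝ))
    rw [neg_zero, Real.rpow_zero, one_mul] at hcont
    have := hcont.eventually_lt_const (show 1 - η < 1 - η / 2 by linarith)
    obtain ⟨δ, hδ, hδ'⟩ := Metric.eventually_nhds_iff.mp this
    exact ⟨δ / 2, by positivity, (hδ' (by
      rw [Real.dist_eq, sub_zero, abs_of_pos (by positivity)]; linarith)).le⟩
  set B : ℝ := 2 * (1 / 4 : ℝ) ^ (-ε) / η with hB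
  have hB0 : 0 < B := by positivity
  have hq1 : 1 ≤ (1 / 4 : ℝ) ^ (-ε) :=
    Real.one_le_rpow_of_pos_of_le_one_of_nonpos (by norm_num) (by norm_num) (by linarith)
  have hB1 : 1 ≤ B := by
    rw [hB, le_div_iff₀ hη0]
    linarith
  refine ⟨ε, hε0, B, hB0, fun T ch P b σ h => ?_⟩
  have child : ∀ R, P R → ∀ i, c * b R ≤ b (ch i R) := by
    intro R hR i
    have h1 : b R ^ 2 ≤ C * b (ch i R) ^ 2 := (h.sq_le R hR).trans (h.rh R hR i)
    have hp := h.pos R hR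
    have hp' := h.pos _ (h.step R hR i)
    have h2 : b R ^ 2 ≤ (C * b (ch i R)) ^ 2 := by
      refine h1.trans ?_
      rw [mul_pow]
      have : C ≤ C ^ 2 := by nlinarith
      gcongr
    have h3 := (sq_le_sq₀ hp.le (by positivity)).mp h2
    rw [hc, one_div, inv_mul_le_iff₀ (by positivity)]
    exact h3
  have key : ∀ n R, P R → stopAvg ch b (1 / 4 * b R) n R ≤ 1 - η := by
    intro n R hR
    have hp := h.pos R hR
    have hp0 := h.pos _ (h.step R hR 0)
    have hb4 : b (ch 0 R) ≤ 4 * b R := by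
      have h1 := h.pos _ (h.step R hR 1)
      have h2 := h.pos _ (h.step R hR 2)
      have h3 := h.pos _ (h.step R hR 3)
      have := h.avg_b R hR
      rw [Fin.sum_univ_four] at this
      linarith
    have hσ : σ R ≤ 16 * C * b R ^ 2 := by
      refine (h.rh R hR 0).trans ?_
      have : b (ch 0 R) ^ 2 ≤ (4 * b R) ^ 2 := by gcongr
      nlinarith
    have := h.le_stopped (t := 1 / 4 * b R) (θ := 1 / (16 * C * b R)) (by positivity) n R hR
    set G := stopAvg ch b (1 / 4 * b R) n R
    have e1 : 1 / (16 * C * b R) * σ R ≤ b R := by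
      rw [one_div, inv_mul_le_iff₀ (by positivity)]
      linarith
    have e2 : (1 - G) / (1 / (16 * C * b R)) = (1 - G) * (16 * C) * b R := by field_simp
    rw [e2] at this
    by_contra! hlt
    have e3 : (1 - G) * (16 * C) ≤ 1 / 2 := by
      have : (1 - G) ≤ η := by linarith
      calc (1 - G) * (16 * C) ≤ η * (16 * C) := by gcongr
        _ = 1 / 2 := by rw [hη]; field_simp; norm_num
    have e4 : (1 - G) * (16 * C) * b R ≤ 1 / 2 * b R := by gcongr
    have e5 : 0 ≤ G := by linarith
    have e6 : G ≤ 1 := by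
      have : ∀ n R, stopAvg ch b (1 / 4 * b R) n R ≤ 1 ∧ True := fun _ _ => ⟨by
        have gen : ∀ t n R, stopAvg ch b t n R ≤ 1 := by
          intro t n
          induction n with
          | zero => intro R; simp only [stopAvg]; split_ifs <;> norm_num
          | succ n ih =>
            intro R
            simp only [stopAvg]
            split_ifs
            · norm_num
            · have := Finset.sum_le_card_nsmul Finset.univ _ 1 fun i (_ : i ∈ Finset.univ) =>
                ih (ch i R)
              simp at this
              linarith
        exact gen _ _ _, trivial⟩
      exact (this n R).1
    nlinarith
  intro n
  induction n using Nat.strong_induction_on with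
  | _ n ih =>
    intro R hR
    have hp := h.pos R hR
    match n, ih with
    | 0, _ =>
      simp only [treeAvg]
      have : 0 ≤ b R ^ (-ε) := by positivity
      nlinarith
    | n + 1, ih =>
      set t := 1 / 4 * b R with ht
      have ht0 : 0 < t := by positivity
      have inner : ∀ j, j ≤ n → ∀ S, P S → c * t ≤ b S →
          treeAvg ch (fun R => b R ^ (-ε)) j S ≤ t ^ (-ε) +
            B * (c * t) ^ (-ε) * stopAvg ch b t j S := by
        intro j
        induction j with
        | zero =>
          intro _ S hS hcS
          rcases le_or_gt (b S) t with hle | hlt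
          · rw [stopAvg_of_le ch _ hle, mul_one]
            refine (ih 0 (by omega) S hS).trans ?_
            have : b S ^ (-ε) ≤ (c * t) ^ (-ε) :=
              Real.rpow_le_rpow_of_nonpos (by positivity) hcS (by linarith)
            have h2 : 0 ≤ t ^ (-ε) := by positivity
            nlinarith
          · rw [stopAvg_zero_of_lt ch hlt, mul_zero, add_zero]
            exact Real.rpow_le_rpow_of_nonpos ht0 hlt.le (by linarith)
        | succ j ihj =>
          intro hj S hS hcS
          rcases le_or_gt (b S) t with hle | hlt
          · rw [stopAvg_of_le ch _ hle, mul_one]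
            refine (ih (j + 1) (by omega) S hS).trans ?_
            have : b S ^ (-ε) ≤ (c * t) ^ (-ε) :=
              Real.rpow_le_rpow_of_nonpos (by positivity) hcS (by linarith)
            have h2 : 0 ≤ t ^ (-ε) := by positivity
            nlinarith
          · rw [stopAvg_succ_of_lt ch j hlt, treeAvg]
            have hch : ∀ i, c * t ≤ b (ch i S) := fun i =>
              (mul_le_mul_of_nonneg_left hlt.le hc0.le).trans (child S hS i)
            have hs := Finset.sum_le_sum fun i (_ : i ∈ Finset.univ) =>
              ihj (by omega) (ch i S) (h.step S hS i) (hch i)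
            simp only [Fin.sum_univ_four] at hs ⊢
            linarith
      have htop : treeAvg ch (fun R => b R ^ (-ε)) (n + 1) R ≤ t ^ (-ε) +
            B * (c * t) ^ (-ε) * stopAvg ch b t (n + 1) R := by
        have hlt : t < b R := by rw [ht]; linarith
        rw [stopAvg_succ_of_lt ch n hlt, treeAvg]
        have hch : ∀ i, c * t ≤ b (ch i R) := fun i =>
          (mul_le_mul_of_nonneg_left hlt.le hc0.le).trans (child R hR i)
        have hs := Finset.sum_le_sum fun i (_ : i ∈ Finset.univ) =>
          inner n le_rfl (ch i R) (h.step R hR i) (hch i)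
        simp only [Fin.sum_univ_four] at hs ⊢
        linarith
      refine htop.trans ?_
      have hk := key (n + 1) R hR
      have e1 : t ^ (-ε) = (1 / 4 : ℝ) ^ (-ε) * b R ^ (-ε) := by
        rw [ht, Real.mul_rpow (by norm_num) hp.le]
      have e2 : (c * t) ^ (-ε) = (c * (1 / 4)) ^ (-ε) * b R ^ (-ε) := by
        rw [ht, ← mul_assoc, Real.mul_rpow (by positivity) hp.le]
      have hbε : 0 < b R ^ (-ε) := by positivity
      calc t ^ (-ε) + B * (c * t) ^ (-ε) * stopAvg ch b t (n + 1) R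
          ≤ t ^ (-ε) + B * (c * t) ^ (-ε) * (1 - η) := by gcongr
        _ = ((1 / 4 : ℝ) ^ (-ε) + B * ((c * (1 / 4)) ^ (-ε) * (1 - η))) * b R ^ (-ε) := by
          rw [e1, e2]; ring
        _ ≤ ((1 / 4 : ℝ) ^ (-ε) + B * (1 - η / 2)) * b R ^ (-ε) := by gcongr
        _ = B * b R ^ (-ε) := by
          have : B * (η / 2) = (1 / 4 : ℝ) ^ (-ε) := by rw [hB]; field_simp
          rw [mul_sub, this]; ring

end Tree

end GreenLp

namespace GreenLp
open Set

section BoxTree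

theorem restrict_Icc_prod {a m b : ℝ} (h1 : a ≤ m) (h2 : m ≤ b) (S : Set ℝ)
    (hS : MeasurableSet S) :
    (volume : Measure (ℝ × ℝ)).restrict (Icc a b ×ˢ S) =
      volume.restrict (Icc a m ×ˢ S) + volume.restrict (Icc m b ×ˢ S) := by
  rw [← Icc_union_Icc_eq_Icc h1 h2, union_prod, Measure.restrict_union₀]
  · rw [AEDisjoint, ← inter_prod]
    have : (volume : Measure (ℝ × ℝ)) (({m} : Set ℝ) ×ˢ S) = 0 := by
      rw [Measure.volume_eq_prod, Measure.prod_prod]; simp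
    refine measure_mono_null (prod_mono_left ?_) this
    rintro x ⟨hx, hx'⟩
    exact le_antisymm hx.2 hx'.1
  · exact (measurableSet_Icc.prod hS).nullMeasurableSet

theorem restrict_prod_Icc {a m b : ℝ} (h1 : a ≤ m) (h2 : m ≤ b) (S : Set ℝ)
    (hS : MeasurableSet S) :
    (volume : Measure (ℝ × ℝ)).restrict (S ×ˢ Icc a b) =
      volume.restrict (S ×ˢ Icc a m) + volume.restrict (S ×ˢ Icc m b) := by
  rw [← Icc_union_Icc_eq_Icc h1 h2, prod_union, Measure.restrict_union₀]
  · rw [AEDisjoint, ← prod_inter]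
    have : (volume : Measure (ℝ × ℝ)) (S ×ˢ ({m} : Set ℝ)) = 0 := by
      rw [Measure.volume_eq_prod, Measure.prod_prod]; simp
    refine measure_mono_null (prod_mono_right ?_) this
    rintro x ⟨hx, hx'⟩
    exact le_antisymm hx.2 hx'.1
  · exact (hS.prod measurableSet_Icc).nullMeasurableSet

/-- The four half-size sub-boxes of a box. -/
def boxChild (i : Fin 4) (R : (ℝ × ℝ) × ℝ) : (ℝ × ℝ) × ℝ :=
  ((R.1.1 + ![-1, -1, 1, 1] i * (R.2 / 2), R.1.2 + ![-1, 1, -1, 1] i * (R.2 / 2)), R.2 / 2)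

theorem restrict_box (R : (ℝ × ℝ) × ℝ) (hR : 0 < R.2) :
    (volume : Measure (ℝ × ℝ)).restrict (box R.1 R.2) =
      ∑ i, volume.restrict (box (boxChild i R).1 (boxChild i R).2) := by
  obtain ⟨⟨x, q⟩, h⟩ := R
  simp only at hR
  simp only [Fin.sum_univ_four, boxChild, box]
  simp only [Matrix.cons_val]
  rw [restrict_Icc_prod (m := x) (by linarith) (by linarith) _ measurableSet_Icc,
    restrict_prod_Icc (a := q - h) (m := q) (by linarith) (by linarith) (Icc (x - h) x)
      measurableSet_Icc,
    restrict_prod_Icc (a := q - h) (m := q) (by linarith) (by linarith) (Icc x (x + h))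
      measurableSet_Icc]
  ring_nf
  rw [add_assoc (_ + _)]

theorem boxChild_sub (i : Fin 4) (R : (ℝ × ℝ) × ℝ) (hR : 0 < R.2) :
    |(boxChild i R).1.1 - R.1.1| ≤ R.2 / 2 ∧ |(boxChild i R).1.2 - R.1.2| ≤ R.2 / 2 := by
  fin_cases i <;> simp [boxChild, abs_of_pos (half_pos hR)]

theorem box_subset_box {c c' : ℝ × ℝ} {h h' : ℝ} (h1 : |c'.1 - c.1| ≤ h - h')
    (h2 : |c'.2 - c.2| ≤ h - h') : box c' h' ⊆ box c h := by
  rw [abs_le] at h1 h2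
  exact prod_mono (Icc_subset_Icc (by linarith) (by linarith))
    (Icc_subset_Icc (by linarith) (by linarith))

theorem isCompact_box (c : ℝ × ℝ) (h : ℝ) : IsCompact (box c h) :=
  isCompact_Icc.prod isCompact_Icc

theorem volume_box (c : ℝ × ℝ) {h : ℝ} (hh : 0 < h) :
    volume (box c h) = ENNReal.ofReal (4 * h ^ 2) := by
  rw [box, Measure.volume_eq_prod, Measure.prod_prod, Real.volume_Icc, Real.volume_Icc,
    ← ENNReal.ofReal_mul (by linarith)]
  congr 1; ring

theorem volume_real_box (c : ℝ × ℝ) {h : ℝ} (hh : 0 < h) :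
    volume.real (box c h) = 4 * h ^ 2 := by
  rw [Measure.real, volume_box c hh, ENNReal.toReal_ofReal (by positivity)]

/-- Average of a function over a box. -/
def boxAvg (f : ℝ × ℝ → ℝ) (R : (ℝ × ℝ) × ℝ) : ℝ := (∫ z in box R.1 R.2, f z) / (4 * R.2 ^ 2)

theorem boxAvg_eq_sum {f : ℝ × ℝ → ℝ} {R : (ℝ × ℝ) × ℝ} (hR : 0 < R.2)
    (hf : ContinuousOn f (box R.1 R.2)) :
    boxAvg f R = (∑ i, boxAvg f (boxChild i R)) / 4 := by
  have hInt : ∫ z in box R.1 R.2, f z =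
      ∑ i, ∫ z in box (boxChild i R).1 (boxChild i R).2, f z := by
    rw [restrict_box R hR, integral_finsetSum_measure]
    intro i _
    refine (hf.mono (box_subset_box ?_ ?_)).integrableOn_compact (isCompact_box _ _)
    · refine (boxChild_sub i R hR).1.trans ?_
      simp only [boxChild]; linarith
    · refine (boxChild_sub i R hR).2.trans ?_
      simp only [boxChild]; linarith
  simp only [boxAvg]
  rw [hInt, Finset.sum_div, Finset.sum_div]
  refine Finset.sum_congr rfl fun i _ => ?_
  have : (boxChild i R).2 = R.2 / 2 := rfl
  rw [this]
  field_simp; ring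

theorem sq_boxAvg_le {f : ℝ × ℝ → ℝ} {R : (ℝ × ℝ) × ℝ} (hR : 0 < R.2)
    (hf : ContinuousOn f (box R.1 R.2)) :
    boxAvg f R ^ 2 ≤ boxAvg (fun z => f z ^ 2) R := by
  have i1 : IntegrableOn f (box R.1 R.2) := hf.integrableOn_compact (isCompact_box _ _)
  have i2 : IntegrableOn (fun z => f z ^ 2) (box R.1 R.2) :=
    (hf.pow 2).integrableOn_compact (isCompact_box _ _)
  set b := boxAvg f R with hb
  have e1 : ∫ z in box R.1 R.2, f z = b * (4 * R.2 ^ 2) := by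
    rw [hb, boxAvg]; field_simp
  have i3 : IntegrableOn (fun _ : ℝ × ℝ => b ^ 2) (box R.1 R.2) :=
    continuousOn_const.integrableOn_compact (isCompact_box _ _)
  have h0 : 0 ≤ ∫ z in box R.1 R.2, (f z - b) ^ 2 := integral_nonneg fun z => sq_nonneg _
  have e2 : ∫ z in box R.1 R.2, (f z - b) ^ 2 =
      (∫ z in box R.1 R.2, f z ^ 2) - 2 * b * (b * (4 * R.2 ^ 2)) + b ^ 2 * (4 * R.2 ^ 2) := by
    have : ∀ z, (f z - b) ^ 2 = f z ^ 2 - 2 * b * f z + b ^ 2 := fun z => by ring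
    simp_rw [this]
    have i4 : IntegrableOn (fun z => f z ^ 2 - 2 * b * f z) (box R.1 R.2) :=
      i2.sub (i1.const_mul _)
    rw [integral_add i4 i3, integral_sub i2 (i1.const_mul _),
      integral_const_mul, e1, setIntegral_const, volume_real_box _ hR, smul_eq_mul, mul_comm (b ^ 2)]
  rw [boxAvg, le_div_iff₀ (by positivity)]
  rw [e2] at h0
  linarith

theorem lintegral_box_le_of_desc {F : ℝ × ℝ → ENNReal} {b : (ℝ × ℝ) × ℝ → ℝ}
    (hb : ∀ R, 0 ≤ b R) {M : ENNReal} {P : (ℝ × ℝ) × ℝ → Prop}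
    (hP : ∀ R, P R → 0 < R.2 ∧ ∀ i, P (boxChild i R)) {δ : ℝ}
    (hdesc : ∀ R, P R → R.2 ≤ δ →
      ∫⁻ z in box R.1 R.2, F z ≤ M * ENNReal.ofReal (b R * (4 * R.2 ^ 2))) (n : ℕ) :
    ∀ R, P R → R.2 / 2 ^ n ≤ δ → ∫⁻ z in box R.1 R.2, F z ≤
      M * ENNReal.ofReal (treeAvg boxChild b n R * (4 * R.2 ^ 2)) := by
  have hnn : ∀ n R, 0 ≤ treeAvg boxChild b n R := by
    intro n
    induction n with
    | zero => exact hb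
    | succ n ih =>
      intro R
      exact div_nonneg (Finset.sum_nonneg fun i _ => ih _) (by norm_num)
  induction n with
  | zero =>
    intro R hR hδ
    exact hdesc R hR (by simpa using hδ)
  | succ n ih =>
    intro R hR hδ
    rw [restrict_box R (hP R hR).1, lintegral_finsetSum_measure]
    have : treeAvg boxChild b (n + 1) R * (4 * R.2 ^ 2) =
        ∑ i, treeAvg boxChild b n (boxChild i R) * (4 * (boxChild i R).2 ^ 2) := by
      rw [treeAvg, div_mul_eq_mul_div, Finset.sum_mul, Finset.sum_div]
      refine Finset.sum_congr rfl fun i _ => ?_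
      have : (boxChild i R).2 = R.2 / 2 := rfl
      rw [this]; ring
    rw [this, ENNReal.ofReal_sum_of_nonneg fun i _ => mul_nonneg (hnn _ _) (by positivity),
      Finset.mul_sum]
    refine Finset.sum_le_sum fun i _ => ih _ ((hP R hR).2 i) ?_
    have : (boxChild i R).2 = R.2 / 2 := rfl
    rw [this, div_div, ← pow_succ']
    exact hδ

end BoxTree

namespace Saddle

/-- The weight `k = Z_qq` has an integrable negative power, with an exponent depending only on the
ellipticity constant. -/
theorem exists_neg_power {μ : ℝ} (hμ : 0 < μ) (hμ1 : μ ≤ 1) :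
    ∃ ε : ℝ, 0 < ε ∧ ∃ B : ℝ, 0 < B ∧ ∀ (D : Set (ℝ × ℝ)) (Z w p k l m : ℝ × ℝ → ℝ),
      Saddle μ D Z w p k l m → ∀ (c : ℝ × ℝ) (h : ℝ), 0 < h → box c (5 / 3 * h) ⊆ D →
      ∫⁻ z in box c h, ENNReal.ofReal (k z ^ (-ε)) ≤
        ENNReal.ofReal (B * ((∫ z in box c h, k z) / (4 * h ^ 2)) ^ (-ε) * (4 * h ^ 2)) := by
  obtain ⟨C, hC, H⟩ := reverse_holder hμ hμ1
  obtain ⟨ε, hε, B, hB, HT⟩ := GreenLp.exists_neg_power hC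
  refine ⟨ε, hε, 2 ^ ε * B, by positivity, fun D Z w p k l m hS c h hh hD => ?_⟩
  set K := box c (5 / 3 * h) with hK
  set P : (ℝ × ℝ) × ℝ → Prop := fun R => 0 < R.2 ∧ box R.1 (5 / 3 * R.2) ⊆ K with hPdef
  have hPstep : ∀ R, P R → ∀ i, P (boxChild i R) := by
    intro R hR i
    have h2 : (boxChild i R).2 = R.2 / 2 := rfl
    have hR2 := hR.1
    refine ⟨by rw [h2]; linarith, Subset.trans (box_subset_box ?_ ?_) hR.2⟩
    · refine (boxChild_sub i R hR.1).1.trans ?_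
      rw [h2]; linarith
    · refine (boxChild_sub i R hR.1).2.trans ?_
      rw [h2]; linarith
  have hPsub : ∀ R, P R → box R.1 R.2 ⊆ K := fun R hR => by
    have hR2 := hR.1
    refine Subset.trans (box_subset_box ?_ ?_) hR.2 <;> simp <;> linarith
  have hkc : ∀ R, P R → ContinuousOn k (box R.1 R.2) := fun R hR =>
    hS.k_cont.mono ((hPsub R hR).trans hD)
  have hpos : ∀ R, P R → 0 < boxAvg k R := by
    intro R hR
    have hR2 := hR.1
    refine div_pos ?_ (by positivity)
    rw [setIntegral_pos_iff_support_of_nonneg_ae]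
    · rw [inter_eq_self_of_subset_right fun z hz =>
        Function.mem_support.mpr (hS.k_pos z (hD (hPsub R hR hz))).ne', volume_box _ hR2]
      simpa using by positivity
    · filter_upwards [ae_restrict_mem (measurableSet_box _ _)] with z hz
      exact (hS.k_pos z (hD (hPsub R hR hz))).le
    · exact (hkc R hR).integrableOn_compact (isCompact_box _ _)
  have htree : TreeRH C boxChild P (boxAvg k) (boxAvg fun z => k z ^ 2) := by
    refine ⟨hPstep, hpos, fun R hR => boxAvg_eq_sum hR.1 (hkc R hR),
      fun R hR => boxAvg_eq_sum hR.1 ((hkc R hR).pow 2), fun R hR => sq_boxAvg_le hR.1 (hkc R hR),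
      fun R hR i => ?_⟩
    have hR2 := hR.1
    have key := H D Z w p k l m hS R.1 (boxChild i R).1 R.2 hR.1 (hR.2.trans hD)
      (boxChild_sub i R hR.1).1 (boxChild_sub i R hR.1).2
    have hInt : IntegrableOn (fun z => k z ^ 2) (box R.1 R.2) :=
      ((hkc R hR).pow 2).integrableOn_compact (isCompact_box _ _)
    rw [← ofReal_integral_eq_lintegral_ofReal hInt
      (Filter.Eventually.of_forall fun z => sq_nonneg _),
      ENNReal.ofReal_le_ofReal_iff (by positivity)] at key
    have h2 : (boxChild i R).2 = R.2 / 2 := rfl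
    simp only [boxAvg]
    rw [h2, div_le_iff₀ (by positivity)]
    refine key.trans ?_
    set A := ∫ z in box (boxChild i R).1 (R.2 / 2), k z
    have : C * (A / (4 * (R.2 / 2) ^ 2)) ^ 2 * (4 * R.2 ^ 2) = 4 * (C / R.2 ^ 2 * A ^ 2) := by
      field_simp; ring
    rw [this]
    have : 0 ≤ C / R.2 ^ 2 * A ^ 2 := by positivity
    linarith
  have hKne : K.Nonempty := ⟨c, by
    simp only [hK, box, mem_prod, mem_Icc]; refine ⟨⟨?_, ?_⟩, ?_, ?_⟩ <;> linarith⟩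
  obtain ⟨z0, hz0, hmin⟩ := (isCompact_box c (5 / 3 * h)).exists_isMinOn hKne (hS.k_cont.mono hD)
  have hκ := hS.k_pos z0 (hD hz0)
  have huc := (isCompact_box c (5 / 3 * h)).uniformContinuousOn_of_continuous (hS.k_cont.mono hD)
  rw [Metric.uniformContinuousOn_iff] at huc
  obtain ⟨δ, hδ, huc⟩ := huc (k z0) hκ
  have hdesc : ∀ R, P R → R.2 ≤ δ / 3 →
      ∫⁻ z in box R.1 R.2, ENNReal.ofReal (k z ^ (-ε)) ≤
        ENNReal.ofReal (2 ^ ε) * ENNReal.ofReal (boxAvg k R ^ (-ε) * (4 * R.2 ^ 2)) := by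
    intro R hR hRδ
    have hR2 := hR.1
    have hle : ∀ z ∈ box R.1 R.2, k z ^ (-ε) ≤ 2 ^ ε * boxAvg k R ^ (-ε) := by
      intro z hz
      have h1 : boxAvg k R ≤ 2 * k z := by
        rw [boxAvg, div_le_iff₀ (by positivity), ← volume_real_box R.1 hR2, mul_comm,
          ← smul_eq_mul, ← setIntegral_const]
        refine setIntegral_mono_on ((hkc R hR).integrableOn_compact (isCompact_box _ _))
          (continuousOn_const.integrableOn_compact (isCompact_box _ _)) (measurableSet_box _ _) ?_
        intro z' hz'
        have hd : dist z' z < δ := by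
          rw [Prod.dist_eq, max_lt_iff, Real.dist_eq, Real.dist_eq]
          obtain ⟨⟨a1, a2⟩, a3, a4⟩ := hz
          obtain ⟨⟨b1, b2⟩, b3, b4⟩ := hz'
          constructor <;> rw [abs_lt] <;> constructor <;> linarith
        have := huc z' (hPsub R hR hz') z (hPsub R hR hz) hd
        rw [Real.dist_eq] at this
        have h3 := (abs_lt.mp this).2
        have h4 : k z0 ≤ k z := hmin (hPsub R hR hz)
        linarith
      have hb := hpos R hR
      have h2 : k z ^ (-ε) ≤ (boxAvg k R / 2) ^ (-ε) :=
        Real.rpow_le_rpow_of_nonpos (by positivity) (by linarith) (by linarith)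
      refine h2.trans (le_of_eq ?_)
      rw [Real.div_rpow hb.le (by norm_num), Real.rpow_neg (x := 2) (by norm_num), div_inv_eq_mul,
        mul_comm]
    calc ∫⁻ z in box R.1 R.2, ENNReal.ofReal (k z ^ (-ε))
        ≤ ∫⁻ _ in box R.1 R.2, ENNReal.ofReal (2 ^ ε * boxAvg k R ^ (-ε)) :=
          setLIntegral_mono measurable_const fun z hz => ENNReal.ofReal_le_ofReal (hle z hz)
      _ = _ := by
        have hb := hpos R hR
        rw [setLIntegral_const, volume_box _ hR2, ← ENNReal.ofReal_mul (by positivity),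
          ← ENNReal.ofReal_mul (by positivity), mul_assoc]
  obtain ⟨n, hn⟩ := pow_unbounded_of_one_lt (h / (δ / 3)) (show (1 : ℝ) < 2 by norm_num)
  have hroot : P (c, h) := ⟨hh, Subset.rfl⟩
  have hfin := lintegral_box_le_of_desc (F := fun z => ENNReal.ofReal (k z ^ (-ε)))
    (b := fun R => |boxAvg k R ^ (-ε)|) (fun R => abs_nonneg _) (P := P)
    (fun R hR => ⟨hR.1, hPstep R hR⟩) (M := ENNReal.ofReal (2 ^ ε)) (δ := δ / 3) (by
      intro R hR hRδ
      have hb := hpos R hR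
      rw [abs_of_pos (by positivity)]
      exact hdesc R hR hRδ) n (c, h) hroot (by
        rw [div_lt_iff₀ (by positivity)] at hn
        rw [div_le_iff₀ (by positivity)]
        linarith)
  refine hfin.trans ?_
  rw [← ENNReal.ofReal_mul (by positivity)]
  apply ENNReal.ofReal_le_ofReal
  have habs : ∀ n R, P R → treeAvg boxChild (fun R => |boxAvg k R ^ (-ε)|) n R =
      treeAvg boxChild (fun R => boxAvg k R ^ (-ε)) n R := by
    intro n
    induction n with
    | zero =>
      intro R hR
      have hb := hpos R hR
      exact abs_of_pos (by positivity)
    | succ n ih =>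
      intro R hR
      simp only [treeAvg]
      rw [Finset.sum_congr rfl fun i _ => ih _ (hPstep R hR i)]
  rw [habs n _ hroot]
  have := HT _ _ _ _ _ htree n (c, h) hroot
  have h4 : (0 : ℝ) ≤ 4 * h ^ 2 := by positivity
  calc (2 : ℝ) ^ ε * (treeAvg boxChild (fun R => boxAvg k R ^ (-ε)) n (c, h) * (4 * h ^ 2))
      ≤ 2 ^ ε * (B * boxAvg k (c, h) ^ (-ε) * (4 * h ^ 2)) := by gcongr
    _ = _ := by simp only [boxAvg]; ring

end Saddle

end GreenLp

namespace GreenLp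
open Set

/-- A planar potential with its derivatives up to order two, strictly convex with Hessian
determinant between `lam` and `Lam`. -/
structure Pot (lam Lam : ℝ) (O : Set (ℝ × ℝ)) (v vx vy a b c : ℝ × ℝ → ℝ) : Prop where
  isOpen : IsOpen O
  convex : Convex ℝ O
  hv : ∀ z ∈ O, HasFDerivAt v
    (vx z • ContinuousLinearMap.fst ℝ ℝ ℝ + vy z • ContinuousLinearMap.snd ℝ ℝ ℝ) z
  hvx : ∀ z ∈ O, HasFDerivAt vx
    (a z • ContinuousLinearMap.fst ℝ ℝ ℝ + b z • ContinuousLinearMap.snd ℝ ℝ ℝ) z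
  hvy : ∀ z ∈ O, HasFDerivAt vy
    (b z • ContinuousLinearMap.fst ℝ ℝ ℝ + c z • ContinuousLinearMap.snd ℝ ℝ ℝ) z
  a_cont : ContinuousOn a O
  b_cont : ContinuousOn b O
  c_cont : ContinuousOn c O
  c_pos : ∀ z ∈ O, 0 < c z
  det_ge : ∀ z ∈ O, lam ≤ a z * c z - b z ^ 2
  det_le : ∀ z ∈ O, a z * c z - b z ^ 2 ≤ Lam

/-- The invertible linear map `(s, t) ↦ (s, b s + c t)`. -/
def shearEquiv (b c : ℝ) (hc : c ≠ 0) : (ℝ × ℝ) ≃L[ℝ] (ℝ × ℝ) :=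
  ContinuousLinearEquiv.equivOfInverse
    ((ContinuousLinearMap.fst ℝ ℝ ℝ).prod
      (b • ContinuousLinearMap.fst ℝ ℝ ℝ + c • ContinuousLinearMap.snd ℝ ℝ ℝ))
    ((ContinuousLinearMap.fst ℝ ℝ ℝ).prod
      ((-b / c) • ContinuousLinearMap.fst ℝ ℝ ℝ + (1 / c) • ContinuousLinearMap.snd ℝ ℝ ℝ))
    (fun z => by ext <;> simp <;> field_simp <;> ring)
    (fun z => by ext <;> simp <;> field_simp <;> ring)

namespace Pot

variable {lam Lam : ℝ} {O : Set (ℝ × ℝ)} {v vx vy a b c : ℝ × ℝ → ℝ}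

/-- The partial gradient map `(x, y) ↦ (x, v_y)`. -/
def pg (vy : ℝ × ℝ → ℝ) (z : ℝ × ℝ) : ℝ × ℝ := (z.1, vy z)

theorem hasDerivAt_slice (h : Pot lam Lam O v vx vy a b c) {x y : ℝ} (hz : (x, y) ∈ O) :
    HasDerivAt (fun y => v (x, y)) (vy (x, y)) y := by
  have := (h.hv _ hz).comp_hasDerivAt y ((hasDerivAt_const y x).prodMk (hasDerivAt_id y))
  exact this.congr_deriv (by simp)

theorem hasDerivAt_vy (h : Pot lam Lam O v vx vy a b c) {x y : ℝ} (hz : (x, y) ∈ O) :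
    HasDerivAt (fun y => vy (x, y)) (c (x, y)) y := by
  have := (h.hvy _ hz).comp_hasDerivAt y ((hasDerivAt_const y x).prodMk (hasDerivAt_id y))
  exact this.congr_deriv (by simp)

theorem injOn_pg (h : Pot lam Lam O v vx vy a b c) : InjOn (pg vy) O := by
  rintro ⟨x, y⟩ hz ⟨x', y'⟩ hz' he
  simp only [pg, Prod.mk.injEq] at he
  obtain ⟨rfl, he⟩ := he
  have hconv : Convex ℝ {y | (x, y) ∈ O} := by
    intro y1 h1 y2 h2 s t hs ht hst
    have := h.convex h1 h2 hs ht hst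
    simp only [Prod.smul_mk, Prod.mk_add_mk, smul_eq_mul, ← add_mul, hst, one_mul] at this
    exact this
  have hmono : StrictMonoOn (fun y => vy (x, y)) {y | (x, y) ∈ O} := by
    refine strictMonoOn_of_deriv_pos hconv
      (fun y hy => (h.hasDerivAt_vy hy).continuousAt.continuousWithinAt) fun y hy => ?_
    have hy' := interior_subset hy
    rw [(h.hasDerivAt_vy hy').deriv]
    exact h.c_pos _ hy'
  rw [hmono.injOn hz hz' he]

theorem hasStrictFDerivAt_pg (h : Pot lam Lam O v vx vy a b c) {z : ℝ × ℝ} (hz : z ∈ O) :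
    HasStrictFDerivAt (pg vy)
      (shearEquiv (b z) (c z) (h.c_pos z hz).ne' : (ℝ × ℝ) →L[ℝ] (ℝ × ℝ)) z := by
  have h1 : HasStrictFDerivAt vy
      (b z • ContinuousLinearMap.fst ℝ ℝ ℝ + c z • ContinuousLinearMap.snd ℝ ℝ ℝ) z := by
    refine hasStrictFDerivAt_of_hasFDerivAt_of_continuousAt
      (f' := fun z => b z • ContinuousLinearMap.fst ℝ ℝ ℝ + c z • ContinuousLinearMap.snd ℝ ℝ ℝ)
      ?_ ?_
    · filter_upwards [h.isOpen.mem_nhds hz] with z hz using h.hvy z hz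
    · have hb := h.b_cont.continuousAt (h.isOpen.mem_nhds hz)
      have hc := h.c_cont.continuousAt (h.isOpen.mem_nhds hz)
      exact (hb.smul continuousAt_const).add (hc.smul continuousAt_const)
  exact hasStrictFDerivAt_fst.prodMk h1

/-- Inverse of the partial gradient map. -/
def ipg (O : Set (ℝ × ℝ)) (vy : ℝ × ℝ → ℝ) : ℝ × ℝ → ℝ × ℝ := Function.invFunOn (pg vy) O

theorem ipg_mem {z : ℝ × ℝ} (hz : z ∈ pg vy '' O) : ipg O vy z ∈ O :=
  Function.invFunOn_mem hz

theorem pg_ipg {z : ℝ × ℝ} (hz : z ∈ pg vy '' O) : pg vy (ipg O vy z) = z :=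
  Function.invFunOn_eq hz

theorem ipg_pg (h : Pot lam Lam O v vx vy a b c) {z : ℝ × ℝ} (hz : z ∈ O) :
    ipg O vy (pg vy z) = z :=
  h.injOn_pg.leftInvOn_invFunOn hz

theorem ipg_fst {z : ℝ × ℝ} (hz : z ∈ pg vy '' O) : (ipg O vy z).1 = z.1 :=
  (Prod.ext_iff.mp (pg_ipg hz)).1

theorem vy_ipg {z : ℝ × ℝ} (hz : z ∈ pg vy '' O) : vy (ipg O vy z) = z.2 :=
  (Prod.ext_iff.mp (pg_ipg hz)).2

theorem isOpen_image (h : Pot lam Lam O v vx vy a b c) : IsOpen (pg vy '' O) := by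
  rw [isOpen_iff_mem_nhds]
  rintro _ ⟨z, hz, rfl⟩
  rw [← (h.hasStrictFDerivAt_pg hz).map_nhds_eq_of_equiv]
  exact Filter.image_mem_map (h.isOpen.mem_nhds hz)

theorem continuousAt_ipg (h : Pot lam Lam O v vx vy a b c) {z : ℝ × ℝ} (hz : z ∈ pg vy '' O) :
    ContinuousAt (ipg O vy) z := by
  obtain ⟨y, hy, rfl⟩ := hz
  rw [ContinuousAt, h.ipg_pg hy]
  intro N hN
  rw [Filter.mem_map, ← (h.hasStrictFDerivAt_pg hy).map_nhds_eq_of_equiv, Filter.mem_map]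
  filter_upwards [hN, h.isOpen.mem_nhds hy] with z hz hzO
  rw [mem_preimage, mem_preimage, h.ipg_pg hzO]
  exact hz

theorem hasFDerivAt_ipg (h : Pot lam Lam O v vx vy a b c) {z : ℝ × ℝ} (hz : z ∈ pg vy '' O) :
    HasFDerivAt (ipg O vy)
      ((shearEquiv (b (ipg O vy z)) (c (ipg O vy z)) (h.c_pos _ (ipg_mem hz)).ne').symm :
        (ℝ × ℝ) →L[ℝ] (ℝ × ℝ)) z := by
  refine HasFDerivAt.of_local_left_inverse (h.continuousAt_ipg hz)
    (h.hasStrictFDerivAt_pg (ipg_mem hz)).hasFDerivAt ?_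
  filter_upwards [h.isOpen_image.mem_nhds hz] with y hy using pg_ipg hy

theorem shearEquiv_symm (b c : ℝ) (hc : c ≠ 0) :
    ((shearEquiv b c hc).symm : (ℝ × ℝ) →L[ℝ] (ℝ × ℝ)) =
      (ContinuousLinearMap.fst ℝ ℝ ℝ).prod
      ((-b / c) • ContinuousLinearMap.fst ℝ ℝ ℝ + (1 / c) • ContinuousLinearMap.snd ℝ ℝ ℝ) := rfl

/-- The partial Legendre transform of a potential is a saddle function. -/
theorem saddle (h : Pot lam Lam O v vx vy a b c) {μ : ℝ} (hlam : 0 < lam)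
    (h1 : μ ≤ lam) (h2 : μ * Lam ≤ 1) (hμ : 0 ≤ μ) :
    Saddle μ (pg vy '' O) (fun z => z.2 * (ipg O vy z).2 - v (ipg O vy z))
      (fun z => (ipg O vy z).2) (fun z => vx (ipg O vy z)) (fun z => 1 / c (ipg O vy z))
      (fun z => a (ipg O vy z) - b (ipg O vy z) ^ 2 / c (ipg O vy z))
      (fun z => -b (ipg O vy z) / c (ipg O vy z)) := by
  have hl : ∀ z ∈ pg vy '' O, a (ipg O vy z) - b (ipg O vy z) ^ 2 / c (ipg O vy z) =
      (a (ipg O vy z) * c (ipg O vy z) - b (ipg O vy z) ^ 2) / c (ipg O vy z) := fun z hz => by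
    have := (h.c_pos _ (ipg_mem hz)).ne'
    field_simp
  have hw : ∀ z ∈ pg vy '' O, HasFDerivAt (fun z => (ipg O vy z).2)
      ((-b (ipg O vy z) / c (ipg O vy z)) • ContinuousLinearMap.fst ℝ ℝ ℝ +
        (1 / c (ipg O vy z)) • ContinuousLinearMap.snd ℝ ℝ ℝ) z := fun z hz =>
    (hasFDerivAt_snd.comp z (h.hasFDerivAt_ipg hz)).congr_fderiv (by
      rw [shearEquiv_symm]; ext <;> simp)
  have hcomp : ContinuousOn (ipg O vy) (pg vy '' O) := fun z hz =>
    (h.continuousAt_ipg hz).continuousWithinAt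
  have hmaps : MapsTo (ipg O vy) (pg vy '' O) O := fun z hz => ipg_mem hz
  refine ⟨fun z hz => ?_, hw, fun z hz => ?_, fun z hz => ?_, fun z hz => ?_, fun z hz => ?_,
    fun z hz => ?_, ?_, ?_⟩
  · have hc := (h.c_pos _ (ipg_mem hz)).ne'
    refine ((hasFDerivAt_snd.mul (hw z hz)).sub
      ((h.hv _ (ipg_mem hz)).comp z (h.hasFDerivAt_ipg hz))).congr_fderiv ?_
    rw [shearEquiv_symm, vy_ipg hz]
    ext <;> simp
  · have hc := (h.c_pos _ (ipg_mem hz)).ne'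
    refine ((h.hvx _ (ipg_mem hz)).comp z (h.hasFDerivAt_ipg hz)).congr_fderiv ?_
    rw [shearEquiv_symm]
    ext <;> simp <;> field_simp
    ring
  · exact one_div_pos.mpr (h.c_pos _ (ipg_mem hz))
  · simp only [hl z hz]
    exact div_pos (hlam.trans_le (h.det_ge _ (ipg_mem hz))) (h.c_pos _ (ipg_mem hz))
  · simp only [hl z hz]
    rw [mul_one_div]
    have := h.c_pos _ (ipg_mem hz)
    have := h.det_ge _ (ipg_mem hz)
    gcongr
    linarith
  · simp only [hl z hz]
    rw [← mul_div_assoc]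
    have := h.c_pos _ (ipg_mem hz)
    have h3 := h.det_le _ (ipg_mem hz)
    gcongr
    exact (mul_le_mul_of_nonneg_left h3 hμ).trans h2
  · exact continuousOn_const.div (h.c_cont.comp hcomp hmaps) fun z hz =>
      (h.c_pos _ (ipg_mem hz)).ne'
  · exact (h.a_cont.comp hcomp hmaps).sub (((h.b_cont.comp hcomp hmaps).pow 2).div
      (h.c_cont.comp hcomp hmaps) fun z hz => (h.c_pos _ (ipg_mem hz)).ne')

end Pot

end GreenLp

namespace GreenLp
open Set

/-- A potential on a bounded section `{v < ρ}` centred at its minimum `0`. -/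
structure Bowl (lam Lam ρ L R : ℝ) (O : Set (ℝ × ℝ)) (v vx vy a b c : ℝ × ℝ → ℝ) : Prop
    extends Pot lam Lam O v vx vy a b c where
  bdd : ∀ z ∈ closure O, ∀ z' ∈ closure O, |z.1 - z'.1| ≤ R ∧ |z.2 - z'.2| ≤ R
  cont : ContinuousOn v (closure O)
  mem : ∀ z ∈ closure O, v z < ρ → z ∈ O
  lip : ∀ z ∈ O, ∀ z' ∈ O, |v z - v z'| ≤ L * dist z z'
  zero_mem : (0 : ℝ × ℝ) ∈ O
  v_zero : v 0 = 0
  vx_zero : vx 0 = 0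
  vy_zero : vy 0 = 0
  tangent : ∀ z ∈ O, ∀ z' ∈ O, v z + vx z * (z'.1 - z.1) + vy z * (z'.2 - z.2) ≤ v z'

namespace Bowl

variable {lam Lam ρ L R : ℝ} {O : Set (ℝ × ℝ)} {v vx vy a b c : ℝ × ℝ → ℝ}

theorem isCompact_closure (h : Bowl lam Lam ρ L R O v vx vy a b c) : IsCompact (closure O) := by
  refine Metric.isCompact_of_isClosed_isBounded isClosed_closure ?_
  rw [Metric.isBounded_iff]
  refine ⟨R, fun z hz z' hz' => ?_⟩
  rw [Prod.dist_eq]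
  exact max_le (h.bdd z hz z' hz').1 (h.bdd z hz z' hz').2

theorem mem_of_dist (h : Bowl lam Lam ρ L R O v vx vy a b c) (hL : 0 ≤ L) {z z' : ℝ × ℝ}
    (hz : z ∈ O) (hd : v z + L * dist z z' < ρ) : z' ∈ O ∧ v z' ≤ v z + L * dist z z' := by
  have hcl : ∀ e ∈ closure O, v e ≤ v z + L * dist z e := by
    intro e he
    refine ContinuousWithinAt.closure_le (f := v) (g := fun e => v z + L * dist z e)
      (s := O) he ((h.cont e he).mono subset_closure) (by fun_prop) fun y hy => ?_
    have := h.lip y hy z hz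
    rw [dist_comm z y]
    linarith [(abs_le.mp this).2]
  have hseg : segment ℝ z z' ⊆ O := by
    refine (convex_segment z z').isPreconnected.subset_of_closure_inter_subset h.isOpen
      ⟨z, left_mem_segment ℝ z z', hz⟩ ?_
    rintro e ⟨he, hes⟩
    refine h.mem e he ((hcl e he).trans_lt (lt_of_le_of_lt ?_ hd))
    gcongr
    have := dist_add_dist_of_mem_segment hes
    linarith [dist_nonneg (x := e) (y := z')]
  have hz' := hseg (right_mem_segment ℝ z z')
  exact ⟨hz', hcl z' (subset_closure hz')⟩

theorem exists_slope (h : Bowl lam Lam ρ L R O v vx vy a b c) {x y₀ q : ℝ}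
    (hy₀ : (x, y₀) ∈ O) (hq : v (x, y₀) + |q| * R < ρ) :
    ∃ y, (x, y) ∈ O ∧ vy (x, y) = q ∧ v (x, y) ≤ v (x, y₀) + |q| * R := by
  have hK : IsCompact (closure O ∩ {z | z.1 = x}) :=
    h.isCompact_closure.inter_right (isClosed_eq continuous_fst continuous_const)
  obtain ⟨⟨x', y⟩, ⟨hyc, rfl⟩, hmin⟩ := hK.exists_isMinOn (f := fun z => v z - q * z.2)
    ⟨(x, y₀), subset_closure hy₀, rfl⟩
    ((h.cont.mono inter_subset_left).sub (by fun_prop))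
  have h1 : v (x', y) - q * y ≤ v (x', y₀) - q * y₀ :=
    hmin (show (x', y₀) ∈ closure O ∩ {z | z.1 = x'} from ⟨subset_closure hy₀, rfl⟩)
  have h2 : q * (y - y₀) ≤ |q| * R := by
    refine (le_abs_self _).trans ?_
    rw [abs_mul]
    exact mul_le_mul_of_nonneg_left (h.bdd _ hyc _ (subset_closure hy₀)).2 (abs_nonneg q)
  have h3 : v (x', y) ≤ v (x', y₀) + |q| * R := by linarith
  have hyO := h.mem _ hyc (h3.trans_lt hq)
  refine ⟨y, hyO, ?_, h3⟩
  have hd : HasDerivAt (fun t => v (x', t) - q * t) (vy (x', y) - q) y := by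
    exact ((h.hasDerivAt_slice hyO).sub ((hasDerivAt_id y).const_mul q)).congr_deriv (by simp)
  have hloc : IsLocalMin (fun t => v (x', t) - q * t) y := by
    have : ∀ᶠ t in nhds y, (x', t) ∈ O :=
      (by fun_prop : Continuous fun t : ℝ => (x', t)).continuousAt.eventually
        (h.isOpen.mem_nhds hyO)
    filter_upwards [this] with t ht
    exact hmin (show (x', t) ∈ closure O ∩ {z | z.1 = x'} from ⟨subset_closure ht, rfl⟩)
  linarith [hloc.hasDerivAt_eq_zero hd]

/-- Projection of a sublevel set to the first axis. -/
def shadow (O : Set (ℝ × ℝ)) (v : ℝ × ℝ → ℝ) (t : ℝ) : Set ℝ := {x | ∃ y, (x, y) ∈ O ∧ v (x, y) < t}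

theorem ordConnected_shadow (h : Bowl lam Lam ρ L R O v vx vy a b c) (t : ℝ) :
    (shadow O v t).OrdConnected := by
  refine Convex.ordConnected ?_
  rintro x ⟨y, hy, hyt⟩ x' ⟨y', hy', hyt'⟩ s s' hs hs' hss
  refine ⟨s * y + s' * y', ?_⟩
  have hm := h.convex hy hy' hs hs' hss
  simp only [Prod.smul_mk, Prod.mk_add_mk, smul_eq_mul] at hm ⊢
  refine ⟨hm, ?_⟩
  have h1 := h.tangent _ hm _ hy
  have h2 := h.tangent _ hm _ hy'
  set z := (s * x + s' * x', s * y + s' * y')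
  simp only at h1 h2
  have h3 := mul_le_mul_of_nonneg_left h1 hs
  have h4 := mul_le_mul_of_nonneg_left h2 hs'
  have e : s' = 1 - s := by linarith
  have h5 : v z ≤ s * v (x, y) + s' * v (x', y') := by
    refine le_trans (le_of_eq ?_) (add_le_add h3 h4)
    simp only [z, e]
    ring
  have h6 : s * v (x, y) + s' * v (x', y') < s * t + s' * t := by
    rcases hs.eq_or_lt with rfl | hs0
    · have : s' = 1 := by linarith
      simp [this, hyt']
    · have := mul_lt_mul_of_pos_left hyt hs0
      have := mul_le_mul_of_nonneg_left hyt'.le hs'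
      linarith
  rw [← add_mul, hss, one_mul] at h6
  linarith

theorem shadow_add (h : Bowl lam Lam ρ L R O v vx vy a b c) (hL : 0 ≤ L) {x y s t : ℝ}
    (hz : (x, y) ∈ O) (ht : t ≤ ρ) (hs : v (x, y) + L * |s| < t) : x + s ∈ shadow O v t := by
  have hd : dist (x, y) (x + s, y) = |s| := by
    simp [Prod.dist_eq]
  obtain ⟨h1, h2⟩ := h.mem_of_dist hL (z' := (x + s, y)) hz (by rw [hd]; linarith)
  exact ⟨y, h1, by rw [hd] at h2; linarith⟩

theorem mem_image (h : Bowl lam Lam ρ L R O v vx vy a b c) {ρ₂ ρ₄ σ x q : ℝ} (hR : 0 ≤ R)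
    (hx : x ∈ shadow O v ρ₂) (hq : |q| ≤ σ) (h4 : ρ₂ + σ * R ≤ ρ₄) (hρ : ρ₄ ≤ ρ) :
    (x, q) ∈ Pot.pg vy '' O ∧ v (Pot.ipg O vy (x, q)) < ρ₄ := by
  obtain ⟨y₀, hy₀, hv⟩ := hx
  have h1 : |q| * R ≤ σ * R := by gcongr
  obtain ⟨y, hy, hyq, hyv⟩ := h.exists_slope (q := q) hy₀ (by linarith)
  have he : Pot.pg vy (x, y) = (x, q) := by rw [Pot.pg, hyq]
  refine ⟨⟨(x, y), hy, he⟩, ?_⟩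
  rw [← he, h.ipg_pg hy]
  linarith

end Bowl

end GreenLp

namespace GreenLp
open Set

namespace Bowl

/-- Lower bound for the mass of `k` on boxes of fixed size in the partial Legendre chart. -/
theorem exists_mass_lower {lam Lam μ : ℝ} (hlam : 0 < lam) (hμ : 0 < μ) (hμ1 : μ ≤ 1)
    (hμl : μ ≤ lam) (hμL : μ * Lam ≤ 1) {ρ₀ ρ₂ ρ₄ ρ L R σ : ℝ} (hρ₀ : 0 < ρ₀) (h02 : ρ₀ < ρ₂)
    (hL : 0 < L) (hR : 0 < R) (hσ : 0 < σ) (h4 : ρ₂ + σ * R ≤ ρ₄) (hρ : ρ₄ ≤ ρ) :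
    ∃ h > 0, ∃ κ > 0, ∀ (O : Set (ℝ × ℝ)) (v vx vy a b c : ℝ × ℝ → ℝ),
      Bowl lam Lam ρ L R O v vx vy a b c → ∀ z₀ : ℝ × ℝ, z₀.1 ∈ shadow O v ρ₀ → |z₀.2| ≤ σ / 2 →
      (∀ z ∈ box z₀ (5 / 3 * h), z ∈ Pot.pg vy '' O ∧ v (Pot.ipg O vy z) < ρ₄) ∧
      κ ≤ ∫ z in box z₀ h, 1 / c (Pot.ipg O vy z) := by
  set η := min (ρ₂ / (2 * L)) ((ρ₂ - ρ₀) / L) with hη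
  have hρ₂ : 0 < ρ₂ := hρ₀.trans h02
  have hη0 : 0 < η := lt_min (by positivity) (div_pos (by linarith) hL)
  have hη1 : L * η ≤ ρ₂ / 2 := by
    calc L * η ≤ L * (ρ₂ / (2 * L)) := by gcongr; exact min_le_left _ _
      _ = ρ₂ / 2 := by field_simp
  have hη2 : L * η ≤ ρ₂ - ρ₀ := by
    calc L * η ≤ L * ((ρ₂ - ρ₀) / L) := by gcongr; exact min_le_right _ _
      _ = ρ₂ - ρ₀ := by field_simp
  set d := min η σ / 4 with hd
  have hd0 : 0 < d := by positivity
  have hdη : d ≤ η / 4 := by rw [hd]; gcongr; exact min_le_left _ _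
  have hdσ : d ≤ σ / 4 := by rw [hd]; gcongr; exact min_le_right _ _
  set M := max R (max σ (η / 2)) with hM
  have hM0 : 0 < M := lt_max_of_lt_left hR
  have hMR : R ≤ M := le_max_left _ _
  have hMσ : σ ≤ M := (le_max_left _ _).trans (le_max_right _ _)
  set s := d / (2 * M) with hs
  have hs0 : 0 < s := by positivity
  have hsM : s * (2 * M) = d := by rw [hs]; field_simp
  set mm := min (η / 2) σ with hmm
  have hmm0 : 0 < mm := by positivity
  have hmmM : mm ≤ M := (min_le_right _ _).trans hMσ
  set ν := μ * (mm / M) ^ 2 with hν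
  have hν0 : 0 < ν := by positivity
  have hr1 : (mm / M) ^ 2 ≤ 1 := pow_le_one₀ (by positivity) ((div_le_one hM0).mpr hmmM)
  have hν1 : ν ≤ 1 := by rw [hν]; nlinarith [sq_nonneg (mm / M)]
  obtain ⟨C, hC, H⟩ := Saddle.core hν0 hν1 hs0
  have hC0 : 0 < C := by linarith
  refine ⟨d, hd0, μ * σ * ρ₂ / (2 * R * C), by positivity, ?_⟩
  intro O v vx vy a b c h z₀ hz₁ hz₂
  set I := shadow O v ρ₂ with hI
  have hIo : I.OrdConnected := h.ordConnected_shadow ρ₂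
  have hIR : ∀ x ∈ I, |x| ≤ R := by
    rintro x ⟨y, hy, -⟩
    simpa using (h.bdd _ (subset_closure hy) _ (subset_closure h.zero_mem)).1
  have hIa : BddAbove I := ⟨R, fun x hx => (le_abs_self x).trans (hIR x hx)⟩
  have hIb : BddBelow I := ⟨-R, fun x hx => neg_le_of_abs_le (hIR x hx)⟩
  have hρ₂ρ : ρ₂ ≤ ρ := by
    have : 0 ≤ σ * R := by positivity
    linarith
  have h00 : ((0 : ℝ), (0 : ℝ)) ∈ O := h.zero_mem
  have hv00 : v (0, 0) = 0 := h.v_zero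
  have hp : η ∈ I := by
    have := h.shadow_add hL.le (s := η) h00 hρ₂ρ (by rw [abs_of_pos hη0, hv00]; linarith)
    rwa [zero_add] at this
  have hn : -η ∈ I := by
    have := h.shadow_add hL.le (s := -η) h00 hρ₂ρ (by rw [abs_neg, abs_of_pos hη0, hv00]; linarith)
    rwa [zero_add] at this
  obtain ⟨y₁, hy₁, hvy₁⟩ := hz₁
  have hzp : z₀.1 + η ∈ I :=
    h.shadow_add hL.le hy₁ hρ₂ρ (by rw [abs_of_pos hη0]; linarith)
  have hzn : z₀.1 + -η ∈ I :=
    h.shadow_add hL.le hy₁ hρ₂ρ (by rw [abs_neg, abs_of_pos hη0]; linarith)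
  set xp := sSup I with hxp
  set xn := sInf I with hxn
  have p1 := le_csSup hIa hp
  have p2 := le_csSup hIa hzp
  have n1 := csInf_le hIb hn
  have n2 := csInf_le hIb hzn
  have hin : ∀ x, xn < x → x < xp → x ∈ I := by
    intro x h1 h2
    obtain ⟨x1, hx1, hlt1⟩ := exists_lt_of_csInf_lt ⟨η, hp⟩ h1
    obtain ⟨x2, hx2, hlt2⟩ := exists_lt_of_lt_csSup ⟨η, hp⟩ h2
    exact hIo.out hx1 hx2 ⟨hlt1.le, hlt2.le⟩
  have hwid : xp - xn ≤ 2 * R := by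
    have : xp ≤ R := csSup_le ⟨η, hp⟩ fun x hx => (le_abs_self x).trans (hIR x hx)
    have : -R ≤ xn := le_csInf ⟨η, hp⟩ fun x hx => neg_le_of_abs_le (hIR x hx)
    linarith
  set xc := (xn + xp) / 2 with hxc
  set α := (xp - xn) / 2 - η / 4 with hα
  have hαη : 3 / 4 * η ≤ α := by rw [hα]; linarith
  have hα0 : 0 < α := by linarith
  have hαM : α ≤ M := by linarith
  have hbox : ∀ z ∈ box z₀ (5 / 3 * d), z ∈ Pot.pg vy '' O ∧ v (Pot.ipg O vy z) < ρ₄ := by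
    rintro ⟨x, q⟩ ⟨⟨b1, b2⟩, b3, b4⟩
    simp only at b1 b2 b3 b4
    rw [abs_le] at hz₂
    refine h.mem_image hR.le (hin x (by linarith) (by linarith)) ?_ h4 hρ
    rw [abs_le]
    constructor <;> linarith
  refine ⟨hbox, ?_⟩
  set D := Pot.pg vy '' O with hD
  have S := ((h.toPot.saddle hlam hμl hμL hμ.le).swap).comp_affine (μ' := ν) (D' := unitSq) σ α 0 xc
    hσ.ne' hα0.ne' (by
      rw [hν, mul_assoc]
      gcongr
      rw [div_pow, div_mul_eq_mul_div, div_le_iff₀ (by positivity)]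
      have : mm ≤ σ := min_le_right _ _
      gcongr) (by
      rw [hν, mul_assoc]
      gcongr
      rw [div_pow, div_mul_eq_mul_div, div_le_iff₀ (by positivity)]
      have : mm ≤ α := (min_le_left _ _).trans (by linarith)
      gcongr) (by
      rintro ⟨t, x⟩ hz
      rw [mem_unitSq] at hz
      refine (h.mem_image hR.le (hin _ ?_ ?_) ?_ h4 hρ).1
      · have : α * (-1) ≤ α * x := by gcongr; exact hz.2.1
        simp only; linarith
      · have : α * x ≤ α * 1 := by gcongr; exact hz.2.2
        simp only; linarith
      · simp only [zero_add, abs_mul, abs_of_pos hσ]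
        exact mul_le_of_le_one_right hσ.le (abs_le.mpr hz.1))
  set e : ℝ × ℝ := (z₀.2 / σ, (z₀.1 - xc) / α) with he
  set J := ∫ z in box z₀ d, 1 / c (Pot.ipg O vy z) with hJ
  have hsα : s * α ≤ d / 2 := by
    have : s * α ≤ s * M := by gcongr
    linarith
  have hsσ : s * σ ≤ d / 2 := by
    have : s * σ ≤ s * M := by gcongr
    linarith
  have hsub : box z₀ d ⊆ D := fun z hz =>
    (hbox z (box_subset_box (by simp; linarith) (by simp; linarith) hz)).1
  have he1 : |e.1| ≤ 1 - s := by
    rw [he, abs_div, abs_of_pos hσ, div_le_iff₀ hσ]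
    linarith
  have he2 : |e.2| ≤ 1 - s := by
    simp only [he]
    rw [abs_div, abs_of_pos hα0, div_le_iff₀ hα0, abs_le]
    constructor <;> linarith
  have key := (H _ _ _ _ _ _ S e (α / (μ * σ) * J) he1 he2 ?_).1 0 ((0 - xc) / α)
    ((xp - η / 2 - xc) / α) (by simp) ?_ ?_
  · have e0 : ∀ x : ℝ, ((0 : ℝ) + σ * (0, (x - xc) / α).1, xc + α * (0, (x - xc) / α).2).swap =
        (x, 0) := by
      intro x
      ext <;> simp
      field_simp; ring
    rw [e0, e0] at key
    have i0 : Pot.ipg O vy (0, 0) = (0, 0) := by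
      have := h.ipg_pg h.zero_mem
      rwa [Pot.pg, h.vy_zero] at this
    have v0 : vx (Pot.ipg O vy (0, 0)) = 0 := by rw [i0]; exact h.vx_zero
    rw [v0, mul_zero, sub_zero] at key
    set x₂ := xp - η / 2 with hx₂
    have hx₂0 : 0 < x₂ := by linarith
    have hx₂I : x₂ ∈ I := hin _ (by linarith) (by linarith)
    obtain ⟨m1, m2⟩ := h.mem_image (q := 0) hR.le hx₂I (by simpa using hσ.le) h4 hρ
    have hmem := Pot.ipg_mem m1
    have hf := Pot.ipg_fst m1
    have hvy := Pot.vy_ipg m1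
    set ζ := Pot.ipg O vy (x₂, 0) with hζ
    have hge : ρ₂ / 2 ≤ v ζ := by
      by_contra! hlt
      have : ζ.1 + η ∈ I :=
        h.shadow_add hL.le (y := ζ.2) hmem hρ₂ρ (by
          rw [abs_of_pos hη0, Prod.mk.eta]; linarith)
      have := le_csSup hIa this
      rw [hf] at this
      simp only at this
      linarith
    have htan := h.tangent ζ hmem 0 h.zero_mem
    simp only at hf hvy
    rw [hvy, hf, h.v_zero] at htan
    simp only [Prod.fst_zero, zero_mul, add_zero, zero_sub, mul_neg] at htan
    have hx₂R : x₂ ≤ R := (le_abs_self _).trans (hIR _ hx₂I)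
    have hvp : 0 < vx ζ := by
      by_contra! hle
      have := mul_nonpos_of_nonpos_of_nonneg hle hx₂0.le
      linarith
    have hvR : ρ₂ / 2 ≤ vx ζ * R := by
      have : vx ζ * x₂ ≤ vx ζ * R := by gcongr
      linarith
    rw [div_le_iff₀ (by positivity)]
    have k1 : vx ζ ≤ C * (1 / (μ * σ) * J) := by
      have : α * vx ζ ≤ α * (C * (1 / (μ * σ) * J)) := by
        refine key.trans (le_of_eq ?_)
        ring
      exact le_of_mul_le_mul_left this hα0
    have k2 : ρ₂ / 2 ≤ C * (1 / (μ * σ) * J) * R := hvR.trans (by gcongr)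
    have k3 : C * (1 / (μ * σ) * J) * R = J * (R * C) / (μ * σ) := by field_simp
    rw [k3, le_div_iff₀ (by positivity)] at k2
    linarith
  · set T : Set (ℝ × ℝ) := Prod.swap ⁻¹' box z₀ d with hT
    have hTm : MeasurableSet T := measurable_swap (measurableSet_box _ _)
    have hsw : ∫ z in T, 1 / c (Pot.ipg O vy z.swap) = J :=
      (Measure.measurePreserving_swap (μ := (volume : Measure ℝ)) (ν := (volume : Measure ℝ)))
        |>.setIntegral_preimage_emb (MeasurableEquiv.prodComm (α := ℝ) (β := ℝ)).measurableEmbedding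
          (fun z => 1 / c (Pot.ipg O vy z)) (box z₀ d)
    set N : ℝ × ℝ → ℝ × ℝ := fun z => (0 + σ * z.1, xc + α * z.2) with hN
    have hNT : box e s ⊆ N ⁻¹' T := by
      rintro ⟨t, x⟩ ⟨⟨b1, b2⟩, b3, b4⟩
      simp only [he] at b1 b2 b3 b4
      have c1 := mul_le_mul_of_nonneg_left b1 hσ.le
      have c2 := mul_le_mul_of_nonneg_left b2 hσ.le
      have c3 := mul_le_mul_of_nonneg_left b3 hα0.le
      have c4 := mul_le_mul_of_nonneg_left b4 hα0.le
      rw [mul_sub, mul_div_cancel₀ _ hσ.ne'] at c1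
      rw [mul_add, mul_div_cancel₀ _ hσ.ne'] at c2
      rw [mul_sub, mul_div_cancel₀ _ hα0.ne'] at c3
      rw [mul_add, mul_div_cancel₀ _ hα0.ne'] at c4
      refine ⟨⟨?_, ?_⟩, ?_, ?_⟩ <;> simp only [hN, Prod.swap] <;> linarith
    have hkc : ContinuousOn (fun z => 1 / c (Pot.ipg O vy z)) (box z₀ d) :=
      (h.toPot.saddle hlam hμl hμL hμ.le).k_cont.mono hsub
    have hTc : IsCompact T := by
      have : T = box z₀.swap d := by
        ext ⟨t, x⟩
        exact and_comm
      rw [this]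
      exact isCompact_box _ _
    have hkT : ContinuousOn (fun z : ℝ × ℝ => 1 / c (Pot.ipg O vy z.swap)) T :=
      hkc.comp continuous_swap.continuousOn fun z hz => hz
    have hNcont : Continuous N := by fun_prop
    have himg : MeasurableSet (N '' box e s) :=
      ((isCompact_box e s).image hNcont).isClosed.measurableSet
    have hcv := setIntegral_affine hσ hα0 0 xc himg (fun z => 1 / c (Pot.ipg O vy z.swap))
    rw [show (fun z : ℝ × ℝ => (0 + σ * z.1, xc + α * z.2)) = N from rfl,
      preimage_image_eq _ (affine_injective hσ hα0 0 xc)] at hcv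
    have hle : ∫ z in N '' box e s, 1 / c (Pot.ipg O vy z.swap) ≤ J := by
      rw [← hsw]
      refine setIntegral_mono_set (hkT.integrableOn_compact hTc) ?_
        (Filter.Eventually.of_forall (image_subset_iff.mpr hNT))
      filter_upwards [ae_restrict_mem hTm] with z hz
      exact (one_div_pos.mpr (h.c_pos _ (Pot.ipg_mem (hsub hz)))).le
    have hNk : ContinuousOn (fun z : ℝ × ℝ => 1 / c (Pot.ipg O vy (N z).swap)) (box e s) :=
      hkT.comp hNcont.continuousOn hNT
    have hNl : ContinuousOn (fun z : ℝ × ℝ => α ^ 2 * (a (Pot.ipg O vy (N z).swap) -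
        b (Pot.ipg O vy (N z).swap) ^ 2 / c (Pot.ipg O vy (N z).swap))) (box e s) := by
      refine continuousOn_const.mul ?_
      exact (h.toPot.saddle hlam hμl hμL hμ.le).l_cont.comp
        (continuous_swap.comp hNcont).continuousOn fun z hz => hsub (hNT hz)
    have hmono := setIntegral_mono_on (μ := volume) (hNl.integrableOn_compact (isCompact_box e s))
      ((hNk.const_smul (α ^ 2 / μ)).integrableOn_compact (isCompact_box e s)) (measurableSet_box e s)
      (fun z hz => by
        have := (h.toPot.saddle hlam hμl hμL hμ.le).k_ge _ (hsub (hNT hz))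
        simp only [Pi.smul_apply, smul_eq_mul]
        rw [div_mul_eq_mul_div, mul_div_assoc]
        gcongr
        rw [le_div_iff₀ hμ, mul_comm]
        exact this)
    refine hmono.trans ?_
    simp only [Pi.smul_apply, smul_eq_mul]
    rw [integral_const_mul]
    rw [hcv] at hle
    rw [div_mul_eq_mul_div, div_le_iff₀ hμ]
    calc _ = α / σ * (σ * α * ∫ z in box e s, 1 / c (Pot.ipg O vy (N z).swap)) := by
          field_simp
      _ ≤ α / σ * J := by gcongr
      _ = _ := by field_simp
  · rw [abs_div, abs_of_pos hα0, div_le_iff₀ hα0, abs_le]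
    constructor <;> linarith
  · rw [abs_div, abs_of_pos hα0, div_le_iff₀ hα0, abs_le]
    constructor <;> linarith

end Bowl

end GreenLp

namespace GreenLp
open Set

/-- One-dimensional Sobolev inequality. -/
theorem ofReal_le_lintegral_deriv {f f' : ℝ → ℝ} {a b : ℝ} (hab : a < b)
    (hf : ∀ t ∈ Icc a b, HasDerivAt f (f' t) t) (hf' : ContinuousOn f' (Icc a b))
    (h0 : ∀ t ∈ Icc a b, 0 ≤ f t) {t : ℝ} (ht : t ∈ Icc a b) :
    ENNReal.ofReal (f t) ≤ ∫⁻ s in Icc a b, ENNReal.ofReal (1 / (b - a) * f s + |f' s|) := by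
  have hc : ContinuousOn f (Icc a b) := fun t ht => (hf t ht).continuousAt.continuousWithinAt
  have i1 : IntegrableOn f (Icc a b) := hc.integrableOn_compact isCompact_Icc
  have i2 : IntegrableOn (fun s => |f' s|) (Icc a b) := hf'.abs.integrableOn_compact isCompact_Icc
  have hba : 0 < b - a := by linarith
  have hInt : IntegrableOn (fun s => 1 / (b - a) * f s + |f' s|) (Icc a b) :=
    (i1.const_mul _).add i2
  have hnn : ∀ᵐ s ∂(volume.restrict (Icc a b)), 0 ≤ 1 / (b - a) * f s + |f' s| := by
    filter_upwards [ae_restrict_mem measurableSet_Icc] with s hs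
    have := h0 s hs
    positivity
  rw [← ofReal_integral_eq_lintegral_ofReal hInt hnn]
  apply ENNReal.ofReal_le_ofReal
  rw [integral_add (i1.const_mul _) i2, integral_const_mul]
  obtain ⟨s, hs, hmin⟩ := isCompact_Icc.exists_isMinOn ⟨a, left_mem_Icc.mpr hab.le⟩ hc
  have h1 : (b - a) * f s ≤ ∫ s in Icc a b, f s := by
    have := setIntegral_mono_on (μ := volume) (continuousOn_const.integrableOn_compact
      (isCompact_Icc (a := a) (b := b))) i1 measurableSet_Icc (fun y hy => hmin hy)
    rw [setIntegral_const, Real.volume_real_Icc_of_le hab.le] at this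
    exact this
  have h2 : f s ≤ 1 / (b - a) * ∫ s in Icc a b, f s := by
    rw [one_div, ← div_eq_inv_mul, le_div_iff₀ hba]
    linarith
  have hsub : uIcc s t ⊆ Icc a b := uIcc_subset_Icc hs ht
  have h3 : ∫ y in s..t, f' y = f t - f s :=
    intervalIntegral.integral_eq_sub_of_hasDerivAt (fun y hy => hf y (hsub hy))
      (hf'.mono hsub).intervalIntegrable
  have h4 : f t - f s ≤ ∫ y in Icc a b, |f' y| := by
    rw [← h3]
    refine (Real.le_norm_self _).trans
      ((intervalIntegral.norm_integral_le_integral_norm_uIoc).trans ?_)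
    exact setIntegral_mono_set i2 (Filter.Eventually.of_forall fun y => abs_nonneg _)
      (Filter.Eventually.of_forall (uIoc_subset_uIcc.trans hsub))
  linarith

theorem rpow_deriv_bound {W W' : ℝ} (hW : 1 ≤ W) :
    |3 / 4 * W ^ (-(1 / 4 : ℝ)) * W'| ≤ W' ^ 2 * W ^ (-(5 / 4 : ℝ)) + W := by
  have hW0 : 0 < W := by linarith
  set A := W ^ (-(5 / 8 : ℝ)) with hA
  set B := W ^ (3 / 8 : ℝ) with hB
  have hA0 : 0 < A := by positivity
  have hB0 : 0 < B := by positivity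
  have e1 : W ^ (-(1 / 4 : ℝ)) = A * B := by
    rw [hA, hB, ← Real.rpow_add hW0]; norm_num
  have e2 : W ^ (-(5 / 4 : ℝ)) = A ^ 2 := by
    rw [hA, ← Real.rpow_natCast, ← Real.rpow_mul hW0.le]; norm_num
  have e3 : B ^ 2 ≤ W := by
    rw [hB, ← Real.rpow_natCast, ← Real.rpow_mul hW0.le]
    calc W ^ (3 / 8 * ((2 : ℕ) : ℝ)) ≤ W ^ (1 : ℝ) :=
          Real.rpow_le_rpow_of_exponent_le hW (by norm_num)
      _ = W := Real.rpow_one W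
  rw [e1, e2, abs_mul, abs_of_pos (by positivity), ← sq_abs W']
  nlinarith [sq_nonneg (|W'| * A - B), mul_pos hA0 hB0, sq_nonneg (|W'| * A), sq_nonneg B,
    mul_nonneg (mul_nonneg (abs_nonneg W') hA0.le) hB0.le]

theorem slice_bound {W W' : ℝ → ℝ} {a b : ℝ} (hab : a < b)
    (hW : ∀ t ∈ Icc a b, 1 ≤ W t)
    (hd : ∀ t ∈ Icc a b, HasDerivAt W (W' t) t) (hc : ContinuousOn W' (Icc a b)) {F : ℝ → ℝ}
    (hF : ∀ t ∈ Icc a b, W' t ^ 2 ≤ F t) {t : ℝ} (ht : t ∈ Icc a b) :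
    ENNReal.ofReal (W t ^ (3 / 4 : ℝ)) ≤
      ∫⁻ s in Icc a b, ENNReal.ofReal ((1 / (b - a) + 1) * W s + F s * W s ^ (-(5 / 4 : ℝ))) := by
  have hWc : ContinuousOn W (Icc a b) := fun t ht => (hd t ht).continuousAt.continuousWithinAt
  have hba : 0 < b - a := by linarith
  have h1 := ofReal_le_lintegral_deriv (f := fun s => W s ^ (3 / 4 : ℝ))
    (f' := fun s => 3 / 4 * W s ^ (-(1 / 4 : ℝ)) * W' s) hab (fun s hs => by
      have := (hd s hs).rpow_const (p := 3 / 4) (Or.inl (by linarith [hW s hs]))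
      refine this.congr_deriv ?_
      norm_num
      ring)
    ((continuousOn_const.mul (hWc.rpow_const fun s hs => Or.inl (by linarith [hW s hs]))).mul hc)
    (fun s hs => by have := hW s hs; positivity) ht
  refine h1.trans (setLIntegral_mono' measurableSet_Icc fun s hs => ENNReal.ofReal_le_ofReal ?_)
  have hWs := hW s hs
  have h2 := rpow_deriv_bound (W' := W' s) hWs
  have h3 : W s ^ (3 / 4 : ℝ) ≤ W s := by
    calc W s ^ (3 / 4 : ℝ) ≤ W s ^ (1 : ℝ) :=
          Real.rpow_le_rpow_of_exponent_le hWs (by norm_num)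
      _ = W s := Real.rpow_one _
  have h4 : 1 / (b - a) * W s ^ (3 / 4 : ℝ) ≤ 1 / (b - a) * W s := by gcongr
  have h5 : W' s ^ 2 * W s ^ (-(5 / 4 : ℝ)) ≤ F s * W s ^ (-(5 / 4 : ℝ)) := by
    have := hF s hs
    gcongr
  linarith

theorem ae_fst_ne (x : ℝ) : ∀ᵐ z : ℝ × ℝ, z.1 ≠ x := by
  have : (volume : Measure (ℝ × ℝ)) (({x} : Set ℝ) ×ˢ univ) = 0 := by
    rw [Measure.volume_eq_prod, Measure.prod_prod]; simp
  rw [ae_iff]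
  refine measure_mono_null (fun z hz => ?_) this
  simp only [ne_eq, not_not, mem_ofPred_eq] at hz
  exact ⟨hz, trivial⟩

theorem ae_snd_ne (x : ℝ) : ∀ᵐ z : ℝ × ℝ, z.2 ≠ x := by
  have : (volume : Measure (ℝ × ℝ)) (univ ×ˢ ({x} : Set ℝ)) = 0 := by
    rw [Measure.volume_eq_prod, Measure.prod_prod]; simp
  rw [ae_iff]
  refine measure_mono_null (fun z hz => ?_) this
  simp only [ne_eq, not_not, mem_ofPred_eq] at hz
  exact ⟨trivial, hz⟩

/-- Ladyzhenskaya-type estimate on a box for a function with a point singularity. -/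
theorem ladyzhenskaya {c P : ℝ × ℝ} {h : ℝ} (hh : 0 < h) {W Wx Wq : ℝ × ℝ → ℝ}
    (hW : ∀ z ∈ box c h \ {P}, 1 ≤ W z)
    (hd : ∀ z ∈ box c h \ {P}, HasFDerivAt W
      (Wx z • ContinuousLinearMap.fst ℝ ℝ ℝ + Wq z • ContinuousLinearMap.snd ℝ ℝ ℝ) z)
    (hcx : ContinuousOn Wx (box c h \ {P})) (hcq : ContinuousOn Wq (box c h \ {P})) :
    ∫⁻ z in box c h, ENNReal.ofReal (W z ^ (3 / 2 : ℝ)) ≤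
      (∫⁻ z in box c h, ENNReal.ofReal ((1 / (2 * h) + 1) * W z +
        (Wx z ^ 2 + Wq z ^ 2) * W z ^ (-(5 / 4 : ℝ)))) ^ 2 := by
  set I := Icc (c.1 - h) (c.1 + h) with hI
  set J := Icc (c.2 - h) (c.2 + h) with hJ
  set H : ℝ × ℝ → ENNReal := fun z => ENNReal.ofReal ((1 / (2 * h) + 1) * W z +
    (Wx z ^ 2 + Wq z ^ 2) * W z ^ (-(5 / 4 : ℝ))) with hH
  have hbox : box c h = I ×ˢ J := rfl
  have hrestr : (volume : Measure (ℝ × ℝ)).restrict (box c h) =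
      ((volume : Measure ℝ).restrict I).prod ((volume : Measure ℝ).restrict J) := by
    rw [hbox, Measure.prod_restrict, Measure.volume_eq_prod]
  have hWc : ContinuousOn W (box c h \ {P}) := fun z hz => (hd z hz).continuousAt.continuousWithinAt
  have hHm : AEMeasurable H ((volume : Measure (ℝ × ℝ)).restrict (box c h)) := by
    have hm : MeasurableSet (box c h \ {P}) :=
      (measurableSet_box c h).diff (measurableSet_singleton P)
    have : (volume : Measure (ℝ × ℝ)).restrict (box c h) = volume.restrict (box c h \ {P}) :=
      (Measure.restrict_congr_set (sdiff_null_ae_eq_self (measure_singleton P))).symm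
    rw [this]
    refine ENNReal.measurable_ofReal.comp_aemeasurable (ContinuousOn.aemeasurable ?_ hm)
    refine (continuousOn_const.mul hWc).add (((hcx.pow 2).add (hcq.pow 2)).mul
      (hWc.rpow_const fun z hz => Or.inl ?_))
    have := hW z hz
    linarith
  rw [hrestr] at hHm ⊢
  have eA : ∫⁻ z, H z ∂(((volume : Measure ℝ).restrict I).prod ((volume : Measure ℝ).restrict J)) =
      ∫⁻ x in I, ∫⁻ q in J, H (x, q) := lintegral_prod _ hHm
  have eB : ∫⁻ z, H z ∂(((volume : Measure ℝ).restrict I).prod ((volume : Measure ℝ).restrict J)) =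
      ∫⁻ q in J, ∫⁻ x in I, H (x, q) := lintegral_prod_symm _ hHm
  rw [sq]
  nth_rw 1 [eA]
  rw [eB, ← lintegral_prod_mul hHm.lintegral_prod_right' hHm.lintegral_prod_left']
  rw [← hrestr]
  refine lintegral_mono_ae ?_
  filter_upwards [ae_restrict_mem (measurableSet_box c h), ae_restrict_of_ae (ae_fst_ne P.1),
    ae_restrict_of_ae (ae_snd_ne P.2)] with ⟨x, q⟩ ⟨hzI, hzJ⟩ hx hq
  simp only at hx hq hzI hzJ
  have hWz : 1 ≤ W (x, q) := hW _ ⟨⟨hzI, hzJ⟩, fun he => hx (congrArg Prod.fst he)⟩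
  have hsplit : ENNReal.ofReal (W (x, q) ^ (3 / 2 : ℝ)) =
      ENNReal.ofReal (W (x, q) ^ (3 / 4 : ℝ)) * ENNReal.ofReal (W (x, q) ^ (3 / 4 : ℝ)) := by
    rw [← ENNReal.ofReal_mul (by positivity), ← Real.rpow_add (by linarith)]
    norm_num
  rw [hsplit]
  have hwI : c.1 + h - (c.1 - h) = 2 * h := by ring
  have hwJ : c.2 + h - (c.2 - h) = 2 * h := by ring
  have mx : ∀ s ∈ J, (x, s) ∈ box c h \ {P} := fun s hs =>
    ⟨⟨hzI, hs⟩, fun he => hx (congrArg Prod.fst he)⟩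
  have mq : ∀ s ∈ I, (s, q) ∈ box c h \ {P} := fun s hs =>
    ⟨⟨hs, hzJ⟩, fun he => hq (congrArg Prod.snd he)⟩
  refine mul_le_mul' ?_ ?_
  · have := slice_bound (W := fun s => W (x, s)) (W' := fun s => Wq (x, s))
      (F := fun s => Wx (x, s) ^ 2 + Wq (x, s) ^ 2)
      (show c.2 - h < c.2 + h by linarith) (fun s hs => hW _ (mx s hs)) (fun s hs => by
        have := (hd _ (mx s hs)).comp_hasDerivAt s ((hasDerivAt_const s x).prodMk (hasDerivAt_id s))
        exact this.congr_deriv (by simp)) (hcq.comp (by fun_prop) mx)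
      (fun s _ => by nlinarith [sq_nonneg (Wx (x, s))]) hzJ
    rw [hwJ] at this
    exact this
  · have := slice_bound (W := fun s => W (s, q)) (W' := fun s => Wx (s, q))
      (F := fun s => Wx (s, q) ^ 2 + Wq (s, q) ^ 2)
      (show c.1 - h < c.1 + h by linarith) (fun s hs => hW _ (mq s hs)) (fun s hs => by
        have := (hd _ (mq s hs)).comp_hasDerivAt s ((hasDerivAt_id s).prodMk (hasDerivAt_const s q))
        exact this.congr_deriv (by simp)) (hcx.comp (by fun_prop) mq)
      (fun s _ => by nlinarith [sq_nonneg (Wq (s, q))]) hzI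
    rw [hwI] at this
    exact this

theorem young_three {X Y Z α β γ : ℝ} (hX : 0 ≤ X) (hY : 0 ≤ Y) (hZ : 0 ≤ Z) (hα : 0 ≤ α)
    (hβ : 0 ≤ β) (hγ : 0 ≤ γ) (h : α + β + γ ≤ 1) :
    X ^ α * Y ^ β * Z ^ γ ≤ X + Y + Z + 1 := by
  set T := X + Y + Z + 1 with hT
  have hT1 : 1 ≤ T := by linarith
  have h1 : X ^ α ≤ T ^ α := by gcongr; linarith
  have h2 : Y ^ β ≤ T ^ β := by gcongr; linarith
  have h3 : Z ^ γ ≤ T ^ γ := by gcongr; linarith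
  calc X ^ α * Y ^ β * Z ^ γ ≤ T ^ α * T ^ β * T ^ γ := by gcongr
    _ = T ^ (α + β + γ) := by
      rw [Real.rpow_add (by linarith), Real.rpow_add (by linarith)]
    _ ≤ T ^ (1 : ℝ) := Real.rpow_le_rpow_of_exponent_le hT1 h
    _ = T := Real.rpow_one T

theorem pointwise_young {p ε : ℝ} (hp : 1 < p) (hε : 0 < ε) (hpε : 11 * p / 12 + (p - 1) / ε ≤ 1)
    {y k W : ℝ} (hk : 0 < k) (hW : 1 ≤ W) :
    |y / k| ^ p * k ≤ y ^ 2 * W ^ (-(5 / 4 : ℝ)) + W ^ (3 / 2 : ℝ) + k ^ (-ε) + 1 := by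
  have hW0 : 0 < W := by linarith
  refine le_trans (le_of_eq ?_) (young_three (α := p / 2) (β := 5 * p / 12) (γ := (p - 1) / ε)
    (X := y ^ 2 * W ^ (-(5 / 4 : ℝ))) (Y := W ^ (3 / 2 : ℝ)) (Z := k ^ (-ε))
    (by positivity) (by positivity) (by positivity) (by linarith) (by linarith)
    (div_nonneg (by linarith) hε.le) (by linarith))
  rw [abs_div, abs_of_pos hk, Real.div_rpow (abs_nonneg y) hk.le,
    Real.mul_rpow (sq_nonneg y) (by positivity), ← Real.rpow_mul hW0.le, ← Real.rpow_mul hW0.le,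
    ← Real.rpow_mul hk.le, ← sq_abs, ← Real.rpow_natCast, ← Real.rpow_mul (abs_nonneg y)]
  have e1 : ((2 : ℕ) : ℝ) * (p / 2) = p := by push_cast; ring
  have e2 : -ε * ((p - 1) / ε) = 1 - p := by field_simp; ring
  have e3 : W ^ (-(5 / 4) * (p / 2)) * W ^ (3 / 2 * (5 * p / 12)) = 1 := by
    rw [← Real.rpow_add hW0]
    convert Real.rpow_zero W using 2
    ring
  rw [e1, e2, mul_assoc (|y| ^ p), e3, mul_one, Real.rpow_sub hk, Real.rpow_one]
  ring

end GreenLp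

namespace GreenLp
open Set

/-- The negative power estimate of `Saddle.exists_neg_power` with fixed constants. -/
def NegPower (μ ε B : ℝ) : Prop :=
  ∀ (D : Set (ℝ × ℝ)) (Z w p k l m : ℝ × ℝ → ℝ), Saddle μ D Z w p k l m → ∀ (c : ℝ × ℝ) (h : ℝ),
    0 < h → box c (5 / 3 * h) ⊆ D →
    ∫⁻ z in box c h, ENNReal.ofReal (k z ^ (-ε)) ≤
      ENNReal.ofReal (B * ((∫ z in box c h, k z) / (4 * h ^ 2)) ^ (-ε) * (4 * h ^ 2))

/-- A nonnegative function on `O`, continuously differentiable away from the origin. -/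
structure Sing (O : Set (ℝ × ℝ)) (g gx gy : ℝ × ℝ → ℝ) : Prop where
  nonneg : ∀ z ∈ O \ {0}, 0 ≤ g z
  hg : ∀ z ∈ O \ {0}, HasFDerivAt g
    (gx z • ContinuousLinearMap.fst ℝ ℝ ℝ + gy z • ContinuousLinearMap.snd ℝ ℝ ℝ) z
  gx_cont : ContinuousOn gx (O \ {0})
  gy_cont : ContinuousOn gy (O \ {0})

/-- The energy density `U ∇g · ∇g`. -/
def energy (a b c gx gy : ℝ × ℝ → ℝ) (z : ℝ × ℝ) : ℝ :=
  c z * gx z ^ 2 - 2 * b z * gx z * gy z + a z * gy z ^ 2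

namespace Pot

variable {lam Lam : ℝ} {O : Set (ℝ × ℝ)} {v vx vy a b c : ℝ × ℝ → ℝ}

theorem lintegral_image (h : Pot lam Lam O v vx vy a b c) {s : Set (ℝ × ℝ)} (hs : MeasurableSet s)
    (hsO : s ⊆ O) (f : ℝ × ℝ → ENNReal) :
    ∫⁻ z in pg vy '' s, f z = ∫⁻ z in s, ENNReal.ofReal (c z) * f (pg vy z) := by
  rw [lintegral_image_eq_lintegral_abs_det_fderiv_mul volume hs (f := pg vy)
    (f' := fun z => (ContinuousLinearMap.fst ℝ ℝ ℝ).prod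
      (b z • ContinuousLinearMap.fst ℝ ℝ ℝ + c z • ContinuousLinearMap.snd ℝ ℝ ℝ))
    (fun z hz => ((hasFDerivAt_fst.prodMk (h.hvy z (hsO hz))).hasFDerivWithinAt))
    (h.injOn_pg.mono hsO)]
  refine setLIntegral_congr_fun hs fun z hz => ?_
  have := det_prod_fst_snd 1 0 (b z) (c z)
  simp only [one_smul, zero_smul, add_zero, one_mul, zero_mul, sub_zero] at this
  simp only [this, abs_of_pos (h.c_pos z (hsO hz))]

theorem continuousOn_pg (h : Pot lam Lam O v vx vy a b c) : ContinuousOn (pg vy) O := fun z hz =>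
  (h.hasStrictFDerivAt_pg hz).continuousAt.continuousWithinAt

theorem measurableSet_preimage (h : Pot lam Lam O v vx vy a b c) {Q : Set (ℝ × ℝ)}
    (hQ : IsClosed Q) : MeasurableSet (O ∩ pg vy ⁻¹' Q) := by
  have : O ∩ pg vy ⁻¹' Q = O \ (O ∩ pg vy ⁻¹' Qᶜ) := by ext; simp
  rw [this]
  exact h.isOpen.measurableSet.diff
    (h.continuousOn_pg.isOpen_inter_preimage h.isOpen hQ.isOpen_compl).measurableSet

theorem lintegral_of_subset (h : Pot lam Lam O v vx vy a b c) {Q : Set (ℝ × ℝ)} (hQ : IsClosed Q)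
    (hQO : Q ⊆ pg vy '' O) (f : ℝ × ℝ → ℝ) :
    ∫⁻ z in Q, ENNReal.ofReal (f z) =
      ∫⁻ z in O ∩ pg vy ⁻¹' Q, ENNReal.ofReal (c z * f (pg vy z)) := by
  have hm := h.measurableSet_preimage hQ
  have : Q = pg vy '' (O ∩ pg vy ⁻¹' Q) := by
    rw [image_inter_preimage, inter_eq_right.mpr hQO]
  conv_lhs => rw [this]
  rw [h.lintegral_image hm inter_subset_left]
  refine setLIntegral_congr_fun hm fun z hz => ?_
  rw [ENNReal.ofReal_mul (h.c_pos z hz.1).le]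

end Pot

namespace Bowl

variable {lam Lam ρ L R : ℝ} {O : Set (ℝ × ℝ)} {v vx vy a b c g gx gy : ℝ × ℝ → ℝ}

theorem energy_bound {lam A B C X Y : ℝ} (hlam : 0 < lam) (hC : 0 < C) (hd : lam ≤ A * C - B ^ 2) :
    C * ((X - Y * B / C) ^ 2 + (Y / C) ^ 2) ≤
      max 1 (1 / lam) * (C * X ^ 2 - 2 * B * X * Y + A * Y ^ 2) := by
  have e1 : C * X ^ 2 - 2 * B * X * Y + A * Y ^ 2 =
      C * ((X - Y * B / C) ^ 2 + (A * C - B ^ 2) * (Y / C) ^ 2) := by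
    field_simp
    ring
  have h1 : (1 : ℝ) ≤ max 1 (1 / lam) := le_max_left _ _
  have h2 : 1 ≤ max 1 (1 / lam) * (A * C - B ^ 2) := by
    calc (1 : ℝ) = 1 / lam * lam := by field_simp
      _ ≤ max 1 (1 / lam) * (A * C - B ^ 2) := by gcongr; exact le_max_right _ _
  rw [e1, mul_left_comm]
  refine mul_le_mul_of_nonneg_left ?_ hC.le
  have h3 : (X - Y * B / C) ^ 2 ≤ max 1 (1 / lam) * (X - Y * B / C) ^ 2 :=
    le_mul_of_one_le_left (sq_nonneg _) h1
  have h4 : (Y / C) ^ 2 ≤ max 1 (1 / lam) * (A * C - B ^ 2) * (Y / C) ^ 2 :=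
    le_mul_of_one_le_left (sq_nonneg _) h2
  linarith

/-- The gradient estimate on a single box in partial Legendre coordinates. -/
theorem box_bound (hB : Bowl lam Lam ρ L R O v vx vy a b c) (hS : Sing O g gx gy)
    (hlam : 0 < lam) {p ε : ℝ} (hp : 1 < p) (hε : 0 < ε) (hpε : 11 * p / 12 + (p - 1) / ε ≤ 1)
    {ρ₄ E₁ C₁ K h : ℝ} {z₀ : ℝ × ℝ} (hh : 0 < h) (hE₁ : 0 ≤ E₁) (hC₁ : 0 ≤ C₁) (hK : 0 ≤ K)
    (hQ : ∀ z ∈ box z₀ h, z ∈ Pot.pg vy '' O ∧ v (Pot.ipg O vy z) < ρ₄)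
    (hE : ∫⁻ z in {z ∈ O | v z < ρ₄},
      ENNReal.ofReal (energy a b c gx gy z * (1 + g z) ^ (-(5 / 4 : ℝ))) ≤ ENNReal.ofReal E₁)
    (hC : ∫⁻ z in {z ∈ O | v z < ρ₄}, ENNReal.ofReal ((1 + g z) * c z) ≤ ENNReal.ofReal C₁)
    (hk : ∫⁻ z in box z₀ h, ENNReal.ofReal ((1 / c (Pot.ipg O vy z)) ^ (-ε)) ≤ ENNReal.ofReal K) :
    ∫⁻ z in box z₀ h, ENNReal.ofReal
        (|gy (Pot.ipg O vy z)| ^ p * (1 / c (Pot.ipg O vy z))) ≤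
      ENNReal.ofReal (max 1 (1 / lam) * E₁ +
        ((1 / (2 * h) + 1) * C₁ + max 1 (1 / lam) * E₁) ^ 2 + K + 4 * h ^ 2) := by
  set M := max 1 (1 / lam) with hM
  have hM0 : 0 ≤ M := zero_le_one.trans (le_max_left _ _)
  set f := Pot.ipg O vy with hf
  set Q := box z₀ h with hQdef
  have hQO : Q ⊆ Pot.pg vy '' O := fun z hz => (hQ z hz).1
  have hQcl : IsClosed Q := (isCompact_box z₀ h).isClosed
  have hQm : MeasurableSet Q := measurableSet_box z₀ h
  have hpg0 : Pot.pg vy 0 = 0 := by simp [Pot.pg, hB.vy_zero]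
  have hfmem : ∀ z ∈ Q, f z ∈ O := fun z hz => Pot.ipg_mem (hQO hz)
  have hfmem' : ∀ z ∈ Q \ {0}, f z ∈ O \ {0} := fun z hz => ⟨hfmem z hz.1, fun h0 => hz.2 (by
    rw [mem_singleton_iff] at h0 ⊢
    rw [← Pot.pg_ipg (hQO hz.1), ← hf, h0, hpg0])⟩
  have hcpos : ∀ z ∈ Q, 0 < c (f z) := fun z hz => hB.c_pos _ (hfmem z hz)
  have hfcont : ContinuousOn f Q := fun z hz => (hB.continuousAt_ipg (hQO hz)).continuousWithinAt
  set W : ℝ × ℝ → ℝ := fun z => 1 + g (f z) with hW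
  set Wx : ℝ × ℝ → ℝ := fun z => gx (f z) - gy (f z) * b (f z) / c (f z) with hWx
  set Wq : ℝ × ℝ → ℝ := fun z => gy (f z) / c (f z) with hWq
  have hW1 : ∀ z ∈ Q \ {0}, 1 ≤ W z := fun z hz => by
    have := hS.nonneg _ (hfmem' z hz)
    simp only [hW]
    linarith
  have hWd : ∀ z ∈ Q \ {0}, HasFDerivAt W
      (Wx z • ContinuousLinearMap.fst ℝ ℝ ℝ + Wq z • ContinuousLinearMap.snd ℝ ℝ ℝ) z :=
    fun z hz => by
    have h1 := ((hS.hg _ (hfmem' z hz)).comp z (hB.hasFDerivAt_ipg (hQO hz.1))).const_add 1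
    refine h1.congr_fderiv ?_
    rw [Pot.shearEquiv_symm]
    ext <;> simp [hWx, hWq, hf] <;> ring
  have hcc : ContinuousOn (fun z => c (f z)) Q := hB.c_cont.comp hfcont hfmem
  have hbc : ContinuousOn (fun z => b (f z)) Q := hB.b_cont.comp hfcont hfmem
  have hc0 : ∀ z ∈ Q \ {0}, c (f z) ≠ 0 := fun z hz => (hcpos z hz.1).ne'
  have hcc' := hcc.mono (sdiff_subset (t := {0}))
  have hbc' := hbc.mono (sdiff_subset (t := {0}))
  have hfc' := hfcont.mono (sdiff_subset (t := {0}))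
  have hgxc : ContinuousOn (fun z => gx (f z)) (Q \ {0}) := hS.gx_cont.comp hfc' hfmem'
  have hgyc : ContinuousOn (fun z => gy (f z)) (Q \ {0}) := hS.gy_cont.comp hfc' hfmem'
  have hWxc : ContinuousOn Wx (Q \ {0}) := hgxc.sub ((hgyc.mul hbc').div hcc' hc0)
  have hWqc : ContinuousOn Wq (Q \ {0}) := hgyc.div hcc' hc0
  have hWc : ContinuousOn W (Q \ {0}) := fun z hz => (hWd z hz).continuousAt.continuousWithinAt
  have hrestr : (volume : Measure (ℝ × ℝ)).restrict Q = volume.restrict (Q \ {0}) :=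
    (Measure.restrict_congr_set (sdiff_null_ae_eq_self (measure_singleton 0))).symm
  have hm' : MeasurableSet (Q \ {0}) := hQm.diff (measurableSet_singleton 0)
  have hmeas : ∀ F : ℝ × ℝ → ℝ, ContinuousOn F (Q \ {0}) →
      AEMeasurable (fun z => ENNReal.ofReal (F z)) (volume.restrict Q) := fun F hF => by
    rw [hrestr]
    exact ENNReal.measurable_ofReal.comp_aemeasurable (hF.aemeasurable hm')
  have hWr : ∀ s : ℝ, ContinuousOn (fun z => W z ^ s) (Q \ {0}) := fun s =>
    hWc.rpow_const fun z hz => Or.inl (by linarith [hW1 z hz])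
  have hpre : O ∩ Pot.pg vy ⁻¹' Q ⊆ {z ∈ O | v z < ρ₄} := fun z hz => ⟨hz.1, by
    have := (hQ _ hz.2).2
    rwa [hf, hB.ipg_pg hz.1] at this⟩
  have hprem := hB.measurableSet_preimage hQcl
  have hae : ∀ᵐ z : ℝ × ℝ, z ≠ 0 := by
    rw [ae_iff]; simp
  have hrestr2 : ∀ F₁ F₂ : ℝ × ℝ → ENNReal, (∀ z ∈ Q \ {0}, F₁ z ≤ F₂ z) →
      ∫⁻ z in Q, F₁ z ≤ ∫⁻ z in Q, F₂ z := fun F₁ F₂ hF => by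
    rw [hrestr]
    exact setLIntegral_mono' hm' hF
  have F1 : ∫⁻ z in Q, ENNReal.ofReal ((Wx z ^ 2 + Wq z ^ 2) * W z ^ (-(5 / 4 : ℝ))) ≤
      ENNReal.ofReal (M * E₁) := by
    have e : ∫⁻ z in Q, ENNReal.ofReal ((Wx z ^ 2 + Wq z ^ 2) * W z ^ (-(5 / 4 : ℝ))) ≤
        ∫⁻ z in Q, ENNReal.ofReal ((Wx z ^ 2 + Wq z ^ 2) * |W z ^ (-(5 / 4 : ℝ))|) :=
      hrestr2 _ _ fun z hz => ENNReal.ofReal_le_ofReal (by gcongr; exact le_abs_self _)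
    refine e.trans ?_
    rw [hB.lintegral_of_subset hQcl hQO _, ENNReal.ofReal_mul hM0]
    refine le_trans ?_ (mul_le_mul_right hE _)
    rw [← lintegral_const_mul' _ _ ENNReal.ofReal_ne_top]
    refine le_trans (lintegral_mono_ae ?_) (lintegral_mono_set hpre)
    filter_upwards [ae_restrict_mem hprem, ae_restrict_of_ae hae] with z hz hz0
    rw [← ENNReal.ofReal_mul hM0]
    apply ENNReal.ofReal_le_ofReal
    have hg0 := hS.nonneg z ⟨hz.1, hz0⟩
    simp only [hW, hWx, hWq, hf, hB.ipg_pg hz.1]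
    rw [abs_of_nonneg (by positivity), ← mul_assoc, ← mul_assoc]
    refine mul_le_mul_of_nonneg_right ?_ (by positivity)
    exact energy_bound hlam (hB.c_pos z hz.1) (hB.det_ge z hz.1)
  have F2 : ∫⁻ z in Q, ENNReal.ofReal (W z) ≤ ENNReal.ofReal C₁ := by
    have e : ∫⁻ z in Q, ENNReal.ofReal (W z) ≤ ∫⁻ z in Q, ENNReal.ofReal |W z| :=
      hrestr2 _ _ fun z hz => ENNReal.ofReal_le_ofReal (le_abs_self _)
    refine e.trans ?_
    rw [hB.lintegral_of_subset hQcl hQO _]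
    refine le_trans (le_trans (lintegral_mono_ae ?_) (lintegral_mono_set hpre)) hC
    filter_upwards [ae_restrict_mem hprem, ae_restrict_of_ae hae] with z hz hz0
    apply ENNReal.ofReal_le_ofReal
    have hg0 := hS.nonneg z ⟨hz.1, hz0⟩
    simp only [hW, hf, hB.ipg_pg hz.1]
    rw [abs_of_nonneg (by positivity), mul_comm]
  have F3 : ∫⁻ z in Q, ENNReal.ofReal (W z ^ (3 / 2 : ℝ)) ≤
      ENNReal.ofReal (((1 / (2 * h) + 1) * C₁ + M * E₁) ^ 2) := by
    refine (ladyzhenskaya hh hW1 hWd hWxc hWqc).trans ?_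
    rw [ENNReal.ofReal_pow (by positivity)]
    refine pow_le_pow_left' ?_ 2
    rw [ENNReal.ofReal_add (by positivity) (by positivity),
      ENNReal.ofReal_mul (p := 1 / (2 * h) + 1) (by positivity)]
    refine le_trans ?_ (add_le_add (mul_le_mul_right F2 _) F1)
    rw [← lintegral_const_mul' _ _ ENNReal.ofReal_ne_top, ← lintegral_add_left'
      ((hmeas _ hWc).const_mul _)]
    refine hrestr2 _ _ fun z hz => ?_
    have := hW1 z hz
    rw [← ENNReal.ofReal_mul (by positivity), ← ENNReal.ofReal_add (by positivity) (by positivity)]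
  have hadd : ENNReal.ofReal (M * E₁ + ((1 / (2 * h) + 1) * C₁ + M * E₁) ^ 2 + K + 4 * h ^ 2) =
      ENNReal.ofReal (M * E₁) + ENNReal.ofReal (((1 / (2 * h) + 1) * C₁ + M * E₁) ^ 2) +
      ENNReal.ofReal K + ENNReal.ofReal (4 * h ^ 2) := by
    rw [ENNReal.ofReal_add (by positivity) (by positivity),
      ENNReal.ofReal_add (by positivity) (by positivity),
      ENNReal.ofReal_add (by positivity) (by positivity)]
  rw [hadd, ← volume_box z₀ hh, ← setLIntegral_one]
  refine le_trans ?_ (add_le_add_left (add_le_add (add_le_add F1 F3) hk) _)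
  have m1 := hmeas (fun z => (Wx z ^ 2 + Wq z ^ 2) * W z ^ (-(5 / 4 : ℝ)))
    (((hWxc.pow 2).add (hWqc.pow 2)).mul (hWr (-(5 / 4 : ℝ))))
  have m2 := hmeas _ (hWr (3 / 2 : ℝ))
  have m12 : AEMeasurable (fun z => ENNReal.ofReal ((Wx z ^ 2 + Wq z ^ 2) *
    W z ^ (-(5 / 4 : ℝ))) + ENNReal.ofReal (W z ^ (3 / 2 : ℝ))) (volume.restrict Q) := m1.add m2
  rw [← lintegral_add_left' m1, ← lintegral_add_left' m12,
    ← lintegral_add_right _ measurable_const]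
  refine hrestr2 _ _ fun z hz => ?_
  have hkp : 0 < 1 / c (f z) := one_div_pos.mpr (hcpos z hz.1)
  have hWz := hW1 z hz
  have hW0 : 0 < W z := by linarith
  have hy := pointwise_young hp hε hpε (y := Wq z) hkp hWz
  have e1 : Wq z / (1 / c (f z)) = gy (f z) := by
    have := (hcpos z hz.1).ne'
    simp only [hWq]
    field_simp
  rw [e1] at hy
  rw [← ENNReal.ofReal_one, ← ENNReal.ofReal_add (by positivity) (by positivity),
    ← ENNReal.ofReal_add (by positivity) (by positivity),
    ← ENNReal.ofReal_add (by positivity) (by positivity)]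
  apply ENNReal.ofReal_le_ofReal
  have : Wq z ^ 2 * W z ^ (-(5 / 4 : ℝ)) ≤ (Wx z ^ 2 + Wq z ^ 2) * W z ^ (-(5 / 4 : ℝ)) := by
    gcongr
    nlinarith [sq_nonneg (Wx z)]
  linarith

end Bowl
end GreenLp

namespace GreenLp
open Set

namespace Bowl

theorem lintegral_le_of_cover {α : Type*} [MeasurableSpace α] {ν : Measure α} {ι : Type*}
    (t : Finset ι) {T : Set α} {U : ι → Set α} (hT : T ⊆ ⋃ i ∈ t, U i) {f : α → ENNReal}
    {M : ENNReal} (hM : ∀ i ∈ t, ∫⁻ x in T ∩ U i, f x ∂ν ≤ M) :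
    ∫⁻ x in T, f x ∂ν ≤ t.card * M := by
  have h1 : T ⊆ ⋃ i : t, T ∩ U i := fun x hx => by
    obtain ⟨i, hi, hxi⟩ := mem_iUnion₂.mp (hT hx)
    exact mem_iUnion.mpr ⟨⟨i, hi⟩, hx, hxi⟩
  calc ∫⁻ x in T, f x ∂ν ≤ ∫⁻ x in ⋃ i : t, T ∩ U i, f x ∂ν := lintegral_mono_set h1
    _ ≤ ∑' i : t, ∫⁻ x in T ∩ U i, f x ∂ν := lintegral_iUnion_le _ _
    _ ≤ ∑' i : t, M := ENNReal.tsum_le_tsum fun i => hM i i.2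
    _ = t.card * M := by simp

/-- The `L^p` bound for the derivative of a Green-type function in the second variable, on the
part of the section where the corresponding slope of the potential is small. -/
theorem exists_gradient_bound {lam Lam μ ε B : ℝ} (hlam : 0 < lam) (hμ : 0 < μ) (hμ1 : μ ≤ 1)
    (hμl : μ ≤ lam) (hμL : μ * Lam ≤ 1) (hε : 0 < ε) (hB : 0 < B) (hN : NegPower μ ε B)
    {p : ℝ} (hp : 1 < p) (hpε : 11 * p / 12 + (p - 1) / ε ≤ 1)
    {ρ₀ ρ₂ ρ₄ ρ L R σ E₁ C₁ : ℝ} (hρ₀ : 0 < ρ₀) (h02 : ρ₀ < ρ₂)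
    (hL : 0 < L) (hR : 0 < R) (hσ : 0 < σ) (h4 : ρ₂ + σ * R ≤ ρ₄) (hρ : ρ₄ ≤ ρ)
    (hE₁ : 0 ≤ E₁) (hC₁ : 0 ≤ C₁) :
    ∃ K : ℝ, 0 ≤ K ∧ ∀ (O : Set (ℝ × ℝ)) (v vx vy a b c g gx gy : ℝ × ℝ → ℝ),
      Bowl lam Lam ρ L R O v vx vy a b c → Sing O g gx gy →
      ∫⁻ z in {z ∈ O | v z < ρ₄}, ENNReal.ofReal
        (energy a b c gx gy z * (1 + g z) ^ (-(5 / 4 : ℝ))) ≤ ENNReal.ofReal E₁ →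
      ∫⁻ z in {z ∈ O | v z < ρ₄}, ENNReal.ofReal ((1 + g z) * c z) ≤ ENNReal.ofReal C₁ →
      ∫⁻ z in {z ∈ O | v z < ρ₀ ∧ |vy z| ≤ σ / 2}, ENNReal.ofReal (|gy z| ^ p) ≤
        ENNReal.ofReal K := by
  obtain ⟨h, hh, κ, hκ, hmass⟩ := exists_mass_lower hlam hμ hμ1 hμl hμL hρ₀ h02 hL hR hσ h4 hρ
  obtain ⟨t, -, ht⟩ := (isCompact_box 0 (R + σ)).finite_cover_balls (half_pos hh)
  set K₀ := B * (κ / (4 * h ^ 2)) ^ (-ε) * (4 * h ^ 2) with hK₀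
  set K₁ := max 1 (1 / lam) * E₁ +
        ((1 / (2 * h) + 1) * C₁ + max 1 (1 / lam) * E₁) ^ 2 + K₀ + 4 * h ^ 2 with hK₁
  have hM0 : (0 : ℝ) ≤ max 1 (1 / lam) := zero_le_one.trans (le_max_left _ _)
  have hK₀0 : 0 ≤ K₀ := by positivity
  have hK₁0 : 0 ≤ K₁ := by positivity
  obtain ⟨hfin, hcov⟩ := ht
  refine ⟨hfin.toFinset.card * K₁, by positivity, ?_⟩
  intro O v vx vy a b c g gx gy hb hS hE hC
  set A := {z ∈ O | v z < ρ₀ ∧ |vy z| ≤ σ / 2} with hA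
  have hAO : A ⊆ O := fun z hz => hz.1
  have hvc : ContinuousOn v O := fun z hz => (hb.hv z hz).continuousAt.continuousWithinAt
  have hvyc : ContinuousOn vy O := fun z hz => (hb.hvy z hz).continuousAt.continuousWithinAt
  have hAm : MeasurableSet A := by
    have : A = (O ∩ v ⁻¹' Iio ρ₀) \ (O ∩ vy ⁻¹' {q | |q| ≤ σ / 2}ᶜ) := by
      ext z
      simp [hA]
      tauto
    rw [this]
    refine (hvc.isOpen_inter_preimage hb.isOpen isOpen_Iio).measurableSet.diff
      (hvyc.isOpen_inter_preimage hb.isOpen 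
        (isClosed_le continuous_abs continuous_const).isOpen_compl).measurableSet
  have e1 : ∫⁻ z in A, ENNReal.ofReal (|gy z| ^ p) = ∫⁻ z in Pot.pg vy '' A, ENNReal.ofReal
        (|gy (Pot.ipg O vy z)| ^ p * (1 / c (Pot.ipg O vy z))) := by
    rw [hb.lintegral_image hAm hAO]
    refine setLIntegral_congr_fun hAm fun z hz => ?_
    have hc := hb.c_pos z hz.1
    simp only [hb.ipg_pg hz.1]
    rw [← ENNReal.ofReal_mul hc.le]
    congr 1
    field_simp
  rw [e1, ENNReal.ofReal_mul (by positivity), ENNReal.ofReal_natCast]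
  refine lintegral_le_of_cover hfin.toFinset (U := fun e => Metric.ball e (h / 2)) ?_ ?_
  · rintro _ ⟨z, hz, rfl⟩
    have h0 := hb.bdd z (subset_closure hz.1) 0 (subset_closure hb.zero_mem)
    have : Pot.pg vy z ∈ box 0 (R + σ) := by
      have h1 := abs_le.mp h0.1
      have h2 := abs_le.mp hz.2.2
      simp only [Prod.fst_zero, sub_zero] at h1
      refine ⟨⟨?_, ?_⟩, ⟨?_, ?_⟩⟩ <;> simp only [Pot.pg, Prod.fst_zero, Prod.snd_zero] <;> linarith
    simpa using hcov this
  · intro e _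
    rcases (Pot.pg vy '' A ∩ Metric.ball e (h / 2)).eq_empty_or_nonempty with h0 | ⟨z₀, hz₀, hz₀e⟩
    · rw [h0]
      simp
    obtain ⟨z₁, hz₁, rfl⟩ := hz₀
    set z₀ := Pot.pg vy z₁ with hz₀
    obtain ⟨hm1, hm2⟩ := hmass O v vx vy a b c hb z₀ ⟨z₁.2, hz₁.1, hz₁.2.1⟩ hz₁.2.2
    have hsub : Pot.pg vy '' A ∩ Metric.ball e (h / 2) ⊆ box z₀ h := by
      rintro z ⟨-, hz⟩
      rw [Metric.mem_ball] at hz hz₀e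
      have : dist z z₀ < h := by
        have := dist_triangle_right z z₀ e
        linarith
      rw [Prod.dist_eq, max_lt_iff, Real.dist_eq, Real.dist_eq, abs_lt, abs_lt] at this
      exact ⟨⟨by linarith, by linarith⟩, ⟨by linarith, by linarith⟩⟩
    refine (lintegral_mono_set hsub).trans ?_
    have hbb : box z₀ h ⊆ box z₀ (5 / 3 * h) :=
      box_subset_box (by simp; linarith) (by simp; linarith)
    refine hb.box_bound hS hlam hp hε hpε hh hE₁ hC₁ hK₀0 (fun z hz => hm1 z (hbb hz)) hE hC ?_
    refine (hN _ _ _ _ _ _ _ (hb.saddle hlam hμl hμL hμ.le) z₀ h hh fun z hz => (hm1 z hz).1).trans ?_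
    apply ENNReal.ofReal_le_ofReal
    rw [hK₀]
    have : ((∫ z in box z₀ h, 1 / c (Pot.ipg O vy z)) / (4 * h ^ 2)) ^ (-ε) ≤
        (κ / (4 * h ^ 2)) ^ (-ε) :=
      Real.rpow_le_rpow_of_nonpos (by positivity) (by gcongr) (by linarith)
    gcongr

end Bowl
end GreenLp

namespace GreenLp
open Set

/-- Smoothness at a point of the plane. -/
abbrev Sm (f : E 2 → ℝ) (x : E 2) : Prop := ContDiffAt ℝ (⊤ : ℕ∞) f x

variable {u f k : E 2 → ℝ} {x : E 2}

theorem Sm.differentiableAt (hf : Sm f x) : DifferentiableAt ℝ f x :=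
  ContDiffAt.differentiableAt hf (by simp)

theorem Sm.pd (hf : Sm f x) (i : Fin 2) : Sm (fun y => pd f y i) x := by
  have : ContDiffAt ℝ (⊤ : ℕ∞) (fderiv ℝ f) x := hf.fderiv_right (by simp)
  exact this.clm_apply contDiffAt_const

theorem Sm.pd2 (hf : Sm f x) (i j : Fin 2) : Sm (fun y => pd2 f y i j) x := (hf.pd j).pd i

theorem Sm.two (hf : Sm f x) : ContDiffAt ℝ 2 f x := contDiffAt_infty.mp hf 2

theorem Sm.eventually (hf : Sm f x) : ∀ᶠ y in nhds x, ContDiffAt ℝ 2 f y :=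
  hf.two.eventually (by simp)

theorem pd_congr (h : f =ᶠ[nhds x] k) (i : Fin 2) : pd f x i = pd k x i := by
  rw [pd, pd, h.fderiv_eq]

theorem pd_add (hf : DifferentiableAt ℝ f x) (hk : DifferentiableAt ℝ k x) (i : Fin 2) :
    pd (fun y => f y + k y) x i = pd f x i + pd k x i := by
  simp only [pd, fderiv_fun_add hf hk, add_apply]

theorem pd_sub (hf : DifferentiableAt ℝ f x) (hk : DifferentiableAt ℝ k x) (i : Fin 2) :
    pd (fun y => f y - k y) x i = pd f x i - pd k x i := by
  simp only [pd, fderiv_fun_sub hf hk, sub_apply]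

theorem pd_mul (hf : DifferentiableAt ℝ f x) (hk : DifferentiableAt ℝ k x) (i : Fin 2) :
    pd (fun y => f y * k y) x i = f x * pd k x i + k x * pd f x i := by
  simp only [pd, fderiv_fun_mul hf hk, add_apply,
    smul_apply, smul_eq_mul]

theorem pd_comp {T : ℝ → ℝ} {T' : ℝ} (hT : HasDerivAt T T' (f x)) (hf : DifferentiableAt ℝ f x)
    (i : Fin 2) : pd (fun y => T (f y)) x i = T' * pd f x i := by
  have h := hT.comp_hasFDerivAt x hf.hasFDerivAt
  have h' : fderiv ℝ (fun y => T (f y)) x = T' • fderiv ℝ f x := h.fderiv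
  simp only [pd, h', smul_apply, smul_eq_mul]

theorem pd2_eq (f : E 2 → ℝ) (x : E 2) (i j : Fin 2) : pd2 f x i j = pd (fun y => pd f y j) x i :=
  rfl

theorem pd2_symm (hf : ContDiffAt ℝ 2 f x) (i j : Fin 2) : pd2 f x i j = pd2 f x j i := by
  have h := (hf.isSymmSndFDerivAt (by simp)).eq (EuclideanSpace.single i 1)
    (EuclideanSpace.single j 1)
  have hd : DifferentiableAt ℝ (fderiv ℝ f) x :=
    (hf.fderiv_right (m := 1) (by norm_num)).differentiableAt (by simp)
  have e : ∀ i j : Fin 2, pd2 f x i j =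
      fderiv ℝ (fderiv ℝ f) x (EuclideanSpace.single i 1) (EuclideanSpace.single j 1) := by
    intro i j
    rw [pd2, fderiv_clm_apply hd (differentiableAt_const _)]
    simp
  rw [e, e, h]

theorem pd2_add (hf : Sm f x) (hk : Sm k x) (i j : Fin 2) :
    pd2 (fun y => f y + k y) x i j = pd2 f x i j + pd2 k x i j := by
  rw [pd2_eq, pd2_eq, pd2_eq,
    ← pd_add (hf.pd j).differentiableAt (hk.pd j).differentiableAt]
  refine pd_congr ?_ i
  filter_upwards [hf.eventually, hk.eventually] with y h1 h2
  exact pd_add (h1.differentiableAt (by simp)) (h2.differentiableAt (by simp)) j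

theorem pd2_sub (hf : Sm f x) (hk : Sm k x) (i j : Fin 2) :
    pd2 (fun y => f y - k y) x i j = pd2 f x i j - pd2 k x i j := by
  rw [pd2_eq, pd2_eq, pd2_eq,
    ← pd_sub (hf.pd j).differentiableAt (hk.pd j).differentiableAt]
  refine pd_congr ?_ i
  filter_upwards [hf.eventually, hk.eventually] with y h1 h2
  exact pd_sub (h1.differentiableAt (by simp)) (h2.differentiableAt (by simp)) j

theorem pd2_mul (hf : Sm f x) (hk : Sm k x) (i j : Fin 2) :
    pd2 (fun y => f y * k y) x i j = f x * pd2 k x i j + k x * pd2 f x i j +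
      pd f x i * pd k x j + pd k x i * pd f x j := by
  have h1 : pd2 (fun y => f y * k y) x i j =
      pd (fun y => f y * pd k y j + k y * pd f y j) x i := by
    rw [pd2_eq]
    refine pd_congr ?_ i
    filter_upwards [hf.eventually, hk.eventually] with y h1 h2
    exact pd_mul (h1.differentiableAt (by simp)) (h2.differentiableAt (by simp)) j
  have a := hf.differentiableAt
  have b := hk.differentiableAt
  have c := (hf.pd j).differentiableAt
  have d := (hk.pd j).differentiableAt
  rw [h1, pd_add (a.fun_mul d) (b.fun_mul c), pd_mul a d, pd_mul b c, pd2_eq, pd2_eq]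
  ring

theorem pd2_comp {T T' : ℝ → ℝ} {T'' : ℝ} (hT : ∀ᶠ t in nhds (f x), HasDerivAt T (T' t) t)
    (hT' : HasDerivAt T' T'' (f x)) (hf : Sm f x) (i j : Fin 2) :
    pd2 (fun y => T (f y)) x i j = T' (f x) * pd2 f x i j + T'' * pd f x i * pd f x j := by
  have h1 : pd2 (fun y => T (f y)) x i j = pd (fun y => T' (f y) * pd f y j) x i := by
    rw [pd2_eq]
    refine pd_congr ?_ i
    filter_upwards [hf.eventually, hf.continuousAt.eventually hT] with y h1 h2
    exact pd_comp h2 (h1.differentiableAt (by simp)) j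
  have a := hf.differentiableAt
  rw [h1, pd_mul (hT'.differentiableAt.fun_comp' x a) (hf.pd j).differentiableAt, pd_comp hT' a, pd2_eq]
  ring

/-- The linearized operator `U^{ij} ∂_{ij}`. -/
def LL (u f : E 2 → ℝ) (x : E 2) : ℝ := ∑ i, ∑ j, cofU u x i j * pd2 f x i j

/-- The bilinear form `U^{ij} ∂_i f ∂_j k`. -/
def BB (u f k : E 2 → ℝ) (x : E 2) : ℝ := ∑ i, ∑ j, cofU u x i j * pd f x i * pd k x j

theorem LL_eq (u f : E 2 → ℝ) (x : E 2) : LL u f x = pd2 u x 1 1 * pd2 f x 0 0 -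
    pd2 u x 0 1 * pd2 f x 0 1 - pd2 u x 1 0 * pd2 f x 1 0 + pd2 u x 0 0 * pd2 f x 1 1 := by
  simp [LL, Fin.sum_univ_two, cofU, Matrix.adjugate_fin_two, Hess]
  ring

theorem BB_eq (u f k : E 2 → ℝ) (x : E 2) : BB u f k x = pd2 u x 1 1 * pd f x 0 * pd k x 0 -
    pd2 u x 0 1 * pd f x 0 * pd k x 1 - pd2 u x 1 0 * pd f x 1 * pd k x 0 +
    pd2 u x 0 0 * pd f x 1 * pd k x 1 := by
  simp [BB, Fin.sum_univ_two, cofU, Matrix.adjugate_fin_two, Hess]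
  ring

theorem BB_comm (hu : Sm u x) : BB u f k x = BB u k f x := by
  rw [BB_eq, BB_eq, pd2_symm hu.two 1 0]
  ring

theorem LL_add (hf : Sm f x) (hk : Sm k x) :
    LL u (fun y => f y + k y) x = LL u f x + LL u k x := by
  simp only [LL_eq, pd2_add hf hk]
  ring

theorem LL_sub (hf : Sm f x) (hk : Sm k x) :
    LL u (fun y => f y - k y) x = LL u f x - LL u k x := by
  simp only [LL_eq, pd2_sub hf hk]
  ring

theorem LL_comp {T T' : ℝ → ℝ} {T'' : ℝ} (hT : ∀ᶠ t in nhds (f x), HasDerivAt T (T' t) t)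
    (hT' : HasDerivAt T' T'' (f x)) (hf : Sm f x) :
    LL u (fun y => T (f y)) x = T' (f x) * LL u f x + T'' * BB u f f x := by
  simp only [LL_eq, BB_eq, pd2_comp hT hT' hf]
  ring

theorem BB_mul_left {l : E 2 → ℝ} (hf : DifferentiableAt ℝ f x) (hk : DifferentiableAt ℝ k x) :
    BB u (fun y => f y * k y) l x = f x * BB u k l x + k x * BB u f l x := by
  simp only [BB_eq, pd_mul hf hk]
  ring

theorem BB_comp_left {l : E 2 → ℝ} {T : ℝ → ℝ} {T' : ℝ} (hT : HasDerivAt T T' (f x))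
    (hf : DifferentiableAt ℝ f x) : BB u (fun y => T (f y)) l x = T' * BB u f l x := by
  simp only [BB_eq, pd_comp hT hf]
  ring

theorem BB_comp_right {l : E 2 → ℝ} {T : ℝ → ℝ} {T' : ℝ} (hT : HasDerivAt T T' (f x))
    (hf : DifferentiableAt ℝ f x) : BB u l (fun y => T (f y)) x = T' * BB u l f x := by
  simp only [BB_eq, pd_comp hT hf]
  ring

/-- The flux `U ∇f`. -/
def flux (u f : E 2 → ℝ) (i : Fin 2) (x : E 2) : ℝ :=
  match i with
  | 0 => pd2 u x 1 1 * pd f x 0 - pd2 u x 0 1 * pd f x 1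
  | 1 => pd2 u x 0 0 * pd f x 1 - pd2 u x 1 0 * pd f x 0

theorem Sm.flux (hu : Sm u x) (hf : Sm f x) (i : Fin 2) : Sm (flux u f i) x := by
  fin_cases i
  · exact ((hu.pd2 1 1).mul (hf.pd 0)).sub ((hu.pd2 0 1).mul (hf.pd 1))
  · exact ((hu.pd2 0 0).mul (hf.pd 1)).sub ((hu.pd2 1 0).mul (hf.pd 0))

theorem div_flux (hu : Sm u x) (hf : Sm f x) (hk : Sm k x) :
    ∑ i, pd (fun y => k y * flux u f i y) x i = k x * LL u f x + BB u k f x := by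
  have d2 : ∀ i j, DifferentiableAt ℝ (fun y => pd2 u y i j) x := fun i j =>
    (hu.pd2 i j).differentiableAt
  have d1 : ∀ i, DifferentiableAt ℝ (fun y => pd f y i) x := fun i => (hf.pd i).differentiableAt
  have e0 : pd (flux u f 0) x 0 = pd2 u x 1 1 * pd2 f x 0 0 +
      pd f x 0 * pd (fun y => pd2 u y 1 1) x 0 - (pd2 u x 0 1 * pd2 f x 0 1 +
      pd f x 1 * pd (fun y => pd2 u y 0 1) x 0) := by
    have : flux u f 0 = fun y => pd2 u y 1 1 * pd f y 0 - pd2 u y 0 1 * pd f y 1 := rfl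
    rw [this, pd_sub ((d2 1 1).fun_mul (d1 0)) ((d2 0 1).fun_mul (d1 1)), pd_mul (d2 1 1) (d1 0),
      pd_mul (d2 0 1) (d1 1), ← pd2_eq, ← pd2_eq]
  have e1 : pd (flux u f 1) x 1 = pd2 u x 0 0 * pd2 f x 1 1 +
      pd f x 1 * pd (fun y => pd2 u y 0 0) x 1 - (pd2 u x 1 0 * pd2 f x 1 0 +
      pd f x 0 * pd (fun y => pd2 u y 1 0) x 1) := by
    have : flux u f 1 = fun y => pd2 u y 0 0 * pd f y 1 - pd2 u y 1 0 * pd f y 0 := rfl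
    rw [this, pd_sub ((d2 0 0).fun_mul (d1 1)) ((d2 1 0).fun_mul (d1 0)), pd_mul (d2 0 0) (d1 1),
      pd_mul (d2 1 0) (d1 0), ← pd2_eq, ← pd2_eq]
  have s1 : pd (fun y => pd2 u y 1 0) x 1 = pd (fun y => pd2 u y 1 1) x 0 := by
    rw [pd_congr (hu.eventually.mono fun y hy => pd2_symm hy 1 0)]
    exact pd2_symm (hu.pd 1).two 1 0
  have s2 : pd (fun y => pd2 u y 0 0) x 1 = pd (fun y => pd2 u y 0 1) x 0 := by
    rw [pd_congr (hu.eventually.mono fun y hy => pd2_symm hy 0 1)]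
    exact pd2_symm (hu.pd 0).two 1 0
  rw [Fin.sum_univ_two, pd_mul hk.differentiableAt (hu.flux hf 0).differentiableAt,
    pd_mul hk.differentiableAt (hu.flux hf 1).differentiableAt, e0, e1, s1, s2, LL_eq, BB_eq]
  simp only [flux]
  ring

end GreenLp

namespace GreenLp
open Set

theorem integrableOn_of_zero_off {f : E 2 → ℝ} {W K : Set (E 2)} (hW : IsOpen W)
    (hK : IsCompact K) (hKW : K ⊆ W) (hf : ContinuousOn f W) (h0 : ∀ x ∈ W \ K, f x = 0) :
    IntegrableOn f W := by
  have h1 : IntegrableOn f K := (hf.mono hKW).integrableOn_compact hK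
  have h2 : IntegrableOn f (W \ K) := integrableOn_zero.congr_fun (fun x hx => (h0 x hx).symm)
    (hW.measurableSet.diff hK.measurableSet)
  have := h1.union h2
  rwa [union_sdiff_cancel hKW] at this

theorem integral_pd_eq_zero {F : E 2 → ℝ} {W K : Set (E 2)} (hW : IsOpen W)
    (hK : IsCompact K) (hKW : K ⊆ W) (hF : ∀ x ∈ W, Sm F x) (h0 : ∀ x ∈ W \ K, F x = 0)
    (i : Fin 2) : ∫ x in W, pd F x i = 0 := by
  set G : E 2 → ℝ := W.indicator F with hG
  have hGK : ∀ x ∉ K, G x = 0 := fun x hx => by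
    by_cases hxW : x ∈ W
    · rw [hG, indicator_of_mem hxW, h0 x ⟨hxW, hx⟩]
    · rw [hG, indicator_of_notMem hxW]
  have e1 : ∀ x ∈ W, G =ᶠ[nhds x] F := fun x hx => by
    filter_upwards [hW.mem_nhds hx] with y hy
    rw [hG, indicator_of_mem hy]
  have e0 : ∀ x ∉ K, G =ᶠ[nhds x] fun _ => 0 := fun x hx => by
    filter_upwards [hK.isClosed.isOpen_compl.mem_nhds hx] with y hy using hGK y hy
  have hsm : ContDiff ℝ (⊤ : ℕ∞) G := by
    rw [contDiff_iff_contDiffAt]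
    intro x
    by_cases hx : x ∈ W
    · exact (hF x hx).congr_of_eventuallyEq (e1 x hx)
    · exact contDiffAt_const.congr_of_eventuallyEq (e0 x fun h => hx (hKW h))
  have hcs : HasCompactSupport G := HasCompactSupport.intro hK hGK
  have hi : Integrable G := hsm.continuous.integrable_of_hasCompactSupport hcs
  have hd : Differentiable ℝ G := hsm.differentiable (by simp)
  have hfd : Continuous fun x => fderiv ℝ G x (EuclideanSpace.single i 1) :=
    (hsm.continuous_fderiv (by simp)).clm_apply continuous_const
  have hdi : Integrable fun x => fderiv ℝ G x (EuclideanSpace.single i 1) :=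
    hfd.integrable_of_hasCompactSupport (hcs.fderiv_apply ℝ _)
  have key := integral_mul_fderiv_eq_neg_fderiv_mul_of_integrable (μ := (volume : Measure (E 2)))
    (f := fun _ => (1 : ℝ)) (g := G)
    (v := EuclideanSpace.single i 1) (by simp) (by simpa using hdi) (by simpa using hi)
    (fun _ _ => differentiableAt_const _) (fun x _ => hd x)
  simp only [one_mul, fderiv_fun_const, Pi.zero_apply, zero_apply, zero_mul,
    integral_zero, neg_zero] at key
  rw [← key, ← integral_indicator hW.measurableSet]
  congr 1
  ext x
  by_cases hx : x ∈ W
  · rw [indicator_of_mem hx, pd, (e1 x hx).fderiv_eq]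
  · rw [indicator_of_notMem hx, (e0 x fun h => hx (hKW h)).fderiv_eq]
    simp

theorem Sm.continuousOn {f : E 2 → ℝ} {W : Set (E 2)} (hf : ∀ x ∈ W, Sm f x) :
    ContinuousOn f W := fun x hx => (hf x hx).continuousAt.continuousWithinAt

variable {u f k : E 2 → ℝ} {x : E 2}

theorem Sm.LL (hu : Sm u x) (hf : Sm f x) : Sm (LL u f) x := by
  rw [funext (LL_eq u f)]
  exact ((((hu.pd2 1 1).mul (hf.pd2 0 0)).sub ((hu.pd2 0 1).mul (hf.pd2 0 1))).sub
    ((hu.pd2 1 0).mul (hf.pd2 1 0))).add ((hu.pd2 0 0).mul (hf.pd2 1 1))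

theorem Sm.BB (hu : Sm u x) (hf : Sm f x) (hk : Sm k x) : Sm (BB u f k) x := by
  rw [funext (BB_eq u f k)]
  exact (((((hu.pd2 1 1).mul (hf.pd 0)).mul (hk.pd 0)).sub
    (((hu.pd2 0 1).mul (hf.pd 0)).mul (hk.pd 1))).sub
    (((hu.pd2 1 0).mul (hf.pd 1)).mul (hk.pd 0))).add
    (((hu.pd2 0 0).mul (hf.pd 1)).mul (hk.pd 1))

/-- Divergence theorem for the field `k U ∇f`. -/
theorem integral_div {W K : Set (E 2)} (hW : IsOpen W) (hK : IsCompact K) (hKW : K ⊆ W)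
    (hu : ∀ x ∈ W, Sm u x) (hf : ∀ x ∈ W, Sm f x) (hk : ∀ x ∈ W, Sm k x)
    (h0 : ∀ x ∈ W \ K, k x = 0 ∨ ∀ i, pd f x i = 0) :
    IntegrableOn (fun x => k x * LL u f x + BB u k f x) W ∧
      ∫ x in W, (k x * LL u f x + BB u k f x) = 0 := by
  have hF : ∀ i, ∀ x ∈ W, Sm (fun y => k y * flux u f i y) x := fun i x hx =>
    (hk x hx).mul ((hu x hx).flux (hf x hx) i)
  have hF0 : ∀ i, ∀ x ∈ W \ K, k x * flux u f i x = 0 := fun i x hx => by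
    rcases h0 x hx with h | h
    · rw [h, zero_mul]
    · fin_cases i <;> simp [flux, h]
  have hpd0 : ∀ i, ∀ x ∈ W \ K, pd (fun y => k y * flux u f i y) x i = 0 := fun i x hx => by
    have : (fun y => k y * flux u f i y) =ᶠ[nhds x] fun _ => 0 := by
      filter_upwards [(hW.sdiff hK.isClosed).mem_nhds hx] with y hy using hF0 i y hy
    rw [pd_congr this, pd]
    simp
  have hInt : ∀ i, IntegrableOn (fun x => pd (fun y => k y * flux u f i y) x i) W := fun i =>
    integrableOn_of_zero_off hW hK hKW (Sm.continuousOn fun x hx => (hF i x hx).pd i) (hpd0 i)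
  have heq : EqOn (fun x => ∑ i, pd (fun y => k y * flux u f i y) x i)
      (fun x => k x * LL u f x + BB u k f x) W := fun x hx =>
    div_flux (hu x hx) (hf x hx) (hk x hx)
  constructor
  · exact IntegrableOn.congr_fun (integrable_finsetSum _ fun i _ => hInt i) heq hW.measurableSet
  · rw [← setIntegral_congr_fun hW.measurableSet heq, integral_finsetSum _ fun i _ => hInt i]
    exact Finset.sum_eq_zero fun i _ => integral_pd_eq_zero hW hK hKW (hF i) (hF0 i) i

end GreenLp

namespace GreenLp
open Set

/-- A smooth convex function vanishing on `(-∞, 0]` and of slope one on `[1, ∞)`. -/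
def ramp (s : ℝ) : ℝ := ∫ t in (0 : ℝ)..s, Real.smoothTransition t

theorem hasDerivAt_ramp (s : ℝ) : HasDerivAt ramp (Real.smoothTransition s) s :=
  intervalIntegral.integral_hasDerivAt_right
    (Real.smoothTransition.continuous.intervalIntegrable _ _)
    (Real.smoothTransition.continuous.stronglyMeasurableAtFilter _ _)
    Real.smoothTransition.continuous.continuousAt

theorem hasDerivAt_smoothTransition (s : ℝ) :
    HasDerivAt Real.smoothTransition (deriv Real.smoothTransition s) s :=
  ((Real.smoothTransition.contDiff (n := 1)).differentiable (by simp) s).hasDerivAt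

theorem deriv_smoothTransition_nonneg (s : ℝ) : 0 ≤ deriv Real.smoothTransition s :=
  Real.smoothTransition.monotone.deriv_nonneg

theorem contDiff_ramp : ContDiff ℝ (⊤ : ℕ∞) ramp := by
  rw [contDiff_infty_iff_deriv]
  refine ⟨fun s => (hasDerivAt_ramp s).differentiableAt, ?_⟩
  rw [funext fun s => (hasDerivAt_ramp s).deriv]
  exact Real.smoothTransition.contDiff

theorem monotone_ramp : Monotone ramp :=
  monotone_of_hasDerivAt_nonneg hasDerivAt_ramp fun s => Real.smoothTransition.nonneg s

theorem ramp_of_nonpos {s : ℝ} (hs : s ≤ 0) : ramp s = 0 := by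
  rw [ramp, intervalIntegral.integral_congr (g := fun _ => 0), intervalIntegral.integral_zero]
  intro t ht
  rw [uIcc_of_ge hs] at ht
  exact Real.smoothTransition.zero_of_nonpos ht.2

theorem ramp_nonneg (s : ℝ) : 0 ≤ ramp s := by
  rcases le_total s 0 with h | h
  · rw [ramp_of_nonpos h]
  · rw [← ramp_of_nonpos le_rfl]
    exact monotone_ramp h

theorem ramp_le {s : ℝ} (hs : 0 ≤ s) : ramp s ≤ s := by
  have : Antitone fun s => ramp s - s := antitone_of_hasDerivAt_nonpos
    (fun s => (hasDerivAt_ramp s).sub (hasDerivAt_id s))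
    fun s => by have := Real.smoothTransition.le_one s; simpa using this
  have := this hs
  simp only [ramp_of_nonpos le_rfl] at this
  linarith

theorem le_ramp (s : ℝ) : s - 1 ≤ ramp s := by
  rcases le_total s 1 with h | h
  · exact (by linarith : s - 1 ≤ 0).trans (ramp_nonneg s)
  · have : MonotoneOn (fun s => ramp s - s) (Ici 1) := by
      refine monotoneOn_of_deriv_nonneg (convex_Ici 1)
        (contDiff_ramp.continuous.sub continuous_id).continuousOn
        (fun s _ => ((hasDerivAt_ramp s).sub (hasDerivAt_id s)).differentiableAt.differentiableWithinAt) ?_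
      intro s hs
      rw [interior_Ici] at hs
      rw [((hasDerivAt_ramp s).fun_sub (hasDerivAt_id' s)).deriv,
        Real.smoothTransition.one_of_one_le hs.le, sub_self]
    have := this self_mem_Ici h h
    simp only at this
    linarith [ramp_nonneg 1]

/-- The truncation `κ ramp ((t - κ) / κ)` of the identity. -/
def trunc (κ t : ℝ) : ℝ := κ * ramp ((t - κ) / κ)

variable {κ : ℝ}

theorem contDiff_trunc : ContDiff ℝ (⊤ : ℕ∞) (trunc κ) :=
  contDiff_const.mul (contDiff_ramp.comp ((contDiff_id.sub contDiff_const).div_const κ))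

theorem hasDerivAt_trunc (hκ : 0 < κ) (t : ℝ) :
    HasDerivAt (trunc κ) (Real.smoothTransition ((t - κ) / κ)) t := by
  have h := ((hasDerivAt_ramp ((t - κ) / κ)).comp t
    (((hasDerivAt_id' t).sub_const κ).div_const κ)).const_mul κ
  refine h.congr_deriv ?_
  field_simp

theorem hasDerivAt_trunc' (t : ℝ) :
    HasDerivAt (fun t => Real.smoothTransition ((t - κ) / κ))
      (deriv Real.smoothTransition ((t - κ) / κ) / κ) t := by
  have h := (hasDerivAt_smoothTransition ((t - κ) / κ)).comp t
    (((hasDerivAt_id' t).sub_const κ).div_const κ)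
  refine h.congr_deriv ?_
  rw [mul_one_div]

theorem trunc_of_le (hκ : 0 < κ) {t : ℝ} (ht : t ≤ κ) : trunc κ t = 0 := by
  rw [trunc, ramp_of_nonpos (div_nonpos_of_nonpos_of_nonneg (by linarith) hκ.le), mul_zero]

theorem trunc_nonneg (hκ : 0 < κ) (t : ℝ) : 0 ≤ trunc κ t := mul_nonneg hκ.le (ramp_nonneg _)

theorem trunc_le (hκ : 0 < κ) {t : ℝ} (ht : 0 ≤ t) : trunc κ t ≤ t := by
  rcases le_total t κ with h | h
  · rwa [trunc_of_le hκ h]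
  · have := mul_le_mul_of_nonneg_left (ramp_le (div_nonneg (sub_nonneg.2 h) hκ.le)) hκ.le
    rw [mul_div_cancel₀ _ hκ.ne'] at this
    exact this.trans (by linarith)

theorem le_trunc (hκ : 0 < κ) (t : ℝ) : t - 2 * κ ≤ trunc κ t := by
  have := mul_le_mul_of_nonneg_left (le_ramp ((t - κ) / κ)) hκ.le
  rw [mul_sub, mul_div_cancel₀ _ hκ.ne'] at this
  exact le_trans (by linarith) this

end GreenLp

namespace GreenLp
open Set

/-- The Laplacian in the plane. -/
def lap (u : E 2 → ℝ) (x : E 2) : ℝ := pd2 u x 0 0 + pd2 u x 1 1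

theorem hasFDerivAt_coord (j : Fin 2) (c : ℝ) (x : E 2) :
    HasFDerivAt (fun y : E 2 => y j - c) (EuclideanSpace.proj j : E 2 →L[ℝ] ℝ) x :=
  (EuclideanSpace.proj j : E 2 →L[ℝ] ℝ).hasFDerivAt.sub_const c

theorem pd_coord (i j : Fin 2) (c : ℝ) (x : E 2) :
    pd (fun y : E 2 => y j - c) x i = if j = i then 1 else 0 := by
  rw [pd, (hasFDerivAt_coord j c x).fderiv]
  simp

theorem sm_coord (j : Fin 2) (c : ℝ) (x : E 2) : Sm (fun y : E 2 => y j - c) x :=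
  (EuclideanSpace.proj j : E 2 →L[ℝ] ℝ).contDiff.contDiffAt.sub
    contDiffAt_const

theorem pd2_coord (i j k : Fin 2) (c : ℝ) (x : E 2) :
    pd2 (fun y : E 2 => y k - c) x i j = 0 := by
  rw [pd2_eq]
  simp only [pd_coord]
  simp [pd]

theorem LL_coord (u : E 2 → ℝ) (k : Fin 2) (c : ℝ) (x : E 2) :
    LL u (fun y : E 2 => y k - c) x = 0 := by
  simp [LL, pd2_coord]

/-- The paraboloid `(R² - |x - x₀|²) / 2`. -/
def cap (R : ℝ) (x₀ x : E 2) : ℝ :=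
  R ^ 2 / 2 - ((x 0 - x₀ 0) ^ 2 / 2 + (x 1 - x₀ 1) ^ 2 / 2)

theorem sm_cap (R : ℝ) (x₀ x : E 2) : Sm (cap R x₀) x :=
  contDiffAt_const.sub ((((sm_coord 0 (x₀ 0) x).pow 2).div_const 2).add
    (((sm_coord 1 (x₀ 1) x).pow 2).div_const 2))

theorem pd_const (c : ℝ) (x : E 2) (i : Fin 2) : pd (fun _ : E 2 => c) x i = 0 := by simp [pd]

theorem pd2_const (c : ℝ) (x : E 2) (i j : Fin 2) : pd2 (fun _ : E 2 => c) x i j = 0 := by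
  simp [pd2]

theorem LL_cap (u : E 2 → ℝ) (R : ℝ) (x₀ x : E 2) : LL u (cap R x₀) x = -lap u x := by
  have hT : ∀ t : ℝ, HasDerivAt (fun t : ℝ => t ^ 2 / 2) t t := fun t =>
    ((hasDerivAt_pow 2 t).div_const 2).congr_deriv (by simp)
  have h : ∀ j : Fin 2, LL u (fun y : E 2 => (y j - x₀ j) ^ 2 / 2) x =
      BB u (fun y : E 2 => y j - x₀ j) (fun y : E 2 => y j - x₀ j) x := fun j => by
    rw [LL_comp (T := fun t => t ^ 2 / 2) (T' := fun t => t) (.of_forall hT) (hasDerivAt_id _)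
      (sm_coord j _ x), LL_coord, mul_zero, zero_add, one_mul]
  have h0 := ((sm_coord 0 (x₀ 0) x).pow 2).div_const 2
  have h1 := ((sm_coord 1 (x₀ 1) x).pow 2).div_const 2
  have hc : cap R x₀ = fun y => (fun _ => R ^ 2 / 2) y -
      (fun y => (y 0 - x₀ 0) ^ 2 / 2 + (y 1 - x₀ 1) ^ 2 / 2) y := rfl
  rw [hc, LL_sub contDiffAt_const (h0.add h1), LL_add h0 h1, h, h]
  simp [LL, pd2_const, BB_eq, pd_coord, lap]
  ring

theorem cap_eq (R : ℝ) (x₀ x : E 2) : cap R x₀ x = (R ^ 2 - dist x x₀ ^ 2) / 2 := by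
  rw [EuclideanSpace.dist_eq, Real.sq_sqrt (by positivity), Fin.sum_univ_two, cap,
    Real.dist_eq, Real.dist_eq, sq_abs, sq_abs]
  ring

/-- A Green's function with pole `x₀` on an open set `V` on whose closure `u` is smooth, with
positive definite Hessian and determinant between `lam` and `Lam`. -/
structure Pole (lam Lam : ℝ) (V : Set (E 2)) (u : E 2 → ℝ) (x₀ : E 2) (g : E 2 → ℝ) : Prop where
  isOpen : IsOpen V
  cpt : IsCompact (closure V)
  mem : x₀ ∈ V
  hu : ∀ x ∈ closure V, Sm u x
  p0 : ∀ x ∈ V, 0 < pd2 u x 0 0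
  p1 : ∀ x ∈ V, 0 < pd2 u x 1 1
  det_ge : ∀ x ∈ V, lam ≤ pd2 u x 0 0 * pd2 u x 1 1 - pd2 u x 0 1 ^ 2
  det_le : ∀ x ∈ V, pd2 u x 0 0 * pd2 u x 1 1 - pd2 u x 0 1 ^ 2 ≤ Lam
  green : IsGreen u V x₀ g

variable {lam Lam : ℝ} {V : Set (E 2)} {u : E 2 → ℝ} {x₀ : E 2} {g f k : E 2 → ℝ} {x : E 2}

namespace Pole

theorem smu (h : Pole lam Lam V u x₀ g) (hx : x ∈ V) : Sm u x := h.hu x (subset_closure hx)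

theorem open_punct (h : Pole lam Lam V u x₀ g) : IsOpen (V \ {x₀}) :=
  h.isOpen.sdiff isClosed_singleton

theorem smg (h : Pole lam Lam V u x₀ g) (hx : x ∈ V \ {x₀}) : Sm g x :=
  h.green.2.1.contDiffAt (h.open_punct.mem_nhds hx)

theorem LLg (h : Pole lam Lam V u x₀ g) (hx : x ∈ V \ {x₀}) : LL u g x = 0 :=
  h.green.2.2.1 x hx

theorem pos (h : Pole lam Lam V u x₀ g) (hx : x ∈ V \ {x₀}) : 0 < g x := h.green.1 x hx

theorem weak (h : Pole lam Lam V u x₀ g) {φ : E 2 → ℝ} (hφ : ContDiff ℝ (⊤ : ℕ∞) φ)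
    (hc : HasCompactSupport φ) (hs : tsupport φ ⊆ V) : ∫ x in V, g x * LL u φ x = -φ x₀ :=
  h.green.2.2.2.2.2 φ hφ hc hs

theorem BB_nonneg (h : Pole lam Lam V u x₀ g) (hlam : 0 ≤ lam) (hx : x ∈ V) : 0 ≤ BB u f f x := by
  rw [BB_eq, pd2_symm (h.smu hx).two 1 0]
  have h0 := h.p0 x hx
  have h1 := h.det_ge x hx
  refine nonneg_of_mul_nonneg_right (a := pd2 u x 0 0) ?_ h0
  nlinarith [sq_nonneg (pd2 u x 0 0 * pd f x 1 - pd2 u x 0 1 * pd f x 0),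
    mul_nonneg (hlam.trans h1) (sq_nonneg (pd f x 0))]

theorem lap_pos (h : Pole lam Lam V u x₀ g) (hx : x ∈ V) : 0 < lap u x :=
  add_pos (h.p0 x hx) (h.p1 x hx)

/-- The superlevel sets of `g` away from the pole are compact in `V`. -/
theorem isCompact_superlevel (h : Pole lam Lam V u x₀ g) {κ δ : ℝ} (hκ : 0 < κ) (hδ : 0 < δ) :
    IsCompact {x ∈ closure V \ Metric.ball x₀ δ | κ ≤ g x} ∧
      {x ∈ closure V \ Metric.ball x₀ δ | κ ≤ g x} ⊆ V \ {x₀} := by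
  have hsub : closure V \ Metric.ball x₀ δ ⊆ closure V \ {x₀} := fun x hx =>
    ⟨hx.1, fun hx' => hx.2 (by rw [mem_singleton_iff.1 hx']; exact Metric.mem_ball_self hδ)⟩
  constructor
  · have : IsClosed {x ∈ closure V \ Metric.ball x₀ δ | κ ≤ g x} :=
      (h.green.2.2.2.1.mono hsub).preimage_isClosed_of_isClosed
        (isClosed_closure.sdiff Metric.isOpen_ball) isClosed_Ici
    exact h.cpt.of_isClosed_subset this fun x hx => hx.1.1
  · intro x hx
    refine ⟨?_, (hsub hx.1).2⟩
    by_contra hV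
    have : x ∈ frontier V := ⟨hx.1.1, fun hi => hV (interior_subset hi)⟩
    have := h.green.2.2.2.2.1 x this
    linarith [hx.2]

end Pole

theorem continuousOn_LL {K : Set (E 2)} (hu : ∀ x ∈ K, Sm u x) (hf : ∀ x ∈ K, Sm f x) :
    ContinuousOn (LL u f) K := Sm.continuousOn fun x hx => (hu x hx).LL (hf x hx)

end GreenLp

namespace GreenLp
open Set

variable {lam Lam : ℝ} {V : Set (E 2)} {u : E 2 → ℝ} {x₀ : E 2} {g f k : E 2 → ℝ} {x : E 2}

theorem pd_eq_zero_of_eqOn {U : Set (E 2)} (hU : IsOpen U) (hx : x ∈ U) (h : ∀ y ∈ U, f y = 0)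
    (i : Fin 2) : pd f x i = 0 := by
  have : f =ᶠ[nhds x] fun _ => 0 := by
    filter_upwards [hU.mem_nhds hx] with y hy using h y hy
  rw [pd_congr this, pd_const]

namespace Pole

theorem ae_restrict (V : Set (E 2)) (x₀ : E 2) : (V \ {x₀} : Set (E 2)) =ᵐ[volume] V :=
  sdiff_null_ae_eq_self (measure_singleton x₀)

theorem integrableOn_LL (h : Pole lam Lam V u x₀ g) {P : E 2 → ℝ} (hP : ∀ x, Sm P x) :
    IntegrableOn (LL u P) V :=
  ((continuousOn_LL h.hu fun x _ => hP x).integrableOn_compact h.cpt).mono_set subset_closure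

theorem integral_trunc_LL_nonneg (h : Pole lam Lam V u x₀ g) (hlam : 0 ≤ lam) {q : E 2 → ℝ}
    {δ κ : ℝ} (hκ : 0 < κ) (hδ : 0 < δ) (hq : ∀ x, Sm q x) (hq0 : ∀ x ∈ Metric.ball x₀ δ, q x = 0)
    (hqn : ∀ x ∈ V, 0 ≤ q x) :
    IntegrableOn (fun x => trunc κ (g x) * LL u q x) (V \ {x₀}) ∧
      0 ≤ ∫ x in V \ {x₀}, trunc κ (g x) * LL u q x := by
  set W := V \ {x₀} with hW
  obtain ⟨hK, hKW⟩ := h.isCompact_superlevel hκ hδ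
  set K := {x ∈ closure V \ Metric.ball x₀ δ | κ ≤ g x} with hKd
  have huW : ∀ x ∈ W, Sm u x := fun x hx => h.smu hx.1
  have htW : ∀ x ∈ W, Sm (fun x => trunc κ (g x)) x := fun x hx =>
    contDiff_trunc.contDiffAt.comp x (h.smg hx)
  have hd : ∀ x ∈ W, HasDerivAt (trunc κ) (Real.smoothTransition ((g x - κ) / κ)) (g x) :=
    fun x _ => hasDerivAt_trunc hκ _
  have hoff : ∀ x ∈ W \ K, x ∈ Metric.ball x₀ δ ∨ g x ≤ κ := fun x hx => by
    by_cases hb : x ∈ Metric.ball x₀ δ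
    · exact Or.inl hb
    · right
      by_contra hg
      exact hx.2 ⟨⟨subset_closure hx.1.1, hb⟩, (not_le.1 hg).le⟩
  have i1 := integral_div h.open_punct hK hKW huW htW (fun x _ => hq x) fun x hx => by
    rcases hoff x hx with hb | hg
    · exact Or.inl (hq0 x hb)
    · right
      intro i
      rw [pd_comp (hd x hx.1) (h.smg hx.1).differentiableAt,
        Real.smoothTransition.zero_of_nonpos
          (div_nonpos_of_nonpos_of_nonneg (by linarith) hκ.le), zero_mul]
  have i2 := integral_div h.open_punct hK hKW huW (fun x _ => hq x) htW fun x hx => by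
    rcases hoff x hx with hb | hg
    · exact Or.inr fun i => pd_eq_zero_of_eqOn Metric.isOpen_ball hb hq0 i
    · exact Or.inl (trunc_of_le hκ hg)
  have hInt : IntegrableOn (fun x => trunc κ (g x) * LL u q x) W := by
    refine integrableOn_of_zero_off h.open_punct hK hKW ?_ fun x hx => ?_
    · exact (Sm.continuousOn htW).mul (continuousOn_LL huW fun x _ => hq x)
    · rcases hoff x hx with hb | hg
      · have : ∀ i, ∀ y ∈ Metric.ball x₀ δ, pd q y i = 0 := fun i y hy =>
          pd_eq_zero_of_eqOn Metric.isOpen_ball hy hq0 i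
        simp [LL, pd2_eq, fun i j => pd_eq_zero_of_eqOn Metric.isOpen_ball hb (this j) i]
      · rw [trunc_of_le hκ hg, zero_mul]
  refine ⟨hInt, ?_⟩
  have hsub := i1.1.sub i2.1
  have heq : ∀ x ∈ W, trunc κ (g x) * LL u q x + ((q x * LL u (fun x => trunc κ (g x)) x +
      BB u q (fun x => trunc κ (g x)) x) - (trunc κ (g x) * LL u q x +
      BB u (fun x => trunc κ (g x)) q x)) =
      q x * (deriv Real.smoothTransition ((g x - κ) / κ) / κ * BB u g g x) := fun x hx => by
    rw [BB_comm (huW x hx), LL_comp (.of_forall (hasDerivAt_trunc hκ)) (hasDerivAt_trunc' (g x))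
      (h.smg hx), h.LLg hx]
    ring
  have := integral_add hInt hsub
  simp only [Pi.sub_apply] at this
  rw [integral_sub i1.1 i2.1, i1.2, i2.2, sub_zero, add_zero] at this
  rw [← this, setIntegral_congr_fun h.open_punct.measurableSet heq]
  refine setIntegral_nonneg h.open_punct.measurableSet fun x hx => ?_
  exact mul_nonneg (hqn x hx.1) (mul_nonneg (div_nonneg (deriv_smoothTransition_nonneg _) hκ.le)
    (h.BB_nonneg hlam hx.1))

theorem integral_trunc_lap_le (h : Pole lam Lam V u x₀ g) (hlam : 0 ≤ lam) {χ : E 2 → ℝ}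
    {R δ κ : ℝ} (hR : 0 < R) (hVR : V ⊆ Metric.ball x₀ R) (hκ : 0 < κ) (hδ : 0 < δ)
    (hχ : ContDiff ℝ (⊤ : ℕ∞) χ) (hχc : HasCompactSupport χ) (hχV : tsupport χ ⊆ V)
    (hχ1 : ∀ x, χ x ≤ 1) (hχe : ∀ x ∈ Metric.ball x₀ δ, χ x = 1) :
    IntegrableOn (fun x => trunc κ (g x) * lap u x) (V \ {x₀}) ∧
      ∫ x in V \ {x₀}, trunc κ (g x) * lap u x ≤
        R ^ 2 / 2 + 2 * κ * ∫ x in V, |LL u (fun x => χ x * cap R x₀ x) x| := by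
  set W := V \ {x₀} with hW
  set P : E 2 → ℝ := fun x => χ x * cap R x₀ x with hP
  set q : E 2 → ℝ := fun x => (1 - χ x) * cap R x₀ x with hq
  have hcap : ContDiff ℝ (⊤ : ℕ∞) (cap R x₀) := contDiff_iff_contDiffAt.2 fun x => sm_cap R x₀ x
  have hPs : ContDiff ℝ (⊤ : ℕ∞) P := hχ.mul hcap
  have hqs : ContDiff ℝ (⊤ : ℕ∞) q := (contDiff_const.sub hχ).mul hcap
  have hx₀ : P x₀ = R ^ 2 / 2 := by
    simp only [hP]
    rw [hχe x₀ (Metric.mem_ball_self hδ), cap_eq]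
    simp
  have hweak := h.weak hPs hχc.mul_right ((tsupport_mul_subset_left).trans hχV)
  have hgP : IntegrableOn (fun x => g x * LL u P x) V := by
    by_contra hc
    rw [integral_undef hc, hx₀] at hweak
    have : 0 < R ^ 2 / 2 := by positivity
    linarith
  have hgPW : IntegrableOn (fun x => g x * LL u P x) W := hgP.mono_set sdiff_subset
  have hweakW : ∫ x in W, g x * LL u P x = -(R ^ 2 / 2) := by
    rw [setIntegral_congr_set (ae_restrict V x₀), hweak, hx₀]
  have hLP : IntegrableOn (LL u P) V := h.integrableOn_LL fun x => hPs.contDiffAt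
  have hLPW : IntegrableOn (LL u P) W := hLP.mono_set sdiff_subset
  have hqi := h.integral_trunc_LL_nonneg hlam hκ hδ (q := q) (fun x => hqs.contDiffAt)
    (fun x hx => by simp only [hq]; rw [hχe x hx, sub_self, zero_mul]) (fun x hx => by
      refine mul_nonneg (sub_nonneg.2 (hχ1 x)) ?_
      have h1 : dist x x₀ < R := hVR hx
      have h2 : dist x x₀ ^ 2 ≤ R ^ 2 := pow_le_pow_left₀ dist_nonneg h1.le 2
      rw [cap_eq]
      linarith)
  have hcW : ContinuousOn (fun x => (g x - trunc κ (g x)) * LL u P x) W :=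
    ((Sm.continuousOn fun x hx => h.smg hx).sub (Sm.continuousOn fun x hx =>
      contDiff_trunc.contDiffAt.comp x (h.smg hx))).mul
      (continuousOn_LL (fun x hx => h.smu hx.1) fun x _ => hPs.contDiffAt)
  have hbd : ∀ x ∈ W, |(g x - trunc κ (g x)) * LL u P x| ≤ 2 * κ * |LL u P x| := fun x hx => by
    rw [abs_mul]
    refine mul_le_mul_of_nonneg_right ?_ (abs_nonneg _)
    rw [abs_of_nonneg (sub_nonneg.2 (trunc_le hκ (h.pos hx).le))]
    linarith [le_trunc hκ (g x)]
  have hdom : IntegrableOn (fun x => 2 * κ * |LL u P x|) W := hLPW.norm.const_mul (2 * κ)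
  have hmid : IntegrableOn (fun x => (g x - trunc κ (g x)) * LL u P x) W := by
    refine Integrable.mono' hdom
      (hcW.aestronglyMeasurable h.open_punct.measurableSet) ?_
    exact (ae_restrict_iff' h.open_punct.measurableSet).2 (.of_forall hbd)
  have heq : ∀ x ∈ W, (g x - trunc κ (g x)) * LL u P x - trunc κ (g x) * LL u q x -
      g x * LL u P x = trunc κ (g x) * lap u x := fun x hx => by
    have e : cap R x₀ = fun y => P y + q y := by
      ext y; simp only [hP, hq]; ring
    have := LL_cap u R x₀ x
    rw [e, LL_add hPs.contDiffAt hqs.contDiffAt] at this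
    linear_combination (-trunc κ (g x)) * this
  have hI := (hmid.sub hqi.1).sub hgPW
  refine ⟨IntegrableOn.congr_fun hI heq h.open_punct.measurableSet, ?_⟩
  have e1 := integral_sub (hmid.sub hqi.1) hgPW
  have e2 := integral_sub hmid hqi.1
  simp only [Pi.sub_apply] at e1
  rw [← setIntegral_congr_fun h.open_punct.measurableSet heq, e1, e2, hweakW]
  have b1 : ∫ x in W, (g x - trunc κ (g x)) * LL u P x ≤ ∫ x in W, 2 * κ * |LL u P x| :=
    setIntegral_mono_on hmid hdom h.open_punct.measurableSet fun x hx =>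
      (le_abs_self _).trans (hbd x hx)
  have b2 : ∫ x in W, |LL u P x| = ∫ x in V, |LL u P x| :=
    setIntegral_congr_set (ae_restrict V x₀)
  rw [integral_const_mul, b2] at b1
  linarith [hqi.2]

/-- The integral of `g Δu` is controlled by the weak formulation tested against a cap. -/
theorem lintegral_lap_le (h : Pole lam Lam V u x₀ g) (hlam : 0 ≤ lam) {R : ℝ} (hR : 0 < R)
    (hVR : V ⊆ Metric.ball x₀ R) :
    ∫⁻ x in V, ENNReal.ofReal (g x * lap u x) ≤ ENNReal.ofReal (R ^ 2 / 2) := by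
  obtain ⟨ε, hε, hεV⟩ := Metric.nhds_basis_closedBall.mem_iff.1 (h.isOpen.mem_nhds h.mem)
  let χ : ContDiffBump x₀ := ⟨ε / 2, ε, by positivity, by linarith⟩
  set M := ∫ x in V, |LL u (fun x => χ x * cap R x₀ x) x| with hM
  have hlapc : ContinuousOn (lap u) (closure V) := Sm.continuousOn fun x hx =>
    ((h.hu x hx).pd2 0 0).add ((h.hu x hx).pd2 1 1)
  have hlapi : IntegrableOn (lap u) V := (hlapc.integrableOn_compact h.cpt).mono_set subset_closure
  have hlapW : IntegrableOn (lap u) (V \ {x₀}) := hlapi.mono_set sdiff_subset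
  set Q := ∫ x in V \ {x₀}, lap u x with hQ
  have key : ∀ κ : ℝ, 0 < κ → ∫⁻ x in V, ENNReal.ofReal (g x * lap u x) ≤
      ENNReal.ofReal (R ^ 2 / 2 + κ * (2 * M + 2 * Q)) := fun κ hκ => by
    obtain ⟨hi, hle⟩ := h.integral_trunc_lap_le hlam hR hVR hκ (δ := ε / 2) (by positivity)
      χ.contDiff χ.hasCompactSupport (by rw [χ.tsupport_eq]; exact hεV) (fun x => χ.le_one)
      fun x hx => χ.one_of_mem_closedBall (Metric.ball_subset_closedBall hx)
    have hi2 := hi.add (hlapW.const_mul (2 * κ))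
    rw [← setLIntegral_congr (ae_restrict V x₀)]
    calc ∫⁻ x in V \ {x₀}, ENNReal.ofReal (g x * lap u x)
        ≤ ∫⁻ x in V \ {x₀}, ENNReal.ofReal (trunc κ (g x) * lap u x + 2 * κ * lap u x) := by
          refine setLIntegral_mono' h.open_punct.measurableSet fun x hx => ?_
          refine ENNReal.ofReal_le_ofReal ?_
          rw [← add_mul]
          exact mul_le_mul_of_nonneg_right (by linarith [le_trunc hκ (g x)]) (h.lap_pos hx.1).le
      _ = ENNReal.ofReal (∫ x in V \ {x₀}, (trunc κ (g x) * lap u x + 2 * κ * lap u x)) := by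
          refine (ofReal_integral_eq_lintegral_ofReal hi2 ?_).symm
          refine (ae_restrict_iff' h.open_punct.measurableSet).2 (.of_forall fun x hx => ?_)
          have := (h.lap_pos hx.1).le
          exact add_nonneg (mul_nonneg (trunc_nonneg hκ _) this) (by positivity)
      _ ≤ _ := by
          refine ENNReal.ofReal_le_ofReal ?_
          rw [integral_add hi (hlapW.const_mul (2 * κ)), integral_const_mul]
          linarith
  have ht : Filter.Tendsto (fun κ : ℝ => ENNReal.ofReal (R ^ 2 / 2 + κ * (2 * M + 2 * Q)))
      (nhdsWithin 0 (Ioi 0)) (nhds (ENNReal.ofReal (R ^ 2 / 2))) := by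
    have : Filter.Tendsto (fun κ : ℝ => R ^ 2 / 2 + κ * (2 * M + 2 * Q)) (nhds 0)
        (nhds (R ^ 2 / 2 + 0 * (2 * M + 2 * Q))) :=
      Continuous.tendsto (by fun_prop) 0
    rw [zero_mul, add_zero] at this
    exact (ENNReal.tendsto_ofReal this).mono_left nhdsWithin_le_nhds
  exact ge_of_tendsto ht (by filter_upwards [self_mem_nhdsWithin] with κ hκ using key κ hκ)

end Pole

end GreenLp

namespace GreenLp
open Set

/-- The bounded concave function `k (1 - exp (-(1 + t)^{3/4} / k))`. -/
def conc (k t : ℝ) : ℝ := k * (1 - Real.exp (-((1 + t) ^ (3 / 4 : ℝ) / k)))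

/-- The derivative of `conc k`. -/
def conc' (k t : ℝ) : ℝ :=
  Real.exp (-((1 + t) ^ (3 / 4 : ℝ) / k)) * (3 / 4 * (1 + t) ^ (-(1 / 4) : ℝ))

/-- The second derivative of `conc k`. -/
def conc'' (k t : ℝ) : ℝ := -(Real.exp (-((1 + t) ^ (3 / 4 : ℝ) / k)) *
  (3 / 16 * (1 + t) ^ (-(5 / 4) : ℝ) + (3 / 4 * (1 + t) ^ (-(1 / 4) : ℝ)) ^ 2 / k))

variable {κ t : ℝ}

theorem hasDerivAt_one_add_rpow (ht : 0 < t) (q : ℝ) :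
    HasDerivAt (fun t : ℝ => (1 + t) ^ q) (q * (1 + t) ^ (q - 1)) t :=
  (((hasDerivAt_id' t).const_add 1).rpow_const (p := q) (Or.inl (by positivity))).congr_deriv
    (by ring)

theorem hasDerivAt_exp_one_add (ht : 0 < t) :
    HasDerivAt (fun t : ℝ => Real.exp (-((1 + t) ^ (3 / 4 : ℝ) / κ)))
      (-(Real.exp (-((1 + t) ^ (3 / 4 : ℝ) / κ)) * (3 / 4 * (1 + t) ^ (-(1 / 4) : ℝ) / κ))) t := by
  refine ((hasDerivAt_one_add_rpow ht (3 / 4)).div_const κ).fun_neg.exp.congr_deriv ?_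
  norm_num

theorem hasDerivAt_conc (hκ : 0 < κ) (ht : 0 < t) : HasDerivAt (conc κ) (conc' κ t) t := by
  refine (((hasDerivAt_exp_one_add (κ := κ) ht).const_sub 1).const_mul κ).congr_deriv ?_
  rw [conc']
  field_simp

theorem hasDerivAt_conc' (ht : 0 < t) : HasDerivAt (conc' κ) (conc'' κ t) t := by
  refine ((hasDerivAt_exp_one_add (κ := κ) ht).mul
    ((hasDerivAt_one_add_rpow ht (-(1 / 4))).const_mul (3 / 4))).congr_deriv ?_
  rw [conc'']
  norm_num
  ring

theorem contDiffAt_conc (ht : 0 < t) : ContDiffAt ℝ (⊤ : ℕ∞) (conc κ) t := by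
  have h1 : ContDiffAt ℝ (⊤ : ℕ∞) (fun t : ℝ => (1 + t) ^ (3 / 4 : ℝ)) t :=
    (contDiffAt_const.add contDiffAt_id).rpow_const_of_ne (by simp; positivity)
  exact contDiffAt_const.mul (contDiffAt_const.sub (h1.div_const κ).neg.exp)

theorem conc_nonneg (hκ : 0 < κ) (ht : 0 < t) : 0 ≤ conc κ t := by
  have : Real.exp (-((1 + t) ^ (3 / 4 : ℝ) / κ)) ≤ 1 :=
    Real.exp_le_one_iff.2 (neg_nonpos.2 (by positivity))
  exact mul_nonneg hκ.le (by linarith)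

theorem conc_le (hκ : 0 < κ) : conc κ t ≤ κ := by
  have := Real.exp_pos (-((1 + t) ^ (3 / 4 : ℝ) / κ))
  rw [conc]
  nlinarith

theorem conc_le_one_add (hκ : 0 < κ) (ht : 0 < t) : conc κ t ≤ 1 + t := by
  have h1 := Real.add_one_le_exp (-((1 + t) ^ (3 / 4 : ℝ) / κ))
  have h2 : conc κ t ≤ κ * ((1 + t) ^ (3 / 4 : ℝ) / κ) :=
    mul_le_mul_of_nonneg_left (by linarith) hκ.le
  rw [mul_div_cancel₀ _ hκ.ne'] at h2
  refine h2.trans ?_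
  calc (1 + t) ^ (3 / 4 : ℝ) ≤ (1 + t) ^ (1 : ℝ) :=
        Real.rpow_le_rpow_of_exponent_le (by linarith) (by norm_num)
    _ = 1 + t := Real.rpow_one _

theorem le_neg_conc'' (hκ : 0 < κ) (ht : 0 < t) :
    Real.exp (-((1 + t) ^ (3 / 4 : ℝ) / κ)) * (3 / 16 * (1 + t) ^ (-(5 / 4) : ℝ)) ≤
      -conc'' κ t := by
  rw [conc'', neg_neg]
  refine mul_le_mul_of_nonneg_left ?_ (Real.exp_nonneg _)
  have : 0 ≤ (3 / 4 * (1 + t) ^ (-(1 / 4) : ℝ)) ^ 2 / κ := by positivity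
  linarith

theorem neg_conc''_pos (hκ : 0 < κ) (ht : 0 < t) : 0 < -conc'' κ t :=
  lt_of_lt_of_le (by positivity) (le_neg_conc'' hκ ht)

theorem conc'_sq_le (hκ : 0 < κ) (ht : 0 < t) : conc' κ t ^ 2 ≤ κ * -conc'' κ t := by
  have he := Real.exp_pos (-((1 + t) ^ (3 / 4 : ℝ) / κ))
  have he1 : Real.exp (-((1 + t) ^ (3 / 4 : ℝ) / κ)) ≤ 1 :=
    Real.exp_le_one_iff.2 (neg_nonpos.2 (by positivity))
  rw [conc'', conc', neg_neg]
  set e := Real.exp (-((1 + t) ^ (3 / 4 : ℝ) / κ))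
  set F := 3 / 4 * (1 + t) ^ (-(1 / 4) : ℝ)
  have hG : 0 ≤ 3 / 16 * (1 + t) ^ (-(5 / 4) : ℝ) := by positivity
  set G := 3 / 16 * (1 + t) ^ (-(5 / 4) : ℝ)
  have : κ * (e * (G + F ^ 2 / κ)) = κ * e * G + e * F ^ 2 := by field_simp
  rw [this, mul_pow]
  have h1 : e ^ 2 * F ^ 2 ≤ e * F ^ 2 := mul_le_mul_of_nonneg_right (by nlinarith) (sq_nonneg _)
  have h2 : 0 ≤ κ * e * G := by positivity
  linarith

end GreenLp

namespace GreenLp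
open Set

theorem deriv_smoothTransition_of_neg {s : ℝ} (hs : s < 0) : deriv Real.smoothTransition s = 0 := by
  have : Real.smoothTransition =ᶠ[nhds s] fun _ => 0 := by
    filter_upwards [Iio_mem_nhds hs] with t ht using Real.smoothTransition.zero_of_nonpos ht.le
  rw [this.deriv_eq, deriv_const]

theorem deriv_smoothTransition_of_one_lt {s : ℝ} (hs : 1 < s) :
    deriv Real.smoothTransition s = 0 := by
  have : Real.smoothTransition =ᶠ[nhds s] fun _ => 1 := by
    filter_upwards [Ioi_mem_nhds hs] with t ht using Real.smoothTransition.one_of_one_le ht.le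
  rw [this.deriv_eq, deriv_const]

theorem exists_deriv_smoothTransition_sq_le :
    ∃ c : ℝ, 0 < c ∧ ∀ s, deriv Real.smoothTransition s ^ 2 ≤ c := by
  have hc : Continuous (deriv Real.smoothTransition) :=
    (Real.smoothTransition.contDiff (n := 1)).continuous_deriv (by simp)
  obtain ⟨M, hM⟩ := (isCompact_Icc (a := (0 : ℝ)) (b := 1)).bddAbove_image (hc.pow 2).continuousOn
  refine ⟨max M 1, by positivity, fun s => ?_⟩
  by_cases hs : s ∈ Icc (0 : ℝ) 1
  · exact (hM (mem_image_of_mem _ hs)).trans (le_max_left _ _)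
  · have : deriv Real.smoothTransition s = 0 := by
      rw [mem_Icc, not_and_or, not_le, not_le] at hs
      rcases hs with h | h
      · exact deriv_smoothTransition_of_neg h
      · exact deriv_smoothTransition_of_one_lt h
    rw [this]
    simp

/-- The squared distance to `x₀`. -/
def sqd (x₀ x : E 2) : ℝ := (x 0 - x₀ 0) ^ 2 + (x 1 - x₀ 1) ^ 2

theorem sqd_eq (x₀ x : E 2) : sqd x₀ x = dist x x₀ ^ 2 := by
  rw [EuclideanSpace.dist_eq, Real.sq_sqrt (by positivity), Fin.sum_univ_two, sqd,
    Real.dist_eq, Real.dist_eq, sq_abs, sq_abs]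

theorem sm_sqd (x₀ x : E 2) : Sm (sqd x₀) x :=
  ((sm_coord 0 (x₀ 0) x).pow 2).add ((sm_coord 1 (x₀ 1) x).pow 2)

theorem pd_sqd (x₀ x : E 2) (i : Fin 2) : pd (sqd x₀) x i = 2 * (x i - x₀ i) := by
  have h : ∀ j, pd (fun y : E 2 => (y j - x₀ j) ^ 2) x i =
      2 * (x j - x₀ j) * if j = i then 1 else 0 := fun j => by
    rw [pd_comp (T := fun t => t ^ 2) (T' := 2 * (x j - x₀ j))
      ((hasDerivAt_pow 2 _).congr_deriv (by simp)) (sm_coord j _ x).differentiableAt, pd_coord]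
  have := pd_add (Sm.differentiableAt ((sm_coord 0 (x₀ 0) x).pow 2))
    (Sm.differentiableAt ((sm_coord 1 (x₀ 1) x).pow 2)) i
  rw [h, h] at this
  refine Eq.trans this ?_
  fin_cases i <;> simp

/-- The logarithmic cutoff vanishing inside radius `exp (-2 l)` and equal to one outside
radius `exp (-l)`. -/
def logCut (x₀ : E 2) (l : ℝ) (x : E 2) : ℝ :=
  Real.smoothTransition (2 + Real.log (sqd x₀ x) / (2 * l))

variable {x₀ x : E 2} {l : ℝ}

theorem sqd_pos (hx : x ≠ x₀) : 0 < sqd x₀ x := by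
  rw [sqd_eq]
  have := dist_pos.2 hx
  positivity

theorem logCut_arg (hl : 0 < l) (x₀ x : E 2) :
    2 + Real.log (sqd x₀ x) / (2 * l) = 2 + Real.log (dist x x₀) / l := by
  rw [sqd_eq, Real.log_pow]
  field_simp
  ring

theorem sm_logCut (hx : x ≠ x₀) : Sm (logCut x₀ l) x :=
  Real.smoothTransition.contDiffAt.comp x
    (contDiffAt_const.add (((sm_sqd x₀ x).log (sqd_pos hx).ne').div_const _))

theorem pd_logCut (hx : x ≠ x₀) (i : Fin 2) : pd (logCut x₀ l) x i =
    deriv Real.smoothTransition (2 + Real.log (sqd x₀ x) / (2 * l)) * (1 / (sqd x₀ x * l)) *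
      (x i - x₀ i) := by
  have h0 := (sqd_pos hx).ne'
  have h := (hasDerivAt_smoothTransition (2 + Real.log (sqd x₀ x) / (2 * l))).comp (sqd x₀ x)
    (((Real.hasDerivAt_log h0).div_const (2 * l)).const_add 2)
  have := pd_comp h (sm_sqd x₀ x).differentiableAt i
  refine Eq.trans this ?_
  rw [pd_sqd]
  by_cases hl : l = 0
  · simp [hl]
  · field_simp

theorem grad_logCut (hl : 0 < l) (hx : x ≠ x₀) :
    pd (logCut x₀ l) x 0 ^ 2 + pd (logCut x₀ l) x 1 ^ 2 =
      deriv Real.smoothTransition (2 + Real.log (dist x x₀) / l) ^ 2 / (dist x x₀ ^ 2 * l ^ 2) := by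
  have h0 := (sqd_pos hx).ne'
  have : ∀ a : ℝ, (a * (1 / (sqd x₀ x * l)) * (x 0 - x₀ 0)) ^ 2 +
      (a * (1 / (sqd x₀ x * l)) * (x 1 - x₀ 1)) ^ 2 = a ^ 2 / (sqd x₀ x * l ^ 2) := fun a => by
    have : ∀ p q : ℝ, (a * (1 / (sqd x₀ x * l)) * p) ^ 2 + (a * (1 / (sqd x₀ x * l)) * q) ^ 2 =
      (p ^ 2 + q ^ 2) * (a ^ 2 / (sqd x₀ x ^ 2 * l ^ 2)) := fun p q => by field_simp
    rw [this]
    change sqd x₀ x * _ = _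
    field_simp
  rw [pd_logCut hx, pd_logCut hx, this, logCut_arg hl, sqd_eq]

theorem lintegral_radial_le {l c : ℝ} (hl : 0 < l) (hc : 0 ≤ c) (x₀ : E 2) :
    ∫⁻ x : E 2, ENNReal.ofReal ((Icc (Real.exp (-(2 * l))) (Real.exp (-l))).indicator
      (fun y => c / (y ^ 2 * l ^ 2)) (dist x x₀)) ≤
      ENNReal.ofReal (2 * volume.real (Metric.ball (0 : E 2) 1) * (c / l)) := by
  set f : ℝ → ℝ := (Icc (Real.exp (-(2 * l))) (Real.exp (-l))).indicator
      (fun y => c / (y ^ 2 * l ^ 2)) with hf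
  have hfm : Measurable f := (by fun_prop : Measurable fun y : ℝ => c / (y ^ 2 * l ^ 2)).indicator
    measurableSet_Icc
  have hf0 : ∀ y, 0 ≤ f y := fun y => indicator_nonneg (fun y _ => by positivity) y
  have he : Real.exp (-(2 * l)) ≤ Real.exp (-l) := Real.exp_le_exp.2 (by linarith)
  have e1 : ∫⁻ x : E 2, ENNReal.ofReal (f (dist x x₀)) = ∫⁻ x : E 2, ENNReal.ofReal (f ‖x‖) := by
    rw [← lintegral_sub_right_eq_self (fun x : E 2 => ENNReal.ofReal (f ‖x‖)) x₀]
    simp only [dist_eq_norm]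
  have hInt : Integrable fun x : E 2 => f ‖x‖ := by
    refine Integrable.mono' (g := (Metric.closedBall (0 : E 2) (Real.exp (-l))).indicator
      fun _ => c / (Real.exp (-(2 * l)) ^ 2 * l ^ 2)) ?_ (hfm.comp measurable_norm).aestronglyMeasurable ?_
    · exact (integrable_indicator_iff Metric.isClosed_closedBall.measurableSet).2
        (integrableOn_const (Metric.isBounded_closedBall.measure_lt_top).ne)
    · refine .of_forall fun x => ?_
      rw [Real.norm_of_nonneg (hf0 _)]
      by_cases hx : ‖x‖ ∈ Icc (Real.exp (-(2 * l))) (Real.exp (-l))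
      · rw [hf, indicator_of_mem hx, indicator_of_mem (by simpa using hx.2)]
        have := hx.1
        gcongr
      · rw [hf, indicator_of_notMem hx]
        exact indicator_nonneg (fun _ _ => by positivity) x
  rw [e1, ← ofReal_integral_eq_lintegral_ofReal hInt (.of_forall fun x => hf0 _),
    integral_fun_norm_addHaar]
  refine ENNReal.ofReal_le_ofReal (le_of_eq ?_)
  have hfin : Module.finrank ℝ (E 2) = 2 := by simp
  rw [hfin]
  have e2 : ∀ y ∈ Ioi (0 : ℝ), y ^ (2 - 1) • f y =
      (Icc (Real.exp (-(2 * l))) (Real.exp (-l))).indicator (fun y => c / l ^ 2 * y⁻¹) y := by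
    intro y hy
    by_cases h : y ∈ Icc (Real.exp (-(2 * l))) (Real.exp (-l))
    · rw [hf, indicator_of_mem h, indicator_of_mem h]
      have : y ≠ 0 := ne_of_gt hy
      simp
      field_simp
    · rw [hf, indicator_of_notMem h, indicator_of_notMem h, smul_zero]
  have hsub : Icc (Real.exp (-(2 * l))) (Real.exp (-l)) ⊆ Ioi 0 := fun y hy =>
    lt_of_lt_of_le (Real.exp_pos _) hy.1
  rw [setIntegral_congr_fun measurableSet_Ioi e2, setIntegral_indicator measurableSet_Icc,
    inter_eq_right.2 hsub, integral_Icc_eq_integral_Ioc, ← intervalIntegral.integral_of_le he,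
    intervalIntegral.integral_const_mul, integral_inv_of_pos (Real.exp_pos _) (Real.exp_pos _),
    ← Real.exp_sub, Real.log_exp]
  simp only [nsmul_eq_mul, smul_eq_mul]
  field_simp
  norm_num
  ring

/-- Points have zero capacity in the plane. -/
theorem exists_log_cutoff (x₀ : E 2) {ε η : ℝ} (hε : 0 < ε) (hη : 0 < η) :
    ∃ (τ : E 2 → ℝ) (δ : ℝ), 0 < δ ∧ (∀ x ≠ x₀, Sm τ x) ∧ (∀ x, 0 ≤ τ x ∧ τ x ≤ 1) ∧
      (∀ x ∈ Metric.ball x₀ δ \ {x₀}, τ x = 0) ∧ (∀ x, ε ≤ dist x x₀ → τ x = 1) ∧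
      ∫⁻ x in {x₀}ᶜ, ENNReal.ofReal (pd τ x 0 ^ 2 + pd τ x 1 ^ 2) ≤ ENNReal.ofReal η := by
  obtain ⟨c, hc, hcs⟩ := exists_deriv_smoothTransition_sq_le
  set A := 2 * volume.real (Metric.ball (0 : E 2) 1) * c with hA
  have hA0 : 0 ≤ A := by positivity
  obtain ⟨l, hl⟩ : ∃ l, l = max (max (-Real.log ε) (A / η)) 1 := ⟨_, rfl⟩
  have hl1 : 1 ≤ l := hl ▸ le_max_right _ _
  have hl0 : 0 < l := by linarith
  have hlε : -Real.log ε ≤ l := hl ▸ (le_max_left _ _).trans (le_max_left _ _)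
  have hlη : A / η ≤ l := hl ▸ (le_max_right _ _).trans (le_max_left _ _)
  have hexp : Real.exp (-l) ≤ ε := by
    rw [← Real.exp_log hε]
    exact Real.exp_le_exp.2 (by linarith)
  refine ⟨logCut x₀ l, Real.exp (-(2 * l)), Real.exp_pos _, fun x hx => sm_logCut hx,
    fun x => ⟨Real.smoothTransition.nonneg _, Real.smoothTransition.le_one _⟩, fun x hx => ?_,
    fun x hx => ?_, ?_⟩
  · rw [logCut, logCut_arg hl0]
    refine Real.smoothTransition.zero_of_nonpos ?_
    have h1 : Real.log (dist x x₀) ≤ -(2 * l) := by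
      rw [← Real.log_exp (-(2 * l))]
      exact Real.log_le_log (dist_pos.2 hx.2) (Metric.mem_ball.1 hx.1).le
    have := div_le_div_of_nonneg_right h1 hl0.le
    have h2 : -(2 * l) / l = -2 := by field_simp
    linarith
  · rw [logCut, logCut_arg hl0]
    refine Real.smoothTransition.one_of_one_le ?_
    have h1 : -l ≤ Real.log (dist x x₀) := by
      rw [← Real.log_exp (-l)]
      exact Real.log_le_log (Real.exp_pos _) (hexp.trans hx)
    have := div_le_div_of_nonneg_right h1 hl0.le
    have h2 : -l / l = -1 := by field_simp
    linarith
  · calc ∫⁻ x in {x₀}ᶜ, ENNReal.ofReal (pd (logCut x₀ l) x 0 ^ 2 + pd (logCut x₀ l) x 1 ^ 2)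
        ≤ ∫⁻ x in {x₀}ᶜ, ENNReal.ofReal ((Icc (Real.exp (-(2 * l))) (Real.exp (-l))).indicator
          (fun y => c / (y ^ 2 * l ^ 2)) (dist x x₀)) := by
          refine setLIntegral_mono' (measurableSet_singleton _).compl fun x hx => ?_
          refine ENNReal.ofReal_le_ofReal ?_
          have hxd : 0 < dist x x₀ := dist_pos.2 hx
          rw [grad_logCut hl0 hx]
          by_cases hm : dist x x₀ ∈ Icc (Real.exp (-(2 * l))) (Real.exp (-l))
          · rw [indicator_of_mem hm]
            exact div_le_div_of_nonneg_right (hcs _) (by positivity)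
          · rw [indicator_of_notMem hm]
            refine le_of_eq ?_
            rw [mem_Icc, not_and_or, not_le, not_le] at hm
            have : deriv Real.smoothTransition (2 + Real.log (dist x x₀) / l) = 0 := by
              rcases hm with h | h
              · refine deriv_smoothTransition_of_neg ?_
                have h1 := Real.log_lt_log hxd h
                rw [Real.log_exp] at h1
                have := div_lt_div_of_pos_right h1 hl0
                have h2 : -(2 * l) / l = -2 := by field_simp
                linarith
              · refine deriv_smoothTransition_of_one_lt ?_
                have h1 := Real.log_lt_log (Real.exp_pos _) h
                rw [Real.log_exp] at h1
                have := div_lt_div_of_pos_right h1 hl0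
                have h2 : -l / l = -1 := by field_simp
                linarith
            rw [this]
            simp
      _ ≤ ∫⁻ x, ENNReal.ofReal ((Icc (Real.exp (-(2 * l))) (Real.exp (-l))).indicator
          (fun y => c / (y ^ 2 * l ^ 2)) (dist x x₀)) := setLIntegral_le_lintegral _ _
      _ ≤ _ := lintegral_radial_le hl0 hc.le x₀
      _ ≤ _ := by
          refine ENNReal.ofReal_le_ofReal ?_
          rw [div_le_iff₀ hη] at hlη
          rw [← mul_div_assoc, div_le_iff₀ hl0]
          linarith

end GreenLp

namespace GreenLp
open Set

variable {lam Lam : ℝ} {V : Set (E 2)} {u : E 2 → ℝ} {x₀ : E 2} {g f k : E 2 → ℝ} {x : E 2}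

theorem integral_le_of_lintegral_le {α : Type*} [MeasurableSpace α] {μ : Measure α} {f G : α → ℝ}
    {A : ℝ} (hA : 0 ≤ A) (hf : Integrable f μ) (hfG : ∀ᵐ x ∂μ, f x ≤ G x)
    (hG : ∫⁻ x, ENNReal.ofReal (G x) ∂μ ≤ ENNReal.ofReal A) : ∫ x, f x ∂μ ≤ A := by
  rw [integral_eq_lintegral_pos_part_sub_lintegral_neg_part hf]
  have h1 : ∫⁻ x, ENNReal.ofReal (f x) ∂μ ≤ ENNReal.ofReal A :=
    (lintegral_mono_ae (hfG.mono fun x hx => ENNReal.ofReal_le_ofReal hx)).trans hG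
  have h2 := ENNReal.toReal_mono ENNReal.ofReal_ne_top h1
  rw [ENNReal.toReal_ofReal hA] at h2
  have h3 : 0 ≤ (∫⁻ x, ENNReal.ofReal (-f x) ∂μ).toReal := ENNReal.toReal_nonneg
  linarith

/-- The radial truncation `ramp ((ρ - v) / s)` of a section. -/
def secCut (v : E 2 → ℝ) (ρ s : ℝ) (x : E 2) : ℝ := ramp ((ρ - v x) / s)

section secCut
variable {v : E 2 → ℝ} {ρ s : ℝ}

theorem sm_secCut (hv : Sm v x) : Sm (secCut v ρ s) x :=
  contDiff_ramp.contDiffAt.comp x ((contDiffAt_const.sub hv).div_const s)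

theorem hasDerivAt_secCut (t : ℝ) : HasDerivAt (fun t => ramp ((ρ - t) / s))
    (-(Real.smoothTransition ((ρ - t) / s) / s)) t := by
  have h := (hasDerivAt_ramp ((ρ - t) / s)).comp t (((hasDerivAt_id' t).const_sub ρ).div_const s)
  refine HasDerivAt.congr_deriv h ?_
  ring

theorem hasDerivAt_secCut' (t : ℝ) : HasDerivAt (fun t => -(Real.smoothTransition ((ρ - t) / s) / s))
    (deriv Real.smoothTransition ((ρ - t) / s) / s ^ 2) t := by
  have h := (((hasDerivAt_smoothTransition ((ρ - t) / s)).comp t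
    (((hasDerivAt_id' t).const_sub ρ).div_const s)).div_const s).fun_neg
  refine HasDerivAt.congr_deriv h ?_
  ring

theorem pd_secCut (hv : Sm v x) (i : Fin 2) : pd (secCut v ρ s) x i =
    -(Real.smoothTransition ((ρ - v x) / s) / s) * pd v x i :=
  pd_comp (hasDerivAt_secCut _) hv.differentiableAt i

theorem LL_secCut (hv : Sm v x) : LL u (secCut v ρ s) x =
    -(Real.smoothTransition ((ρ - v x) / s) / s) * LL u v x +
      deriv Real.smoothTransition ((ρ - v x) / s) / s ^ 2 * BB u v v x :=
  LL_comp (.of_forall hasDerivAt_secCut) (hasDerivAt_secCut' _) hv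

end secCut

namespace Pole

theorem quad_nonneg (h : Pole lam Lam V u x₀ g) (hlam : 0 ≤ lam) (hx : x ∈ V) (p q : ℝ) :
    0 ≤ pd2 u x 1 1 * p ^ 2 - 2 * pd2 u x 0 1 * p * q + pd2 u x 0 0 * q ^ 2 := by
  have h0 := h.p0 x hx
  have h1 := h.det_ge x hx
  refine nonneg_of_mul_nonneg_right (a := pd2 u x 0 0) ?_ h0
  nlinarith [sq_nonneg (pd2 u x 0 0 * q - pd2 u x 0 1 * p),
    mul_nonneg (hlam.trans h1) (sq_nonneg p)]

theorem BB_cauchy (h : Pole lam Lam V u x₀ g) (hlam : 0 ≤ lam) (hx : x ∈ V) (s t : ℝ) :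
    2 * (s * t) * BB u f k x ≤ s ^ 2 * BB u f f x + t ^ 2 * BB u k k x := by
  have := h.quad_nonneg hlam hx (s * pd f x 0 - t * pd k x 0) (s * pd f x 1 - t * pd k x 1)
  rw [BB_eq, BB_eq, BB_eq, pd2_symm (h.smu hx).two 1 0]
  nlinarith

theorem BB_le_lap (h : Pole lam Lam V u x₀ g) (hlam : 0 ≤ lam) (hx : x ∈ V) :
    BB u f f x ≤ lap u x * (pd f x 0 ^ 2 + pd f x 1 ^ 2) := by
  have := h.quad_nonneg hlam hx (pd f x 1) (-pd f x 0)
  rw [BB_eq, pd2_symm (h.smu hx).two 1 0, lap]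
  nlinarith

/-- The integrated form of `-L(T(g))` tested against `τ² φ`. -/
theorem energy_identity (h : Pole lam Lam V u x₀ g) {K₀ : Set (E 2)} (hK₀ : IsCompact K₀)
    (hK₀V : K₀ ⊆ V) {φ τ : E 2 → ℝ} {κ δ : ℝ} (hκ : 0 < κ) (hδ : 0 < δ)
    (hφ : ∀ x ∈ V, Sm φ x) (hφ0 : ∀ x ∈ V \ K₀, φ x = 0) (hτ : ∀ x ≠ x₀, Sm τ x)
    (hτ0 : ∀ x ∈ Metric.ball x₀ δ \ {x₀}, τ x = 0) :
    IntegrableOn (fun x => τ x ^ 2 * φ x * -conc'' κ (g x) * BB u g g x) (V \ {x₀}) ∧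
    ∃ D : E 2 → ℝ, IntegrableOn D (V \ {x₀}) ∧ ∫ x in V \ {x₀}, D x = 0 ∧ ∀ x ∈ V \ {x₀},
      τ x ^ 2 * φ x * -conc'' κ (g x) * BB u g g x = D x - τ x ^ 2 * conc κ (g x) * LL u φ x -
        2 * (τ x * conc κ (g x)) * BB u τ φ x + 2 * (τ x * φ x * conc' κ (g x)) * BB u τ g x := by
  set W := V \ {x₀} with hW
  have hWo := h.open_punct
  set K := K₀ \ Metric.ball x₀ δ with hKd
  have hK : IsCompact K := hK₀.diff Metric.isOpen_ball
  have hKW : K ⊆ W := fun x hx => ⟨hK₀V hx.1, fun hx' => hx.2 (by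
    rw [mem_singleton_iff.1 hx']; exact Metric.mem_ball_self hδ)⟩
  have hoff : ∀ x ∈ W \ K, τ x = 0 ∨ x ∈ V \ K₀ := fun x hx => by
    by_cases hb : x ∈ Metric.ball x₀ δ
    · exact Or.inl (hτ0 x ⟨hb, hx.1.2⟩)
    · exact Or.inr ⟨hx.1.1, fun hk => hx.2 ⟨hk, hb⟩⟩
  have huW : ∀ x ∈ W, Sm u x := fun x hx => h.smu hx.1
  have hgW : ∀ x ∈ W, Sm g x := fun x hx => h.smg hx
  have hτW : ∀ x ∈ W, Sm τ x := fun x hx => hτ x hx.2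
  have hφW : ∀ x ∈ W, Sm φ x := fun x hx => hφ x hx.1
  have hTW : ∀ x ∈ W, Sm (fun x => conc κ (g x)) x := fun x hx =>
    (contDiffAt_conc (h.pos hx)).comp x (hgW x hx)
  have hτ2 : ∀ x ∈ W, Sm (fun x => τ x * τ x) x := fun x hx => (hτW x hx).mul (hτW x hx)
  have hVK : IsOpen (V \ K₀) := h.isOpen.sdiff hK₀.isClosed
  have i1 := integral_div (u := u) (f := fun x => conc κ (g x)) (k := fun x => τ x * τ x * φ x)
    hWo hK hKW huW hTW (fun x hx => (hτ2 x hx).mul (hφW x hx)) fun x hx => by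
      left
      rcases hoff x hx with h | h
      · simp [h]
      · simp [hφ0 x h]
  have i2 := integral_div (u := u) (f := φ) (k := fun x => τ x * τ x * conc κ (g x))
    hWo hK hKW huW hφW (fun x hx => (hτ2 x hx).mul (hTW x hx)) fun x hx => by
      rcases hoff x hx with h | h
      · left; simp [h]
      · right
        exact fun i => pd_eq_zero_of_eqOn hVK h hφ0 i
  have hD1 : ∀ x ∈ W, HasDerivAt (conc κ) (conc' κ (g x)) (g x) := fun x hx =>
    hasDerivAt_conc hκ (h.pos hx)
  have hLT : ∀ x ∈ W, LL u (fun x => conc κ (g x)) x = conc'' κ (g x) * BB u g g x := fun x hx => by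
    have he : ∀ᶠ t in nhds (g x), HasDerivAt (conc κ) (conc' κ t) t := by
      filter_upwards [Ioi_mem_nhds (h.pos hx)] with t ht using hasDerivAt_conc hκ ht
    rw [LL_comp he (hasDerivAt_conc' (h.pos hx)) (hgW x hx), h.LLg hx]
    ring
  constructor
  · refine integrableOn_of_zero_off hWo hK hKW ?_ fun x hx => ?_
    · refine ContinuousOn.congr (f := fun x => -(τ x * τ x * φ x *
        LL u (fun x => conc κ (g x)) x)) ?_ fun x hx => by
          simp only [hLT x hx]
          ring
      exact (((Sm.continuousOn hτ2).mul (Sm.continuousOn hφW)).mul (continuousOn_LL huW hTW)).neg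
    · rcases hoff x hx with h | h
      · simp [h]
      · simp [hφ0 x h]
  · refine ⟨_, i2.1.sub i1.1, ?_, fun x hx => ?_⟩
    · have := integral_sub i2.1 i1.1
      rw [i1.2, i2.2, sub_zero] at this
      exact this
    · have dτ := (hτW x hx).differentiableAt
      have dφ := (hφW x hx).differentiableAt
      have dT := (hTW x hx).differentiableAt
      have dg := (hgW x hx).differentiableAt
      simp only [Pi.sub_apply]
      rw [hLT x hx, BB_mul_left (dτ.fun_mul dτ) dφ, BB_mul_left (dτ.fun_mul dτ) dT, BB_mul_left dτ dτ,
        BB_mul_left dτ dτ, BB_comp_left (hD1 x hx) dg, BB_comp_right (hD1 x hx) dg,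
        BB_comp_right (hD1 x hx) dg, BB_comm (huW x hx) (f := φ)]
      ring

end Pole

end GreenLp

namespace GreenLp
open Set

variable {lam Lam : ℝ} {V : Set (E 2)} {u : E 2 → ℝ} {x₀ : E 2} {g f k : E 2 → ℝ} {x : E 2}

theorem energy_arith {t T T₁ w κ φ P Qg Qφ X Y L D m : ℝ} (hκ : 0 ≤ κ) (hw : 0 < w)
    (hφ : 0 ≤ φ) (ht0 : 0 ≤ t) (ht1 : t ≤ 1) (hT0 : 0 ≤ T) (hTκ : T ≤ κ)
    (hT₁ : T₁ ^ 2 ≤ κ * w) (hP : 0 ≤ P) (hQφ : 0 ≤ Qφ)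
    (h1 : 2 * (-m⁻¹ * m) * X ≤ (-m⁻¹) ^ 2 * P + m ^ 2 * Qφ) (hm : 0 < m)
    (h2 : 2 * (2 * T₁ * (t * w)) * Y ≤ (2 * T₁) ^ 2 * P + (t * w) ^ 2 * Qg)
    (hD : t ^ 2 * φ * w * Qg = D - t ^ 2 * T * L - 2 * (t * T) * X + 2 * (t * φ * T₁) * Y) :
    2⁻¹ * (t ^ 2 * φ * w * Qg) - D ≤
      t ^ 2 * T * -L + κ * (m⁻¹ ^ 2 * P + m ^ 2 * Qφ) + 2 * κ * φ * P := by
  have a1 : -2 * X ≤ m⁻¹ ^ 2 * P + m ^ 2 * Qφ := by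
    have : -m⁻¹ * m = -1 := by field_simp
    rw [this] at h1
    nlinarith
  have a2 : t * T * (-2 * X) ≤ κ * (m⁻¹ ^ 2 * P + m ^ 2 * Qφ) := by
    have b1 : t * T ≤ κ := (mul_le_of_le_one_left hT0 ht1).trans hTκ
    exact (mul_le_mul_of_nonneg_left a1 (mul_nonneg ht0 hT0)).trans
      (mul_le_mul_of_nonneg_right b1 (by positivity))
  have a3 : 2 * t * T₁ * Y ≤ 2 * κ * P + 2⁻¹ * t ^ 2 * w * Qg := by
    refine le_of_mul_le_mul_left ?_ (show 0 < 2 * w by positivity)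
    have : T₁ ^ 2 * P ≤ κ * w * P := mul_le_mul_of_nonneg_right hT₁ hP
    nlinarith
  have a4 := mul_le_mul_of_nonneg_left a3 hφ
  nlinarith

namespace Pole

variable {v : E 2 → ℝ} {ρ s Lv A : ℝ}

theorem energy_step (h : Pole lam Lam V u x₀ g) (hlam : 0 ≤ lam) (hs : 0 < s) (hLv0 : 0 ≤ Lv)
    (hA : 0 ≤ A) (hv : ∀ x ∈ V, Sm v x) (hLv : ∀ x ∈ V, LL u v x ≤ Lv)
    (hSc : IsCompact (closure {x ∈ V | v x < ρ})) (hSV : closure {x ∈ V | v x < ρ} ⊆ V)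
    (hgA : ∫⁻ x in {x ∈ V | v x < ρ}, ENNReal.ofReal (1 + g x) ≤ ENNReal.ofReal A)
    {κ ε e : ℝ} (hκ : 0 < κ) (hε : 0 < ε) (he : 0 < e) :
    ∃ τ : E 2 → ℝ, (∀ x ≠ x₀, Sm τ x) ∧ (∀ x, ε ≤ dist x x₀ → τ x = 1) ∧
      ∫⁻ x in V \ {x₀}, ENNReal.ofReal (τ x ^ 2 * secCut v ρ s x * -conc'' κ (g x) * BB u g g x) ≤
        ENNReal.ofReal (2 * (Lv / s * A) + e) := by
  set S := {x ∈ V | v x < ρ} with hS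
  set φ := secCut v ρ s with hφd
  have hVfin : volume V ≠ ⊤ := (h.cpt.measure_lt_top.trans_le' (measure_mono subset_closure)).ne
  have hvo : ContinuousOn v V := Sm.continuousOn hv
  have hSo : IsOpen S := hvo.isOpen_inter_preimage h.isOpen isOpen_Iio
  have hφs : ∀ x ∈ V, Sm φ x := fun x hx => sm_secCut (hv x hx)
  have hφn : ∀ x, 0 ≤ φ x := fun x => ramp_nonneg _
  have hns : ∀ x ∈ V \ S, Real.smoothTransition ((ρ - v x) / s) = 0 := fun x hx => by
    refine Real.smoothTransition.zero_of_nonpos (div_nonpos_of_nonpos_of_nonneg ?_ hs.le)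
    have : ¬ v x < ρ := fun hh => hx.2 ⟨hx.1, hh⟩
    linarith
  have hφ0 : ∀ x ∈ V \ closure S, φ x = 0 := fun x hx => by
    refine ramp_of_nonpos (div_nonpos_of_nonpos_of_nonneg ?_ hs.le)
    have : ¬ v x < ρ := fun hh => hx.2 (subset_closure ⟨hx.1, hh⟩)
    linarith
  have hlapc : ContinuousOn (lap u) (closure V) := Sm.continuousOn fun x hx =>
    ((h.hu x hx).pd2 0 0).add ((h.hu x hx).pd2 1 1)
  obtain ⟨M, hM⟩ := h.cpt.bddAbove_image hlapc
  replace hM : ∀ x ∈ V, lap u x ≤ M := fun x hx => hM (mem_image_of_mem _ (subset_closure hx))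
  have hM0 : 0 ≤ M := (h.lap_pos h.mem).le.trans (hM _ h.mem)
  obtain ⟨Φ', hΦ'⟩ := hSc.bddAbove_image (f := φ) (Sm.continuousOn fun x hx => hφs x (hSV hx))
  obtain ⟨Φ, hΦ0, hΦ⟩ : ∃ Φ, 0 ≤ Φ ∧ ∀ x ∈ V, φ x ≤ Φ := by
    refine ⟨max Φ' 0, le_max_right _ _, fun x hx => ?_⟩
    by_cases hxS : x ∈ closure S
    · exact (hΦ' (mem_image_of_mem _ hxS)).trans (le_max_left _ _)
    · rw [hφ0 x ⟨hx, hxS⟩]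
      exact le_max_right _ _
  obtain ⟨M₂', hM₂'⟩ := hSc.bddAbove_image (f := BB u φ φ) (Sm.continuousOn fun x hx =>
    (h.smu (hSV hx)).BB (hφs x (hSV hx)) (hφs x (hSV hx)))
  obtain ⟨M₂, hM₂0, hM₂⟩ : ∃ M₂, 0 ≤ M₂ ∧ ∀ x ∈ V, BB u φ φ x ≤ M₂ := by
    refine ⟨max M₂' 0, le_max_right _ _, fun x hx => ?_⟩
    by_cases hxS : x ∈ closure S
    · exact (hM₂' (mem_image_of_mem _ hxS)).trans (le_max_left _ _)
    · have : BB u φ φ x = 0 := by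
        have := hns x ⟨hx, fun hh => hxS (subset_closure hh)⟩
        simp [BB_eq, hφd, pd_secCut (hv x hx), this]
      rw [this]
      exact le_max_right _ _
  set vol := volume.real V with hvol
  obtain ⟨m, hm, hm1, hmB⟩ : ∃ m : ℝ, 0 < m ∧ m ≤ 1 ∧ m * (κ * M₂ * vol + 1) ≤ e / 4 := by
    have hB : 0 < κ * M₂ * vol + 1 := by positivity
    refine ⟨min 1 (e / 4 / (κ * M₂ * vol + 1)), by positivity, min_le_left _ _, ?_⟩
    rw [← le_div_iff₀ hB]
    exact min_le_right _ _
  obtain ⟨c₁, hc₁⟩ : ∃ c₁, c₁ = κ * (m⁻¹ ^ 2 + 2 * Φ) * M := ⟨_, rfl⟩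
  have hc₁0 : 0 ≤ c₁ := by rw [hc₁]; positivity
  obtain ⟨τ, δ, hδ, hτs, hτ01, hτ0, hτ1, hτη⟩ := exists_log_cutoff x₀ hε
    (show 0 < e / 4 / (c₁ + 1) by positivity)
  refine ⟨τ, hτs, hτ1, ?_⟩
  obtain ⟨hei, D, hDi, hD0, hDe⟩ := h.energy_identity hSc hSV hκ hδ hφs hφ0 hτs hτ0
  set W := V \ {x₀} with hW
  have hWm : MeasurableSet W := h.open_punct.measurableSet
  set G : E 2 → ℝ := fun x => S.indicator (fun x => Lv / s * (1 + g x)) x +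
    c₁ * (pd τ x 0 ^ 2 + pd τ x 1 ^ 2) + m ^ 2 * κ * M₂ with hG
  have hpt : ∀ x ∈ W, 2⁻¹ * (τ x ^ 2 * φ x * -conc'' κ (g x) * BB u g g x) - D x ≤ G x := by
    intro x hx
    have hxV := hx.1
    have hg := h.pos hx
    have hPn := h.BB_nonneg hlam hxV (f := τ)
    have hT0 := conc_nonneg hκ hg
    have hT1 := conc_le_one_add hκ hg
    refine (energy_arith hκ.le (neg_conc''_pos hκ hg) (hφn x) (hτ01 x).1 (hτ01 x).2
      hT0 (conc_le hκ) (conc'_sq_le hκ hg) hPn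
      (h.BB_nonneg hlam hxV (f := φ)) (h.BB_cauchy hlam hxV (-m⁻¹) m (f := τ) (k := φ)) hm
      (h.BB_cauchy hlam hxV (2 * conc' κ (g x)) (τ x * -conc'' κ (g x)) (f := τ) (k := g))
      (hDe x hx)).trans ?_
    have b1 : τ x ^ 2 * conc κ (g x) * -LL u φ x ≤ S.indicator (fun x => Lv / s * (1 + g x)) x := by
      have hdd : 0 ≤ deriv Real.smoothTransition ((ρ - v x) / s) / s ^ 2 * BB u v v x :=
        mul_nonneg (div_nonneg (deriv_smoothTransition_nonneg _) (by positivity))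
          (h.BB_nonneg hlam hxV)
      have ht2 : τ x ^ 2 ≤ 1 := pow_le_one₀ (hτ01 x).1 (hτ01 x).2
      by_cases hxS : x ∈ S
      · rw [indicator_of_mem hxS]
        have hL : -LL u φ x ≤ Lv / s := by
          rw [hφd, LL_secCut (hv x hxV)]
          have h1 := Real.smoothTransition.nonneg ((ρ - v x) / s)
          have h2 := Real.smoothTransition.le_one ((ρ - v x) / s)
          have h3 : Real.smoothTransition ((ρ - v x) / s) * LL u v x ≤ Lv :=
            (mul_le_mul_of_nonneg_left (hLv x hxV) h1).trans (mul_le_of_le_one_left hLv0 h2)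
          have h4 := div_le_div_of_nonneg_right h3 hs.le
          have h5 : -(-(Real.smoothTransition ((ρ - v x) / s) / s) * LL u v x) =
            Real.smoothTransition ((ρ - v x) / s) * LL u v x / s := by ring
          linarith
        have hLs : 0 ≤ Lv / s := by positivity
        calc τ x ^ 2 * conc κ (g x) * -LL u φ x ≤ τ x ^ 2 * conc κ (g x) * (Lv / s) :=
              mul_le_mul_of_nonneg_left hL (by positivity)
          _ ≤ 1 * (1 + g x) * (Lv / s) := by gcongr
          _ = _ := by ring
      · rw [indicator_of_notMem hxS]
        have hL : -LL u φ x ≤ 0 := by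
          rw [hφd, LL_secCut (hv x hxV), hns x ⟨hxV, hxS⟩]
          rw [zero_div, neg_zero, zero_mul, zero_add, neg_nonpos]
          exact hdd
        exact mul_nonpos_of_nonneg_of_nonpos (by positivity) hL
    have b2 : BB u τ τ x ≤ M * (pd τ x 0 ^ 2 + pd τ x 1 ^ 2) := (h.BB_le_lap hlam hxV).trans
      (mul_le_mul_of_nonneg_right (hM x hxV) (by positivity))
    have b3 : 2 * κ * φ x * BB u τ τ x ≤ 2 * κ * Φ * BB u τ τ x := by
      have := hΦ x hxV
      gcongr
    have b4 : κ * (m⁻¹ ^ 2 + 2 * Φ) * BB u τ τ x ≤ c₁ * (pd τ x 0 ^ 2 + pd τ x 1 ^ 2) := by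
      rw [hc₁, mul_assoc _ M]
      exact mul_le_mul_of_nonneg_left b2 (by positivity)
    have b5 : κ * (m ^ 2 * BB u φ φ x) ≤ m ^ 2 * κ * M₂ := by
      rw [mul_left_comm, ← mul_assoc]
      exact mul_le_mul_of_nonneg_left (hM₂ x hxV) (by positivity)
    simp only [hG]
    nlinarith
  have hGi : ∫⁻ x in W, ENNReal.ofReal (G x) ≤ ENNReal.ofReal (Lv / s * A + e / 2) := by
    have hWc : W ⊆ {x₀}ᶜ := fun x hx => hx.2
    have hτm : AEMeasurable (fun x => ENNReal.ofReal (c₁ * (pd τ x 0 ^ 2 + pd τ x 1 ^ 2)))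
        (volume.restrict W) := by
      have : ContinuousOn (fun x => c₁ * (pd τ x 0 ^ 2 + pd τ x 1 ^ 2)) W :=
        continuousOn_const.mul (((Sm.continuousOn fun x hx => (hτs x hx.2).pd 0).pow 2).add
          ((Sm.continuousOn fun x hx => (hτs x hx.2).pd 1).pow 2))
      exact (this.aemeasurable hWm).ennreal_ofReal
    calc ∫⁻ x in W, ENNReal.ofReal (G x)
        ≤ ∫⁻ x in W, (ENNReal.ofReal (S.indicator (fun x => Lv / s * (1 + g x)) x) +
            ENNReal.ofReal (c₁ * (pd τ x 0 ^ 2 + pd τ x 1 ^ 2)) +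
            ENNReal.ofReal (m ^ 2 * κ * M₂)) := by
          refine lintegral_mono fun x => ?_
          exact ENNReal.ofReal_add_le.trans (add_le_add_left ENNReal.ofReal_add_le _)
      _ = (∫⁻ x in W, ENNReal.ofReal (S.indicator (fun x => Lv / s * (1 + g x)) x)) +
            (∫⁻ x in W, ENNReal.ofReal (c₁ * (pd τ x 0 ^ 2 + pd τ x 1 ^ 2))) +
            ENNReal.ofReal (m ^ 2 * κ * M₂) * volume W := by
          rw [lintegral_add_right _ measurable_const, lintegral_add_right' _ hτm,
            setLIntegral_const]
      _ ≤ ENNReal.ofReal (Lv / s * A) + ENNReal.ofReal (e / 4) + ENNReal.ofReal (e / 4) := by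
          refine add_le_add (add_le_add ?_ ?_) ?_
          · calc ∫⁻ x in W, ENNReal.ofReal (S.indicator (fun x => Lv / s * (1 + g x)) x)
                ≤ ∫⁻ x, ENNReal.ofReal (S.indicator (fun x => Lv / s * (1 + g x)) x) :=
                  setLIntegral_le_lintegral _ _
              _ = ∫⁻ x in S, ENNReal.ofReal (Lv / s * (1 + g x)) := by
                  rw [← lintegral_indicator hSo.measurableSet]
                  congr 1
                  ext x
                  by_cases hx : x ∈ S <;> simp [hx]
              _ = ENNReal.ofReal (Lv / s) * ∫⁻ x in S, ENNReal.ofReal (1 + g x) := by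
                  rw [← lintegral_const_mul' _ _ ENNReal.ofReal_ne_top]
                  simp only [ENNReal.ofReal_mul (show 0 ≤ Lv / s by positivity)]
              _ ≤ _ := by
                  rw [ENNReal.ofReal_mul (by positivity)]
                  gcongr
          · simp only [ENNReal.ofReal_mul hc₁0]
            rw [lintegral_const_mul' _ _ ENNReal.ofReal_ne_top]
            refine (mul_le_mul_right ((lintegral_mono_set hWc).trans hτη) _).trans ?_
            rw [← ENNReal.ofReal_mul hc₁0]
            refine ENNReal.ofReal_le_ofReal ?_
            rw [← mul_div_assoc, div_le_iff₀ (by positivity)]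
            nlinarith
          · rw [← ENNReal.ofReal_toReal ((measure_mono sdiff_subset).trans_lt hVfin.lt_top).ne,
              ← ENNReal.ofReal_mul (by positivity)]
            refine ENNReal.ofReal_le_ofReal ?_
            have h1 : (volume W).toReal ≤ vol :=
              ENNReal.toReal_mono hVfin (measure_mono sdiff_subset)
            have h2 : m ^ 2 ≤ m := by nlinarith
            calc m ^ 2 * κ * M₂ * (volume W).toReal ≤ m * κ * M₂ * vol := by gcongr
              _ ≤ e / 4 := by nlinarith
      _ = _ := by
          rw [← ENNReal.ofReal_add (by positivity) (by positivity),
            ← ENNReal.ofReal_add (by positivity) (by positivity)]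
          congr 1
          ring
  have hInt := integral_le_of_lintegral_le (by positivity) ((hei.const_mul 2⁻¹).sub hDi)
    ((ae_restrict_iff' hWm).2 (.of_forall hpt)) hGi
  have hint2 := integral_sub (hei.const_mul 2⁻¹) hDi
  simp only [Pi.sub_apply] at hInt
  rw [hint2, hD0, integral_const_mul, sub_zero] at hInt
  rw [← ofReal_integral_eq_lintegral_ofReal hei]
  · exact ENNReal.ofReal_le_ofReal (by linarith)
  · refine (ae_restrict_iff' hWm).2 (.of_forall fun x hx => ?_)
    exact mul_nonneg (mul_nonneg (mul_nonneg (sq_nonneg _) (hφn x))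
      (neg_conc''_pos hκ (h.pos hx)).le) (h.BB_nonneg hlam hx.1)

end Pole

end GreenLp

namespace GreenLp
open Set

variable {lam Lam : ℝ} {V : Set (E 2)} {u : E 2 → ℝ} {x₀ : E 2} {g f k : E 2 → ℝ} {x : E 2}

namespace Pole

variable {v : E 2 → ℝ} {ρ s Lv A : ℝ}

/-- The weighted energy of `g` on a sublevel set of `v` is controlled by the mass of `1 + g`. -/
theorem lintegral_energy_le (h : Pole lam Lam V u x₀ g) (hlam : 0 ≤ lam) (hs : 0 < s)
    (hLv0 : 0 ≤ Lv) (hA : 0 ≤ A) (hv : ∀ x ∈ V, Sm v x) (hLv : ∀ x ∈ V, LL u v x ≤ Lv)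
    (hSc : IsCompact (closure {x ∈ V | v x < ρ})) (hSV : closure {x ∈ V | v x < ρ} ⊆ V)
    (hgA : ∫⁻ x in {x ∈ V | v x < ρ}, ENNReal.ofReal (1 + g x) ≤ ENNReal.ofReal A) :
    ∫⁻ x in V \ {x₀}, ENNReal.ofReal (secCut v ρ s x *
      (3 / 16 * (1 + g x) ^ (-(5 / 4 : ℝ)) * BB u g g x)) ≤ ENNReal.ofReal (2 * (Lv / s * A)) := by
  have hn : ∀ n : ℕ, (0 : ℝ) < 1 / (n + 1) := fun n => Nat.one_div_pos_of_nat
  choose τ hτ hτ1 hI using fun n : ℕ => h.energy_step hlam hs hLv0 hA hv hLv hSc hSV hgA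
    (κ := n + 1) (ε := 1 / (n + 1)) (e := 1 / (n + 1)) (by positivity) (hn n) (hn n)
  set W := V \ {x₀}
  have hWo := h.open_punct
  set q : E 2 → ℝ := fun x => secCut v ρ s x *
      (3 / 16 * (1 + g x) ^ (-(5 / 4 : ℝ)) * BB u g g x) with hq
  have hq0 : ∀ x ∈ W, 0 ≤ q x := fun x hx => by
    have := h.pos hx
    exact mul_nonneg (ramp_nonneg _) (mul_nonneg (by positivity) (h.BB_nonneg hlam hx.1))
  set F : ℕ → E 2 → ℝ := fun n x => τ n x ^ 2 * Real.exp (-((1 + g x) ^ (3 / 4 : ℝ) / (n + 1))) * q x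
    with hF
  have hgc : ContinuousOn g W := Sm.continuousOn fun x hx => h.smg hx
  have hpw : ∀ e : ℝ, ContinuousOn (fun x => (1 + g x) ^ e) W := fun e =>
    (continuousOn_const.add hgc).rpow_const fun x hx =>
      Or.inl (add_pos one_pos (h.pos hx)).ne'
  have hqc : ContinuousOn q W :=
    (Sm.continuousOn fun x hx => sm_secCut (hv x hx.1)).mul
      ((continuousOn_const.mul (hpw _)).mul
        (Sm.continuousOn fun x hx => (h.smu hx.1).BB (h.smg hx) (h.smg hx)))
  have hFc : ∀ n, ContinuousOn (F n) W := fun n =>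
    (((Sm.continuousOn fun x hx => hτ n x hx.2).pow 2).mul
      ((hpw _).div_const _).neg.rexp).mul hqc
  have hFle : ∀ n, ∫⁻ x in W, ENNReal.ofReal (F n x) ≤
      ENNReal.ofReal (2 * (Lv / s * A) + 1 / (n + 1)) := fun n => by
    refine le_trans (setLIntegral_mono_ae' hWo.measurableSet (.of_forall fun x hx => ?_)) (hI n)
    refine ENNReal.ofReal_le_ofReal ?_
    have h1 := le_neg_conc'' (κ := n + 1) (by positivity) (h.pos hx)
    have h2 : 0 ≤ τ n x ^ 2 * secCut v ρ s x * BB u g g x :=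
      mul_nonneg (mul_nonneg (sq_nonneg _) (ramp_nonneg _)) (h.BB_nonneg hlam hx.1)
    have := mul_le_mul_of_nonneg_left h1 h2
    simp only [hF, hq]
    linarith
  have hlim : ∀ x ∈ W, Filter.Tendsto (fun n => ENNReal.ofReal (F n x)) Filter.atTop
      (nhds (ENNReal.ofReal (q x))) := fun x hx => by
    refine (ENNReal.continuous_ofReal.tendsto _).comp ?_
    have ht : ∀ᶠ n : ℕ in Filter.atTop, τ n x = 1 := by
      have hd : 0 < dist x x₀ := dist_pos.2 hx.2
      filter_upwards [(tendsto_one_div_add_atTop_nhds_zero_nat (𝕜 := ℝ)).eventually_lt_const hd]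
        with n hn using hτ1 n x hn.le
    have he : Filter.Tendsto (fun n : ℕ => Real.exp (-((1 + g x) ^ (3 / 4 : ℝ) / ((n : ℝ) + 1))) * q x)
        Filter.atTop (nhds (q x)) := by
      have h0 := (tendsto_one_div_add_atTop_nhds_zero_nat (𝕜 := ℝ)).const_mul
        (-(1 + g x) ^ (3 / 4 : ℝ))
      rw [mul_zero] at h0
      have h1 := (Real.continuous_exp.tendsto 0).comp h0
      rw [Real.exp_zero] at h1
      have h2 := h1.mul_const (q x)
      rw [one_mul] at h2
      refine h2.congr fun n => ?_
      simp only [Function.comp]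
      congr 2
      ring
    refine he.congr' ?_
    filter_upwards [ht] with n hn
    simp [hF, hn]
  calc ∫⁻ x in W, ENNReal.ofReal (q x)
      = ∫⁻ x in W, Filter.liminf (fun n => ENNReal.ofReal (F n x)) Filter.atTop :=
        setLIntegral_congr_fun hWo.measurableSet fun x hx => (hlim x hx).liminf_eq.symm
    _ ≤ Filter.liminf (fun n => ∫⁻ x in W, ENNReal.ofReal (F n x)) Filter.atTop :=
        lintegral_liminf_le' fun n =>
          ((hFc n).aemeasurable hWo.measurableSet).ennreal_ofReal
    _ ≤ Filter.liminf (fun n : ℕ => ENNReal.ofReal (2 * (Lv / s * A) + 1 / (n + 1)))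
          Filter.atTop := Filter.liminf_le_liminf (.of_forall hFle)
    _ = ENNReal.ofReal (2 * (Lv / s * A)) := by
        refine Filter.Tendsto.liminf_eq ((ENNReal.continuous_ofReal.tendsto _).comp ?_)
        simpa using (tendsto_one_div_add_atTop_nhds_zero_nat (𝕜 := ℝ)).const_add (2 * (Lv / s * A))

theorem lintegral_energy_sublevel_le (h : Pole lam Lam V u x₀ g) (hlam : 0 ≤ lam) (hs : 0 < s)
    (hLv0 : 0 ≤ Lv) (hA : 0 ≤ A) (hv : ∀ x ∈ V, Sm v x) (hLv : ∀ x ∈ V, LL u v x ≤ Lv)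
    (hSc : IsCompact (closure {x ∈ V | v x < ρ})) (hSV : closure {x ∈ V | v x < ρ} ⊆ V)
    (hgA : ∫⁻ x in {x ∈ V | v x < ρ}, ENNReal.ofReal (1 + g x) ≤ ENNReal.ofReal A) {ρ' : ℝ}
    (hρ : ρ' + 2 * s ≤ ρ) :
    ∫⁻ x in {x ∈ V | v x < ρ'}, ENNReal.ofReal (BB u g g x * (1 + g x) ^ (-(5 / 4 : ℝ))) ≤
      ENNReal.ofReal (16 / 3 * (2 * (Lv / s * A))) := by
  have hWo := h.open_punct
  have hSo : IsOpen {x ∈ V | v x < ρ'} :=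
    (Sm.continuousOn hv).isOpen_inter_preimage h.isOpen isOpen_Iio
  have hsub : {x ∈ V | v x < ρ'} ⊆ V := fun x hx => hx.1
  have hae := Pole.ae_restrict V x₀
  calc ∫⁻ x in {x ∈ V | v x < ρ'}, ENNReal.ofReal (BB u g g x * (1 + g x) ^ (-(5 / 4 : ℝ)))
      = ∫⁻ x in {x ∈ V | v x < ρ'} \ {x₀},
          ENNReal.ofReal (BB u g g x * (1 + g x) ^ (-(5 / 4 : ℝ))) :=
        (setLIntegral_congr (Pole.ae_restrict _ x₀)).symm
    _ ≤ ∫⁻ x in {x ∈ V | v x < ρ'} \ {x₀}, ENNReal.ofReal (16 / 3) * ENNReal.ofReal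
          (secCut v ρ s x * (3 / 16 * (1 + g x) ^ (-(5 / 4 : ℝ)) * BB u g g x)) := by
        refine setLIntegral_mono_ae' (hSo.sdiff isClosed_singleton).measurableSet
          (.of_forall fun x hx => ?_)
        rw [← ENNReal.ofReal_mul (by norm_num)]
        refine ENNReal.ofReal_le_ofReal ?_
        have hg := h.pos ⟨hx.1.1, hx.2⟩
        have h1 : 1 ≤ secCut v ρ s x := by
          refine le_trans ?_ (le_ramp _)
          have : 2 ≤ (ρ - v x) / s := by
            rw [le_div_iff₀ hs]
            linarith [hx.1.2]
          linarith
        have h2 : 0 ≤ BB u g g x * (1 + g x) ^ (-(5 / 4 : ℝ)) :=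
          mul_nonneg (h.BB_nonneg hlam hx.1.1) (by positivity)
        nlinarith [mul_le_mul_of_nonneg_right h1 h2]
    _ = ENNReal.ofReal (16 / 3) * ∫⁻ x in {x ∈ V | v x < ρ'} \ {x₀}, ENNReal.ofReal
          (secCut v ρ s x * (3 / 16 * (1 + g x) ^ (-(5 / 4 : ℝ)) * BB u g g x)) :=
        lintegral_const_mul' _ _ ENNReal.ofReal_ne_top
    _ ≤ ENNReal.ofReal (16 / 3) * ENNReal.ofReal (2 * (Lv / s * A)) := by
        gcongr
        exact (lintegral_mono_set (sdiff_subset_sdiff_left hsub)).trans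
          (h.lintegral_energy_le hlam hs hLv0 hA hv hLv hSc hSV hgA)
    _ = _ := (ENNReal.ofReal_mul (by norm_num)).symm

end Pole

end GreenLp

namespace GreenLp
open Set

variable {u f k : E 2 → ℝ} {x w : E 2}

theorem fderiv_eq_pd (f : E 2 → ℝ) (x w : E 2) :
    fderiv ℝ f x w = w 0 * pd f x 0 + w 1 * pd f x 1 := by
  have : w = w 0 • EuclideanSpace.single (0 : Fin 2) (1 : ℝ) +
      w 1 • EuclideanSpace.single (1 : Fin 2) (1 : ℝ) := by
    ext i
    fin_cases i <;> simp
  conv_lhs => rw [this]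
  simp only [map_add, map_smul, smul_eq_mul, pd]

theorem hasDerivAt_line {t : ℝ} (hf : DifferentiableAt ℝ f (x + t • w)) :
    HasDerivAt (fun t : ℝ => f (x + t • w))
      (w 0 * pd f (x + t • w) 0 + w 1 * pd f (x + t • w) 1) t := by
  rw [← fderiv_eq_pd]
  have h : HasDerivAt (fun t : ℝ => x + t • w) w t := by
    simpa using ((hasDerivAt_id t).smul_const w).const_add x
  exact hf.hasFDerivAt.comp_hasDerivAt t h

/-- The second-order necessary condition at a local minimum. -/
theorem hess_nonneg_of_isLocalMin (hf : Sm f x) (hm : IsLocalMin f x) (p q : ℝ) :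
    0 ≤ pd2 f x 0 0 * p ^ 2 + 2 * pd2 f x 0 1 * p * q + pd2 f x 1 1 * q ^ 2 := by
  set w : E 2 := !₂[p, q] with hw
  have hw0 : w 0 = p := rfl
  have hw1 : w 1 = q := rfl
  have hc : Filter.Tendsto (fun t : ℝ => x + t • w) (nhds 0) (nhds x) := by
    have : Continuous fun t : ℝ => x + t • w := by fun_prop
    simpa using this.tendsto 0
  set φ : ℝ → ℝ := fun t => f (x + t • w) with hφ
  have h1 : deriv φ =ᶠ[nhds 0] fun t => p * pd f (x + t • w) 0 + q * pd f (x + t • w) 1 := by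
    filter_upwards [hc.eventually hf.eventually] with t ht
    exact (hasDerivAt_line (ht.differentiableAt (by simp))).deriv
  have h2 : deriv (deriv φ) 0 =
      pd2 f x 0 0 * p ^ 2 + 2 * pd2 f x 0 1 * p * q + pd2 f x 1 1 * q ^ 2 := by
    rw [h1.deriv_eq]
    have d : ∀ i, HasDerivAt (fun t : ℝ => pd f (x + t • w) i)
        (w 0 * pd2 f x 0 i + w 1 * pd2 f x 1 i) 0 := fun i => by
      have hs : Sm (fun y => pd f y i) (x + (0 : ℝ) • w) := by simpa using hf.pd i
      have := hasDerivAt_line (x := x) (w := w) hs.differentiableAt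
      simpa [pd2_eq] using this
    have := ((d 0).const_mul p).add ((d 1).const_mul q)
    refine Eq.trans (HasDerivAt.deriv this) ?_
    rw [hw0, hw1, pd2_symm hf.two 1 0]
    ring
  rw [← h2]
  by_contra! hneg
  have hmin : IsLocalMin φ 0 := by
    have := hc.eventually hm
    simpa [IsLocalMin, IsMinFilter, hφ] using this
  have hsm0 : DifferentiableAt ℝ f (x + (0 : ℝ) • w) := by simpa using hf.differentiableAt
  have hmax : IsLocalMax φ 0 := isLocalMax_of_deriv_deriv_neg hneg hmin.deriv_eq_zero
    (hasDerivAt_line hsm0).continuousAt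
  have hconst : φ =ᶠ[nhds 0] fun _ => φ 0 := by
    filter_upwards [hmin, hmax] with t h1 h2 using le_antisymm h2 h1
  have : deriv (deriv φ) 0 = 0 := by
    rw [hconst.deriv.deriv_eq]
    simp
  linarith

/-- The deviation of `u` from its affine approximation at `x₀`. -/
def tang (u : E 2 → ℝ) (x₀ x : E 2) : ℝ := u x - (u x₀ + fderiv ℝ u x₀ (x - x₀))

theorem tang_eq (u : E 2 → ℝ) (x₀ : E 2) : tang u x₀ = fun x => u x -
    (u x₀ + (pd u x₀ 0 * (x 0 - x₀ 0) + pd u x₀ 1 * (x 1 - x₀ 1))) := by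
  ext x
  rw [tang, fderiv_eq_pd]
  simp
  ring

theorem sm_affine (a b c : ℝ) (x₀ x : E 2) :
    Sm (fun y : E 2 => c + (a * (y 0 - x₀ 0) + b * (y 1 - x₀ 1))) x :=
  contDiffAt_const.add ((contDiffAt_const.mul (sm_coord 0 (x₀ 0) x)).add
    (contDiffAt_const.mul (sm_coord 1 (x₀ 1) x)))

theorem sm_tang {x₀ : E 2} (hu : Sm u x) : Sm (tang u x₀) x := by
  rw [tang_eq]
  exact hu.sub (sm_affine _ _ _ _ _)

theorem pd_affine (a b c : ℝ) (x₀ x : E 2) (i : Fin 2) :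
    pd (fun y : E 2 => c + (a * (y 0 - x₀ 0) + b * (y 1 - x₀ 1))) x i = if i = 0 then a else b := by
  have h0 := fun a => (contDiffAt_const (c := a) (n := ((⊤ : ℕ∞) : WithTop ℕ∞)) (𝕜 := ℝ)).mul
    (sm_coord 0 (x₀ 0) x)
  have h1 := fun a => (contDiffAt_const (c := a) (n := ((⊤ : ℕ∞) : WithTop ℕ∞)) (𝕜 := ℝ)).mul
    (sm_coord 1 (x₀ 1) x)
  rw [pd_add (f := fun _ => c) (differentiableAt_const _)
      (Sm.differentiableAt ((h0 a).add (h1 b))), pd_const, zero_add,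
    pd_add (Sm.differentiableAt (h0 a)) (Sm.differentiableAt (h1 b)),
    pd_mul (f := fun _ => a) (differentiableAt_const _) (sm_coord 0 _ x).differentiableAt,
    pd_mul (f := fun _ => b) (differentiableAt_const _) (sm_coord 1 _ x).differentiableAt]
  simp only [pd_const, pd_coord]
  fin_cases i <;> simp

theorem pd_tang {x₀ : E 2} (hu : Sm u x) (i : Fin 2) :
    pd (tang u x₀) x i = pd u x i - pd u x₀ i := by
  rw [tang_eq, pd_sub hu.differentiableAt (sm_affine _ _ _ _ _).differentiableAt, pd_affine]
  fin_cases i <;> simp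

theorem pd2_tang {x₀ : E 2} (hu : Sm u x) (i j : Fin 2) :
    pd2 (tang u x₀) x i j = pd2 u x i j := by
  rw [tang_eq, pd2_sub hu (sm_affine _ _ _ _ _), pd2_eq (fun y : E 2 => _ + _)]
  simp only [pd_affine, pd_const, sub_zero]

theorem tang_self (u : E 2 → ℝ) (x₀ : E 2) : tang u x₀ x₀ = 0 := by simp [tang]

/-- A convex function lies above its tangent planes. -/
theorem tang_nonneg {s : Set (E 2)} (hu : ConvexOn ℝ s u) {x₀ : E 2} (hx₀ : x₀ ∈ s) (hx : x ∈ s)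
    (hd : DifferentiableAt ℝ u x₀) : 0 ≤ tang u x₀ x := by
  have hd' : DifferentiableAt ℝ u (x₀ + (0 : ℝ) • (x - x₀)) := by simpa using hd
  have h := hasDerivAt_line hd'
  rw [← fderiv_eq_pd, zero_smul, add_zero] at h
  have h2 := h.tendsto_slope_zero_right
  have : fderiv ℝ u x₀ (x - x₀) ≤ u x - u x₀ := by
    refine le_of_tendsto h2 ?_
    filter_upwards [Ioo_mem_nhdsGT (show (0 : ℝ) < 1 by norm_num)] with t ht
    have hc := hu.2 hx₀ hx (sub_nonneg.2 ht.2.le) ht.1.le (by ring)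
    have e : x₀ + (0 + t) • (x - x₀) = (1 - t) • x₀ + t • x := by module
    rw [zero_smul, add_zero, e, smul_eq_mul, inv_mul_le_iff₀ ht.1]
    simp only [smul_eq_mul] at hc
    linarith
  rw [tang]
  linarith

end GreenLp

namespace GreenLp
open Set

variable {lam Lam : ℝ} {Ω : Set (E 2)} {u f k : E 2 → ℝ} {x w : E 2}

theorem pd2_cap (R : ℝ) (c x : E 2) (i j : Fin 2) :
    pd2 (cap R c) x i j = if i = j then -1 else 0 := by
  have e : cap R c = fun x => R ^ 2 / 2 -
      ((x 0 - c 0) * ((x 0 - c 0) * 2⁻¹) + (x 1 - c 1) * ((x 1 - c 1) * 2⁻¹)) := by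
    ext x
    rw [cap]
    ring
  have s := fun l => sm_coord l (c l) x
  have s2 := fun l => (s l).mul (contDiffAt_const (c := (2⁻¹ : ℝ)))
  have hl : ∀ l, pd2 (fun x : E 2 => (x l - c l) * ((x l - c l) * 2⁻¹)) x i j =
      if i = l ∧ j = l then 1 else 0 := fun l => by
    rw [pd2_mul (s l) (s2 l), pd2_mul (k := fun _ => (2⁻¹ : ℝ)) (s l) contDiffAt_const,
      pd_mul (k := fun _ => (2⁻¹ : ℝ)) (s l).differentiableAt (differentiableAt_const _),
      pd_mul (k := fun _ => (2⁻¹ : ℝ)) (s l).differentiableAt (differentiableAt_const _)]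
    simp only [pd2_coord, pd_coord, pd_const, pd2_const]
    fin_cases i <;> fin_cases j <;> fin_cases l <;> norm_num
  rw [e, pd2_sub contDiffAt_const (((s 0).mul (s2 0)).add ((s 1).mul (s2 1))),
    pd2_add ((s 0).mul (s2 0)) ((s 1).mul (s2 1)), hl, hl, pd2_const]
  fin_cases i <;> fin_cases j <;> simp

theorem det_Hess (hu : Sm u x) :
    (Hess u x).det = pd2 u x 0 0 * pd2 u x 1 1 - pd2 u x 0 1 ^ 2 := by
  rw [Matrix.det_fin_two]
  simp only [Hess, Matrix.of_apply]
  rw [pd2_symm hu.two 1 0]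
  ring

namespace Setup

theorem sm (hS : MASetup Ω u) (hx : x ∈ Ω) : Sm u x :=
  hS.2.2.2.2.1.contDiffAt (Filter.mem_of_superset (hS.1.mem_nhds hx) subset_closure)

theorem convexOn (hS : MASetup Ω u) : ConvexOn ℝ (closure Ω) u := hS.2.2.2.2.2.1

theorem compact (hS : MASetup Ω u) : IsCompact (closure Ω) := hS.2.1.isCompact_closure

theorem tang_nonneg (hS : MASetup Ω u) {x₀ : E 2} (hx₀ : x₀ ∈ Ω) (hx : x ∈ closure Ω) :
    0 ≤ tang u x₀ x :=
  GreenLp.tang_nonneg (convexOn hS) (subset_closure hx₀) hx (sm hS hx₀).differentiableAt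

theorem hess_nonneg (hS : MASetup Ω u) (hx : x ∈ Ω) (p q : ℝ) :
    0 ≤ pd2 u x 0 0 * p ^ 2 + 2 * pd2 u x 0 1 * p * q + pd2 u x 1 1 * q ^ 2 := by
  have := hess_nonneg_of_isLocalMin (f := tang u x) (x := x) (sm_tang (sm hS hx)) (by
    filter_upwards [hS.1.mem_nhds hx] with y hy
    rw [tang_self]
    exact tang_nonneg hS hx (subset_closure hy)) p q
  simpa only [pd2_tang (sm hS hx)] using this

theorem det_mem (hS : MASetup Ω u) (hD : DetBounds Ω u lam Lam) (hx : x ∈ Ω) :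
    lam ≤ pd2 u x 0 0 * pd2 u x 1 1 - pd2 u x 0 1 ^ 2 ∧
      pd2 u x 0 0 * pd2 u x 1 1 - pd2 u x 0 1 ^ 2 ≤ Lam := by
  rw [← det_Hess (sm hS hx)]
  exact hD x hx

theorem pd2_pos (hS : MASetup Ω u) (hD : DetBounds Ω u lam Lam) (hlam : 0 < lam) (hx : x ∈ Ω) :
    0 < pd2 u x 0 0 ∧ 0 < pd2 u x 1 1 := by
  have h0 := hess_nonneg hS hx 1 0
  have h1 := hess_nonneg hS hx 0 1
  have hd := (det_mem hS hD hx).1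
  have h2 : 0 < pd2 u x 0 0 * pd2 u x 1 1 := by nlinarith [sq_nonneg (pd2 u x 0 1)]
  norm_num at h0 h1
  constructor
  · refine h0.lt_of_ne fun h => ?_
    rw [← h, zero_mul] at h2
    exact h2.false
  · refine h1.lt_of_ne fun h => ?_
    rw [← h, mul_zero] at h2
    exact h2.false

theorem mem_or_frontier (hS : MASetup Ω u) (hx : x ∈ closure Ω) : x ∈ Ω ∨ x ∈ frontier Ω := by
  by_cases h : x ∈ Ω
  · exact Or.inl h
  · exact Or.inr ⟨hx, by rwa [hS.1.interior_eq]⟩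

theorem nonpos (hS : MASetup Ω u) (hD : DetBounds Ω u lam Lam) (hlam : 0 < lam)
    (hx : x ∈ closure Ω) : u x ≤ 0 := by
  obtain ⟨y, hy, hmax⟩ := (compact hS).exists_isMaxOn ⟨x, hx⟩ hS.2.2.2.2.1.continuousOn
  refine (hmax hx).trans ?_
  rcases mem_or_frontier hS hy with h | h
  · exfalso
    have hsm : Sm (fun y => (0 : ℝ) - u y) y := contDiffAt_const.sub (sm hS h)
    have := hess_nonneg_of_isLocalMin hsm (by
      filter_upwards [hS.1.mem_nhds h] with z hz
      have : u z ≤ u y := hmax (subset_closure hz)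
      linarith) 1 0
    rw [pd2_sub contDiffAt_const (sm hS h), pd2_const] at this
    have hp := (pd2_pos hS hD hlam h).1
    norm_num at this
    linarith
  · exact (hS.2.2.2.2.2.2 y h).le

theorem ge (hS : MASetup Ω u) (hD : DetBounds Ω u lam Lam) {a R : ℝ} {c : E 2} (ha : 0 < a)
    (haL : Lam < a ^ 2) (hR : closure Ω ⊆ Metric.ball c R) (hx : x ∈ closure Ω) :
    -(a * (R ^ 2 / 2)) ≤ u x := by
  have hR0 : ∀ y ∈ closure Ω, 0 ≤ cap R c y ∧ cap R c y ≤ R ^ 2 / 2 := fun y hy => by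
    have h := Metric.mem_ball.1 (hR hy)
    have h0 : 0 ≤ dist y c := dist_nonneg
    rw [cap_eq]
    constructor <;> nlinarith
  have hcc : ContinuousOn (fun y => u y + a * cap R c y) (closure Ω) :=
    hS.2.2.2.2.1.continuousOn.add (continuousOn_const.mul
      (Sm.continuousOn fun y _ => sm_cap R c y))
  obtain ⟨y, hy, hmin⟩ := (compact hS).exists_isMinOn ⟨x, hx⟩ hcc
  suffices 0 ≤ u y + a * cap R c y by
    have h1 : u y + a * cap R c y ≤ u x + a * cap R c x := hmin hx
    have h2 := mul_le_mul_of_nonneg_left (hR0 x hx).2 ha.le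
    linarith
  rcases mem_or_frontier hS hy with h | h
  · exfalso
    have hsc : Sm (fun x => a * cap R c x) y := contDiffAt_const.mul (sm_cap R c y)
    have hq := hess_nonneg_of_isLocalMin ((sm hS h).add hsc) (by
      filter_upwards [hS.1.mem_nhds h] with z hz using hmin (subset_closure hz))
    simp only [pd2_add (sm hS h) hsc, pd2_mul (f := fun _ => a) contDiffAt_const (sm_cap R c y),
      pd2_cap, pd_const, pd2_const] at hq
    norm_num at hq
    have hd := (det_mem hS hD h).2
    have q0 := hq 1 0
    have q1 := hq 0 1
    set A := pd2 u y 0 0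
    set B := pd2 u y 0 1
    set C := pd2 u y 1 1
    norm_num at q0 q1
    have q2 : B ^ 2 ≤ (A - a) * (C - a) := by
      have := discrim_le_zero (a := A - a) (b := 2 * B) (c := C - a) fun p => by
        have := hq p 1
        linarith
      rw [discrim] at this
      linarith
    nlinarith
  · rw [hS.2.2.2.2.2.2 y h, zero_add]
    exact mul_nonneg ha.le (hR0 y hy).1

end Setup

end GreenLp

namespace GreenLp
open Set

variable {lam Lam : ℝ} {Ω : Set (E 2)} {u f k : E 2 → ℝ} {x w : E 2}

/-- Integrating against a fixed cutoff bounds the mass of a nonnegative Laplacian. -/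
theorem exists_lintegral_lap_le {Ω V : Set (E 2)} (hΩ : IsOpen Ω) (hVo : IsOpen V)
    (hV : CptIn V Ω) : ∃ C : ℝ, 0 ≤ C ∧ ∀ (u : E 2 → ℝ) (M : ℝ), 0 ≤ M → (∀ x ∈ Ω, Sm u x) →
      (∀ x ∈ Ω, |u x| ≤ M) → (∀ x ∈ Ω, 0 ≤ lap u x) →
      ∫⁻ x in V, ENNReal.ofReal (lap u x) ≤ ENNReal.ofReal (C * M) := by
  obtain ⟨K, hK, hVK, hKΩ⟩ := exists_compact_between hV.1 hΩ hV.2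
  obtain ⟨φ, h1, h0, h01⟩ := exists_contMDiffMap_one_nhds_of_subset_interior
    (modelWithCornersSelf ℝ (E 2)) (n := ⊤) isClosed_closure hVK
  have hφ : ∀ x, Sm φ x := fun x => (contMDiff_iff_contDiff.1 φ.contMDiff).contDiffAt
  have hVK' : V ⊆ K := fun x hx => interior_subset (hVK (subset_closure hx))
  have hKo : IsOpen (Ω \ K) := hΩ.sdiff hK.isClosed
  have hp0 : ∀ x ∈ Ω \ K, ∀ i, pd φ x i = 0 := fun x hx i =>
    pd_eq_zero_of_eqOn hKo hx (fun y hy => h0 y hy.2) i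
  have hp20 : ∀ x ∈ Ω \ K, ∀ i j, pd2 φ x i j = 0 := fun x hx i j =>
    pd_eq_zero_of_eqOn hKo hx (fun y hy => hp0 y hy j) i
  have hlap0 : ∀ x ∈ Ω \ K, lap φ x = 0 := fun x hx => by rw [lap, hp20 x hx, hp20 x hx, add_zero]
  have hlapc : ∀ {f : E 2 → ℝ}, (∀ x ∈ Ω, Sm f x) → ContinuousOn (lap f) Ω := fun hf =>
    Sm.continuousOn fun x hx => ((hf x hx).pd2 0 0).add ((hf x hx).pd2 1 1)
  have hφc : ContinuousOn (fun x => |lap φ x|) Ω := (hlapc fun x _ => hφ x).abs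
  have hi0 : IntegrableOn (fun x => |lap φ x|) Ω :=
    integrableOn_of_zero_off hΩ hK hKΩ hφc fun x hx => by rw [hlap0 x hx, abs_zero]
  refine ⟨∫ x in Ω, |lap φ x|, integral_nonneg fun x => abs_nonneg _,
    fun u M hM hu huM hl => ?_⟩
  have hF : ∀ i, ∀ x ∈ Ω, Sm (fun x => φ x * pd u x i - u x * pd φ x i) x := fun i x hx =>
    ((hφ x).mul ((hu x hx).pd i)).sub ((hu x hx).mul ((hφ x).pd i))
  have hI := fun i => integral_pd_eq_zero hΩ hK hKΩ (hF i)
    (fun x hx => by simp [h0 x hx.2, hp0 x hx]) i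
  have hpF : ∀ i, ∀ x ∈ Ω, pd (fun x => φ x * pd u x i - u x * pd φ x i) x i =
      φ x * pd2 u x i i - u x * pd2 φ x i i := fun i x hx => by
    have hux := hu x hx
    rw [pd_sub (Sm.differentiableAt ((hφ x).mul (hux.pd i)))
        (Sm.differentiableAt (hux.mul ((hφ x).pd i))),
      pd_mul (hφ x).differentiableAt (hux.pd i).differentiableAt,
      pd_mul hux.differentiableAt ((hφ x).pd i).differentiableAt, pd2_eq, pd2_eq]
    ring
  have hFi : ∀ i, IntegrableOn (fun x => φ x * pd2 u x i i - u x * pd2 φ x i i) Ω := fun i =>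
    integrableOn_of_zero_off hΩ hK hKΩ (Sm.continuousOn fun x hx =>
      ((hφ x).mul ((hu x hx).pd2 i i)).sub ((hu x hx).mul ((hφ x).pd2 i i)))
      fun x hx => by rw [h0 x hx.2, hp20 x hx]; ring
  have hz : ∫ x in Ω, (φ x * lap u x - u x * lap φ x) = 0 := by
    have : ∀ i, ∫ x in Ω, (φ x * pd2 u x i i - u x * pd2 φ x i i) = 0 := fun i =>
      (setIntegral_congr_fun hΩ.measurableSet fun x hx => (hpF i x hx).symm).trans (hI i)
    have h2 := integral_add (hFi 0) (hFi 1)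
    simp only [this, add_zero] at h2
    rw [← h2]
    congr 1
    ext x
    simp only [lap]
    ring
  have i1 : IntegrableOn (fun x => φ x * lap u x) Ω :=
    integrableOn_of_zero_off hΩ hK hKΩ ((Sm.continuousOn fun x _ => hφ x).mul (hlapc hu))
      fun x hx => by rw [h0 x hx.2, zero_mul]
  have i2 : IntegrableOn (fun x => u x * lap φ x) Ω :=
    integrableOn_of_zero_off hΩ hK hKΩ ((Sm.continuousOn hu).mul (hlapc fun x _ => hφ x))
      fun x hx => by rw [hlap0 x hx, mul_zero]
  rw [integral_sub i1 i2, sub_eq_zero] at hz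
  have hb : ∫ x in Ω, φ x * lap u x ≤ (∫ x in Ω, |lap φ x|) * M := by
    rw [hz, ← integral_mul_const]
    refine setIntegral_mono_on i2 (hi0.mul_const M) hΩ.measurableSet fun x hx => ?_
    calc u x * lap φ x ≤ |u x| * |lap φ x| := by rw [← abs_mul]; exact le_abs_self _
      _ ≤ |lap φ x| * M := by
        rw [mul_comm]
        exact mul_le_mul_of_nonneg_left (huM x hx) (abs_nonneg _)
  calc ∫⁻ x in V, ENNReal.ofReal (lap u x) = ∫⁻ x in V, ENNReal.ofReal (φ x * lap u x) :=
        setLIntegral_congr_fun hVo.measurableSet fun x hx => by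
          have : φ x = 1 := h1.self_of_nhdsSet x (subset_closure hx)
          simp only [this, one_mul]
    _ ≤ ∫⁻ x in Ω, ENNReal.ofReal (φ x * lap u x) :=
        lintegral_mono_set (hVK'.trans hKΩ)
    _ = ENNReal.ofReal (∫ x in Ω, φ x * lap u x) := by
        refine (ofReal_integral_eq_lintegral_ofReal i1 ?_).symm
        filter_upwards [ae_restrict_mem hΩ.measurableSet] with x hx
          using mul_nonneg (h01 x).1 (hl x hx)
    _ ≤ _ := ENNReal.ofReal_le_ofReal hb

namespace Setup

theorem abs_pd_le (hS : MASetup Ω u) (hD : DetBounds Ω u lam Lam) (hlam : 0 < lam) {M d : ℝ}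
    (hd : 0 < d) (hM : ∀ x ∈ closure Ω, -M ≤ u x) (hx : Metric.closedBall x d ⊆ Ω) (i : Fin 2) :
    |pd u x i| ≤ M / d := by
  have hxΩ : x ∈ Ω := hx (Metric.mem_closedBall_self hd.le)
  have key : ∀ s : ℝ, |s| = d → s * pd u x i ≤ M := fun s hs => by
    have hy : x + s • EuclideanSpace.single i (1 : ℝ) ∈ Ω := hx (by
      rw [Metric.mem_closedBall, dist_eq_norm, add_sub_cancel_left, norm_smul]
      simp [hs])
    have h1 := tang_nonneg hS hxΩ (subset_closure hy)
    have h2 := nonpos hS hD hlam (subset_closure hy)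
    have h3 := hM x (subset_closure hxΩ)
    rw [tang, add_sub_cancel_left, map_smul, smul_eq_mul] at h1
    change 0 ≤ u _ - (u x + s * pd u x i) at h1
    linarith
  have h1 := key d (abs_of_pos hd)
  have h2 := key (-d) (by rw [abs_neg, abs_of_pos hd])
  rw [abs_le, le_div_iff₀ hd, ← neg_div, div_le_iff₀ hd]
  constructor <;> linarith

theorem lap_nonneg (hS : MASetup Ω u) (hx : x ∈ Ω) : 0 ≤ lap u x := by
  have h0 := hess_nonneg hS hx 1 0
  have h1 := hess_nonneg hS hx 0 1
  norm_num at h0 h1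
  exact add_nonneg h0 h1

theorem pole {V : Set (E 2)} {x₀ : E 2} {g : E 2 → ℝ} (hS : MASetup Ω u)
    (hD : DetBounds Ω u lam Lam) (hlam : 0 < lam) (hVo : IsOpen V) (hV : CptIn V Ω)
    (hx₀ : x₀ ∈ V) (hg : IsGreen u V x₀ g) : Pole lam Lam V u x₀ g where
  isOpen := hVo
  cpt := hV.1
  mem := hx₀
  hu _ hx := sm hS (hV.2 hx)
  p0 _ hx := (pd2_pos hS hD hlam (hV.2 (subset_closure hx))).1
  p1 _ hx := (pd2_pos hS hD hlam (hV.2 (subset_closure hx))).2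
  det_ge _ hx := (det_mem hS hD (hV.2 (subset_closure hx))).1
  det_le _ hx := (det_mem hS hD (hV.2 (subset_closure hx))).2
  green := hg

/-- Quantitative bounds for `u` on `V` in terms of the geometry of `V ⊂⊂ Ω`. -/
theorem exists_bounds {V : Set (E 2)} (hΩ : IsOpen Ω) (hΩb : Bornology.IsBounded Ω)
    (hVo : IsOpen V) (hV : CptIn V Ω) (hlam : 0 < lam) (hlL : lam ≤ Lam) :
    ∃ R G C : ℝ, 0 < R ∧ 0 < G ∧ 0 ≤ C ∧ (∀ x ∈ closure Ω, ∀ y ∈ closure Ω, dist x y < R) ∧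
      ∀ u, MASetup Ω u → DetBounds Ω u lam Lam → (∀ x ∈ V, ∀ i, |pd u x i| ≤ G) ∧
        ∫⁻ x in V, ENNReal.ofReal (lap u x) ≤ ENNReal.ofReal C := by
  obtain ⟨R, hR0, hR⟩ : ∃ R : ℝ, 0 < R ∧ ∀ x ∈ closure Ω, ∀ y ∈ closure Ω, dist x y < R :=
    ⟨Metric.diam (closure Ω) + 1, by positivity, fun x hx y hy =>
      (Metric.dist_le_diam_of_mem hΩb.closure hx hy).trans_lt (by linarith)⟩
  obtain ⟨d, hd, hdΩ⟩ := hV.1.exists_cthickening_subset_open hΩ hV.2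
  obtain ⟨C, hC, hlap⟩ := exists_lintegral_lap_le hΩ hVo hV
  have ha : (0 : ℝ) < Lam + 1 := by linarith
  set M := (Lam + 1) * (R ^ 2 / 2) with hMd
  have hM0 : 0 < M := by positivity
  have hM : ∀ u, MASetup Ω u → DetBounds Ω u lam Lam → ∀ x ∈ closure Ω, -M ≤ u x :=
    fun u hS hD x hx => ge hS hD (c := x) ha (by nlinarith)
      (fun y hy => Metric.mem_ball.2 (hR y hy x hx)) hx
  refine ⟨R, M / d, C * M, hR0, by positivity, by positivity, hR, fun u hS hD => ⟨?_, ?_⟩⟩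
  · intro x hx i
    refine abs_pd_le hS hD hlam hd (hM u hS hD) (fun y hy => hdΩ ?_) i
    exact Metric.mem_cthickening_of_dist_le y x d _ (subset_closure hx) hy
  · refine hlap u M hM0.le (fun x hx => sm hS hx) (fun x hx => ?_) fun x hx => lap_nonneg hS hx
    rw [abs_le]
    exact ⟨hM u hS hD x (subset_closure hx),
      (nonpos hS hD hlam (subset_closure hx)).trans hM0.le⟩

end Setup

end GreenLp

namespace GreenLp
open Set

/-- A pair of vectors spanning a parallelogram of unit area, with coordinates in `[-1, 1]`. -/
structure Frame (a b : E 2) : Prop where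
  det : (a 0 * b 1 - a 1 * b 0) ^ 2 = 1
  ha : ∀ i, |a i| ≤ 1
  hb : ∀ i, |b i| ≤ 1

/-- The affine coordinates with origin `x₀` and axes `a`, `b`. -/
def chart (x₀ a b : E 2) (z : ℝ × ℝ) : E 2 := x₀ + (z.1 • a + z.2 • b)

variable {lam Lam : ℝ} {Ω V : Set (E 2)} {u f k : E 2 → ℝ} {x w x₀ a b : E 2} {z z' : ℝ × ℝ}

theorem chart_apply (x₀ a b : E 2) (z : ℝ × ℝ) (i : Fin 2) :
    chart x₀ a b z i = x₀ i + (z.1 * a i + z.2 * b i) := by simp [chart]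

theorem chart_sub_chart (x₀ a b : E 2) (z z' : ℝ × ℝ) :
    chart x₀ a b z' - chart x₀ a b z = (z'.1 - z.1) • a + (z'.2 - z.2) • b := by
  rw [chart, chart]
  module

theorem chart_zero (x₀ a b : E 2) : chart x₀ a b 0 = x₀ := by simp [chart]

theorem continuous_chart (x₀ a b : E 2) : Continuous (chart x₀ a b) := by
  unfold chart
  fun_prop

theorem abs_apply_le_dist (x y : E 2) (i : Fin 2) : |x i - y i| ≤ dist x y := by
  rw [dist_eq_norm]
  exact PiLp.norm_apply_le (x - y) i

namespace Frame

theorem abs_det (h : Frame a b) : |a 0 * b 1 - a 1 * b 0| = 1 := by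
  rw [← sq_eq_sq₀ (abs_nonneg _) zero_le_one, sq_abs, h.det, one_pow]

theorem abs_sub_le (h : Frame a b) (z z' : ℝ × ℝ) :
    |z.1 - z'.1| ≤ 2 * dist (chart x₀ a b z) (chart x₀ a b z') ∧
      |z.2 - z'.2| ≤ 2 * dist (chart x₀ a b z) (chart x₀ a b z') := by
  set d := dist (chart x₀ a b z) (chart x₀ a b z')
  have hd : 0 ≤ d := dist_nonneg
  have h0 := abs_apply_le_dist (chart x₀ a b z) (chart x₀ a b z') 0
  have h1 := abs_apply_le_dist (chart x₀ a b z) (chart x₀ a b z') 1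
  rw [chart_apply, chart_apply] at h0 h1
  set X := x₀ 0 + (z.1 * a 0 + z.2 * b 0) - (x₀ 0 + (z'.1 * a 0 + z'.2 * b 0)) with hX
  set Y := x₀ 1 + (z.1 * a 1 + z.2 * b 1) - (x₀ 1 + (z'.1 * a 1 + z'.2 * b 1)) with hY
  have key : ∀ p q : ℝ, |p| ≤ 1 → |q| ≤ 1 → |X * p - Y * q| ≤ 2 * d := fun p q hp hq => by
    refine (abs_sub _ _).trans ?_
    rw [abs_mul, abs_mul]
    have := mul_le_mul h0 hp (abs_nonneg _) hd
    have := mul_le_mul h1 hq (abs_nonneg _) hd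
    linarith
  constructor
  · have := key (b 1) (b 0) (h.hb 1) (h.hb 0)
    rw [show X * b 1 - Y * b 0 = (z.1 - z'.1) * (a 0 * b 1 - a 1 * b 0) by rw [hX, hY]; ring,
      abs_mul, h.abs_det, mul_one] at this
    exact this
  · have := key (a 1) (a 0) (h.ha 1) (h.ha 0)
    rw [show X * a 1 - Y * a 0 = -((z.2 - z'.2) * (a 0 * b 1 - a 1 * b 0)) by rw [hX, hY]; ring,
      abs_neg, abs_mul, h.abs_det, mul_one] at this
    exact this

theorem injective_chart (h : Frame a b) : Function.Injective (chart x₀ a b) := by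
  intro z z' hz
  obtain ⟨h1, h2⟩ := h.abs_sub_le (x₀ := x₀) z z'
  rw [hz, dist_self, mul_zero] at h1 h2
  exact Prod.ext (sub_eq_zero.1 (abs_nonpos_iff.1 h1)) (sub_eq_zero.1 (abs_nonpos_iff.1 h2))

theorem measurableEmbedding_chart (h : Frame a b) : MeasurableEmbedding (chart x₀ a b) :=
  (continuous_chart x₀ a b).measurableEmbedding h.injective_chart

theorem measurePreserving_chart (h : Frame a b) : MeasurePreserving (chart x₀ a b) := by
  set M : Matrix (Fin 2) (Fin 2) ℝ := !![a 0, b 0; a 1, b 1] with hM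
  have hdet : M.det = a 0 * b 1 - a 1 * b 0 := by
    rw [hM, Matrix.det_fin_two_of]
    ring
  have h0 : M.det ≠ 0 := by
    rw [hdet]
    intro h1
    have := h.det
    rw [h1] at this
    norm_num at this
  have h1 : MeasurePreserving (Matrix.toLin' M) := by
    refine ⟨(Matrix.toLin' M).continuous_of_finiteDimensional.measurable, ?_⟩
    rw [Real.map_matrix_volume_pi_eq_smul_volume_pi h0, hdet, abs_inv, h.abs_det]
    simp
  have h2 := (measurePreserving_add_left volume x₀).comp
    ((PiLp.volume_preserving_toLp (Fin 2)).comp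
      (h1.comp (volume_preserving_finTwoArrow ℝ).symm))
  convert! h2 using 1
  ext z i
  rw [chart_apply]
  fin_cases i <;>
    simp [hM, MeasurableEquiv.finTwoArrow]

theorem setLIntegral_chart (h : Frame a b) (F : E 2 → ENNReal) (s : Set (E 2)) :
    ∫⁻ z in chart x₀ a b ⁻¹' s, F (chart x₀ a b z) = ∫⁻ x in s, F x :=
  h.measurePreserving_chart.setLIntegral_comp_preimage_emb h.measurableEmbedding_chart F s

end Frame

/-- The directional derivative of `f` along `w`. -/
def dir (f : E 2 → ℝ) (w x : E 2) : ℝ := w 0 * pd f x 0 + w 1 * pd f x 1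

/-- The second derivative of `f` along `w` and `w'`. -/
def dir2 (f : E 2 → ℝ) (w w' x : E 2) : ℝ :=
  w 0 * w' 0 * pd2 f x 0 0 + (w 0 * w' 1 + w 1 * w' 0) * pd2 f x 0 1 + w 1 * w' 1 * pd2 f x 1 1

theorem dir_eq_fderiv (f : E 2 → ℝ) (w x : E 2) : dir f w x = fderiv ℝ f x w :=
  (fderiv_eq_pd f x w).symm

theorem Sm.dir (hf : Sm f x) (w : E 2) : Sm (dir f w) x :=
  (contDiffAt_const.mul (hf.pd 0)).add (contDiffAt_const.mul (hf.pd 1))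

theorem dir_dir (hf : Sm f x) (w w' : E 2) : dir (dir f w) w' x = dir2 f w' w x := by
  have hc := fun i => (contDiffAt_const (c := w i) (n := ((⊤ : ℕ∞) : WithTop ℕ∞)) (𝕜 := ℝ)).mul
    (hf.pd i)
  have h : ∀ i, pd (dir f w) x i = w 0 * pd2 f x i 0 + w 1 * pd2 f x i 1 := fun i => by
    have : dir f w = fun x => w 0 * pd f x 0 + w 1 * pd f x 1 := rfl
    rw [this, pd_add (Sm.differentiableAt (hc 0)) (Sm.differentiableAt (hc 1)),
      pd_mul (f := fun _ => w 0) (differentiableAt_const _) (hf.pd 0).differentiableAt,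
      pd_mul (f := fun _ => w 1) (differentiableAt_const _) (hf.pd 1).differentiableAt,
      pd_const, pd_const, pd2_eq, pd2_eq]
    ring
  rw [GreenLp.dir, h, h, dir2, pd2_symm hf.two 1 0]
  ring

theorem Sm.dir2 (hf : Sm f x) (w w' : E 2) : Sm (dir2 f w w') x :=
  ((contDiffAt_const.mul (hf.pd2 0 0)).add (contDiffAt_const.mul (hf.pd2 0 1))).add
    (contDiffAt_const.mul (hf.pd2 1 1))

theorem dir2_comm (f : E 2 → ℝ) (w w' x : E 2) : dir2 f w w' x = dir2 f w' w x := by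
  rw [dir2, dir2]
  ring

theorem hasFDerivAt_chart (hf : DifferentiableAt ℝ f (chart x₀ a b z)) :
    HasFDerivAt (fun z => f (chart x₀ a b z))
      (dir f a (chart x₀ a b z) • ContinuousLinearMap.fst ℝ ℝ ℝ +
        dir f b (chart x₀ a b z) • ContinuousLinearMap.snd ℝ ℝ ℝ) z := by
  have h : HasFDerivAt (chart x₀ a b) ((ContinuousLinearMap.fst ℝ ℝ ℝ).smulRight a +
      (ContinuousLinearMap.snd ℝ ℝ ℝ).smulRight b) z :=
    ((hasFDerivAt_fst.smul_const a).add (hasFDerivAt_snd.smul_const b)).const_add x₀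
  refine (hf.hasFDerivAt.comp z h).congr_fderiv ?_
  ext <;> simp [dir_eq_fderiv]

theorem Frame.det_dir2 (h : Frame a b) (f : E 2 → ℝ) (x : E 2) :
    dir2 f a a x * dir2 f b b x - dir2 f a b x ^ 2 =
      pd2 f x 0 0 * pd2 f x 1 1 - pd2 f x 0 1 ^ 2 := by
  rw [← one_mul (pd2 f x 0 0 * _ - _), ← h.det, dir2, dir2, dir2]
  ring

theorem Frame.energy_dir (h : Frame a b) (hu : Sm u x) (g : E 2 → ℝ) :
    dir2 u b b x * dir g a x ^ 2 - 2 * dir2 u a b x * dir g a x * dir g b x +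
      dir2 u a a x * dir g b x ^ 2 = BB u g g x := by
  rw [← one_mul (BB _ _ _ _), ← h.det, BB_eq, pd2_symm hu.two 1 0, dir2, dir2, dir2, dir, dir]
  ring

end GreenLp

namespace GreenLp
open Set

variable {lam Lam ρ t R G : ℝ} {Ω V : Set (E 2)} {u f k g : E 2 → ℝ} {x x₀ w a b : E 2}

namespace Setup

theorem convexOn_tang (hS : MASetup Ω u) (x₀ : E 2) : ConvexOn ℝ (closure Ω) (tang u x₀) := by
  have h := ((convexOn hS).add ((-(fderiv ℝ u x₀)).toLinearMap.convexOn (convexOn hS).1)).add_const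
    (-(u x₀) + fderiv ℝ u x₀ x₀)
  refine h.congr fun x _ => ?_
  simp [tang]
  ring

theorem section_eq (hV : CptIn V Ω) (hSec : CptIn (MASection Ω u x₀ ρ) V) (ht : t ≤ ρ) :
    MASection Ω u x₀ t = {x ∈ V | tang u x₀ x < t} := by
  ext x
  have e : tang u x₀ x < t ↔ u x < u x₀ + fderiv ℝ u x₀ (x - x₀) + t := by
    rw [tang, sub_lt_iff_lt_add']
  constructor
  · intro hx
    refine ⟨hSec.2 (subset_closure ⟨hx.1, hx.2.trans_le ?_⟩), e.2 hx.2⟩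
    linarith
  · exact fun hx => ⟨subset_closure (hV.2 (subset_closure hx.1)), e.1 hx.2⟩

theorem convex_sublevel (hS : MASetup Ω u) (hV : CptIn V Ω) (hSec : CptIn (MASection Ω u x₀ ρ) V) :
    Convex ℝ {x ∈ V | tang u x₀ x < ρ} := by
  rw [← section_eq hV hSec le_rfl]
  have : MASection Ω u x₀ ρ = {x ∈ closure Ω | tang u x₀ x < ρ} := by
    ext x
    refine and_congr_right fun _ => ?_
    rw [tang, sub_lt_iff_lt_add']
  rw [this]
  exact (convexOn_tang hS x₀).convex_lt ρ

theorem isOpen_sublevel (hS : MASetup Ω u) (hVo : IsOpen V) (hV : CptIn V Ω) :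
    IsOpen {x ∈ V | tang u x₀ x < t} :=
  (Sm.continuousOn fun _ hx => sm_tang (sm hS (hV.2 (subset_closure hx)))).isOpen_inter_preimage
    hVo isOpen_Iio

end Setup

theorem convex_chart_preimage {s : Set (E 2)} (hs : Convex ℝ s) (x₀ a b : E 2) :
    Convex ℝ (chart x₀ a b ⁻¹' s) := by
  intro z hz z' hz' p q hp hq hpq
  have : chart x₀ a b (p • z + q • z') = p • chart x₀ a b z + q • chart x₀ a b z' := by
    have hp' : p = 1 - q := by linarith
    simp only [chart, hp', Prod.fst_add, Prod.snd_add, Prod.smul_fst, Prod.smul_snd, smul_eq_mul]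
    module
  rw [mem_preimage, this]
  exact hs hz hz' hp hq hpq

theorem dir_tang (hu : Sm u x) (w : E 2) : dir (tang u x₀) w x = dir u w x - dir u w x₀ := by
  rw [dir, pd_tang hu, pd_tang hu, dir, dir]
  ring

theorem dir2_tang (hu : Sm u x) (w w' : E 2) : dir2 (tang u x₀) w w' x = dir2 u w w' x := by
  rw [dir2, pd2_tang hu, pd2_tang hu, pd2_tang hu, dir2]

theorem abs_dir_tang_le (hu : Sm u x) (hw : ∀ i, |w i| ≤ 1) (h : ∀ i, |pd u x i| ≤ G)
    (h₀ : ∀ i, |pd u x₀ i| ≤ G) : |dir (tang u x₀) w x| ≤ 4 * G := by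
  have key : ∀ i, |w i * (pd u x i - pd u x₀ i)| ≤ 2 * G := fun i => by
    rw [abs_mul]
    have h1 := (abs_sub (pd u x i) (pd u x₀ i)).trans (add_le_add (h i) (h₀ i))
    nlinarith [mul_le_mul (hw i) h1 (abs_nonneg _) zero_le_one]
  rw [dir, pd_tang hu, pd_tang hu]
  have := abs_add_le (w 0 * (pd u x 0 - pd u x₀ 0)) (w 1 * (pd u x 1 - pd u x₀ 1))
  linarith [key 0, key 1]

theorem Setup.dir2_pos (hS : MASetup Ω u) (hD : DetBounds Ω u lam Lam) (hlam : 0 < lam)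
    (hx : x ∈ Ω) (hw : w 0 ≠ 0 ∨ w 1 ≠ 0) : 0 < dir2 u w w x := by
  obtain ⟨h0, h1⟩ := pd2_pos hS hD hlam hx
  have hd := (det_mem hS hD hx).1
  have e : dir2 u w w x * pd2 u x 0 0 = (w 0 * pd2 u x 0 0 + w 1 * pd2 u x 0 1) ^ 2 +
      w 1 ^ 2 * (pd2 u x 0 0 * pd2 u x 1 1 - pd2 u x 0 1 ^ 2) := by
    rw [dir2]
    ring
  refine pos_of_mul_pos_left ?_ h0.le
  rw [e]
  by_cases hw1 : w 1 = 0
  · have := hw.resolve_right (not_not.2 hw1)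
    rw [hw1, zero_mul, add_zero, zero_pow two_ne_zero, zero_mul, add_zero]
    positivity
  · have := hlam.trans_le hd
    positivity

theorem Frame.bowl (h : Frame a b) (hS : MASetup Ω u) (hD : DetBounds Ω u lam Lam)
    (hlam : 0 < lam) (hVo : IsOpen V) (hV : CptIn V Ω) (hx₀ : x₀ ∈ V)
    (hSec : CptIn (MASection Ω u x₀ ρ) V) (hρ : 0 < ρ) (hG : 0 < G)
    (hR : ∀ x ∈ closure Ω, ∀ y ∈ closure Ω, dist x y < R) (hpd : ∀ x ∈ V, ∀ i, |pd u x i| ≤ G) :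
    Bowl lam Lam ρ (8 * G) (2 * R) (chart x₀ a b ⁻¹' {x ∈ V | tang u x₀ x < ρ})
      (fun z => tang u x₀ (chart x₀ a b z)) (fun z => dir (tang u x₀) a (chart x₀ a b z))
      (fun z => dir (tang u x₀) b (chart x₀ a b z)) (fun z => dir2 u a a (chart x₀ a b z))
      (fun z => dir2 u a b (chart x₀ a b z)) (fun z => dir2 u b b (chart x₀ a b z)) := by
  set S := {x ∈ V | tang u x₀ x < ρ} with hSd
  have hVΩ : V ⊆ Ω := fun x hx => hV.2 (subset_closure hx)
  have hSV : S ⊆ V := fun x hx => hx.1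
  have hcl : closure S ⊆ V := by
    rw [hSd, ← Setup.section_eq hV hSec le_rfl]
    exact hSec.2
  have hu : ∀ x ∈ V, Sm u x := fun x hx => Setup.sm hS (hVΩ hx)
  have ht : ∀ x ∈ V, Sm (tang u x₀) x := fun x hx => sm_tang (hu x hx)
  have hc := continuous_chart x₀ a b
  have hclO : ∀ z ∈ closure (chart x₀ a b ⁻¹' S), chart x₀ a b z ∈ closure S := fun z hz =>
    hc.closure_preimage_subset _ hz
  have hder : ∀ w, ∀ z ∈ chart x₀ a b ⁻¹' S, HasFDerivAt (fun z => dir (tang u x₀) w (chart x₀ a b z))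
      (dir2 u a w (chart x₀ a b z) • ContinuousLinearMap.fst ℝ ℝ ℝ +
        dir2 u b w (chart x₀ a b z) • ContinuousLinearMap.snd ℝ ℝ ℝ) z := fun w z hz => by
    have hz' := hSV hz
    have := hasFDerivAt_chart (x₀ := x₀) (a := a) (b := b) (z := z)
      ((ht _ hz').dir w).differentiableAt
    rwa [dir_dir (ht _ hz'), dir_dir (ht _ hz'), dir2_tang (hu _ hz'), dir2_tang (hu _ hz')] at this
  have hcont : ∀ w w', ContinuousOn (fun z => dir2 u w w' (chart x₀ a b z))
      (chart x₀ a b ⁻¹' S) := fun w w' z hz =>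
    (((hu _ (hSV hz)).dir2 w w').continuousAt.comp hc.continuousAt).continuousWithinAt
  have htan : ∀ z ∈ chart x₀ a b ⁻¹' S, ∀ z' ∈ chart x₀ a b ⁻¹' S,
      tang u x₀ (chart x₀ a b z) + dir (tang u x₀) a (chart x₀ a b z) * (z'.1 - z.1) +
        dir (tang u x₀) b (chart x₀ a b z) * (z'.2 - z.2) ≤ tang u x₀ (chart x₀ a b z') := by
    intro z hz z' hz'
    have h1 := Setup.tang_nonneg hS (hVΩ (hSV hz)) (subset_closure (hVΩ (hSV hz')))
    rw [dir_tang (hu _ (hSV hz)), dir_tang (hu _ (hSV hz))]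
    rw [tang, chart_sub_chart, map_add, map_smul, map_smul, smul_eq_mul, smul_eq_mul,
      ← dir_eq_fderiv, ← dir_eq_fderiv] at h1
    rw [tang, tang, ← sub_nonneg]
    have e : chart x₀ a b z' - x₀ = z'.1 • a + z'.2 • b := by simp [chart]
    have e' : chart x₀ a b z - x₀ = z.1 • a + z.2 • b := by simp [chart]
    rw [e, e']
    simp only [map_add, map_smul, smul_eq_mul, ← dir_eq_fderiv]
    linarith
  have hlip : ∀ z ∈ chart x₀ a b ⁻¹' S, ∀ z' ∈ chart x₀ a b ⁻¹' S,
      tang u x₀ (chart x₀ a b z) - tang u x₀ (chart x₀ a b z') ≤ 8 * G * dist z z' := by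
    intro z hz z' hz'
    have h1 := htan z hz z' hz'
    have ha := abs_dir_tang_le (w := a) (hu _ (hSV hz)) h.ha (hpd _ (hSV hz)) (hpd _ hx₀)
    have hb := abs_dir_tang_le (w := b) (hu _ (hSV hz)) h.hb (hpd _ (hSV hz)) (hpd _ hx₀)
    have d1 : |z'.1 - z.1| ≤ dist z z' := by
      rw [Prod.dist_eq, ← Real.dist_eq, dist_comm]
      exact le_max_left _ _
    have d2 : |z'.2 - z.2| ≤ dist z z' := by
      rw [Prod.dist_eq, ← Real.dist_eq, dist_comm z'.2]
      exact le_max_right _ _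
    have m1 := mul_le_mul ha d1 (abs_nonneg _) (by positivity)
    have m2 := mul_le_mul hb d2 (abs_nonneg _) (by positivity)
    rw [← abs_mul] at m1 m2
    linarith [neg_le_of_abs_le m1, neg_le_of_abs_le m2]
  have hbne : b 0 ≠ 0 ∨ b 1 ≠ 0 := by
    by_contra! hb
    have := h.det
    rw [hb.1, hb.2] at this
    norm_num at this
  refine
    { isOpen := (Setup.isOpen_sublevel hS hVo hV).preimage hc
      convex := convex_chart_preimage (Setup.convex_sublevel hS hV hSec) x₀ a b
      hv := fun z hz => hasFDerivAt_chart (ht _ (hSV hz)).differentiableAt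
      hvx := fun z hz => ?_
      hvy := hder b
      a_cont := hcont a a
      b_cont := hcont a b
      c_cont := hcont b b
      c_pos := fun z hz => Setup.dir2_pos hS hD hlam (hVΩ (hSV hz)) hbne
      det_ge := fun z hz => ?_
      det_le := fun z hz => ?_
      bdd := fun z hz z' hz' => ?_
      cont := fun z hz => ?_
      mem := fun z hz hlt => ⟨hcl (hclO z hz), hlt⟩
      lip := fun z hz z' hz' => abs_le.2 ⟨?_, hlip z hz z' hz'⟩
      zero_mem := ?_
      v_zero := ?_
      vx_zero := ?_
      vy_zero := ?_
      tangent := htan }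
  · rw [dir2_comm u a b]
    exact hder a z hz
  · rw [h.det_dir2]
    exact (Setup.det_mem hS hD (hVΩ (hSV hz))).1
  · rw [h.det_dir2]
    exact (Setup.det_mem hS hD (hVΩ (hSV hz))).2
  · have hd := hR _ (subset_closure (hVΩ (hcl (hclO z hz)))) _
      (subset_closure (hVΩ (hcl (hclO z' hz'))))
    have := h.abs_sub_le (x₀ := x₀) z z'
    constructor <;> linarith [this.1, this.2]
  · exact ((ht _ (hcl (hclO z hz))).continuousAt.comp hc.continuousAt).continuousWithinAt
  · have := hlip z' hz' z hz
    rw [dist_comm] at this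
    linarith
  · rw [mem_preimage, chart_zero]
    exact ⟨hx₀, by rwa [tang_self]⟩
  · simp only [chart_zero, tang_self]
  · simp only [chart_zero, dir_tang (hu _ hx₀), sub_self]
  · simp only [chart_zero, dir_tang (hu _ hx₀), sub_self]

theorem Frame.sing (h : Frame a b) (hP : Pole lam Lam V u x₀ g) {S : Set (E 2)} (hSV : S ⊆ V) :
    Sing (chart x₀ a b ⁻¹' S) (fun z => g (chart x₀ a b z)) (fun z => dir g a (chart x₀ a b z))
      (fun z => dir g b (chart x₀ a b z)) := by
  have hne : ∀ z ∈ chart x₀ a b ⁻¹' S \ {0}, chart x₀ a b z ∈ V \ {x₀} := fun z hz => by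
    refine ⟨hSV hz.1, fun he => hz.2 (h.injective_chart (x₀ := x₀) ?_)⟩
    rw [chart_zero]
    exact he
  have hc := continuous_chart x₀ a b
  have hcont : ∀ w, ContinuousOn (fun z => dir g w (chart x₀ a b z))
      (chart x₀ a b ⁻¹' S \ {0}) := fun w z hz =>
    (((hP.smg (hne z hz)).dir w).continuousAt.comp hc.continuousAt).continuousWithinAt
  exact
    { nonneg := fun z hz => (hP.green.1 _ (hne z hz)).le
      hg := fun z hz => hasFDerivAt_chart (hP.smg (hne z hz)).differentiableAt
      gx_cont := hcont a
      gy_cont := hcont b }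

end GreenLp

namespace GreenLp
open Set

variable {lam Lam ρ t R G C : ℝ} {Ω V : Set (E 2)} {u f k g : E 2 → ℝ} {x x₀ w a b : E 2}

namespace Pole

theorem lintegral_one_add_mul_lap_le (h : Pole lam Lam V u x₀ g) (hlam : 0 ≤ lam) (hR : 0 < R)
    (hVR : V ⊆ Metric.ball x₀ R) (hC : 0 ≤ C)
    (hlap : ∫⁻ x in V, ENNReal.ofReal (lap u x) ≤ ENNReal.ofReal C) :
    ∫⁻ x in V, ENNReal.ofReal ((1 + g x) * lap u x) ≤ ENNReal.ofReal (C + R ^ 2 / 2) := by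
  have hm : AEMeasurable (fun x => ENNReal.ofReal (lap u x)) (volume.restrict V) := by
    have : ContinuousOn (fun x => pd2 u x 0 0 + pd2 u x 1 1) V := fun x hx =>
      ((h.smu hx).pd2 0 0).continuousAt.continuousWithinAt.add
        ((h.smu hx).pd2 1 1).continuousAt.continuousWithinAt
    exact (this.aemeasurable h.isOpen.measurableSet).ennreal_ofReal
  calc ∫⁻ x in V, ENNReal.ofReal ((1 + g x) * lap u x)
      = ∫⁻ x in V \ {x₀}, ENNReal.ofReal ((1 + g x) * lap u x) :=
        (setLIntegral_congr (ae_restrict V x₀)).symm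
    _ ≤ ∫⁻ x in V \ {x₀}, (ENNReal.ofReal (lap u x) + ENNReal.ofReal (g x * lap u x)) := by
        refine setLIntegral_mono' h.open_punct.measurableSet fun x _ => ?_
        rw [one_add_mul]
        exact ENNReal.ofReal_add_le
    _ = ∫⁻ x in V, (ENNReal.ofReal (lap u x) + ENNReal.ofReal (g x * lap u x)) :=
        setLIntegral_congr (ae_restrict V x₀)
    _ = (∫⁻ x in V, ENNReal.ofReal (lap u x)) + ∫⁻ x in V, ENNReal.ofReal (g x * lap u x) :=
        lintegral_add_left' hm _
    _ ≤ ENNReal.ofReal C + ENNReal.ofReal (R ^ 2 / 2) :=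
        add_le_add hlap (h.lintegral_lap_le hlam hR hVR)
    _ = _ := (ENNReal.ofReal_add hC (by positivity)).symm

theorem lintegral_le_of_le_lap (h : Pole lam Lam V u x₀ g) {F : E 2 → ℝ} {c A : ℝ} (hc : 0 ≤ c)
    (hA : ∫⁻ x in V, ENNReal.ofReal ((1 + g x) * lap u x) ≤ ENNReal.ofReal A) {S : Set (E 2)}
    (hSV : S ⊆ V) (hF : ∀ x ∈ V, F x ≤ c * lap u x) :
    ∫⁻ x in S, ENNReal.ofReal ((1 + g x) * F x) ≤ ENNReal.ofReal (c * A) := by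
  calc ∫⁻ x in S, ENNReal.ofReal ((1 + g x) * F x)
      ≤ ∫⁻ x in V, ENNReal.ofReal ((1 + g x) * F x) := lintegral_mono_set hSV
    _ = ∫⁻ x in V \ {x₀}, ENNReal.ofReal ((1 + g x) * F x) :=
        (setLIntegral_congr (ae_restrict V x₀)).symm
    _ ≤ ∫⁻ x in V \ {x₀}, ENNReal.ofReal c * ENNReal.ofReal ((1 + g x) * lap u x) := by
        refine setLIntegral_mono' h.open_punct.measurableSet fun x hx => ?_
        rw [← ENNReal.ofReal_mul hc]
        refine ENNReal.ofReal_le_ofReal ?_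
        have := mul_le_mul_of_nonneg_left (hF x hx.1) (add_nonneg zero_le_one (h.pos hx).le)
        linarith
    _ = ∫⁻ x in V, ENNReal.ofReal c * ENNReal.ofReal ((1 + g x) * lap u x) :=
        setLIntegral_congr (ae_restrict V x₀)
    _ = ENNReal.ofReal c * ∫⁻ x in V, ENNReal.ofReal ((1 + g x) * lap u x) :=
        lintegral_const_mul' _ _ ENNReal.ofReal_ne_top
    _ ≤ ENNReal.ofReal c * ENNReal.ofReal A := by gcongr
    _ = _ := (ENNReal.ofReal_mul hc).symm

theorem sqrt_le_lap (h : Pole lam Lam V u x₀ g) (hx : x ∈ V) : √lam ≤ lap u x := by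
  have h0 := h.p0 x hx
  have h1 := h.p1 x hx
  have hd := h.det_ge x hx
  refine Real.sqrt_le_iff.2 ⟨(add_pos h0 h1).le, ?_⟩
  rw [lap]
  nlinarith [mul_pos h0 h1, sq_nonneg (pd2 u x 0 1), sq_nonneg (pd2 u x 0 0 - pd2 u x 1 1)]

theorem dir2_le_lap (h : Pole lam Lam V u x₀ g) (hlam : 0 ≤ lam) (hx : x ∈ V)
    (hb : ∀ i, |b i| ≤ 1) : dir2 u b b x ≤ 2 * lap u x := by
  have h0 := h.p0 x hx
  have h1 := h.p1 x hx
  have hd := h.det_ge x hx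
  have b0 := (sq_le_one_iff_abs_le_one _).2 (hb 0)
  have b1 := (sq_le_one_iff_abs_le_one _).2 (hb 1)
  have hs : |pd2 u x 0 1| ≤ lap u x / 2 := by
    rw [lap]
    refine abs_le_of_sq_le_sq ?_ (by positivity)
    nlinarith [sq_nonneg (pd2 u x 0 0 - pd2 u x 1 1)]
  have hm : |b 0 * b 1| ≤ 1 := by
    rw [abs_mul]
    exact mul_le_one₀ (hb 0) (abs_nonneg _) (hb 1)
  have hp := mul_le_mul hm hs (abs_nonneg _) zero_le_one
  rw [← abs_mul] at hp
  have := le_of_abs_le hp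
  have e0 := mul_le_mul_of_nonneg_right b0 h0.le
  have e1 := mul_le_mul_of_nonneg_right b1 h1.le
  rw [dir2]
  rw [lap] at *
  linarith

end Pole

theorem LL_tang (hu : Sm u x) : LL u (tang u x₀) x =
    2 * (pd2 u x 0 0 * pd2 u x 1 1 - pd2 u x 0 1 ^ 2) := by
  rw [LL_eq, pd2_tang hu, pd2_tang hu, pd2_tang hu, pd2_tang hu, pd2_symm hu.two 1 0]
  ring

theorem exists_frame_bound {μ ε B p r : ℝ} (hlam : 0 < lam) (hlL : lam ≤ Lam) (hμ : 0 < μ)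
    (hμ1 : μ ≤ 1) (hμl : μ ≤ lam) (hμL : μ * Lam ≤ 1) (hε : 0 < ε) (hB : 0 < B)
    (hN : NegPower μ ε B) (hp : 1 < p) (hpε : 11 * p / 12 + (p - 1) / ε ≤ 1)
    (hΩ : IsOpen Ω) (hΩb : Bornology.IsBounded Ω) (hVo : IsOpen V) (hV : CptIn V Ω)
    (hr : 0 < r) (hrρ : r < ρ) :
    ∃ σ K G : ℝ, 0 < σ ∧ 0 ≤ K ∧ 0 < G ∧ ∀ u, MASetup Ω u → DetBounds Ω u lam Lam →
      (∀ x ∈ V, ∀ i, |pd u x i| ≤ G) ∧ ∀ x₀ ∈ V, CptIn (MASection Ω u x₀ ρ) V →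
      ∀ g, IsGreen u V x₀ g → ∀ a b, Frame a b →
      ∫⁻ x in {x ∈ V | tang u x₀ x < r ∧ |dir (tang u x₀) b x| ≤ σ},
        ENNReal.ofReal (|dir g b x| ^ p) ≤ ENNReal.ofReal K := by
  obtain ⟨R, G, C, hR0, hG0, hC0, hR, hbd⟩ := Setup.exists_bounds hΩ hΩb hVo hV hlam hlL
  set ρ₂ := (r + ρ) / 2 with hρ₂
  set σ := (ρ - ρ₂) / (4 * R) with hσd
  set ρ₄ := ρ₂ + σ * (2 * R) with hρ₄
  have e4 : ρ₄ = (ρ₂ + ρ) / 2 := by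
    rw [hρ₄, hσd]
    field_simp
    ring
  have h2 : ρ₂ < ρ := by linarith
  have hσ : 0 < σ := div_pos (by linarith) (by positivity)
  have hρ : 0 < ρ := hr.trans hrρ
  set s := (ρ - ρ₄) / 2 with hsd
  have hs : 0 < s := by linarith
  have hsl : 0 < √lam := Real.sqrt_pos.2 hlam
  set A₀ := C + R ^ 2 / 2 with hA₀
  have hA₀0 : 0 ≤ A₀ := by positivity
  have hLam : 0 < Lam := hlam.trans_le hlL
  obtain ⟨K, hK, hmain⟩ := Bowl.exists_gradient_bound (L := 8 * G) (R := 2 * R) (ρ₀ := r)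
    (ρ₂ := ρ₂) (ρ₄ := ρ₄) (ρ := ρ) (σ := σ) (E₁ := 16 / 3 * (2 * (2 * Lam / s * (1 / √lam * A₀))))
    (C₁ := 2 * A₀) hlam hμ hμ1 hμl hμL hε hB hN hp hpε hr (by linarith) (by positivity)
    (by positivity) hσ le_rfl (by linarith) (by positivity) (by positivity)
  refine ⟨σ / 2, K, G, half_pos hσ, hK, hG0, fun u hS hD => ⟨(hbd u hS hD).1, ?_⟩⟩
  intro x₀ hx₀ hSec g hg a b hF
  have hP := Setup.pole hS hD hlam hVo hV hx₀ hg
  have hVΩ : V ⊆ Ω := fun x hx => hV.2 (subset_closure hx)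
  have hVR : V ⊆ Metric.ball x₀ R := fun x hx =>
    hR x (subset_closure (hVΩ hx)) x₀ (subset_closure (hVΩ hx₀))
  have hA := hP.lintegral_one_add_mul_lap_le hlam.le hR0 hVR hC0 (hbd u hS hD).2
  have hSeq := Setup.section_eq hV hSec le_rfl
  have hsub : ∀ t, {x ∈ V | tang u x₀ x < t} ⊆ V := fun t x hx => hx.1
  have hset : ∀ q : E 2 → Prop, (∀ x, q x → tang u x₀ x < ρ) →
      {z ∈ chart x₀ a b ⁻¹' {x ∈ V | tang u x₀ x < ρ} | q (chart x₀ a b z)} =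
        chart x₀ a b ⁻¹' {x ∈ V | q x} := fun q hq => by
    ext z
    exact ⟨fun hz => ⟨hz.1.1, hz.2⟩, fun hz => ⟨⟨hz.1, hq _ hz.2⟩, hz.2⟩⟩
  have hE := hP.lintegral_energy_sublevel_le (v := tang u x₀) (ρ := ρ) (ρ' := ρ₄) (s := s)
    (Lv := 2 * Lam) (A := 1 / √lam * A₀) hlam.le hs (by positivity) (by positivity)
    (fun x hx => sm_tang (hP.smu hx))
    (fun x hx => by
      rw [LL_tang (hP.smu hx)]
      linarith [hP.det_le x hx])
    (by rw [← hSeq]; exact hSec.1) (by rw [← hSeq]; exact hSec.2)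
    (by
      have := hP.lintegral_le_of_le_lap (F := fun _ => 1) (c := 1 / √lam) (by positivity) hA
        (hsub ρ) fun x hx => by
          rw [one_div, ← div_eq_inv_mul, le_div_iff₀ hsl, one_mul]
          exact hP.sqrt_le_lap hx
      simpa only [mul_one] using this)
    (by linarith)
  have hC := hP.lintegral_le_of_le_lap (F := dir2 u b b) (c := 2) zero_le_two hA
    (hsub ρ₄) fun x hx => hP.dir2_le_lap hlam.le hx hF.hb
  have h4ρ : ∀ x, tang u x₀ x < ρ₄ → tang u x₀ x < ρ := fun x hx => by linarith
  have hfin := hmain _ _ _ _ _ _ _ _ _ _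
    (hF.bowl hS hD hlam hVo hV hx₀ hSec hρ hG0 hR (hbd u hS hD).1) (hF.sing hP (hsub ρ))
    (by
      rw [hset (fun x => tang u x₀ x < ρ₄) h4ρ]
      refine le_of_eq_of_le ?_ hE
      rw [← hF.setLIntegral_chart (x₀ := x₀)]
      refine setLIntegral_congr_fun ?_ fun z hz => ?_
      · exact ((Setup.isOpen_sublevel hS hVo hV).preimage (continuous_chart x₀ a b)).measurableSet
      · simp only [energy]
        rw [hF.energy_dir (hP.smu hz.1)])
    (by
      rw [hset (fun x => tang u x₀ x < ρ₄) h4ρ]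
      exact (hF.setLIntegral_chart (x₀ := x₀)
        (fun x => ENNReal.ofReal ((1 + g x) * dir2 u b b x)) _).trans_le hC)
  rw [hset (fun x => tang u x₀ x < r ∧ |dir (tang u x₀) b x| ≤ σ / 2)
    (fun x hx => hx.1.trans hrρ)] at hfin
  exact (hF.setLIntegral_chart (x₀ := x₀) (fun x => ENNReal.ofReal (|dir g b x| ^ p)) _).symm.trans_le
    hfin

end GreenLp

namespace GreenLp
open Set

variable {lam Lam ρ t R G C : ℝ} {Ω V : Set (E 2)} {u f k g : E 2 → ℝ} {x x₀ w a b : E 2}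

/-- The slope `-1 + j / N` of the `j`-th direction of the net. -/
def slope (N j : ℕ) : ℝ := ((j : ℝ) - N) / N

/-- A net of directions, indexed by the dominant coordinate and the slope. -/
def netDir (N : ℕ) (i : Bool × ℕ) : E 2 :=
  if i.1 then !₂[slope N i.2, 1] else !₂[1, slope N i.2]

theorem abs_slope_le {N j : ℕ} (hN : 0 < N) (hj : j ≤ 2 * N) : |slope N j| ≤ 1 := by
  have hN' : (0 : ℝ) < N := by exact_mod_cast hN
  have hj' : (j : ℝ) ≤ 2 * N := by exact_mod_cast hj
  have h0 : (0 : ℝ) ≤ j := j.cast_nonneg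
  rw [slope, abs_div, abs_of_pos hN', div_le_one hN', abs_le]
  constructor <;> linarith

theorem slope_succ {N j : ℕ} (hN : 0 < N) : slope N (j + 1) = slope N j + 1 / N := by
  have hN' : (N : ℝ) ≠ 0 := by exact_mod_cast hN.ne'
  rw [slope, slope]
  push_cast
  ring

theorem exists_frame_netDir {N : ℕ} (hN : 0 < N) {i : Bool × ℕ} (hi : i.2 ≤ 2 * N) :
    ∃ a, Frame a (netDir N i) := by
  have hs := abs_slope_le hN hi
  obtain ⟨_ | _, j⟩ := i
  · refine ⟨!₂[0, 1], by simp [netDir], fun l => ?_, fun l => ?_⟩ <;> fin_cases l <;>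
      simp [netDir] <;> exact hs
  · refine ⟨!₂[1, 0], by simp [netDir], fun l => ?_, fun l => ?_⟩ <;> fin_cases l <;>
      simp [netDir] <;> exact hs

theorem dir_netDir_true (f : E 2 → ℝ) (N j : ℕ) (x : E 2) :
    dir f (netDir N (true, j)) x = slope N j * pd f x 0 + pd f x 1 := by
  simp [dir, netDir]

theorem dir_netDir_false (f : E 2 → ℝ) (N j : ℕ) (x : E 2) :
    dir f (netDir N (false, j)) x = slope N j * pd f x 1 + pd f x 0 := by
  simp [dir, netDir]
  ring

theorem exists_slope_near {N : ℕ} (hN : 0 < N) {τ : ℝ} (hτ : |τ| ≤ 1) :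
    ∃ j, j + 1 ≤ 2 * N ∧ |slope N j - τ| ≤ 1 / N ∧ |slope N (j + 1) - τ| ≤ 1 / N := by
  have hN' : (0 : ℝ) < N := by exact_mod_cast hN
  set y := N * (τ + 1) with hy
  have h1 := abs_le.1 hτ
  have hy0 : 0 ≤ y := mul_nonneg hN'.le (by linarith)
  have hy1 : y ≤ 2 * N := by nlinarith
  obtain ⟨j, hj, hj0, hj1⟩ : ∃ j : ℕ, j + 1 ≤ 2 * N ∧ (j : ℝ) ≤ y ∧ y ≤ j + 1 := by
    rcases hy1.lt_or_eq with h | h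
    · refine ⟨⌊y⌋₊, ?_, Nat.floor_le hy0, (Nat.lt_floor_add_one y).le⟩
      rw [Nat.succ_le_iff, Nat.floor_lt hy0]
      exact_mod_cast h
    · have hc : ((2 * N - 1 : ℕ) : ℝ) = 2 * N - 1 := by
        rw [Nat.cast_sub (by omega)]
        push_cast
        ring
      refine ⟨2 * N - 1, by omega, ?_, ?_⟩ <;> rw [hc] <;> linarith
  have e : slope N j - τ = (j - y) / N := by
    rw [slope, hy]
    field_simp
    ring
  refine ⟨j, hj, ?_, ?_⟩
  · rw [e, abs_div, abs_of_pos hN', div_le_div_iff_of_pos_right hN', abs_le]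
    constructor <;> linarith
  · rw [slope_succ hN, add_sub_right_comm, e, ← add_div, abs_div, abs_of_pos hN',
      div_le_div_iff_of_pos_right hN', abs_le]
    constructor <;> linarith

theorem exists_slope_small {N : ℕ} (hN : 0 < N) {p q M : ℝ} (hpq : |q| ≤ |p|) (hp : |p| ≤ M) :
    ∃ j, j + 1 ≤ 2 * N ∧ |slope N j * p + q| ≤ M / N ∧ |slope N (j + 1) * p + q| ≤ M / N := by
  have hM : 0 ≤ M := (abs_nonneg p).trans hp
  have hq : q = q / p * p := by
    rcases eq_or_ne p 0 with h | h
    · rw [h, abs_zero] at hpq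
      rw [h, mul_zero, abs_nonpos_iff.1 hpq]
    · rw [div_mul_cancel₀ q h]
  have hτ : |-(q / p)| ≤ 1 := by
    rw [abs_neg, abs_div]
    exact div_le_one_of_le₀ hpq (abs_nonneg p)
  obtain ⟨j, hj, h0, h1⟩ := exists_slope_near hN hτ
  have key : ∀ s : ℝ, |s - -(q / p)| ≤ 1 / N → |s * p + q| ≤ M / N := fun s hs => by
    have e : s * p + q = (s - -(q / p)) * p := by linear_combination hq
    rw [e, abs_mul, div_eq_mul_one_div M, mul_comm M]
    exact mul_le_mul hs hp (abs_nonneg p) (by positivity)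
  exact ⟨j, hj, key _ h0, key _ h1⟩

theorem exists_slope_large {N : ℕ} (hN : 0 < N) {j : ℕ} (hj : j ≤ 2 * N) (p q : ℝ) :
    |p| + |q| ≤ (4 * N + 2) * |slope N j * p + q| ∨
      |p| + |q| ≤ (4 * N + 2) * |slope N (j + 1) * p + q| := by
  have hN' : (0 : ℝ) < N := by exact_mod_cast hN
  set X := slope N j * p + q with hX
  set Y := slope N (j + 1) * p + q with hY
  have e : p = N * (Y - X) := by
    rw [hX, hY, slope_succ hN]
    field_simp
    ring
  have hp : |p| ≤ N * (|X| + |Y|) := by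
    rw [e, abs_mul, abs_of_pos hN', add_comm |X|]
    exact mul_le_mul_of_nonneg_left (abs_sub _ _) hN'.le
  have hq : |q| ≤ |X| + |p| := by
    have e' : q = X - slope N j * p := by
      rw [hX]
      ring
    rw [e']
    refine (abs_sub _ _).trans ?_
    rw [abs_mul]
    gcongr
    exact mul_le_of_le_one_left (abs_nonneg p) (abs_slope_le hN hj)
  rcases le_total |X| |Y| with h | h
  · right
    nlinarith [abs_nonneg X]
  · left
    nlinarith [abs_nonneg Y]

/-- Some direction of the net is both almost tangential for `f` and captures the gradient
of `k`. -/
theorem exists_netDir (f k : E 2 → ℝ) (x : E 2) {N : ℕ} (hN : 0 < N) {M : ℝ}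
    (hf : ∀ i, |pd f x i| ≤ M) :
    ∃ i : Bool × ℕ, i.2 < 2 * N + 1 ∧ |dir f (netDir N i) x| ≤ M / N ∧
      |pd k x 0| + |pd k x 1| ≤ (4 * N + 2) * |dir k (netDir N i) x| := by
  rcases le_total |pd f x 1| |pd f x 0| with h | h
  · obtain ⟨j, hj, h0, h1⟩ := exists_slope_small hN h (hf 0)
    rcases exists_slope_large hN (by omega : j ≤ 2 * N) (pd k x 0) (pd k x 1) with hk | hk
    · exact ⟨(true, j), by dsimp only; omega, by rwa [dir_netDir_true], by rwa [dir_netDir_true]⟩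
    · exact ⟨(true, j + 1), by dsimp only; omega, by rwa [dir_netDir_true],
        by rwa [dir_netDir_true]⟩
  · obtain ⟨j, hj, h0, h1⟩ := exists_slope_small hN h (hf 1)
    rcases exists_slope_large hN (by omega : j ≤ 2 * N) (pd k x 1) (pd k x 0) with hk | hk
    · exact ⟨(false, j), by dsimp only; omega, by rwa [dir_netDir_false],
        by rwa [dir_netDir_false, add_comm]⟩
    · exact ⟨(false, j + 1), by dsimp only; omega, by rwa [dir_netDir_false],
        by rwa [dir_netDir_false, add_comm]⟩

end GreenLp

namespace GreenLp
open Set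

variable {lam Lam ρ t R G C : ℝ} {Ω V : Set (E 2)} {u f k g : E 2 → ℝ} {x x₀ w a b : E 2}

theorem measurableSet_inter_le {s : Set (E 2)} (hs : IsOpen s) (hf : ContinuousOn f s) (c : ℝ) :
    MeasurableSet {x ∈ s | f x ≤ c} := by
  have : {x ∈ s | f x ≤ c} = s \ (s ∩ f ⁻¹' Ioi c) := by
    ext x
    simp +contextual
  rw [this]
  exact (hs.measurableSet : MeasurableSet s).diff (hf.isOpen_inter_preimage hs isOpen_Ioi).measurableSet

theorem norm_gradient_le (g : E 2 → ℝ) (x : E 2) : ‖gradient g x‖ ≤ |pd g x 0| + |pd g x 1| := by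
  rw [gradient, LinearIsometryEquiv.norm_map]
  refine ContinuousLinearMap.opNorm_le_bound _ (by positivity) fun w => ?_
  rw [fderiv_eq_pd, Real.norm_eq_abs, add_mul]
  refine (abs_add_le _ _).trans (add_le_add ?_ ?_) <;> rw [abs_mul, mul_comm]
  · exact mul_le_mul_of_nonneg_left (PiLp.norm_apply_le w 0) (abs_nonneg _)
  · exact mul_le_mul_of_nonneg_left (PiLp.norm_apply_le w 1) (abs_nonneg _)

theorem exists_lintegral_gradient_bound {μ ε B p r : ℝ} (hlam : 0 < lam) (hlL : lam ≤ Lam)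
    (hμ : 0 < μ) (hμ1 : μ ≤ 1) (hμl : μ ≤ lam) (hμL : μ * Lam ≤ 1) (hε : 0 < ε) (hB : 0 < B)
    (hN : NegPower μ ε B) (hp : 1 < p) (hpε : 11 * p / 12 + (p - 1) / ε ≤ 1)
    (hΩ : IsOpen Ω) (hΩb : Bornology.IsBounded Ω) (hVo : IsOpen V) (hV : CptIn V Ω)
    (hr : 0 < r) (hrρ : r < ρ) :
    ∃ K : ℝ, 0 ≤ K ∧ ∀ u, MASetup Ω u → DetBounds Ω u lam Lam →
      ∀ x₀ ∈ V, CptIn (MASection Ω u x₀ ρ) V → ∀ g, IsGreen u V x₀ g →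
      ∫⁻ x in MASection Ω u x₀ r, ENNReal.ofReal (‖gradient g x‖ ^ p) ≤ ENNReal.ofReal K := by
  obtain ⟨σ, K, G, hσ, hK, hG, hmain⟩ := exists_frame_bound hlam hlL hμ hμ1 hμl hμL hε hB hN hp hpε
    hΩ hΩb hVo hV hr hrρ
  obtain ⟨N, hNσ⟩ := exists_nat_gt (2 * G / σ)
  have hN' : (0 : ℝ) < N := (by positivity : 0 < 2 * G / σ).trans hNσ
  have hN0 : 0 < N := by exact_mod_cast hN'
  set M : ℝ := (4 * N + 2) ^ p with hM
  have hM0 : 0 ≤ M := by positivity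
  set net : Finset (Bool × ℕ) := Finset.univ ×ˢ Finset.range (2 * N + 1) with hnet
  refine ⟨net.card * (M * K), by positivity, fun u hS hD x₀ hx₀ hSec g hg => ?_⟩
  obtain ⟨hpd, hInt⟩ := hmain u hS hD
  have hP := Setup.pole hS hD hlam hVo hV hx₀ hg
  set S := {x ∈ V | tang u x₀ x < r} with hSdef
  have hSo : IsOpen (S \ {x₀}) := (Setup.isOpen_sublevel hS hVo hV).sdiff isClosed_singleton
  have hSV : S \ {x₀} ⊆ V \ {x₀} := fun x hx => ⟨hx.1.1, hx.2⟩
  set U : Bool × ℕ → Set (E 2) := fun i => {x | |dir (tang u x₀) (netDir N i) x| ≤ σ ∧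
    |pd g x 0| + |pd g x 1| ≤ (4 * N + 2) * |dir g (netDir N i) x|} with hU
  have hcov : S \ {x₀} ⊆ ⋃ i ∈ net, U i := by
    intro x hx
    have hxV : x ∈ V := hx.1.1
    obtain ⟨i, hi, h1, h2⟩ := exists_netDir (tang u x₀) g x hN0 (M := 2 * G) fun l => by
      rw [pd_tang (hP.smu hxV)]
      have := (abs_sub (pd u x l) (pd u x₀ l)).trans (add_le_add (hpd x hxV l) (hpd x₀ hx₀ l))
      linarith
    refine mem_iUnion₂.2 ⟨i, ?_, h1.trans ?_, h2⟩
    · rw [hnet, Finset.mem_product, Finset.mem_range]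
      exact ⟨Finset.mem_univ _, hi⟩
    · rw [div_lt_iff₀ hσ] at hNσ
      rw [div_le_iff₀ hN']
      linarith
  have hcard : ENNReal.ofReal (net.card * (M * K)) = net.card * ENNReal.ofReal (M * K) := by
    rw [ENNReal.ofReal_mul (Nat.cast_nonneg _), ENNReal.ofReal_natCast]
  rw [Setup.section_eq hV hSec hrρ.le, ← setLIntegral_congr (Pole.ae_restrict S x₀), hcard]
  refine Bowl.lintegral_le_of_cover net hcov fun i hi => ?_
  have hi' : i.2 ≤ 2 * N := by
    have := (Finset.mem_product.1 hi).2
    rw [Finset.mem_range] at this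
    omega
  obtain ⟨a, ha⟩ := exists_frame_netDir hN0 hi'
  have hm : MeasurableSet (S \ {x₀} ∩ U i) := by
    have e : S \ {x₀} ∩ U i = {x ∈ S \ {x₀} | |dir (tang u x₀) (netDir N i) x| ≤ σ} ∩
        {x ∈ S \ {x₀} | |pd g x 0| + |pd g x 1| - (4 * N + 2) * |dir g (netDir N i) x| ≤ 0} := by
      ext x
      simp only [hU, mem_inter_iff, mem_ofPred_eq, sub_nonpos]
      tauto
    rw [e]
    refine (measurableSet_inter_le hSo ?_ _).inter (measurableSet_inter_le hSo ?_ _)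
    · exact ContinuousOn.abs fun x hx =>
        ((sm_tang (hP.smu hx.1.1)).dir _).continuousAt.continuousWithinAt
    · have h0 : ∀ l, ContinuousOn (fun x => |pd g x l|) (S \ {x₀}) := fun l =>
        ContinuousOn.abs fun x hx => ((hP.smg (hSV hx)).pd l).continuousAt.continuousWithinAt
      have h1 : ContinuousOn (fun x => |dir g (netDir N i) x|) (S \ {x₀}) :=
        ContinuousOn.abs fun x hx => ((hP.smg (hSV hx)).dir _).continuousAt.continuousWithinAt
      exact ((h0 0).add (h0 1)).sub (continuousOn_const.mul h1)
  calc ∫⁻ x in S \ {x₀} ∩ U i, ENNReal.ofReal (‖gradient g x‖ ^ p)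
      ≤ ∫⁻ x in S \ {x₀} ∩ U i, ENNReal.ofReal M *
          ENNReal.ofReal (|dir g (netDir N i) x| ^ p) := by
        refine setLIntegral_mono' hm fun x hx => ?_
        rw [← ENNReal.ofReal_mul hM0, hM, ← Real.mul_rpow (by positivity) (abs_nonneg _)]
        exact ENNReal.ofReal_le_ofReal (Real.rpow_le_rpow (norm_nonneg _)
          ((norm_gradient_le g x).trans hx.2.2) (by linarith))
    _ = ENNReal.ofReal M * ∫⁻ x in S \ {x₀} ∩ U i,
          ENNReal.ofReal (|dir g (netDir N i) x| ^ p) :=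
        lintegral_const_mul' _ _ ENNReal.ofReal_ne_top
    _ ≤ ENNReal.ofReal M * ENNReal.ofReal K := by
        gcongr
        refine (lintegral_mono_set fun x hx => ?_).trans (hInt x₀ hx₀ hSec g hg a _ ha)
        exact ⟨hx.1.1.1, hx.1.1.2, hx.2.1⟩
    _ = _ := (ENNReal.ofReal_mul hM0).symm

end GreenLp

/-- Theorem 1.1(iii): `L^p` integrability of the gradient of the Green's function
in two dimensions. -/
theorem green_gradient_Lp_dim_two
    (lam Lam : ℝ) (hlam : 0 < lam) (hlL : lam ≤ Lam) :
    ∃ pstar > (1 : ℝ), ∀ p : ℝ, 1 < p → p < pstar →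
      ∀ (Ω V : Set (E 2)), IsOpen V → ∀ r : ℝ, 0 < r → r < 1 / 4 →
      ∃ C > 0, ∀ u : E 2 → ℝ,
        MASetup Ω u → DetBounds Ω u lam Lam → CptIn V Ω →
        ∀ x₀ ∈ V, CptIn (MASection Ω u x₀ (Real.sqrt r)) V →
        ∀ g : E 2 → ℝ, IsGreen u V x₀ g →
        (∫ x in MASection Ω u x₀ r, ‖gradient g x‖ ^ p) ^ (1 / p) ≤ C := by
  have hLam : 0 < Lam := hlam.trans_le hlL
  set μ := min (min lam (1 / Lam)) 1 with hμd
  have hμ : 0 < μ := lt_min (lt_min hlam (by positivity)) one_pos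
  have hμ1 : μ ≤ 1 := min_le_right _ _
  have hμl : μ ≤ lam := (min_le_left _ _).trans (min_le_left _ _)
  have hμL : μ * Lam ≤ 1 := by
    rw [← le_div_iff₀ hLam]
    exact (min_le_left _ _).trans (min_le_right _ _)
  obtain ⟨ε, hε, B, hB, hN⟩ := GreenLp.Saddle.exists_neg_power hμ hμ1
  refine ⟨1 + 1 / 12 / (11 / 12 + 1 / ε), lt_add_of_pos_right _ (by positivity), ?_⟩
  intro p hp hps Ω V hVo r hr hr4
  have hpε : 11 * p / 12 + (p - 1) / ε ≤ 1 := by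
    rw [← sub_lt_iff_lt_add', lt_div_iff₀ (by positivity)] at hps
    have : (p - 1) * (1 / ε) = (p - 1) / ε := by ring
    linarith
  by_cases hyp : IsOpen Ω ∧ Bornology.IsBounded Ω ∧ CptIn V Ω
  · have hrρ : r < √r := Real.lt_sqrt_of_sq_lt (by nlinarith)
    obtain ⟨K, hK, h⟩ := GreenLp.exists_lintegral_gradient_bound hlam hlL hμ hμ1 hμl hμL hε hB hN hp
      hpε hyp.1 hyp.2.1 hVo hyp.2.2 hr hrρ
    refine ⟨K ^ (1 / p) + 1, by positivity, fun u hS hD _ x₀ hx₀ hSec g hg => ?_⟩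
    have hle : ∫ x in MASection Ω u x₀ r, ‖gradient g x‖ ^ p ≤ K := by
      by_cases hi : IntegrableOn (fun x => ‖gradient g x‖ ^ p) (MASection Ω u x₀ r)
      · exact GreenLp.integral_le_of_lintegral_le hK hi (.of_forall fun _ => le_rfl)
          (h u hS hD x₀ hx₀ hSec g hg)
      · rwa [integral_undef hi]
    have := Real.rpow_le_rpow (integral_nonneg fun x => by positivity) hle
      (by positivity : 0 ≤ 1 / p)
    linarith
  · exact ⟨1, one_pos, fun u hS _ hV => absurd ⟨hS.1, hS.2.1, hV⟩ hyp⟩
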